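/- Let N ≥ 2, 0 < s < 1 and 1 ≤ q < 2*_s := 2N/(N−2s). There exists a constant σ₁ > 0, depending only on N, s and q, such that for every open set Ω ⊆ ℝ^N with finite positive Lebesgue measure and every open ball B ⊆ ℝ^N one has |Ω|^{2/q−1+2s/N} λ_{s,q}(Ω) − |B|^{2/q−1+2s/N} λ_{s,q}(B) ≥ (σ₁/(1−s)) · A(Ω)^{3/s}. -/

import Mathlib

open MeasureTheory Filter
open scoped ENNReal NNReal Topology FourierTransform RealInnerProductSpace

noncomputable section

/-- Euclidean space ℝ^N -/
abbrev Eu (N : ℕ) := EuclideanSpace ℝ (Fin N)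

/-- Squared Gagliardo seminorm `[u]_{W^{s,2}}²`, as an extended nonnegative real. -/
def gagliardoSq (N : ℕ) (s : ℝ) (u : Eu N → ℝ) : ℝ≥0∞ :=
  ∫⁻ x, ∫⁻ y, ENNReal.ofReal (|u x - u y| ^ 2 / ‖x - y‖ ^ ((N : ℝ) + 2 * s))

/-- Squared Gagliardo seminorm, as a real number. -/
def gagliardoSqR (N : ℕ) (s : ℝ) (u : Eu N → ℝ) : ℝ :=
  (gagliardoSq N s u).toReal

/-- The sharp fractional Poincaré–Sobolev constant
`λ_{s,q}(Ω) = inf { [u]_{W^{s,2}}² : u ∈ C_c^∞(Ω), ‖u‖_{L^q(Ω)} = 1 }`. -/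
def sobolevConst (N : ℕ) (s q : ℝ) (Ω : Set (Eu N)) : ℝ :=
  sInf { c : ℝ | ∃ u : Eu N → ℝ, ContDiff ℝ (⊤ : ℕ∞) u ∧ HasCompactSupport u ∧
    tsupport u ⊆ Ω ∧ (∫ x in Ω, |u x| ^ q) = 1 ∧ c = gagliardoSqR N s u }

/-- The Fraenkel asymmetry `A(Ω)`. -/
def asym (N : ℕ) (Ω : Set (Eu N)) : ℝ :=
  sInf { c : ℝ | ∃ (x₀ : Eu N) (r : ℝ), 0 < r ∧
    volume (Metric.ball x₀ r) = volume Ω ∧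
    c = (volume (symmDiff Ω (Metric.ball x₀ r))).toReal / (volume Ω).toReal }

/-- The normalizing constant `β_{N,s}`. -/
def betaC (N : ℕ) (s : ℝ) : ℝ :=
  (∫ x : Eu N, ((1 : ℝ) + ‖x‖ ^ 2) ^ (-((N : ℝ) + 2 * s) / 2))⁻¹

/-- The Poisson kernel `P_z(x) = β_{N,s} z^{2s} (z² + |x|²)^{-(N+2s)/2}`. -/
def poisson (N : ℕ) (s z : ℝ) (x : Eu N) : ℝ :=
  betaC N s * z ^ (2 * s) * ((z ^ 2 + ‖x‖ ^ 2) ^ (-((N : ℝ) + 2 * s) / 2))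

/-- The Caffarelli–Silvestre extension `U(x,z) = (P_z ∗ u)(x)`. -/
def csExt (N : ℕ) (s : ℝ) (u : Eu N → ℝ) (x : Eu N) (z : ℝ) : ℝ :=
  ∫ y, poisson N s z (x - y) * u y

/-- A first minimizer for `λ_{s,q}(Ω)`: a nonnegative measurable function, vanishing a.e.
outside `Ω`, with unit `L^q` norm, realizing the infimum, and positive inside `Ω`. -/
def IsFirstMinimizer (N : ℕ) (s q : ℝ) (Ω : Set (Eu N)) (u : Eu N → ℝ) : Prop :=
  Measurable u ∧ (∀ x, 0 ≤ u x) ∧ (∀ᵐ x, x ∉ Ω → u x = 0) ∧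
  (∫ x in Ω, u x ^ q) = 1 ∧ gagliardoSqR N s u = sobolevConst N s q Ω ∧
  ∀ x ∈ Ω, 0 < u x

/-- The level `T` from (4.1): `T = sup { t > 0 : |{u > t}| ≥ |Ω| (1 - A(Ω)/9) }`. -/
def levelT (N : ℕ) (Ω : Set (Eu N)) (u : Eu N → ℝ) : ℝ :=
  sSup { t : ℝ | 0 < t ∧
    volume Ω * ENNReal.ofReal (1 - asym N Ω / 9) ≤ volume {x | t < u x} }

/-- The kernel `‖x - y‖^{-(N+2s)}`, with value `0` on the diagonal. -/
def kk (N : ℕ) (s : ℝ) (x y : Eu N) : ℝ := (‖x - y‖ ^ ((N : ℝ) + 2 * s))⁻¹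

section Kernel

variable {N : ℕ} {s : ℝ}

lemma kk_nonneg (x y : Eu N) : 0 ≤ kk N s x y := by unfold kk; positivity

lemma kk_comm (x y : Eu N) : kk N s x y = kk N s y x := by
  unfold kk; rw [norm_sub_rev]

lemma measurable_kk : Measurable (fun z : Eu N × Eu N => kk N s z.1 z.2) := by
  unfold kk; exact ((measurable_fst.sub measurable_snd).norm.pow_const _).inv

lemma measurable_kk_comp {α : Type*} [MeasurableSpace α] {f g : α → Eu N} (hf : Measurable f)
    (hg : Measurable g) : Measurable (fun a => kk N s (f a) (g a)) := by
  unfold kk; exact ((hf.sub hg).norm.pow_const _).inv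

end Kernel

/-- The double integral of (the positive part of) a real function. -/
def dint {N : ℕ} (F : Eu N → Eu N → ℝ) : ℝ≥0∞ := ∫⁻ x, ∫⁻ y, ENNReal.ofReal (F x y)

section Dint

variable {N : ℕ} {F G : Eu N → Eu N → ℝ}

lemma dint_mono (h : ∀ x y, F x y ≤ G x y) : dint F ≤ dint G :=
  lintegral_mono fun x => lintegral_mono fun y => ENNReal.ofReal_le_ofReal (h x y)

lemma dint_congr (h : ∀ x y, F x y = G x y) : dint F = dint G := by
  unfold dint; simp only [h]

lemma dint_add (hF : Measurable fun z : Eu N × Eu N => F z.1 z.2)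
    (hF0 : ∀ x y, 0 ≤ F x y) (hG0 : ∀ x y, 0 ≤ G x y) :
    dint (fun x y => F x y + G x y) = dint F + dint G := by
  unfold dint
  have h1 : ∀ x y, ENNReal.ofReal (F x y + G x y)
      = ENNReal.ofReal (F x y) + ENNReal.ofReal (G x y) := fun x y =>
    ENNReal.ofReal_add (hF0 x y) (hG0 x y)
  simp only [h1]
  have h2 : ∀ x, ∫⁻ y, (ENNReal.ofReal (F x y) + ENNReal.ofReal (G x y))
      = (∫⁻ y, ENNReal.ofReal (F x y)) + ∫⁻ y, ENNReal.ofReal (G x y) := fun x =>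
    lintegral_add_left (by
      have : Measurable fun y => F x y := hF.comp (measurable_const.prodMk measurable_id)
      exact this.ennreal_ofReal) _
  simp only [h2]
  exact lintegral_add_left (Measurable.lintegral_prod_right' (f := fun z : Eu N × Eu N =>
    ENNReal.ofReal (F z.1 z.2)) hF.ennreal_ofReal) _

lemma dint_const_mul {c : ℝ} (hc : 0 ≤ c) :
    dint (fun x y => c * F x y) = ENNReal.ofReal c * dint F := by
  unfold dint
  simp only [ENNReal.ofReal_mul hc]
  have h2 : ∀ x, ∫⁻ y, ENNReal.ofReal c * ENNReal.ofReal (F x y)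
      = ENNReal.ofReal c * ∫⁻ y, ENNReal.ofReal (F x y) := fun x =>
    lintegral_const_mul' _ _ ENNReal.ofReal_ne_top
  simp only [h2]
  exact lintegral_const_mul' _ _ ENNReal.ofReal_ne_top

lemma dint_swap (hF : Measurable fun z : Eu N × Eu N => F z.1 z.2) :
    dint (fun x y => F y x) = dint F := by
  unfold dint
  exact lintegral_lintegral_swap (f := fun x y => ENNReal.ofReal (F y x))
    ((hF.comp measurable_swap).ennreal_ofReal.aemeasurable)

lemma dint_comp_right {T : Eu N ≃ᵐ Eu N} (hT : MeasurePreserving T) :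
    dint (fun x y => F x (T y)) = dint F := by
  unfold dint
  congr 1; ext x
  exact hT.lintegral_comp_emb T.measurableEmbedding fun y => ENNReal.ofReal (F x y)

lemma dint_comp_left {T : Eu N ≃ᵐ Eu N} (hT : MeasurePreserving T) :
    dint (fun x y => F (T x) y) = dint F := by
  unfold dint
  exact hT.lintegral_comp_emb T.measurableEmbedding fun x => ∫⁻ y, ENNReal.ofReal (F x y)

lemma dint_eq_prod (hF : Measurable fun z : Eu N × Eu N => F z.1 z.2) :
    dint F = ∫⁻ z : Eu N × Eu N, ENNReal.ofReal (F z.1 z.2) := by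
  unfold dint
  exact (lintegral_prod (fun z : Eu N × Eu N => ENNReal.ofReal (F z.1 z.2))
    hF.ennreal_ofReal.aemeasurable).symm

end Dint

section Energy

variable {N : ℕ} {s : ℝ} {f g u : Eu N → ℝ}

lemma gagliardoSq_eq (u : Eu N → ℝ) :
    gagliardoSq N s u = dint fun x y => (u x - u y) ^ 2 * kk N s x y := by
  unfold gagliardoSq dint kk
  simp only [sq_abs, div_eq_mul_inv]

lemma gagliardoSq_le_of_abs_sub_le (h : ∀ x y, |f x - f y| ≤ |u x - u y|) :
    gagliardoSq N s f ≤ gagliardoSq N s u := by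
  rw [gagliardoSq_eq, gagliardoSq_eq]
  exact dint_mono fun x y => mul_le_mul_of_nonneg_right (sq_le_sq.2 (h x y)) (kk_nonneg x y)

lemma measurable_energy (hf : Measurable f) :
    Measurable fun z : Eu N × Eu N => (f z.1 - f z.2) ^ 2 * kk N s z.1 z.2 :=
  (((hf.comp measurable_fst).sub (hf.comp measurable_snd)).pow_const 2).mul measurable_kk

lemma gagliardoSq_abs_le (u : Eu N → ℝ) :
    gagliardoSq N s (fun x => |u x|) ≤ gagliardoSq N s u :=
  gagliardoSq_le_of_abs_sub_le fun _ _ => abs_abs_sub_abs_le_abs_sub _ _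

lemma gagliardoSq_min_add_posPart (hu : Measurable u) (t : ℝ) :
    gagliardoSq N s (fun x => min (u x) t) + gagliardoSq N s (fun x => max (u x - t) 0)
      ≤ gagliardoSq N s u := by
  simp only [gagliardoSq_eq]
  rw [← dint_add (measurable_energy (hu.min measurable_const)) (fun x y =>
    mul_nonneg (sq_nonneg _) (kk_nonneg x y))
    (fun x y => mul_nonneg (sq_nonneg _) (kk_nonneg x y))]
  refine dint_mono fun x y => ?_
  rw [← add_mul]
  refine mul_le_mul_of_nonneg_right ?_ (kk_nonneg x y)
  rcases le_total (u x) t with h1 | h1 <;> rcases le_total (u y) t with h2 | h2 <;>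
    simp only [h1, h2, min_eq_left, min_eq_right, max_eq_left, max_eq_right, sub_nonneg,
      sub_nonpos, sub_self] <;> nlinarith [mul_nonneg (sub_nonneg.2 h1) (sub_nonneg.2 h2)]

lemma gagliardoSq_min_add_max (hf : Measurable f) (hg : Measurable g) :
    gagliardoSq N s (fun x => min (f x) (g x)) + gagliardoSq N s (fun x => max (f x) (g x))
      ≤ gagliardoSq N s f + gagliardoSq N s g := by
  simp only [gagliardoSq_eq]
  have k0 : ∀ (a : ℝ) (x y : Eu N), 0 ≤ a ^ 2 * kk N s x y := fun a x y =>
    mul_nonneg (sq_nonneg _) (kk_nonneg x y)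
  rw [← dint_add (measurable_energy (hf.min hg)) (fun x y => k0 _ x y) (fun x y => k0 _ x y),
    ← dint_add (measurable_energy hf) (fun x y => k0 _ x y) (fun x y => k0 _ x y)]
  refine dint_mono fun x y => ?_
  rw [← add_mul, ← add_mul]
  refine mul_le_mul_of_nonneg_right ?_ (kk_nonneg x y)
  rcases le_total (f x) (g x) with h1 | h1 <;> rcases le_total (f y) (g y) with h2 | h2 <;>
    simp only [h1, h2, min_eq_left, min_eq_right, max_eq_left, max_eq_right] <;>
    nlinarith [mul_nonneg (sub_nonneg.2 h1) (sub_nonneg.2 h2)]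

lemma gagliardoSq_const_mul (c : ℝ) (u : Eu N → ℝ) :
    gagliardoSq N s (fun x => c * u x) = ENNReal.ofReal (c ^ 2) * gagliardoSq N s u := by
  simp only [gagliardoSq_eq]
  rw [← dint_const_mul (sq_nonneg c)]
  exact dint_congr fun x y => by ring

lemma gagliardoSq_comp_isometry {T : Eu N ≃ᵐ Eu N} (hT : MeasurePreserving T)
    (hd : ∀ x y, ‖T x - T y‖ = ‖x - y‖) (u : Eu N → ℝ) :
    gagliardoSq N s (fun x => u (T x)) = gagliardoSq N s u := by
  simp only [gagliardoSq_eq]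
  have h : (dint fun x y => (u (T x) - u (T y)) ^ 2 * kk N s x y)
      = dint fun x y => (u (T x) - u (T y)) ^ 2 * kk N s (T x) (T y) :=
    dint_congr fun x y => by unfold kk; rw [hd]
  rw [h, dint_comp_left hT (F := fun x y => (u x - u (T y)) ^ 2 * kk N s x (T y)),
    dint_comp_right hT (F := fun x y => (u x - u y) ^ 2 * kk N s x y)]

lemma gagliardoSq_comp_add (a : Eu N) (u : Eu N → ℝ) :
    gagliardoSq N s (fun x => u (x + a)) = gagliardoSq N s u :=
  gagliardoSq_comp_isometry (T := MeasurableEquiv.addRight a)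
    (measurePreserving_add_right volume a) (fun x y => by simp) u

lemma gagliardoSq_comp_smul {ρ : ℝ} (hρ : 0 < ρ) (u : Eu N → ℝ) :
    gagliardoSq N s (fun x => u (ρ • x))
      = ENNReal.ofReal (ρ ^ (2 * s - N)) * gagliardoSq N s u := by
  simp only [gagliardoSq_eq]
  have key : ∀ G : Eu N → ℝ≥0∞, ∫⁻ x, G (ρ • x) = ENNReal.ofReal ((ρ ^ N)⁻¹) * ∫⁻ x, G x := by
    intro G
    have e := (Homeomorph.smulOfNeZero ρ hρ.ne' : Eu N ≃ₜ Eu N).toMeasurableEquiv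
    have h1 : ∫⁻ x, G (ρ • x) = ∫⁻ x, G x ∂(Measure.map (fun x : Eu N => ρ • x) volume) :=
      (MeasurableEmbedding.lintegral_map
        ((Homeomorph.smulOfNeZero ρ hρ.ne' : Eu N ≃ₜ Eu N).measurableEmbedding) G).symm
    rw [h1, Measure.map_addHaar_smul volume hρ.ne', lintegral_smul_measure]
    simp [abs_of_pos hρ]
  have h : (dint fun x y => (u (ρ • x) - u (ρ • y)) ^ 2 * kk N s x y)
      = dint fun x y => ρ ^ ((N : ℝ) + 2 * s) *
          ((u (ρ • x) - u (ρ • y)) ^ 2 * kk N s (ρ • x) (ρ • y)) := by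
    refine dint_congr fun x y => ?_
    unfold kk
    rw [← smul_sub, norm_smul, Real.norm_of_nonneg hρ.le,
      Real.mul_rpow hρ.le (norm_nonneg _), mul_inv]
    field_simp
  rw [h, dint_const_mul (by positivity)]
  unfold dint
  have key2 : ∀ x, ∫⁻ y, ENNReal.ofReal ((u (ρ • x) - u (ρ • y)) ^ 2 * kk N s (ρ • x) (ρ • y))
      = ENNReal.ofReal ((ρ ^ N)⁻¹) *
        ∫⁻ y, ENNReal.ofReal ((u (ρ • x) - u y) ^ 2 * kk N s (ρ • x) y) := fun x =>
    key (fun y => ENNReal.ofReal ((u (ρ • x) - u y) ^ 2 * kk N s (ρ • x) y))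
  simp only [key2]
  rw [key (fun x => ENNReal.ofReal ((ρ ^ N)⁻¹) *
    ∫⁻ y, ENNReal.ofReal ((u x - u y) ^ 2 * kk N s x y)),
    lintegral_const_mul' _ _ ENNReal.ofReal_ne_top, ← mul_assoc, ← mul_assoc,
    ← ENNReal.ofReal_mul (by positivity), ← ENNReal.ofReal_mul (by positivity)]
  congr 2
  have : ρ ^ (2 * s - (N : ℝ)) = ρ ^ ((N : ℝ) + 2 * s) * ρ ^ (-(N : ℝ)) * ρ ^ (-(N : ℝ)) := by
    rw [← Real.rpow_add hρ, ← Real.rpow_add hρ]; congr 1; ring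
  rw [this, Real.rpow_neg hρ.le, Real.rpow_natCast]

lemma gagliardoSq_fatou {F : ℕ → Eu N → ℝ} (hF : ∀ n, Measurable (F n))
    (h : ∀ᵐ x, Tendsto (fun n => F n x) atTop (𝓝 (f x))) :
    gagliardoSq N s f ≤ liminf (fun n => gagliardoSq N s (F n)) atTop := by
  simp only [gagliardoSq_eq]
  unfold dint
  have hm : ∀ n, Measurable fun z : Eu N × Eu N =>
      ENNReal.ofReal ((F n z.1 - F n z.2) ^ 2 * kk N s z.1 z.2) := fun n =>
    (measurable_energy (hF n)).ennreal_ofReal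
  calc _ ≤ ∫⁻ x, liminf (fun n => ∫⁻ y,
          ENNReal.ofReal ((F n x - F n y) ^ 2 * kk N s x y)) atTop := by
        refine lintegral_mono_ae ?_
        filter_upwards [h] with x hx
        calc _ ≤ ∫⁻ y, liminf (fun n =>
              ENNReal.ofReal ((F n x - F n y) ^ 2 * kk N s x y)) atTop := by
              refine lintegral_mono_ae ?_
              filter_upwards [h] with y hy
              refine le_of_eq (Tendsto.liminf_eq ?_).symm
              exact (ENNReal.continuous_ofReal.tendsto _).comp
                (((hx.sub hy).pow 2).mul_const _)
          _ ≤ _ := lintegral_liminf_le fun n => (hm n).comp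
                (measurable_const.prodMk measurable_id)
    _ ≤ _ := lintegral_liminf_le fun n => (hm n).lintegral_prod_right'

lemma gagliardoSq_ims {χ η : Eu N → ℝ} (hu : Measurable u) (hu0 : ∀ x, 0 ≤ u x)
    (hχ : Measurable χ) (h1 : ∀ x, χ x ^ 2 + η x ^ 2 = 1) :
    gagliardoSq N s (fun x => χ x * u x) + gagliardoSq N s (fun x => η x * u x)
      = gagliardoSq N s u + dint fun x y =>
        u x * u y * ((χ x - χ y) ^ 2 + (η x - η y) ^ 2) * kk N s x y := by
  simp only [gagliardoSq_eq]
  have k0 : ∀ (a : ℝ) (x y : Eu N), 0 ≤ a ^ 2 * kk N s x y := fun a x y =>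
    mul_nonneg (sq_nonneg _) (kk_nonneg x y)
  rw [← dint_add (measurable_energy (hχ.mul hu)) (fun x y => k0 _ x y) (fun x y => k0 _ x y),
    ← dint_add (measurable_energy hu) (fun x y => k0 _ x y) (fun x y =>
      mul_nonneg (mul_nonneg (mul_nonneg (hu0 x) (hu0 y)) (by positivity)) (kk_nonneg x y))]
  refine dint_congr fun x y => ?_
  rw [← add_mul, ← add_mul]
  congr 1
  linear_combination (u x ^ 2 - u x * u y) * h1 x + (u y ^ 2 - u x * u y) * h1 y

end Energy

/-! ### Reflections and polarization -/

/-- The reflection across the hyperplane `⟪x, ν⟫ = h`. -/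
def rfl' {N : ℕ} (ν : Eu N) (h : ℝ) (x : Eu N) : Eu N := x + (2 * (h - ⟪x, ν⟫)) • ν

section Reflection

variable {N : ℕ} {s : ℝ} {ν : Eu N} {h : ℝ}

lemma inner_rfl' (hν : ‖ν‖ = 1) (x : Eu N) : ⟪rfl' ν h x, ν⟫ = 2 * h - ⟪x, ν⟫ := by
  unfold rfl'
  rw [inner_add_left, inner_smul_left, real_inner_self_eq_norm_sq, hν]
  simp; ring

lemma rfl'_rfl' (hν : ‖ν‖ = 1) (x : Eu N) : rfl' ν h (rfl' ν h x) = x := by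
  have := inner_rfl' (h := h) hν x
  rw [rfl', this, rfl']
  module

@[fun_prop]
lemma measurable_rfl' : Measurable (rfl' ν h) := by unfold rfl'; fun_prop

lemma norm_rfl'_sub (hν : ‖ν‖ = 1) (x y : Eu N) : ‖rfl' ν h x - rfl' ν h y‖ = ‖x - y‖ := by
  have e : rfl' ν h x - rfl' ν h y = (x - y) - (2 * ⟪x - y, ν⟫) • ν := by
    unfold rfl'; rw [inner_sub_left]; module
  rw [e]
  have : ‖(x - y) - (2 * ⟪x - y, ν⟫) • ν‖ ^ 2 = ‖x - y‖ ^ 2 := by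
    rw [norm_sub_sq_real, inner_smul_right, norm_smul, hν, mul_one, Real.norm_eq_abs, sq_abs]
    ring
  exact (sq_eq_sq₀ (norm_nonneg _) (norm_nonneg _)).1 this

/-- `‖x - σ y‖² = ‖x - y‖² + 4 (h - ⟪x, ν⟫) (h - ⟪y, ν⟫)`. -/
lemma norm_sub_rfl'_sq (hν : ‖ν‖ = 1) (x y : Eu N) :
    ‖x - rfl' ν h y‖ ^ 2 = ‖x - y‖ ^ 2 + 4 * (h - ⟪x, ν⟫) * (h - ⟪y, ν⟫) := by
  have e : x - rfl' ν h y = (x - y) - (2 * (h - ⟪y, ν⟫)) • ν := by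
    unfold rfl'; module
  rw [e, norm_sub_sq_real, inner_smul_right, norm_smul, hν, mul_one, Real.norm_eq_abs, sq_abs,
    inner_sub_left]
  ring

/-- `‖σ x‖² = ‖x‖² + 4 h (h - ⟪x, ν⟫)`. -/
lemma norm_rfl'_sq (hν : ‖ν‖ = 1) (x : Eu N) :
    ‖rfl' ν h x‖ ^ 2 = ‖x‖ ^ 2 + 4 * h * (h - ⟪x, ν⟫) := by
  have := norm_sub_rfl'_sq (h := h) hν 0 x
  simp at this
  rw [this]

/-- The reflection as a measurable equivalence. -/
def rflEquiv (hν : ‖ν‖ = 1) (h : ℝ) : Eu N ≃ᵐ Eu N where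
  toFun := rfl' ν h
  invFun := rfl' ν h
  left_inv := rfl'_rfl' hν
  right_inv := rfl'_rfl' hν
  measurable_toFun := measurable_rfl'
  measurable_invFun := measurable_rfl'

lemma measurePreserving_rfl' (hν : ‖ν‖ = 1) : MeasurePreserving (rfl' ν h) := by
  let f : Eu N →ₗ[ℝ] Eu N := LinearMap.id - (2 : ℝ) • (innerₗ (Eu N) ν).smulRight ν
  have hf : ∀ x, f x = rfl' ν 0 x := fun x => by
    simp [f, rfl', real_inner_comm, smul_smul, sub_eq_add_neg]
  have hinv : Function.Involutive f := fun x => by rw [hf, hf, rfl'_rfl' hν]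
  let L : Eu N ≃ₗᵢ[ℝ] Eu N := ⟨LinearEquiv.ofInvolutive f hinv, fun x => by
    have := norm_rfl'_sub (h := 0) hν x 0
    rw [← hf, ← hf, map_zero, sub_zero, sub_zero] at this
    simpa using this⟩
  have h1 := (measurePreserving_add_right volume ((2 * h) • ν)).comp L.measurePreserving
  have h2 : rfl' ν h = (fun x => x + (2 * h) • ν) ∘ L := by
    funext x
    have : L x = rfl' ν 0 x := hf x
    rw [Function.comp, this]
    unfold rfl'
    module
  rw [h2]
  exact h1

end Reflection

/-- The polarization of `f` with respect to the half space `⟪x, ν⟫ ≤ h`. -/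
def pol {N : ℕ} (ν : Eu N) (h : ℝ) (f : Eu N → ℝ) (x : Eu N) : ℝ :=
  if ⟪x, ν⟫ ≤ h then max (f x) (f (rfl' ν h x)) else min (f x) (f (rfl' ν h x))

/-- The integrand of the polarization deficit. -/
def polGain {N : ℕ} (s : ℝ) (ν : Eu N) (h : ℝ) (f : Eu N → ℝ) (x y : Eu N) : ℝ :=
  if ⟪x, ν⟫ < h ∧ ⟪y, ν⟫ < h then
    max (f x - f (rfl' ν h x)) 0 * max (f (rfl' ν h y) - f y) 0 *
      (kk N s x y - kk N s x (rfl' ν h y)) else 0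

section Polarization

variable {N : ℕ} {s : ℝ} {ν : Eu N} {h : ℝ} {f : Eu N → ℝ}

lemma measurable_pol (hf : Measurable f) : Measurable (pol ν h f) := by
  unfold pol
  refine Measurable.ite ?_ ?_ ?_
  · exact measurableSet_le (by fun_prop) measurable_const
  · exact hf.max (hf.comp measurable_rfl')
  · exact hf.min (hf.comp measurable_rfl')

lemma rfl'_of_inner_eq {x : Eu N} (hx : ⟪x, ν⟫ = h) : rfl' ν h x = x := by
  unfold rfl'; simp [hx]

lemma pol_le {x : Eu N} (hx : ⟪x, ν⟫ ≤ h) : pol ν h f x = max (f x) (f (rfl' ν h x)) := by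
  unfold pol; rw [if_pos hx]

lemma pol_ge {x : Eu N} (hx : h ≤ ⟪x, ν⟫) : pol ν h f x = min (f x) (f (rfl' ν h x)) := by
  unfold pol
  rcases hx.eq_or_lt with h1 | h1
  · rw [if_pos h1.ge, rfl'_of_inner_eq h1.symm]; simp
  · rw [if_neg (not_le.2 h1)]

lemma pol_add_pol_rfl' (hν : ‖ν‖ = 1) {β : Type*} [AddCommMonoid β] (G : ℝ → β) (x : Eu N) :
    G (pol ν h f x) + G (pol ν h f (rfl' ν h x)) = G (f x) + G (f (rfl' ν h x)) := by
  rcases le_total ⟪x, ν⟫ h with hx | hx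
  · have h2 : h ≤ ⟪rfl' ν h x, ν⟫ := by rw [inner_rfl' hν]; linarith
    rw [pol_le hx, pol_ge h2, rfl'_rfl' hν]
    rcases le_total (f x) (f (rfl' ν h x)) with h3 | h3 <;> simp [h3, add_comm]
  · have h2 : ⟪rfl' ν h x, ν⟫ ≤ h := by rw [inner_rfl' hν]; linarith
    rw [pol_ge hx, pol_le h2, rfl'_rfl' hν]
    rcases le_total (f x) (f (rfl' ν h x)) with h3 | h3 <;> simp [h3, add_comm]

lemma pol_mem {S : Set ℝ} {x : Eu N} (h1 : f x ∈ S) (h2 : f (rfl' ν h x) ∈ S) :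
    pol ν h f x ∈ S := by
  unfold pol
  split_ifs
  · rcases max_choice (f x) (f (rfl' ν h x)) with h3 | h3 <;> rw [h3] <;> assumption
  · rcases min_choice (f x) (f (rfl' ν h x)) with h3 | h3 <;> rw [h3] <;> assumption

lemma lintegral_comp_rfl' (hν : ‖ν‖ = 1) (G : Eu N → ℝ≥0∞) :
    ∫⁻ x, G (rfl' ν h x) = ∫⁻ x, G x :=
  (measurePreserving_rfl' hν).lintegral_comp_emb (rflEquiv hν h).measurableEmbedding G

lemma lintegral_pol (hν : ‖ν‖ = 1) (hf : Measurable f) {G : ℝ → ℝ≥0∞} (hG : Measurable G) :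
    ∫⁻ x, G (pol ν h f x) = ∫⁻ x, G (f x) := by
  have h1 := lintegral_comp_rfl' (h := h) hν fun x => G (pol ν h f x)
  have h2 := lintegral_comp_rfl' (h := h) hν fun x => G (f x)
  have h3 : ∫⁻ x, (G (pol ν h f x) + G (pol ν h f (rfl' ν h x)))
      = ∫⁻ x, (G (f x) + G (f (rfl' ν h x))) := by
    simp only [pol_add_pol_rfl' hν G]
  have m1 : Measurable fun x => G (pol ν h f x) := hG.comp (measurable_pol hf)
  have m2 : Measurable fun x => G (f x) := hG.comp hf
  rw [lintegral_add_left m1, lintegral_add_left m2, h1, h2,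
    ← two_mul, ← two_mul] at h3
  exact (ENNReal.mul_right_inj (by norm_num) (by norm_num)).1 h3

/-- The four point interaction. -/
def quad (a b c d K L : ℝ) : ℝ :=
  ((a - c) ^ 2 + (b - d) ^ 2) * K + ((a - d) ^ 2 + (b - c) ^ 2) * L

lemma quad_swap_left (a b c d K L : ℝ) : quad a b c d K L = quad b a c d L K := by
  unfold quad; ring

lemma quad_swap_right (a b c d K L : ℝ) : quad a b c d K L = quad a b d c L K := by
  unfold quad; ring

lemma quad_max_min (a b c d : ℝ) {K L : ℝ} (h : L ≤ K) :
    quad (max a b) (min a b) (max c d) (min c d) K L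
      + 2 * (max (a - b) 0 * max (d - c) 0 * (K - L)) ≤ quad a b c d K L := by
  have h0 := sub_nonneg.2 h
  unfold quad
  rcases le_total a b with h1 | h1 <;> rcases le_total c d with h2 | h2
  · rw [max_eq_right h1, min_eq_left h1, max_eq_right h2, min_eq_left h2,
      max_eq_right (sub_nonpos.2 h1)]
    linarith
  · rw [max_eq_right h1, min_eq_left h1, max_eq_left h2, min_eq_right h2,
      max_eq_right (sub_nonpos.2 h1)]
    nlinarith [mul_nonneg (mul_nonneg (sub_nonneg.2 h1) (sub_nonneg.2 h2)) h0]
  · rw [max_eq_left h1, min_eq_right h1, max_eq_right h2, min_eq_left h2,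
      max_eq_left (sub_nonneg.2 h1), max_eq_left (sub_nonneg.2 h2)]
    apply le_of_eq; ring
  · rw [max_eq_left h1, min_eq_right h1, max_eq_left h2, min_eq_right h2,
      max_eq_right (sub_nonpos.2 h2)]
    linarith

lemma kk_rfl'_rfl' (hν : ‖ν‖ = 1) (x y : Eu N) :
    kk N s (rfl' ν h x) (rfl' ν h y) = kk N s x y := by
  unfold kk; rw [norm_rfl'_sub hν]

lemma kk_rfl'_left (hν : ‖ν‖ = 1) (x y : Eu N) :
    kk N s (rfl' ν h x) y = kk N s x (rfl' ν h y) := by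
  conv_lhs => rw [← rfl'_rfl' (h := h) hν y]
  exact kk_rfl'_rfl' hν _ _

lemma kk_rfl'_le (hs : 0 < s) (hν : ‖ν‖ = 1) {x y : Eu N} (hxy : x ≠ y) (hx : ⟪x, ν⟫ ≤ h)
    (hy : ⟪y, ν⟫ ≤ h) : kk N s x (rfl' ν h y) ≤ kk N s x y := by
  unfold kk
  have h0 : 0 < ‖x - y‖ := norm_pos_iff.2 (sub_ne_zero.2 hxy)
  have h1 := norm_sub_rfl'_sq (h := h) hν x y
  have h2 : ‖x - y‖ ≤ ‖x - rfl' ν h y‖ := by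
    refine le_of_sq_le_sq ?_ (norm_nonneg _)
    rw [h1]
    nlinarith [mul_nonneg (sub_nonneg.2 hx) (sub_nonneg.2 hy)]
  gcongr

/-- The symmetrized energy integrand. -/
def polQ (s : ℝ) (ν : Eu N) (h : ℝ) (f : Eu N → ℝ) (x y : Eu N) : ℝ :=
  quad (f x) (f (rfl' ν h x)) (f y) (f (rfl' ν h y)) (kk N s x y) (kk N s x (rfl' ν h y))

lemma polQ_rfl'_left (hν : ‖ν‖ = 1) (x y : Eu N) :
    polQ s ν h f (rfl' ν h x) y = polQ s ν h f x y := by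
  unfold polQ
  rw [rfl'_rfl' hν, kk_rfl'_rfl' hν, kk_rfl'_left hν, quad_swap_left]

lemma polQ_rfl'_right (hν : ‖ν‖ = 1) (x y : Eu N) :
    polQ s ν h f x (rfl' ν h y) = polQ s ν h f x y := by
  unfold polQ
  rw [rfl'_rfl' hν, quad_swap_right]

lemma dint_polQ (hν : ‖ν‖ = 1) (hf : Measurable f) :
    dint (polQ s ν h f) = 4 * gagliardoSq N s f := by
  obtain ⟨F, hF⟩ : ∃ F : Eu N → Eu N → ℝ, F = fun x y => (f x - f y) ^ 2 * kk N s x y :=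
    ⟨_, rfl⟩
  have hF0 : ∀ x y, 0 ≤ F x y := fun x y => by
    rw [hF]; exact mul_nonneg (sq_nonneg _) (kk_nonneg x y)
  have hm : Measurable fun z : Eu N × Eu N => rfl' ν h z.1 := measurable_rfl'.comp measurable_fst
  have hm2 : Measurable fun z : Eu N × Eu N => rfl' ν h z.2 := measurable_rfl'.comp measurable_snd
  have hFc : ∀ a b : Eu N × Eu N → Eu N, Measurable a → Measurable b →
      Measurable fun z => F (a z) (b z) := fun a b ha hb => by
    rw [hF]
    exact (((hf.comp ha).sub (hf.comp hb)).pow_const 2).mul (measurable_kk_comp ha hb)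
  have hFm := hFc _ _ measurable_fst measurable_snd
  have m2 := hFc _ _ hm hm2
  have m3 := hFc _ _ measurable_fst hm2
  have hp : MeasurePreserving (rflEquiv hν h) := measurePreserving_rfl' hν
  have e1 : dint (fun x y => F x (rfl' ν h y)) = dint F := dint_comp_right hp
  have e2 : dint (fun x y => F (rfl' ν h x) y) = dint F := dint_comp_left hp
  have e3 : dint (fun x y => F (rfl' ν h x) (rfl' ν h y)) = dint F :=
    (dint_comp_left hp (F := fun x y => F x (rfl' ν h y))).trans e1
  have e4 : dint (polQ s ν h f) = dint fun x y => ((F x y + F (rfl' ν h x) (rfl' ν h y))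
      + F x (rfl' ν h y)) + F (rfl' ν h x) y := by
    refine dint_congr fun x y => ?_
    simp only [polQ, quad, hF, kk_rfl'_rfl' hν, kk_rfl'_left hν]
    ring
  rw [e4, dint_add ((hFm.add m2).add m3) (fun x y => add_nonneg (add_nonneg (hF0 _ _) (hF0 _ _))
    (hF0 _ _)) (fun x y => hF0 _ _), dint_add (hFm.add m2) (fun x y => add_nonneg (hF0 _ _)
    (hF0 _ _)) (fun x y => hF0 _ _), dint_add hFm (fun x y => hF0 _ _) (fun x y => hF0 _ _),
    e1, e2, e3, gagliardoSq_eq, ← hF]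
  ring

lemma polGain_nonneg (hs : 0 < s) (hν : ‖ν‖ = 1) (x y : Eu N) : 0 ≤ polGain s ν h f x y := by
  unfold polGain
  split_ifs with hxy
  · rcases eq_or_ne x y with rfl | hne
    · rcases le_total (f x) (f (rfl' ν h x)) with h3 | h3
      · rw [max_eq_right (sub_nonpos.2 h3)]; simp
      · rw [max_eq_right (a := f (rfl' ν h x) - f x) (sub_nonpos.2 h3)]; simp
    · exact mul_nonneg (by positivity) (sub_nonneg.2 (kk_rfl'_le hs hν hne hxy.1.le hxy.2.le))
  · exact le_rfl

lemma polQ_pol_add_le (hs : 0 < s) (hν : ‖ν‖ = 1) (x y : Eu N) :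
    polQ s ν h (pol ν h f) x y + 2 * polGain s ν h f x y ≤ polQ s ν h f x y := by
  have key : ∀ x y, ⟪x, ν⟫ ≤ h → ⟪y, ν⟫ ≤ h →
      polQ s ν h (pol ν h f) x y + 2 * polGain s ν h f x y ≤ polQ s ν h f x y := by
    intro x y hx hy
    have hx2 : h ≤ ⟪rfl' ν h x, ν⟫ := by rw [inner_rfl' hν]; linarith
    have hy2 : h ≤ ⟪rfl' ν h y, ν⟫ := by rw [inner_rfl' hν]; linarith
    rcases eq_or_ne x y with rfl | hne
    · have h0 : polGain s ν h f x x ≤ 0 := by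
        unfold polGain
        split_ifs
        · rcases le_total (f x) (f (rfl' ν h x)) with h3 | h3
          · rw [max_eq_right (sub_nonpos.2 h3)]; simp
          · rw [max_eq_right (a := f (rfl' ν h x) - f x) (sub_nonpos.2 h3)]; simp
        · exact le_rfl
      have h1 : polQ s ν h (pol ν h f) x x = polQ s ν h f x x := by
        unfold polQ
        rw [pol_le hx, pol_ge hx2, rfl'_rfl' hν]
        unfold quad
        rcases le_total (f x) (f (rfl' ν h x)) with h3 | h3
        · rw [max_eq_right h3, min_eq_right h3]; ring
        · rw [max_eq_left h3, min_eq_left h3]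
      linarith
    · have h1 := quad_max_min (f x) (f (rfl' ν h x)) (f y) (f (rfl' ν h y))
        (kk_rfl'_le hs hν hne hx hy)
      have h2 : polGain s ν h f x y ≤ max (f x - f (rfl' ν h x)) 0 *
          max (f (rfl' ν h y) - f y) 0 * (kk N s x y - kk N s x (rfl' ν h y)) := by
        unfold polGain
        split_ifs
        · exact le_rfl
        · exact mul_nonneg (by positivity) (sub_nonneg.2 (kk_rfl'_le hs hν hne hx hy))
      have h3 : polQ s ν h (pol ν h f) x y = quad (max (f x) (f (rfl' ν h x)))
          (min (f x) (f (rfl' ν h x))) (max (f y) (f (rfl' ν h y)))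
          (min (f y) (f (rfl' ν h y))) (kk N s x y) (kk N s x (rfl' ν h y)) := by
        unfold polQ
        rw [pol_le hx, pol_ge hx2, pol_le hy, pol_ge hy2, rfl'_rfl' hν, rfl'_rfl' hν,
          min_comm (f (rfl' ν h x)), min_comm (f (rfl' ν h y))]
      rw [h3]
      unfold polQ
      linarith
  have g0 : ∀ x y, ¬ (⟪x, ν⟫ ≤ h ∧ ⟪y, ν⟫ ≤ h) → polGain s ν h f x y = 0 := fun x y hxy => by
    unfold polGain
    rw [if_neg fun h' => hxy ⟨h'.1.le, h'.2.le⟩]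
  have fl : ∀ x, ¬ ⟪x, ν⟫ ≤ h → ⟪rfl' ν h x, ν⟫ ≤ h := fun x hx => by
    rw [inner_rfl' hν]; push Not at hx; linarith
  by_cases hx : ⟪x, ν⟫ ≤ h <;> by_cases hy : ⟪y, ν⟫ ≤ h
  · exact key x y hx hy
  · have h1 := key x (rfl' ν h y) hx (fl y hy)
    rw [polQ_rfl'_right hν, polQ_rfl'_right hν] at h1
    rw [g0 x y (fun h' => hy h'.2)]
    linarith [polGain_nonneg (f := f) hs hν (h := h) x (rfl' ν h y)]
  · have h1 := key (rfl' ν h x) y (fl x hx) hy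
    rw [polQ_rfl'_left hν, polQ_rfl'_left hν] at h1
    rw [g0 x y (fun h' => hx h'.1)]
    linarith [polGain_nonneg (f := f) hs hν (h := h) (rfl' ν h x) y]
  · have h1 := key (rfl' ν h x) (rfl' ν h y) (fl x hx) (fl y hy)
    rw [polQ_rfl'_left hν, polQ_rfl'_left hν, polQ_rfl'_right hν, polQ_rfl'_right hν] at h1
    rw [g0 x y (fun h' => hx h'.1)]
    linarith [polGain_nonneg (f := f) hs hν (h := h) (rfl' ν h x) (rfl' ν h y)]

lemma measurable_polQ (hf : Measurable f) :
    Measurable fun z : Eu N × Eu N => polQ s ν h f z.1 z.2 := by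
  unfold polQ quad
  have hm : Measurable fun z : Eu N × Eu N => rfl' ν h z.1 := measurable_rfl'.comp measurable_fst
  have hm2 : Measurable fun z : Eu N × Eu N => rfl' ν h z.2 := measurable_rfl'.comp measurable_snd
  have k1 : Measurable fun z : Eu N × Eu N => kk N s z.1 z.2 := measurable_kk
  have k2 : Measurable fun z : Eu N × Eu N => kk N s z.1 (rfl' ν h z.2) :=
    measurable_kk_comp measurable_fst hm2
  fun_prop

/-- Polarization decreases the energy, quantitatively. -/
lemma gagliardoSq_pol_add (hs : 0 < s) (hν : ‖ν‖ = 1) (hf : Measurable f) :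
    4 * gagliardoSq N s (pol ν h f) + 2 * dint (polGain s ν h f) ≤ 4 * gagliardoSq N s f := by
  have q0 : ∀ g : Eu N → ℝ, ∀ x y, 0 ≤ polQ s ν h g x y := fun g x y => by
    unfold polQ quad
    have := kk_nonneg (s := s) x y
    have := kk_nonneg (s := s) x (rfl' ν h y)
    positivity
  rw [← dint_polQ hν hf, ← dint_polQ hν (measurable_pol hf)]
  have : (2 : ℝ≥0∞) = ENNReal.ofReal 2 := by simp
  rw [this, ← dint_const_mul (by norm_num), ← dint_add (measurable_polQ (measurable_pol hf))
    (q0 _) (fun x y => mul_nonneg (by norm_num) (polGain_nonneg hs hν x y))]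
  exact dint_mono fun x y => polQ_pol_add_le hs hν x y

lemma gagliardoSq_pol_le (hs : 0 < s) (hν : ‖ν‖ = 1) (hf : Measurable f) :
    gagliardoSq N s (pol ν h f) ≤ gagliardoSq N s f := by
  have h1 := le_self_add.trans (gagliardoSq_pol_add (h := h) hs hν hf)
  exact (ENNReal.mul_le_mul_iff_right (by norm_num) (by norm_num)).1 h1

end Polarization

/-! ### Kernel integrals and elementary energy bounds -/

/-- The volume of the unit ball. -/
def om (N : ℕ) : ℝ := (volume (Metric.ball (0 : Eu N) 1)).toReal

section KernelIntegrals

variable {N : ℕ} {s : ℝ} {f u : Eu N → ℝ}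

lemma om_pos : 0 < om N :=
  ENNReal.toReal_pos (Metric.measure_ball_pos _ _ one_pos).ne' measure_ball_lt_top.ne

lemma nontrivial_Eu (hN : 2 ≤ N) : Nontrivial (Eu N) := by
  have : Nonempty (Fin N) := ⟨⟨0, by omega⟩⟩
  infer_instance

lemma volume_ball_eq (hN : 2 ≤ N) (x : Eu N) {r : ℝ} (hr : 0 ≤ r) :
    volume (Metric.ball x r) = ENNReal.ofReal (om N * r ^ N) := by
  have := nontrivial_Eu hN
  rw [Measure.addHaar_ball volume x hr, om, mul_comm, ENNReal.ofReal_mul (by positivity),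
    ENNReal.ofReal_toReal measure_ball_lt_top.ne]
  simp

/-- The integral of `min(1,|z|²)|z|^{-(N+2s)}`. -/
def kerInt (N : ℕ) (s : ℝ) : ℝ≥0∞ :=
  ∫⁻ z : Eu N, ENNReal.ofReal (min 1 (‖z‖ ^ 2) * kk N s z 0)

lemma kerInt_lt_top (hN : 2 ≤ N) (hs0 : 0 < s) (hs1 : s < 1) : kerInt N s < ⊤ := by
  have := nontrivial_Eu hN
  let φ : ℝ → ℝ := fun r => min 1 (r ^ 2) * (r ^ ((N : ℝ) + 2 * s))⁻¹
  have hφ : Integrable (fun z : Eu N => φ ‖z‖) := by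
    rw [integrable_fun_norm_addHaar]
    simp only [finrank_euclideanSpace, Fintype.card_fin, smul_eq_mul]
    have hN1 : ((N - 1 : ℕ) : ℝ) = (N : ℝ) - 1 := by
      rw [Nat.cast_sub (by omega)]; simp
    rw [← Set.Ioo_union_Ici_eq_Ioi (a := (0 : ℝ)) (b := 1) one_pos, integrableOn_union]
    constructor
    · have h1 : IntegrableOn (fun r : ℝ => r ^ (1 - 2 * s)) (Set.Ioo 0 1) :=
        (intervalIntegral.integrableOn_Ioo_rpow_iff one_pos).2 (by linarith)
      refine h1.congr_fun (fun r hr => ?_) measurableSet_Ioo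
      have hr0 : 0 < r := hr.1
      have : min 1 (r ^ 2) = r ^ 2 := min_eq_right (by nlinarith [hr.1, hr.2])
      simp only [φ, this]
      rw [← Real.rpow_natCast r (N - 1), hN1, ← Real.rpow_neg hr0.le, ← Real.rpow_two,
        ← Real.rpow_add hr0, ← Real.rpow_add hr0]
      congr 1; ring
    · rw [integrableOn_Ici_iff_integrableOn_Ioi]
      have h1 : IntegrableOn (fun r : ℝ => r ^ (-1 - 2 * s)) (Set.Ioi 1) :=
        integrableOn_Ioi_rpow_of_lt (by linarith) one_pos
      refine h1.congr_fun (fun r hr => ?_) measurableSet_Ioi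
      have hr1 : 1 < r := hr
      have hr0 : 0 < r := by linarith
      have : min 1 (r ^ 2) = 1 := min_eq_left (by nlinarith)
      simp only [φ, this, one_mul]
      rw [← Real.rpow_natCast r (N - 1), hN1, ← Real.rpow_neg hr0.le, ← Real.rpow_add hr0]
      congr 1; ring
  have h2 := hφ.lintegral_lt_top
  unfold kerInt kk
  simpa [φ] using h2

/-- A double integral of a weight against the truncated kernel. -/
lemma dint_weight (hf : Measurable f) (hf0 : ∀ x, 0 ≤ f x) :
    dint (fun x y => f x * (min 1 (‖x - y‖ ^ 2) * kk N s x y))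
      = kerInt N s * ∫⁻ x, ENNReal.ofReal (f x) := by
  unfold dint kerInt
  rw [← lintegral_const_mul _ hf.ennreal_ofReal]
  congr 1; ext x
  simp only [ENNReal.ofReal_mul (hf0 x)]
  rw [lintegral_const_mul' _ _ ENNReal.ofReal_ne_top, mul_comm]
  congr 1
  rw [← lintegral_sub_left_eq_self (fun z : Eu N =>
    ENNReal.ofReal (min 1 (‖z‖ ^ 2) * kk N s z 0)) x]
  congr 1; ext y
  unfold kk
  rw [sub_zero]

lemma measurable_trunc_kernel :
    Measurable fun z : Eu N × Eu N => min 1 (‖z.1 - z.2‖ ^ 2) * kk N s z.1 z.2 :=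
  (measurable_const.min ((measurable_fst.sub measurable_snd).norm.pow_const 2)).mul measurable_kk

/-- Bounded Lipschitz functions with support of finite measure have finite energy. -/
lemma gagliardoSq_lt_top (hN : 2 ≤ N) (hs0 : 0 < s) (hs1 : s < 1) {L : ℝ} {S : Set (Eu N)}
    (hS : MeasurableSet S) (hSf : volume S ≠ ⊤) (h0 : ∀ x ∉ S, u x = 0)
    (hL : ∀ x y, (u x - u y) ^ 2 ≤ L * min 1 (‖x - y‖ ^ 2)) :
    gagliardoSq N s u < ⊤ := by
  have hL0 : 0 ≤ max L 0 := le_max_right _ _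
  let g : Eu N → ℝ := S.indicator fun _ => max L 0
  have hg : Measurable g := measurable_const.indicator hS
  have hg0 : ∀ x, 0 ≤ g x := fun x => Set.indicator_nonneg (fun _ _ => hL0) x
  have hk : ∀ x y : Eu N, 0 ≤ min 1 (‖x - y‖ ^ 2) * kk N s x y := fun x y =>
    mul_nonneg (by positivity) (kk_nonneg x y)
  have hbd : ∀ x y, (u x - u y) ^ 2 * kk N s x y ≤
      g x * (min 1 (‖x - y‖ ^ 2) * kk N s x y) + g y * (min 1 (‖x - y‖ ^ 2) * kk N s x y) := by
    intro x y
    by_cases h : x ∈ S ∨ y ∈ S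
    · have h1 : max L 0 ≤ g x + g y := by
        rcases h with h | h
        · have : g x = max L 0 := Set.indicator_of_mem h _
          linarith [hg0 y]
        · have : g y = max L 0 := Set.indicator_of_mem h _
          linarith [hg0 x]
      have h2 : (u x - u y) ^ 2 ≤ (g x + g y) * min 1 (‖x - y‖ ^ 2) :=
        (hL x y).trans (mul_le_mul_of_nonneg_right ((le_max_left _ _).trans h1) (by positivity))
      calc _ ≤ (g x + g y) * min 1 (‖x - y‖ ^ 2) * kk N s x y :=
            mul_le_mul_of_nonneg_right h2 (kk_nonneg x y)
        _ = _ := by ring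
    · push Not at h
      rw [h0 x h.1, h0 y h.2]
      have := mul_nonneg (hg0 x) (hk x y)
      have := mul_nonneg (hg0 y) (hk x y)
      simp; linarith
  have hgm : Measurable fun z : Eu N × Eu N =>
      g z.1 * (min 1 (‖z.1 - z.2‖ ^ 2) * kk N s z.1 z.2) :=
    (hg.comp measurable_fst).mul measurable_trunc_kernel
  have e2 : dint (fun x y => g y * (min 1 (‖x - y‖ ^ 2) * kk N s x y))
      = dint fun x y => g x * (min 1 (‖x - y‖ ^ 2) * kk N s x y) := by
    refine Eq.trans (dint_congr fun x y => ?_) (dint_swap hgm)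
    rw [norm_sub_rev, kk_comm]
  have hfin : ∫⁻ x, ENNReal.ofReal (g x) < ⊤ := by
    have : ∀ x, ENNReal.ofReal (g x) = S.indicator (fun _ => ENNReal.ofReal (max L 0)) x :=
      fun x => by by_cases hx : x ∈ S <;> simp [g, hx]
    simp only [this]
    rw [lintegral_indicator hS, setLIntegral_const]
    exact ENNReal.mul_lt_top ENNReal.ofReal_lt_top hSf.lt_top
  rw [gagliardoSq_eq]
  refine (dint_mono hbd).trans_lt ?_
  rw [dint_add hgm (fun x y => mul_nonneg (hg0 x) (hk x y)) (fun x y => mul_nonneg (hg0 y)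
    (hk x y)), e2, dint_weight hg hg0]
  have := ENNReal.mul_lt_top (kerInt_lt_top hN hs0 hs1) hfin
  exact ENNReal.add_lt_top.2 ⟨this, this⟩

lemma gagliardoSq_lt_top_of_smooth (hN : 2 ≤ N) (hs0 : 0 < s) (hs1 : s < 1)
    (hu : ContDiff ℝ (⊤ : ℕ∞) u) (hc : HasCompactSupport u) : gagliardoSq N s u < ⊤ := by
  obtain ⟨C, hC⟩ := (hu.of_le (by simp) : ContDiff ℝ 1 u).lipschitzWith_of_hasCompactSupport
    hc one_ne_zero
  obtain ⟨M, hM⟩ := hc.exists_bound_of_continuous hu.continuous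
  have hM0 : 0 ≤ M := (norm_nonneg _).trans (hM 0)
  refine gagliardoSq_lt_top (L := (C : ℝ) ^ 2 + 4 * M ^ 2) hN hs0 hs1
    (isClosed_tsupport u).measurableSet hc.measure_lt_top.ne
    (fun x hx => image_eq_zero_of_notMem_tsupport hx) fun x y => ?_
  have h1 : |u x - u y| ≤ C * ‖x - y‖ := by
    have := hC.dist_le_mul x y
    rwa [Real.dist_eq, dist_eq_norm] at this
  have h2 : |u x - u y| ≤ 2 * M := by
    have := abs_sub (u x) (u y)
    have h3 := hM x
    have h4 := hM y
    rw [Real.norm_eq_abs] at h3 h4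
    linarith
  have h5 : (u x - u y) ^ 2 ≤ (C : ℝ) ^ 2 * ‖x - y‖ ^ 2 := by
    rw [← sq_abs, ← mul_pow]; exact pow_le_pow_left₀ (abs_nonneg _) h1 2
  have h6 : (u x - u y) ^ 2 ≤ 4 * M ^ 2 := by
    rw [← sq_abs]; calc _ ≤ (2 * M) ^ 2 := pow_le_pow_left₀ (abs_nonneg _) h2 2
      _ = _ := by ring
  rcases le_total 1 (‖x - y‖ ^ 2) with h7 | h7
  · rw [min_eq_left h7]; nlinarith [sq_nonneg (C : ℝ)]
  · rw [min_eq_right h7]; nlinarith [sq_nonneg M, sq_nonneg ‖x - y‖]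

/-- Lower bound for the energy on points of low density of the support. -/
lemma gagliardoSq_density (hN : 2 ≤ N) (hs0 : 0 < s) (hf : Measurable f) {ℓ : ℝ} (hℓ : 0 < ℓ)
    {D : Set (Eu N)} (hD : MeasurableSet D)
    (h : ∀ x ∈ D, 2 * volume ({y | f y ≠ 0} ∩ Metric.ball x ℓ) ≤ volume (Metric.ball x ℓ)) :
    ENNReal.ofReal (om N / 2 * ℓ ^ (-(2 * s))) * ∫⁻ x in D, ENNReal.ofReal (f x ^ 2)
      ≤ gagliardoSq N s f := by
  rw [gagliardoSq_eq]
  unfold dint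
  rw [← lintegral_const_mul _ (hf.pow_const 2).ennreal_ofReal]
  refine le_trans (setLIntegral_mono' hD fun x hx => ?_) (setLIntegral_le_lintegral D _)
  have hm : MeasurableSet {y | f y ≠ 0} := (hf (measurableSet_singleton 0)).compl
  set Z := Metric.ball x ℓ \ {y | f y ≠ 0} with hZ
  have hZm : MeasurableSet Z := measurableSet_ball.diff hm
  have hvol : volume (Metric.ball x ℓ) = ENNReal.ofReal (om N * ℓ ^ N) := volume_ball_eq hN x hℓ.le
  have h1 : ENNReal.ofReal (om N * ℓ ^ N / 2) ≤ volume Z := by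
    have h2 := measure_inter_add_sdiff (μ := volume) (Metric.ball x ℓ) hm
    rw [← hZ, Set.inter_comm] at h2
    have h3 := h x hx
    by_contra hlt
    push Not at hlt
    have h4 : volume ({y | f y ≠ 0} ∩ Metric.ball x ℓ) ≤ ENNReal.ofReal (om N * ℓ ^ N / 2) := by
      rw [hvol] at h3
      rw [ENNReal.ofReal_div_of_pos (by norm_num), ENNReal.le_div_iff_mul_le (by simp) (by simp),
        mul_comm]
      simpa using h3
    have h5 : volume (Metric.ball x ℓ) < ENNReal.ofReal (om N * ℓ ^ N / 2)
        + ENNReal.ofReal (om N * ℓ ^ N / 2) := by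
      rw [← h2]
      exact ENNReal.add_lt_add_of_le_of_lt (measure_ne_top_of_subset Set.inter_subset_right
        measure_ball_lt_top.ne) h4 hlt
    have hp := om_pos (N := N)
    rw [hvol, ← ENNReal.ofReal_add (by positivity) (by positivity), add_halves] at h5
    exact lt_irrefl _ h5
  have hp := om_pos (N := N)
  have h6 : om N / 2 * ℓ ^ (-(2 * s)) = om N * ℓ ^ N / 2 * (ℓ ^ ((N : ℝ) + 2 * s))⁻¹ := by
    rw [← Real.rpow_natCast, ← Real.rpow_neg hℓ.le]
    have : ℓ ^ (-(2 * s)) = ℓ ^ (N : ℝ) * ℓ ^ (-((N : ℝ) + 2 * s)) := by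
      rw [← Real.rpow_add hℓ]; congr 1; ring
    rw [this]; ring
  calc ENNReal.ofReal (om N / 2 * ℓ ^ (-(2 * s))) * ENNReal.ofReal (f x ^ 2)
      = ENNReal.ofReal (om N * ℓ ^ N / 2) *
        ENNReal.ofReal (f x ^ 2 * (ℓ ^ ((N : ℝ) + 2 * s))⁻¹) := by
        rw [h6, ← ENNReal.ofReal_mul (by positivity), ← ENNReal.ofReal_mul (by positivity)]
        congr 1; ring
    _ ≤ volume Z * ENNReal.ofReal (f x ^ 2 * (ℓ ^ ((N : ℝ) + 2 * s))⁻¹) := by gcongr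
    _ = ∫⁻ y in Z, ENNReal.ofReal (f x ^ 2 * (ℓ ^ ((N : ℝ) + 2 * s))⁻¹) := by
        rw [setLIntegral_const, mul_comm]
    _ ≤ ∫⁻ y in Z, ENNReal.ofReal ((f x - f y) ^ 2 * kk N s x y) := by
        refine setLIntegral_mono' hZm fun y hy => ENNReal.ofReal_le_ofReal ?_
        have hy0 : f y = 0 := by simpa using hy.2
        rw [hy0, sub_zero]
        rcases eq_or_ne x y with rfl | hne
        · simp [hy0]
        · refine mul_le_mul_of_nonneg_left ?_ (sq_nonneg _)
          unfold kk
          have h7 : 0 < ‖x - y‖ := norm_pos_iff.2 (sub_ne_zero.2 hne)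
          have h8 : ‖x - y‖ ≤ ℓ := by
            have := hy.1
            rw [Metric.mem_ball, dist_comm, dist_eq_norm] at this
            exact this.le
          gcongr
    _ ≤ _ := setLIntegral_le_lintegral _ _

end KernelIntegrals

/-! ### Reflections and non-radial functions -/

/-- The weighted defect of symmetry of `f` across the hyperplane `⟪x, ν⟫ = h`. -/
def reflDefect {N : ℕ} (f : Eu N → ℝ) (ν : Eu N) (h : ℝ) : ℝ≥0∞ :=
  ∫⁻ x, ENNReal.ofReal (if ⟪x, ν⟫ < h then (h - ⟪x, ν⟫) * max (f (rfl' ν h x) - f x) 0 else 0)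

/-- The defect of radial monotonicity. -/
def radDefect {N : ℕ} (f : Eu N → ℝ) : ℝ≥0∞ :=
  dint fun x y => if ‖x‖ < ‖y‖ then max (f y - f x) 0 else 0

section Radial

variable {N : ℕ} {f : Eu N → ℝ}

lemma lintegral_polar {H : Eu N → ℝ≥0∞} (hN : 2 ≤ N) (hH : Measurable H) :
    ∫⁻ z, H z = ∫⁻ ν : Metric.sphere (0 : Eu N) 1, ∫⁻ r in Set.Ioi (0 : ℝ),
      ENNReal.ofReal (r ^ (N - 1)) * H (r • (ν : Eu N)) ∂volume
        ∂(volume : Measure (Eu N)).toSphere := by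
  have := nontrivial_Eu hN
  have h1 : ∫⁻ z, H z = ∫⁻ z in ({0}ᶜ : Set (Eu N)), H z := by
    rw [restrict_compl_singleton]
  have hp := (volume : Measure (Eu N)).measurePreserving_homeomorphUnitSphereProd
  have hp' := hp.symm (homeomorphUnitSphereProd (Eu N)).toMeasurableEquiv
  rw [h1, ← lintegral_subtype_comap (measurableSet_singleton 0).compl,
    ← hp'.lintegral_comp (f := fun z : ({0}ᶜ : Set (Eu N)) => H z)
      (hH.comp measurable_subtype_coe)]
  have hm : Measurable fun a : Metric.sphere (0 : Eu N) 1 × Set.Ioi (0 : ℝ) =>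
      H ((homeomorphUnitSphereProd (Eu N)).toMeasurableEquiv.symm a) :=
    hH.comp (measurable_subtype_coe.comp (MeasurableEquiv.measurable _))
  rw [lintegral_prod _ hm.aemeasurable]
  · refine lintegral_congr fun ν => ?_
    rw [Measure.volumeIoiPow, lintegral_withDensity_eq_lintegral_mul]
    · rw [← lintegral_subtype_comap measurableSet_Ioi]
      simp [homeomorphUnitSphereProd]
    · fun_prop
    · exact hm.comp (measurable_const.prodMk measurable_id)

lemma lintegral_affine_sub {g : ℝ → ℝ≥0∞} (hg : Measurable g) (a : ℝ) :
    ∫⁻ r, g r = 2 * ∫⁻ h, g (2 * (h - a)) := by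
  rw [lintegral_sub_right_eq_self (fun h => g (2 * h)) a,
    ← lintegral_map (f := g) (g := fun h : ℝ => 2 * h) hg (by fun_prop),
    Real.map_volume_mul_left (by norm_num : (2 : ℝ) ≠ 0), lintegral_smul_measure, smul_eq_mul,
    ← mul_assoc]
  have : (2 : ℝ≥0∞) * ENNReal.ofReal |2⁻¹| = 1 := by
    rw [abs_of_pos (by norm_num), ENNReal.ofReal_inv_of_pos (by norm_num)]
    simp [ENNReal.mul_inv_cancel]
  rw [this, one_mul]

lemma measurable_radDefect_integrand (hf : Measurable f) : Measurable fun z : Eu N × Eu N =>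
    if ‖z.1‖ < ‖z.2‖ then max (f z.2 - f z.1) 0 else 0 := by
  refine Measurable.ite (measurableSet_lt (by fun_prop) (by fun_prop)) ?_ measurable_const
  exact ((hf.comp measurable_snd).sub (hf.comp measurable_fst)).max measurable_const

lemma radDefect_pointwise (hN : 2 ≤ N) {R : ℝ} (hR : 0 < R) (h0 : ∀ x, R < ‖x‖ → f x = 0)
    (hf0 : ∀ x, 0 ≤ f x) {ν : Eu N} (hν : ‖ν‖ = 1) (x : Eu N) {h : ℝ} (hx : ⟪x, ν⟫ < h) :
    (2 * (h - ⟪x, ν⟫)) ^ (N - 1) * (if ‖x‖ < ‖rfl' ν h x‖ then max (f (rfl' ν h x) - f x) 0 else 0)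
      ≤ if 0 < h ∧ h ≤ R then
        (2 * (2 * R) ^ (N - 2)) * ((h - ⟪x, ν⟫) * max (f (rfl' ν h x) - f x) 0) else 0 := by
  have hn := norm_rfl'_sq (h := h) hν x
  have hx1 : 0 < h - ⟪x, ν⟫ := sub_pos.2 hx
  split_ifs with h1 h2 h2
  · have h3 : max (f (rfl' ν h x) - f x) 0 = 0 ∨ ‖rfl' ν h x‖ ≤ R := by
      by_contra hcon
      push Not at hcon
      rw [h0 _ hcon.2] at hcon
      exact hcon.1 (max_eq_right (by linarith [hf0 x]))
    rcases h3 with h3 | h3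
    · rw [h3]; simp
    · have h4 : ‖rfl' ν h x - x‖ = 2 * (h - ⟪x, ν⟫) := by
        unfold rfl'
        rw [add_sub_cancel_left, norm_smul, hν, mul_one, Real.norm_of_nonneg (by linarith)]
      have h5 : 2 * (h - ⟪x, ν⟫) ≤ 2 * R := by
        rw [← h4]
        have := norm_sub_le (rfl' ν h x) x
        linarith
      have h6 : (2 * (h - ⟪x, ν⟫)) ^ (N - 1) = (2 * (h - ⟪x, ν⟫)) ^ (N - 2) *
          (2 * (h - ⟪x, ν⟫)) := by
        rw [← pow_succ]; congr 1; omega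
      rw [h6]
      have h7 : (2 * (h - ⟪x, ν⟫)) ^ (N - 2) ≤ (2 * R) ^ (N - 2) :=
        pow_le_pow_left₀ (by linarith) h5 _
      have h8 : 0 ≤ max (f (rfl' ν h x) - f x) 0 := le_max_right _ _
      calc _ = (2 * (h - ⟪x, ν⟫)) ^ (N - 2) * (2 * (h - ⟪x, ν⟫) * max (f (rfl' ν h x) - f x) 0) := by
            ring
        _ ≤ (2 * R) ^ (N - 2) * (2 * (h - ⟪x, ν⟫) * max (f (rfl' ν h x) - f x) 0) :=
            mul_le_mul_of_nonneg_right h7 (by positivity)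
        _ = _ := by ring
  · have h9 : 0 < h := by
      have : ‖x‖ ^ 2 < ‖rfl' ν h x‖ ^ 2 := pow_lt_pow_left₀ h1 (norm_nonneg _) two_ne_zero
      rw [hn] at this
      by_contra hcon
      push Not at hcon
      nlinarith
    have h10 : R < h := by
      by_contra hcon
      exact h2 ⟨h9, not_lt.1 hcon⟩
    have h11 : R < ‖rfl' ν h x‖ := by
      have h12 := inner_rfl' (h := h) hν x
      have h13 := real_inner_le_norm (rfl' ν h x) ν
      rw [hν, mul_one] at h13
      linarith
    rw [h0 _ h11, max_eq_right (by linarith [hf0 x])]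
    simp
  · rw [mul_zero]; positivity
  · simp

/-- The constant in `radDefect_le`. -/
def radConst (N : ℕ) (R : ℝ) : ℝ≥0∞ :=
  (volume : Measure (Eu N)).toSphere Set.univ * (2 * (ENNReal.ofReal (2 * (2 * R) ^ (N - 2)) *
    ∫⁻ h in Set.Ioc 0 R, ENNReal.ofReal (h ^ (-(1 / 3) : ℝ))))

lemma radConst_lt_top (R : ℝ) (hR : 0 < R) : radConst N R < ⊤ := by
  unfold radConst
  refine ENNReal.mul_lt_top (measure_lt_top _ _) (ENNReal.mul_lt_top (by simp)
    (ENNReal.mul_lt_top ENNReal.ofReal_lt_top ?_))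
  have h1 : IntegrableOn (fun r : ℝ => r ^ (-(1 / 3) : ℝ)) (Set.Ioc 0 R) := by
    rw [← intervalIntegrable_iff_integrableOn_Ioc_of_le hR.le]
    exact intervalIntegral.intervalIntegrable_rpow' (by norm_num)
  exact h1.lintegral_lt_top

/-- If the symmetry defects of `f` across all hyperplanes not through the origin are small,
then `f` is nearly radially decreasing. -/
lemma radDefect_le (hN : 2 ≤ N) (hf : Measurable f) (hf0 : ∀ x, 0 ≤ f x) {R : ℝ} (hR : 0 < R)
    (h0 : ∀ x, R < ‖x‖ → f x = 0) {D : ℝ≥0∞}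
    (hD : ∀ ν : Eu N, ‖ν‖ = 1 → ∀ h : ℝ, 0 < h →
      reflDefect f ν h ≤ D * ENNReal.ofReal (h ^ (-(1 / 3) : ℝ))) :
    radDefect f ≤ radConst N R * D := by
  obtain ⟨G, hG⟩ : ∃ G : Eu N → Eu N → ℝ,
    G = fun x y => if ‖x‖ < ‖y‖ then max (f y - f x) 0 else 0 := ⟨_, rfl⟩
  have hGm : Measurable fun z : Eu N × Eu N => G z.1 z.2 := by
    rw [hG]; exact measurable_radDefect_integrand hf
  have hGm' : Measurable fun z : Eu N × Eu N => ENNReal.ofReal (G z.1 (z.1 + z.2)) :=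
    (hGm.comp (measurable_fst.prodMk (measurable_fst.add measurable_snd))).ennreal_ofReal
  have e1 : radDefect f = ∫⁻ z, ∫⁻ x, ENNReal.ofReal (G x (x + z)) := by
    unfold radDefect dint
    rw [← hG]
    refine Eq.trans (lintegral_congr fun x => ?_) (lintegral_lintegral_swap hGm'.aemeasurable)
    exact (lintegral_add_left_eq_self (fun y => ENNReal.ofReal (G x y)) x).symm
  have hHm : Measurable fun z : Eu N => ∫⁻ x, ENNReal.ofReal (G x (x + z)) :=
    hGm'.lintegral_prod_left'
  rw [e1, lintegral_polar hN hHm, radConst, mul_assoc, mul_comm ((volume : Measure (Eu N)).toSphere _),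
    ← lintegral_const]
  refine lintegral_mono fun ν => ?_
  obtain ⟨ν, hν'⟩ := ν
  have hν : ‖ν‖ = 1 := by simpa using hν'
  let W : Eu N → ℝ → ℝ≥0∞ := fun x r =>
    if 0 < r then ENNReal.ofReal (r ^ (N - 1)) * ENNReal.ofReal (G x (x + r • ν)) else 0
  have hWm : Measurable fun z : Eu N × ℝ => W z.1 z.2 := by
    refine Measurable.ite (measurableSet_lt measurable_const measurable_snd) ?_ measurable_const
    refine (measurable_snd.pow_const _).ennreal_ofReal.mul ?_
    exact (hGm.comp (measurable_fst.prodMk (measurable_fst.add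
      (measurable_snd.smul_const ν)))).ennreal_ofReal
  have hWm2 : Measurable fun z : Eu N × ℝ => W z.1 (2 * (z.2 - ⟪z.1, ν⟫)) := by
    have h1 : Measurable fun z : Eu N × ℝ => (z.1, 2 * (z.2 - ⟪z.1, ν⟫)) := by fun_prop
    exact hWm.comp h1
  have e2 : ∫⁻ r in Set.Ioi (0 : ℝ), ENNReal.ofReal (r ^ (N - 1)) *
      ∫⁻ x, ENNReal.ofReal (G x (x + r • ν)) = ∫⁻ x, ∫⁻ r, W x r := by
    rw [lintegral_lintegral_swap hWm.aemeasurable, ← lintegral_indicator measurableSet_Ioi]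
    refine lintegral_congr fun r => ?_
    by_cases hr : 0 < r
    · rw [Set.indicator_of_mem (Set.mem_Ioi.2 hr), ← lintegral_const_mul' _ _ ENNReal.ofReal_ne_top]
      simp only [W, if_pos hr]
    · rw [Set.indicator_of_notMem (by simpa using hr)]
      simp only [W, if_neg hr, lintegral_zero]
  have e3 : ∀ x, ∫⁻ r, W x r = 2 * ∫⁻ h, W x (2 * (h - ⟪x, ν⟫)) := fun x =>
    lintegral_affine_sub (hWm.comp (measurable_const.prodMk measurable_id)) _
  change ∫⁻ r in Set.Ioi (0 : ℝ), ENNReal.ofReal (r ^ (N - 1)) *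
      ∫⁻ x, ENNReal.ofReal (G x (x + r • ν)) ≤ _
  rw [e2]
  simp only [e3]
  rw [lintegral_const_mul' _ _ (by simp), mul_assoc]
  gcongr
  rw [lintegral_lintegral_swap hWm2.aemeasurable]
  have hb : ∀ h, ∫⁻ x, W x (2 * (h - ⟪x, ν⟫)) ≤ (Set.Ioc 0 R).indicator (fun h =>
      ENNReal.ofReal (2 * (2 * R) ^ (N - 2)) * (D * ENNReal.ofReal (h ^ (-(1 / 3) : ℝ)))) h := by
    intro h
    have hpt : ∀ x, W x (2 * (h - ⟪x, ν⟫)) ≤ if 0 < h ∧ h ≤ R then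
        ENNReal.ofReal (2 * (2 * R) ^ (N - 2)) * ENNReal.ofReal (if ⟪x, ν⟫ < h then
          (h - ⟪x, ν⟫) * max (f (rfl' ν h x) - f x) 0 else 0) else 0 := by
      intro x
      by_cases hx : ⟪x, ν⟫ < h
      · have hx' : 0 < 2 * (h - ⟪x, ν⟫) := by linarith
        simp only [W, if_pos hx', if_pos hx]
        rw [← ENNReal.ofReal_mul (by positivity), ← ENNReal.ofReal_mul (by positivity)]
        have := radDefect_pointwise hN hR h0 hf0 hν x hx
        have e : x + (2 * (h - ⟪x, ν⟫)) • ν = rfl' ν h x := rfl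
        rw [hG, e]
        beta_reduce
        split_ifs at this ⊢ with a1 a2 a2
        · exact ENNReal.ofReal_le_ofReal this
        · rw [ENNReal.ofReal_of_nonpos this]
        · exact ENNReal.ofReal_le_ofReal this
        · rw [ENNReal.ofReal_of_nonpos this]
      · have hx' : ¬ 0 < 2 * (h - ⟪x, ν⟫) := by linarith
        simp only [W, if_neg hx']
        exact zero_le
    refine (lintegral_mono hpt).trans ?_
    by_cases hh : 0 < h ∧ h ≤ R
    · rw [Set.indicator_of_mem (show h ∈ Set.Ioc 0 R from hh)]
      simp only [if_pos hh]
      rw [lintegral_const_mul' _ _ ENNReal.ofReal_ne_top]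
      gcongr
      exact hD ν hν h hh.1
    · simp [if_neg hh]
  refine (lintegral_mono hb).trans ?_
  rw [lintegral_indicator measurableSet_Ioc, lintegral_const_mul' _ _ ENNReal.ofReal_ne_top,
    lintegral_const_mul _ (by fun_prop), mul_assoc, mul_comm D]

end Radial

/-- Bounded, nonnegative, measurable functions with bounded support. -/
structure Adm {N : ℕ} (f : Eu N → ℝ) : Prop where
  meas : Measurable f
  nonneg : ∀ x, 0 ≤ f x
  bdd : ∃ M, 0 < M ∧ ∀ x, f x ≤ M
  supp : ∃ R, 0 < R ∧ ∀ x, R < ‖x‖ → f x = 0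

/-- The symmetric decreasing rearrangement. -/
def rearr {N : ℕ} (f : Eu N → ℝ) (x : Eu N) : ℝ :=
  sSup {t | 0 ≤ t ∧ volume (Metric.ball (0 : Eu N) ‖x‖) < volume {y | t < f y}}

/-- Equimeasurability. -/
def EqDist {N : ℕ} (f g : Eu N → ℝ) : Prop :=
  ∀ t : ℝ, 0 ≤ t → volume {y | t < f y} = volume {y | t < g y}

section Rearrangement

variable {N : ℕ} {s : ℝ} {f g : Eu N → ℝ}

lemma sq_lintegral_le {α : Type*} [MeasurableSpace α] (μ : Measure α) {F : α → ℝ≥0∞}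
    (hF : AEMeasurable F μ) : (∫⁻ a, F a ∂μ) ^ 2 ≤ μ Set.univ * ∫⁻ a, F a ^ 2 ∂μ := by
  have h := ENNReal.lintegral_mul_le_Lp_mul_Lq μ Real.HolderConjugate.two_two
    (f := fun _ => 1) aemeasurable_const hF
  simp only [Pi.mul_apply, one_mul, ENNReal.one_rpow, lintegral_const] at h
  calc _ ≤ (μ Set.univ ^ (1 / 2 : ℝ) * (∫⁻ a, F a ^ (2 : ℝ) ∂μ) ^ (1 / 2 : ℝ)) ^ 2 := by gcongr
    _ = _ := by
      rw [mul_pow, ← ENNReal.rpow_natCast, ← ENNReal.rpow_mul, ← ENNReal.rpow_natCast,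
        ← ENNReal.rpow_mul]
      norm_num

lemma Adm.volume_pos_lt_top (hf : Adm f) : volume {x | 0 < f x} < ⊤ := by
  obtain ⟨R, hR, h⟩ := hf.supp
  refine lt_of_le_of_lt (measure_mono fun x hx => ?_)
    (measure_closedBall_lt_top (x := (0 : Eu N)) (r := R))
  rw [mem_closedBall_zero_iff]
  by_contra hc
  exact (ne_of_gt hx) (h x (not_le.1 hc))

lemma Adm.volume_lt_lt_top (hf : Adm f) {t : ℝ} (ht : 0 ≤ t) : volume {x | t < f x} < ⊤ :=
  lt_of_le_of_lt (measure_mono fun _ hx => lt_of_le_of_lt ht hx) hf.volume_pos_lt_top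

lemma rearr_bddAbove (hf : Adm f) (x : Eu N) :
    BddAbove {t | 0 ≤ t ∧ volume (Metric.ball (0 : Eu N) ‖x‖) < volume {y | t < f y}} := by
  obtain ⟨M, hM, h⟩ := hf.bdd
  refine ⟨M, fun t ht => ?_⟩
  by_contra hc
  have : {y | t < f y} = ∅ := by
    ext y; simp only [Set.mem_ofPred_eq, Set.mem_empty_iff_false, iff_false, not_lt]
    linarith [h y, not_le.1 hc]
  have h2 := ht.2
  rw [this, measure_empty] at h2
  exact absurd h2 not_lt_zero

lemma rearr_nonneg (x : Eu N) : 0 ≤ rearr f x := Real.sSup_nonneg fun _ ht => ht.1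

lemma lt_rearr_iff (hf : Adm f) {t : ℝ} (ht : 0 ≤ t) (x : Eu N) :
    t < rearr f x ↔ volume (Metric.ball (0 : Eu N) ‖x‖) < volume {y | t < f y} := by
  constructor
  · intro h
    have hne : {t | 0 ≤ t ∧ volume (Metric.ball (0 : Eu N) ‖x‖) < volume {y | t < f y}}.Nonempty := by
      by_contra hc
      rw [Set.not_nonempty_iff_eq_empty] at hc
      rw [rearr, hc, Real.sSup_empty] at h
      linarith
    obtain ⟨t', ht', h'⟩ := exists_lt_of_lt_csSup hne h
    exact ht'.2.trans_le (measure_mono fun y hy => h'.trans hy)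
  · intro h
    have e : {y | t < f y} = ⋃ n : ℕ, {y | t + 1 / ((n : ℝ) + 1) < f y} := by
      ext y
      simp only [Set.mem_ofPred_eq, Set.mem_iUnion]
      refine ⟨fun hy => ?_, fun ⟨n, hn⟩ => ?_⟩
      · obtain ⟨n, hn⟩ := exists_nat_one_div_lt (sub_pos.2 hy)
        exact ⟨n, by linarith⟩
      · have : (0 : ℝ) < 1 / ((n : ℝ) + 1) := by positivity
        linarith
    have hmono : Monotone fun n : ℕ => {y | t + 1 / ((n : ℝ) + 1) < f y} := by
      intro n m hnm y hy
      have h1 : (1 : ℝ) / ((m : ℝ) + 1) ≤ 1 / ((n : ℝ) + 1) := by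
        apply one_div_le_one_div_of_le (by positivity)
        have : (n : ℝ) ≤ m := by exact_mod_cast hnm
        linarith
      simp only [Set.mem_ofPred_eq] at hy ⊢
      linarith
    rw [e, hmono.measure_iUnion, lt_iSup_iff] at h
    obtain ⟨n, hn⟩ := h
    have h0 : (0 : ℝ) < 1 / ((n : ℝ) + 1) := by positivity
    have := le_csSup (rearr_bddAbove hf x)
      (show t + 1 / ((n : ℝ) + 1) ∈ {t | 0 ≤ t ∧ volume (Metric.ball (0 : Eu N) ‖x‖) <
        volume {y | t < f y}} from ⟨by linarith, hn⟩)
    unfold rearr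
    linarith

lemma exists_ball_volume (hN : 2 ≤ N) {m : ℝ≥0∞} (hm : m ≠ ⊤) :
    ∃ r : ℝ, 0 ≤ r ∧ ∀ x : Eu N, volume (Metric.ball x r) = m := by
  refine ⟨(m.toReal / om N) ^ ((N : ℝ)⁻¹), Real.rpow_nonneg (div_nonneg ENNReal.toReal_nonneg om_pos.le) _, fun x => ?_⟩
  have h0 := om_pos (N := N)
  rw [volume_ball_eq hN _ (Real.rpow_nonneg (div_nonneg ENNReal.toReal_nonneg h0.le) _),
    Real.rpow_inv_natCast_pow (div_nonneg ENNReal.toReal_nonneg h0.le) (by omega),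
    mul_div_cancel₀ _ h0.ne', ENNReal.ofReal_toReal hm]

lemma volume_ball_lt_iff (hN : 2 ≤ N) {a r : ℝ} (ha : 0 ≤ a) (hr : 0 ≤ r) (x y : Eu N) :
    volume (Metric.ball x a) < volume (Metric.ball y r) ↔ a < r := by
  have h0 := om_pos (N := N)
  rw [volume_ball_eq hN _ ha, volume_ball_eq hN _ hr, ENNReal.ofReal_lt_ofReal_iff_of_nonneg
    (by positivity), mul_lt_mul_iff_right₀ h0, pow_lt_pow_iff_left₀ ha hr (by omega)]

lemma rearr_superlevel (hN : 2 ≤ N) (hf : Adm f) {t : ℝ} (ht : 0 ≤ t) :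
    ∃ r : ℝ, 0 ≤ r ∧ {x | t < rearr f x} = Metric.ball 0 r ∧
      volume (Metric.ball (0 : Eu N) r) = volume {x | t < f x} := by
  obtain ⟨r, hr, h⟩ := exists_ball_volume hN (hf.volume_lt_lt_top ht).ne
  refine ⟨r, hr, ?_, h 0⟩
  ext x
  rw [Set.mem_ofPred_eq, lt_rearr_iff hf ht, ← h 0, volume_ball_lt_iff hN (norm_nonneg _) hr,
    mem_ball_zero_iff]

lemma measurable_rearr (hN : 2 ≤ N) (hf : Adm f) : Measurable (rearr f) := by
  refine measurable_of_Ioi fun t => ?_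
  change MeasurableSet {x | t < rearr f x}
  rcases le_or_gt 0 t with ht | ht
  · obtain ⟨r, _, h, _⟩ := rearr_superlevel hN hf ht
    rw [h]; exact measurableSet_ball
  · have : {x | t < rearr f x} = Set.univ := by
      ext x; simp [ht.trans_le (rearr_nonneg x)]
    rw [this]; exact MeasurableSet.univ

lemma eqDist_rearr (hN : 2 ≤ N) (hf : Adm f) : EqDist (rearr f) f := by
  intro t ht
  obtain ⟨r, _, h, h'⟩ := rearr_superlevel hN hf ht
  rw [h, h']

lemma EqDist.rearr_eq (h : EqDist f g) : rearr f = rearr g := by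
  funext x
  unfold rearr
  congr 1
  ext t
  simp only [Set.mem_ofPred_eq]
  refine and_congr_right fun ht => ?_
  rw [h t ht]

lemma EqDist.lintegral_eq (h : EqDist f g) (hf : Measurable f) (hg : Measurable g)
    (hf0 : ∀ x, 0 ≤ f x) (hg0 : ∀ x, 0 ≤ g x) (hfin : volume {x | 0 < f x} ≠ ⊤)
    {G : ℝ → ℝ≥0∞} (hG : Measurable G) (hG0 : G 0 = 0) :
    ∫⁻ x, G (f x) = ∫⁻ x, G (g x) := by
  have key : ∀ {k : Eu N → ℝ}, Measurable k → (∀ x, 0 ≤ k x) → ∫⁻ x, G (k x) =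
      ∫⁻ t, G t ∂((Measure.map k volume).restrict (Set.Ioi 0)) := by
    intro k hk hk0
    rw [setLIntegral_map measurableSet_Ioi hG hk, ← lintegral_indicator (hk measurableSet_Ioi)]
    refine lintegral_congr fun x => ?_
    by_cases hx : 0 < k x
    · rw [Set.indicator_of_mem]; exact hx
    · rw [Set.indicator_of_notMem (by exact hx), le_antisymm (not_lt.1 hx) (hk0 x), hG0]
  have hfin2 : IsFiniteMeasure ((Measure.map f volume).restrict (Set.Ioi 0)) := by
    refine ⟨?_⟩
    rw [Measure.restrict_apply_univ, Measure.map_apply hf measurableSet_Ioi]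
    exact lt_top_iff_ne_top.2 hfin
  have : (Measure.map f volume).restrict (Set.Ioi 0) =
      (Measure.map g volume).restrict (Set.Ioi 0) := by
    refine MeasureTheory.ext_of_generate_finite (Set.range Set.Ioi)
      (borel_eq_generateFrom_Ioi ℝ ▸ BorelSpace.measurable_eq) isPiSystem_Ioi ?_ ?_
    · rintro _ ⟨a, rfl⟩
      rw [Measure.restrict_apply measurableSet_Ioi, Measure.restrict_apply measurableSet_Ioi,
        Set.Ioi_inter_Ioi, Measure.map_apply hf measurableSet_Ioi,
        Measure.map_apply hg measurableSet_Ioi]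
      exact h _ le_sup_right
    · rw [Measure.restrict_apply_univ, Measure.restrict_apply_univ,
        Measure.map_apply hf measurableSet_Ioi, Measure.map_apply hg measurableSet_Ioi]
      exact h 0 le_rfl
  rw [key hf hf0, key hg hg0, this]

lemma rearr_le (hf : Adm f) {M : ℝ} (hM : 0 ≤ M) (h : ∀ x, f x ≤ M) (x : Eu N) :
    rearr f x ≤ M := by
  by_contra hc
  have := (lt_rearr_iff hf hM x).1 (not_le.1 hc)
  have e : {y | M < f y} = ∅ := by
    ext y; simpa using h y
  rw [e, measure_empty] at this
  exact absurd this not_lt_zero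

lemma Adm.rearr (hN : 2 ≤ N) (hf : Adm f) : Adm (rearr f) where
  meas := measurable_rearr hN hf
  nonneg := rearr_nonneg
  bdd := by
    obtain ⟨M, hM, h⟩ := hf.bdd
    exact ⟨M, hM, rearr_le hf hM.le h⟩
  supp := by
    obtain ⟨r, hr, h1, -⟩ := rearr_superlevel hN hf le_rfl
    refine ⟨r + 1, by linarith, fun x hx => ?_⟩
    by_contra hc
    have h2 : x ∈ {x | 0 < _root_.rearr f x} := lt_of_le_of_ne (rearr_nonneg x) (Ne.symm hc)
    rw [h1, mem_ball_zero_iff] at h2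
    linarith

lemma ofReal_sub_eq_lintegral {a b M : ℝ} (ha : a ≤ M) (hb : 0 ≤ b) :
    ENNReal.ofReal (a - b) = ∫⁻ t in Set.Ico 0 M, if b ≤ t ∧ t < a then 1 else 0 := by
  have e : (fun t => if b ≤ t ∧ t < a then (1 : ℝ≥0∞) else 0) = (Set.Ico b a).indicator 1 := by
    funext t; simp [Set.indicator_apply]
  rw [e, lintegral_indicator_one measurableSet_Ico, Measure.restrict_apply measurableSet_Ico]
  have : Set.Ico b a ∩ Set.Ico 0 M = Set.Ico b a :=
    Set.inter_eq_left.2 (Set.Ico_subset_Ico hb ha)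
  rw [this, Real.volume_Ico]

lemma lintegral_ofReal_sub (hf : Measurable f) (hg : Measurable g) (hg0 : ∀ x, 0 ≤ g x)
    {M : ℝ} (hM : ∀ x, f x ≤ M) :
    ∫⁻ x, ENNReal.ofReal (f x - g x) =
      ∫⁻ t in Set.Ico 0 M, volume ({x | t < f x} \ {x | t < g x}) := by
  have hm : Measurable fun z : Eu N × ℝ => if g z.1 ≤ z.2 ∧ z.2 < f z.1 then (1 : ℝ≥0∞) else 0 :=
    Measurable.ite ((measurableSet_le (hg.comp measurable_fst) measurable_snd).inter
      (measurableSet_lt measurable_snd (hf.comp measurable_fst))) measurable_const measurable_const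
  calc _ = ∫⁻ x, ∫⁻ t in Set.Ico 0 M, if g x ≤ t ∧ t < f x then 1 else 0 :=
        lintegral_congr fun x => ofReal_sub_eq_lintegral (hM x) (hg0 x)
    _ = ∫⁻ t in Set.Ico 0 M, ∫⁻ x, if g x ≤ t ∧ t < f x then 1 else 0 :=
        lintegral_lintegral_swap hm.aemeasurable
    _ = _ := by
        refine lintegral_congr fun t => ?_
        rw [← lintegral_indicator_one]
        · refine lintegral_congr fun x => ?_
          simp [Set.indicator_apply, and_comm]
        · exact (measurableSet_lt measurable_const hf).diff (measurableSet_lt measurable_const hg)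

lemma measure_diff_comm_of_eq {A B : Set (Eu N)} (hA : MeasurableSet A) (hB : MeasurableSet B)
    (h : volume A = volume B) (hfin : volume A ≠ ⊤) : volume (A \ B) = volume (B \ A) := by
  have h1 := measure_inter_add_sdiff (μ := volume) A hB
  have h2 := measure_inter_add_sdiff (μ := volume) B hA
  rw [Set.inter_comm] at h2
  have h3 : volume (A ∩ B) ≠ ⊤ := measure_ne_top_of_subset Set.inter_subset_left hfin
  rw [← h2, ← h1] at h
  exact (ENNReal.add_right_inj h3).1 h

lemma lintegral_sub_rearr_comm (hN : 2 ≤ N) (hf : Adm f) :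
    ∫⁻ x, ENNReal.ofReal (rearr f x - f x) = ∫⁻ x, ENNReal.ofReal (f x - rearr f x) := by
  obtain ⟨M, hM, h⟩ := hf.bdd
  have hr := hf.rearr hN
  rw [lintegral_ofReal_sub hr.meas hf.meas hf.nonneg (rearr_le hf hM.le h),
    lintegral_ofReal_sub hf.meas hr.meas hr.nonneg h]
  refine setLIntegral_congr_fun measurableSet_Ico fun t ht => ?_
  exact measure_diff_comm_of_eq (measurableSet_lt measurable_const hr.meas)
    (measurableSet_lt measurable_const hf.meas) (eqDist_rearr hN hf t ht.1)
    (hr.volume_lt_lt_top ht.1).ne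

/-- Distance to the rearrangement in terms of the radial defect. -/
lemma sq_lintegral_sub_rearr_le (hN : 2 ≤ N) (hf : Adm f) {M : ℝ}
    (h : ∀ x, f x ≤ M) :
    (∫⁻ x, ENNReal.ofReal (f x - rearr f x)) ^ 2 ≤ ENNReal.ofReal M * radDefect f := by
  have hr := hf.rearr hN
  have mE : ∀ t, MeasurableSet {x | t < f x} := fun t => measurableSet_lt measurable_const hf.meas
  have mB : ∀ t, MeasurableSet {x | t < rearr f x} := fun t =>
    measurableSet_lt measurable_const hr.meas
  obtain ⟨U, hU⟩ : ∃ U : Eu N → ℝ → ℝ≥0∞,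
    U = fun x t => if rearr f x ≤ t ∧ t < f x then 1 else 0 := ⟨_, rfl⟩
  obtain ⟨V, hV⟩ : ∃ V : Eu N → ℝ → ℝ≥0∞,
    V = fun x t => if f x ≤ t ∧ t < rearr f x then 1 else 0 := ⟨_, rfl⟩
  have hm : Measurable fun z : Eu N × ℝ => U z.1 z.2 := by
    rw [hU]
    exact Measurable.ite ((measurableSet_le (hr.meas.comp measurable_fst) measurable_snd).inter
      (measurableSet_lt measurable_snd (hf.meas.comp measurable_fst))) measurable_const
      measurable_const
  have hm' : Measurable fun z : Eu N × ℝ => V z.1 z.2 := by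
    rw [hV]
    exact Measurable.ite ((measurableSet_le (hf.meas.comp measurable_fst) measurable_snd).inter
      (measurableSet_lt measurable_snd (hr.meas.comp measurable_fst))) measurable_const
      measurable_const
  have e1 : ∀ t, volume ({x | t < f x} \ {x | t < rearr f x}) = ∫⁻ x, U x t := fun t => by
    rw [← lintegral_indicator_one ((mE t).diff (mB t)), hU]
    refine lintegral_congr fun x => ?_
    simp [Set.indicator_apply, and_comm]
  have e2 : ∀ t, volume ({x | t < rearr f x} \ {x | t < f x}) = ∫⁻ x, V x t := fun t => by
    rw [← lintegral_indicator_one ((mB t).diff (mE t)), hV]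
    refine lintegral_congr fun x => ?_
    simp [Set.indicator_apply, and_comm]
  have me : Measurable fun t => volume ({x | t < f x} \ {x | t < rearr f x}) := by
    simp only [e1]
    exact hm.lintegral_prod_left'
  rw [lintegral_ofReal_sub hf.meas hr.meas hr.nonneg h]
  refine (sq_lintegral_le _ me.aemeasurable).trans ?_
  rw [Measure.restrict_apply_univ, Real.volume_Ico, sub_zero]
  gcongr
  have m3 : Measurable fun z : (Eu N × Eu N) × ℝ => V z.1.1 z.2 * U z.1.2 z.2 := by
    have h1 : Measurable fun z : (Eu N × Eu N) × ℝ => (z.1.1, z.2) := by fun_prop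
    have h2 : Measurable fun z : (Eu N × Eu N) × ℝ => (z.1.2, z.2) := by fun_prop
    exact (hm'.comp h1).mul (hm.comp h2)
  calc ∫⁻ t in Set.Ico 0 M, volume ({x | t < f x} \ {x | t < rearr f x}) ^ 2
      = ∫⁻ t in Set.Ico 0 M, ∫⁻ z : Eu N × Eu N, V z.1 t * U z.2 t := by
        refine setLIntegral_congr_fun measurableSet_Ico fun t ht => ?_
        have h5 := measure_diff_comm_of_eq (mE t) (mB t) (eqDist_rearr hN hf t ht.1).symm
          (hf.volume_lt_lt_top ht.1).ne
        beta_reduce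
        rw [pow_two]
        nth_rw 1 [h5]
        rw [e1, e2, Measure.volume_eq_prod]
        have h6 : Measurable fun x => V x t := hm'.comp (measurable_id.prodMk measurable_const)
        have h7 : Measurable fun x => U x t := hm.comp (measurable_id.prodMk measurable_const)
        exact (lintegral_prod_mul h6.aemeasurable h7.aemeasurable).symm
    _ = ∫⁻ z : Eu N × Eu N, ∫⁻ t in Set.Ico 0 M, V z.1 t * U z.2 t :=
        (lintegral_lintegral_swap m3.aemeasurable).symm
    _ ≤ ∫⁻ z : Eu N × Eu N, ENNReal.ofReal (if ‖z.1‖ < ‖z.2‖ then max (f z.2 - f z.1) 0 else 0) := by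
        refine lintegral_mono fun z => ?_
        by_cases hz : ‖z.1‖ < ‖z.2‖
        · have : ENNReal.ofReal (max (f z.2 - f z.1) 0) = ENNReal.ofReal (f z.2 - f z.1) := by
            rcases le_total (f z.2 - f z.1) 0 with h8 | h8
            · rw [max_eq_right h8, ENNReal.ofReal_of_nonpos h8, ENNReal.ofReal_zero]
            · rw [max_eq_left h8]
          beta_reduce
          rw [if_pos hz, this, ofReal_sub_eq_lintegral (h z.2) (hf.nonneg z.1), hU, hV]
          refine lintegral_mono fun t => ?_
          beta_reduce
          by_cases h8 : f z.1 ≤ t ∧ t < f z.2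
          · rw [if_pos h8]
            split_ifs <;> simp
          · rw [if_neg h8]
            split_ifs with h9 h10 h10 <;> simp
            exact h8 ⟨h9.1, h10.2⟩
        · beta_reduce
          rw [if_neg hz]
          refine le_of_eq ?_
          rw [ENNReal.ofReal_zero, hU, hV]
          refine (setLIntegral_congr_fun measurableSet_Ico fun t ht => ?_).trans lintegral_zero
          beta_reduce
          split_ifs with h9 h10 h10 <;> simp
          have h11 := (lt_rearr_iff hf ht.1 z.1).1 h9.2
          have h12 : t < rearr f z.2 := (lt_rearr_iff hf ht.1 z.2).2
            (lt_of_le_of_lt (measure_mono (Metric.ball_subset_ball (not_lt.1 hz))) h11)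
          linarith [h10.1]
    _ = radDefect f := by
        unfold radDefect
        rw [dint_eq_prod (measurable_radDefect_integrand hf.meas)]

end Rearrangement

/-- The second moment. -/
def mom {N : ℕ} (f : Eu N → ℝ) : ℝ≥0∞ := ∫⁻ x, ENNReal.ofReal (‖x‖ ^ 2 * f x)

section Riesz

variable {N : ℕ} {s : ℝ} {ν : Eu N} {h R : ℝ} {f g : Eu N → ℝ}

lemma EqDist.trans {k : Eu N → ℝ} (h : EqDist f g) (h' : EqDist g k) : EqDist f k :=
  fun t ht => (h t ht).trans (h' t ht)

lemma eqDist_pol (hν : ‖ν‖ = 1) (hf : Measurable f) : EqDist (pol ν h f) f := by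
  intro t _
  have hG : Measurable ((Set.Ioi t).indicator (1 : ℝ → ℝ≥0∞)) :=
    measurable_one.indicator measurableSet_Ioi
  have := lintegral_pol (h := h) hν hf hG
  rw [← lintegral_indicator_one (measurableSet_lt measurable_const (measurable_pol hf)),
    ← lintegral_indicator_one (measurableSet_lt measurable_const hf)]
  exact this

lemma pol_nonneg (hf : ∀ x, 0 ≤ f x) (x : Eu N) : 0 ≤ pol ν h f x :=
  pol_mem (S := Set.Ici 0) (hf x) (hf _)

lemma norm_le_norm_rfl' (hν : ‖ν‖ = 1) (hh : 0 ≤ h) {x : Eu N} (hx : ⟪x, ν⟫ ≤ h) :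
    ‖x‖ ≤ ‖rfl' ν h x‖ := by
  have h1 := norm_rfl'_sq (h := h) hν x
  have h2 : 0 ≤ 4 * h * (h - ⟪x, ν⟫) := mul_nonneg (by linarith) (by linarith)
  exact (sq_le_sq₀ (norm_nonneg _) (norm_nonneg _)).1 (by linarith)

lemma pol_supp (hν : ‖ν‖ = 1) (hh : 0 ≤ h) (hf0 : ∀ x, 0 ≤ f x) (hf : ∀ x, R < ‖x‖ → f x = 0)
    (x : Eu N) (hx : R < ‖x‖) : pol ν h f x = 0 := by
  rcases le_total ⟪x, ν⟫ h with h1 | h1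
  · rw [pol_le h1, hf x hx, hf _ (hx.trans_le (norm_le_norm_rfl' hν hh h1)), max_self]
  · rw [pol_ge h1, hf x hx, min_eq_left (hf0 _)]

lemma Adm.pol (hf : Adm f) (hν : ‖ν‖ = 1) (hh : 0 ≤ h) : Adm (pol ν h f) where
  meas := measurable_pol hf.meas
  nonneg := pol_nonneg hf.nonneg
  bdd := by
    obtain ⟨M, hM, h⟩ := hf.bdd
    exact ⟨M, hM, fun x => pol_mem (S := Set.Iic M) (h x) (h _)⟩
  supp := by
    obtain ⟨R, hR, h⟩ := hf.supp
    exact ⟨R, hR, pol_supp hν hh hf.nonneg h⟩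

lemma Adm.lintegral_lt_top (hf : Adm f) : ∫⁻ x, ENNReal.ofReal (f x) < ⊤ := by
  obtain ⟨R, hR, h⟩ := hf.supp
  obtain ⟨M, hM, h'⟩ := hf.bdd
  calc _ ≤ ∫⁻ x, (Metric.closedBall (0 : Eu N) R).indicator (fun _ => ENNReal.ofReal M) x := by
        refine lintegral_mono fun x => ?_
        by_cases hx : x ∈ Metric.closedBall (0 : Eu N) R
        · rw [Set.indicator_of_mem hx]; exact ENNReal.ofReal_le_ofReal (h' x)
        · rw [mem_closedBall_zero_iff, not_le] at hx
          rw [h x hx]; simp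
    _ < ⊤ := by
        rw [lintegral_indicator measurableSet_closedBall, setLIntegral_const]
        exact ENNReal.mul_lt_top ENNReal.ofReal_lt_top measure_closedBall_lt_top

lemma mom_lt_top (hf : Adm f) : mom f < ⊤ := by
  obtain ⟨R, hR, h⟩ := hf.supp
  calc mom f ≤ ∫⁻ x, ENNReal.ofReal (R ^ 2) * ENNReal.ofReal (f x) := by
        refine lintegral_mono fun x => ?_
        rw [← ENNReal.ofReal_mul (by positivity)]
        rcases lt_or_ge R ‖x‖ with hx | hx
        · rw [h x hx]; simp
        · exact ENNReal.ofReal_le_ofReal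
            (mul_le_mul_of_nonneg_right (by gcongr) (hf.nonneg x))
    _ < ⊤ := by
        rw [lintegral_const_mul' _ _ ENNReal.ofReal_ne_top]
        exact ENNReal.mul_lt_top ENNReal.ofReal_lt_top hf.lintegral_lt_top

lemma measurable_reflDefect_integrand (hf : Measurable f) : Measurable fun x =>
    if ⟪x, ν⟫ < h then (h - ⟪x, ν⟫) * max (f (rfl' ν h x) - f x) 0 else 0 := by
  refine Measurable.ite (measurableSet_lt (by fun_prop) measurable_const) ?_ measurable_const
  refine Measurable.mul (by fun_prop) ?_
  exact ((hf.comp measurable_rfl').sub hf).max measurable_const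

/-- Polarization decreases the second moment. -/
lemma mom_pol_add_le (hν : ‖ν‖ = 1) (hh : 0 ≤ h) (hf : Measurable f) (hf0 : ∀ x, 0 ≤ f x) :
    mom (pol ν h f) + ENNReal.ofReal (2 * h) * reflDefect f ν h ≤ mom f := by
  have key : ∀ k : Eu N → ℝ, Measurable k → (∀ x, 0 ≤ k x) →
      2 * mom k = ∫⁻ x, ENNReal.ofReal (‖x‖ ^ 2 * k x + ‖rfl' ν h x‖ ^ 2 * k (rfl' ν h x)) := by
    intro k hk hk0
    have h1 := lintegral_comp_rfl' (h := h) hν fun x => ENNReal.ofReal (‖x‖ ^ 2 * k x)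
    have hm : Measurable fun x : Eu N => ENNReal.ofReal (‖x‖ ^ 2 * k x) :=
      ((measurable_norm.pow_const 2).mul hk).ennreal_ofReal
    rw [two_mul]
    nth_rw 2 [mom]
    rw [← h1, mom, ← lintegral_add_left hm]
    refine lintegral_congr fun x => ?_
    rw [ENNReal.ofReal_add (mul_nonneg (by positivity) (hk0 _))
      (mul_nonneg (by positivity) (hk0 _))]
  have h2 : 2 * mom (pol ν h f) + 2 * (ENNReal.ofReal (2 * h) * reflDefect f ν h) ≤ 2 * mom f := by
    have e : 2 * (ENNReal.ofReal (2 * h) * reflDefect f ν h) = ∫⁻ x, ENNReal.ofReal (4 * h *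
        (if ⟪x, ν⟫ < h then (h - ⟪x, ν⟫) * max (f (rfl' ν h x) - f x) 0 else 0)) := by
      have e1 : ∀ x, ENNReal.ofReal (4 * h *
        (if ⟪x, ν⟫ < h then (h - ⟪x, ν⟫) * max (f (rfl' ν h x) - f x) 0 else 0)) =
          ENNReal.ofReal (4 * h) * ENNReal.ofReal
          (if ⟪x, ν⟫ < h then (h - ⟪x, ν⟫) * max (f (rfl' ν h x) - f x) 0 else 0) := fun x =>
        ENNReal.ofReal_mul (by linarith)
      simp only [e1]
      rw [lintegral_const_mul' _ _ ENNReal.ofReal_ne_top, ← mul_assoc, reflDefect]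
      congr 1
      rw [show (4 : ℝ) * h = 2 * (2 * h) by ring, ENNReal.ofReal_mul (by norm_num)]
      simp
    have hm := measurable_reflDefect_integrand (ν := ν) (h := h) hf
    rw [key _ (measurable_pol hf) (pol_nonneg hf0), key _ hf hf0, e,
      ← lintegral_add_right _ (hm.const_mul _).ennreal_ofReal]
    refine lintegral_mono fun x => ?_
    beta_reduce
    rw [← ENNReal.ofReal_add]
    · refine ENNReal.ofReal_le_ofReal ?_
      have h3 := norm_rfl'_sq (h := h) hν x
      rw [h3]
      rcases lt_or_ge ⟪x, ν⟫ h with hx | hx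
      · have hx2 : h ≤ ⟪rfl' ν h x, ν⟫ := by rw [inner_rfl' hν]; linarith
        rw [pol_le hx.le, pol_ge hx2, rfl'_rfl' hν, if_pos hx]
        rcases le_total (f x) (f (rfl' ν h x)) with h4 | h4
        · rw [max_eq_right h4, min_eq_right h4, max_eq_left (by linarith)]
          exact le_of_eq (by ring)
        · rw [max_eq_left h4, min_eq_left h4, max_eq_right (by linarith)]
          exact le_of_eq (by ring)
      · have hx2 : ⟪rfl' ν h x, ν⟫ ≤ h := by rw [inner_rfl' hν]; linarith
        rw [pol_ge hx, pol_le hx2, rfl'_rfl' hν, if_neg (not_lt.2 hx)]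
        have h5 : 4 * h * (h - ⟪x, ν⟫) ≤ 0 :=
          mul_nonpos_of_nonneg_of_nonpos (by linarith) (by linarith)
        rcases le_total (f x) (f (rfl' ν h x)) with h4 | h4
        · rw [min_eq_left h4, max_eq_left h4]
          exact le_of_eq (by ring)
        · rw [min_eq_right h4, max_eq_right h4]
          nlinarith
    · have := pol_nonneg (ν := ν) (h := h) hf0
      exact add_nonneg (mul_nonneg (by positivity) (this _)) (mul_nonneg (by positivity) (this _))
    · split_ifs with h6
      · exact mul_nonneg (by linarith) (mul_nonneg (by linarith) (le_max_right _ _))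
      · simp
  rw [← mul_add] at h2
  exact (ENNReal.mul_le_mul_iff_right (by norm_num) (by norm_num)).1 h2

lemma reflDefect_le (hν : ‖ν‖ = 1) (hh : 0 ≤ h) (hf0 : ∀ x, 0 ≤ f x) (hR : 0 ≤ R)
    (hf : ∀ x, R < ‖x‖ → f x = 0) :
    reflDefect f ν h ≤ ENNReal.ofReal R * ∫⁻ x, ENNReal.ofReal (f x) := by
  rw [← lintegral_comp_rfl' (h := h) hν fun x => ENNReal.ofReal (f x),
    ← lintegral_const_mul' _ _ ENNReal.ofReal_ne_top, reflDefect]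
  refine lintegral_mono fun x => ?_
  beta_reduce
  rw [← ENNReal.ofReal_mul hR]
  refine ENNReal.ofReal_le_ofReal ?_
  have h0 := hf0 (rfl' ν h x)
  split_ifs with hx
  · rcases lt_or_ge R ‖rfl' ν h x‖ with h1 | h1
    · rw [hf _ h1, max_eq_right (by linarith [hf0 x])]; simp
    · have h2 := inner_rfl' (h := h) hν x
      have h3 := (real_inner_le_norm (rfl' ν h x) ν).trans (by rw [hν, mul_one])
      refine mul_le_mul (by linarith) (max_le (by linarith [hf0 x]) h0) (le_max_right _ _) hR
  · positivity

/-- A cubic bound gives the decay required in `radDefect_le`. -/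
lemma le_rpow_of_cube_mul_le {D K : ℝ≥0∞} {h : ℝ} (hh : 0 < h)
    (hD : D ^ 3 * ENNReal.ofReal h ≤ K) :
    D ≤ K ^ (1 / 3 : ℝ) * ENNReal.ofReal (h ^ (-(1 / 3) : ℝ)) := by
  have h1 : D = (D ^ 3) ^ (1 / 3 : ℝ) := by
    rw [← ENNReal.rpow_natCast, ← ENNReal.rpow_mul]; norm_num
  have h2 : D ^ 3 ≤ K * ENNReal.ofReal h⁻¹ := by
    rw [ENNReal.ofReal_inv_of_pos hh, ← div_eq_mul_inv]
    exact (ENNReal.le_div_iff_mul_le (Or.inl (by simpa using hh)) (Or.inl ENNReal.ofReal_ne_top)).2 hD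
  calc D = (D ^ 3) ^ (1 / 3 : ℝ) := h1
    _ ≤ (K * ENNReal.ofReal h⁻¹) ^ (1 / 3 : ℝ) := by gcongr
    _ = _ := by
      rw [ENNReal.mul_rpow_of_nonneg _ _ (by norm_num), ENNReal.ofReal_rpow_of_pos (by positivity),
        Real.inv_rpow hh.le, Real.rpow_neg hh.le]

/-- Lower semicontinuity of the energy with respect to `L¹` convergence. -/
lemma gagliardoSq_le_of_tendsto {F : ℕ → Eu N → ℝ} (hF : ∀ n, Measurable (F n))
    (hf : Measurable f) {C : ℝ≥0∞} (hC : ∀ n, gagliardoSq N s (F n) ≤ C)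
    (h : Tendsto (fun n => ∫⁻ x, ENNReal.ofReal |F n x - f x|) atTop (𝓝 0)) :
    gagliardoSq N s f ≤ C := by
  have h1 : TendstoInMeasure volume F atTop f := by
    refine tendstoInMeasure_of_tendsto_eLpNorm one_ne_zero (fun n => (hF n).aestronglyMeasurable)
      hf.aestronglyMeasurable ?_
    refine h.congr fun n => ?_
    rw [eLpNorm_one_eq_lintegral_enorm]
    refine lintegral_congr fun x => ?_
    rw [Pi.sub_apply, Real.enorm_eq_ofReal_abs]
  obtain ⟨φ, -, hφ⟩ := h1.exists_seq_tendsto_ae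
  refine (gagliardoSq_fatou (fun n => hF (φ n)) hφ).trans ?_
  exact liminf_le_of_frequently_le' (Frequently.of_forall fun n => hC _)

lemma lintegral_abs_sub_rearr (hN : 2 ≤ N) (hf : Adm f) :
    ∫⁻ x, ENNReal.ofReal |f x - rearr f x| = 2 * ∫⁻ x, ENNReal.ofReal (f x - rearr f x) := by
  rw [two_mul]
  nth_rw 2 [← lintegral_sub_rearr_comm hN hf]
  have hm : Measurable fun x => ENNReal.ofReal (f x - rearr f x) :=
    (hf.meas.sub (hf.rearr hN).meas).ennreal_ofReal
  rw [← lintegral_add_left hm]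
  refine lintegral_congr fun x => ?_
  rcases le_total (f x) (rearr f x) with h1 | h1
  · rw [abs_of_nonpos (by linarith), ENNReal.ofReal_of_nonpos (p := f x - rearr f x) (by linarith)]
    simp
  · rw [abs_of_nonneg (by linarith), ENNReal.ofReal_of_nonpos (p := rearr f x - f x) (by linarith)]
    simp

/-- Quantitative closeness to the rearrangement from smallness of the reflection defects. -/
lemma sq_lintegral_sub_rearr_le_of_reflDefect (hN : 2 ≤ N) (hf : Adm f) {M : ℝ}
    (hfM : ∀ x, f x ≤ M) (hR : 0 < R) (hfR : ∀ x, R < ‖x‖ → f x = 0) {K : ℝ≥0∞}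
    (hK : ∀ ν : Eu N, ‖ν‖ = 1 → ∀ h : ℝ, 0 < h → reflDefect f ν h ^ 3 * ENNReal.ofReal h ≤ K) :
    (∫⁻ x, ENNReal.ofReal (f x - rearr f x)) ^ 2 ≤
      ENNReal.ofReal M * (radConst N R * K ^ (1 / 3 : ℝ)) := by
  refine (sq_lintegral_sub_rearr_le hN hf hfM).trans ?_
  gcongr
  exact radDefect_le hN hf.meas hf.nonneg hR hfR fun ν hν h hh =>
    le_rpow_of_cube_mul_le hh (hK ν hν h hh)

/-- Fractional Pólya–Szegő inequality. -/
theorem gagliardoSq_rearr_le (hN : 2 ≤ N) (hs : 0 < s) (hf : Adm f) :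
    gagliardoSq N s (rearr f) ≤ gagliardoSq N s f := by
  obtain ⟨M, hM, hfM⟩ := hf.bdd
  obtain ⟨R, hR, hfR⟩ := hf.supp
  let P : Set (Eu N → ℝ) := {g | Adm g ∧ (∀ x, g x ≤ M) ∧ (∀ x, R < ‖x‖ → g x = 0) ∧
    EqDist g f ∧ gagliardoSq N s g ≤ gagliardoSq N s f}
  have hfP : f ∈ P := ⟨hf, hfM, hfR, fun _ _ => rfl, le_rfl⟩
  have hpol : ∀ g ∈ P, ∀ ν : Eu N, ‖ν‖ = 1 → ∀ h : ℝ, 0 ≤ h → pol ν h g ∈ P := by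
    rintro g ⟨h1, h2, h3, h4, h5⟩ ν hν h hh
    exact ⟨h1.pol hν hh, fun x => pol_mem (S := Set.Iic M) (h2 x) (h2 _),
      pol_supp hν hh h1.nonneg h3, (eqDist_pol hν h1.meas).trans h4,
      (gagliardoSq_pol_le hs hν h1.meas).trans h5⟩
  obtain ⟨m0, hm0⟩ : ∃ m0, m0 = sInf (mom '' P) := ⟨_, rfl⟩
  have hm0le : ∀ g ∈ P, m0 ≤ mom g := fun g hg => hm0 ▸ sInf_le ⟨g, hg, rfl⟩
  have hm0top : m0 ≠ ⊤ := ((hm0le f hfP).trans_lt (mom_lt_top hf)).ne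
  have hex : ∀ n : ℕ, ∃ g ∈ P, mom g ≤ m0 + ENNReal.ofReal (1 / ((n : ℝ) + 1)) := by
    intro n
    have : m0 < m0 + ENNReal.ofReal (1 / ((n : ℝ) + 1)) :=
      ENNReal.lt_add_right hm0top (by simp; positivity)
    nth_rw 1 [hm0] at this
    obtain ⟨_, ⟨g, hg, rfl⟩, h⟩ := sInf_lt_iff.1 this
    exact ⟨g, hg, h.le⟩
  choose g hgP hg using hex
  obtain ⟨C1, hC1⟩ : ∃ C1, C1 = ENNReal.ofReal R * ∫⁻ x, ENNReal.ofReal (f x) := ⟨_, rfl⟩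
  have hC1top : C1 ≠ ⊤ := by
    rw [hC1]; exact (ENNReal.mul_lt_top ENNReal.ofReal_lt_top hf.lintegral_lt_top).ne
  have hstar : ∀ n, rearr (g n) = rearr f := fun n => (hgP n).2.2.2.1.rearr_eq
  have hrefl : ∀ n ν, ‖ν‖ = 1 → ∀ h : ℝ, 0 < h → reflDefect (g n) ν h ^ 3 * ENNReal.ofReal h ≤
      C1 ^ 2 * ENNReal.ofReal (1 / ((n : ℝ) + 1)) := by
    intro n ν hν h hh
    obtain ⟨h1, h2, h3, h4, h5⟩ := hgP n
    have a1 : reflDefect (g n) ν h ≤ C1 := by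
      have e : ∫⁻ x, ENNReal.ofReal (g n x) = ∫⁻ x, ENNReal.ofReal (f x) :=
        h4.lintegral_eq h1.meas hf.meas h1.nonneg hf.nonneg h1.volume_pos_lt_top.ne
          ENNReal.measurable_ofReal ENNReal.ofReal_zero
      rw [hC1, ← e]
      exact reflDefect_le hν hh.le h1.nonneg hR.le h3
    have a2 : ENNReal.ofReal (2 * h) * reflDefect (g n) ν h ≤
        ENNReal.ofReal (1 / ((n : ℝ) + 1)) := by
      have b1 := mom_pol_add_le hν hh.le h1.meas h1.nonneg
      have b2 := hm0le _ (hpol _ (hgP n) ν hν h hh.le)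
      have b3 : m0 + ENNReal.ofReal (2 * h) * reflDefect (g n) ν h ≤
          m0 + ENNReal.ofReal (1 / ((n : ℝ) + 1)) :=
        (add_le_add_left b2 _).trans (b1.trans (hg n))
      exact (ENNReal.add_le_add_iff_left hm0top).1 b3
    calc _ = reflDefect (g n) ν h ^ 2 * (ENNReal.ofReal h * reflDefect (g n) ν h) := by ring
      _ ≤ C1 ^ 2 * (ENNReal.ofReal (2 * h) * reflDefect (g n) ν h) := by
        gcongr; linarith
      _ ≤ _ := by gcongr
  have hconv : Tendsto (fun n => ∫⁻ x, ENNReal.ofReal |g n x - rearr f x|) atTop (𝓝 0) := by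
    have hε : Tendsto (fun n : ℕ => ENNReal.ofReal (1 / ((n : ℝ) + 1))) atTop (𝓝 0) := by
      have := ENNReal.tendsto_ofReal tendsto_one_div_add_atTop_nhds_zero_nat
      simpa using this
    have b1 : Tendsto (fun n : ℕ => ENNReal.ofReal M * (radConst N R *
        (C1 ^ 2 * ENNReal.ofReal (1 / ((n : ℝ) + 1))) ^ (1 / 3 : ℝ))) atTop (𝓝 0) := by
      have c1 := ENNReal.Tendsto.const_mul hε (a := C1 ^ 2) (Or.inr (by simp [hC1top]))
      have c2 := c1.ennrpow_const (1 / 3 : ℝ)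
      have c3 := ENNReal.Tendsto.const_mul c2 (a := radConst N R) (Or.inr (radConst_lt_top R hR).ne)
      have c4 := ENNReal.Tendsto.const_mul c3 (a := ENNReal.ofReal M) (Or.inr ENNReal.ofReal_ne_top)
      simpa using c4
    have b2 : Tendsto (fun n => (∫⁻ x, ENNReal.ofReal (g n x - rearr f x)) ^ 2) atTop (𝓝 0) := by
      refine tendsto_of_tendsto_of_tendsto_of_le_of_le tendsto_const_nhds b1
        (fun _ => zero_le) fun n => ?_
      have := sq_lintegral_sub_rearr_le_of_reflDefect hN (hgP n).1 (hgP n).2.1 hR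
        (hgP n).2.2.1 (hrefl n)
      rwa [hstar] at this
    have b3 := (b2.ennrpow_const (1 / 2 : ℝ))
    have b4 := ENNReal.Tendsto.const_mul b3 (a := 2) (Or.inr (by norm_num))
    have e0 : (2 : ℝ≥0∞) * 0 ^ (1 / 2 : ℝ) = 0 := by
      rw [ENNReal.zero_rpow_of_pos (by norm_num), mul_zero]
    rw [e0] at b4
    refine b4.congr fun n => ?_
    have := lintegral_abs_sub_rearr hN (hgP n).1
    rw [hstar] at this
    rw [this, ← ENNReal.rpow_natCast, ← ENNReal.rpow_mul]
    norm_num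
  exact gagliardoSq_le_of_tendsto (fun n => (hgP n).1.meas) (measurable_rearr hN hf)
    (fun n => (hgP n).2.2.2.2) hconv

end Riesz

section Admissible

variable {N : ℕ} {s q : ℝ} {f u : Eu N → ℝ}

lemma gagliardoSq_l2 (hN : 2 ≤ N) (hs0 : 0 < s) :
    ∃ c : ℝ, 0 < c ∧ ∀ f : Eu N → ℝ, Measurable f → ∀ m : ℝ, 0 < m →
      volume {x | f x ≠ 0} ≤ ENNReal.ofReal m →
      ENNReal.ofReal (c * m ^ (-(2 * s / N))) * ∫⁻ x, ENNReal.ofReal (f x ^ 2) ≤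
        gagliardoSq N s f := by
  have h0 := om_pos (N := N)
  refine ⟨om N / 2 * (2 / om N) ^ (-(2 * s / N)), by positivity, fun f hf m hm hv => ?_⟩
  have hN0 : (N : ℝ) ≠ 0 := by positivity
  have hl : 0 < (2 * m / om N) ^ ((N : ℝ)⁻¹) := by positivity
  have h1 := gagliardoSq_density hN hs0 hf hl MeasurableSet.univ (fun x _ => by
    rw [volume_ball_eq hN _ hl.le, Real.rpow_inv_natCast_pow (by positivity) (by omega),
      mul_div_cancel₀ _ h0.ne', ENNReal.ofReal_mul (by norm_num)]
    simp only [ENNReal.ofReal_ofNat]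
    gcongr
    exact (measure_mono Set.inter_subset_left).trans hv)
  rw [Measure.restrict_univ] at h1
  convert h1 using 3
  rw [← Real.rpow_mul (by positivity), mul_assoc, ← Real.mul_rpow (by positivity) hm.le]
  congr 2
  · ring
  · field_simp

lemma Adm.const_mul (hf : Adm f) {c : ℝ} (hc : 0 < c) : Adm fun x => c * f x where
  meas := hf.meas.const_mul c
  nonneg x := mul_nonneg hc.le (hf.nonneg x)
  bdd := by
    obtain ⟨M, hM, h⟩ := hf.bdd
    exact ⟨c * M, by positivity, fun x => by gcongr; exact h x⟩
  supp := by
    obtain ⟨R, hR, h⟩ := hf.supp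
    exact ⟨R, hR, fun x hx => by rw [h x hx, mul_zero]⟩

lemma Adm.comp_smul (hf : Adm f) {ρ : ℝ} (hρ : 0 < ρ) : Adm fun x => f (ρ • x) where
  meas := hf.meas.comp (measurable_const_smul ρ)
  nonneg x := hf.nonneg _
  bdd := by
    obtain ⟨M, hM, h⟩ := hf.bdd
    exact ⟨M, hM, fun x => h _⟩
  supp := by
    obtain ⟨R, hR, h⟩ := hf.supp
    refine ⟨R / ρ, by positivity, fun x hx => h _ ?_⟩
    rw [norm_smul, Real.norm_of_nonneg hρ.le]
    rwa [div_lt_iff₀ hρ, mul_comm] at hx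

lemma Adm.comp_add (hf : Adm f) (a : Eu N) : Adm fun x => f (x + a) where
  meas := hf.meas.comp (measurable_add_const a)
  nonneg x := hf.nonneg _
  bdd := by
    obtain ⟨M, hM, h⟩ := hf.bdd
    exact ⟨M, hM, fun x => h _⟩
  supp := by
    obtain ⟨R, hR, h⟩ := hf.supp
    refine ⟨R + ‖a‖, by positivity, fun x hx => h _ ?_⟩
    have := norm_sub_le (x + a) a
    rw [add_sub_cancel_right] at this
    linarith

/-- Functions dominated by an admissible function are admissible. -/
lemma Adm.of_le {g : Eu N → ℝ} (hf : Adm f) (hg : Measurable g) (h0 : ∀ x, 0 ≤ g x)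
    (h : ∀ x, g x ≤ f x) : Adm g where
  meas := hg
  nonneg := h0
  bdd := by
    obtain ⟨M, hM, h'⟩ := hf.bdd
    exact ⟨M, hM, fun x => (h x).trans (h' x)⟩
  supp := by
    obtain ⟨R, hR, h'⟩ := hf.supp
    exact ⟨R, hR, fun x hx => le_antisymm ((h x).trans (h' x hx).le) (h0 x)⟩

lemma Adm.rpow (hf : Adm f) (hq : 0 < q) : Adm fun x => f x ^ q where
  meas := hf.meas.pow_const q
  nonneg x := Real.rpow_nonneg (hf.nonneg x) q
  bdd := by
    obtain ⟨M, hM, h⟩ := hf.bdd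
    exact ⟨M ^ q, by positivity, fun x => Real.rpow_le_rpow (hf.nonneg x) (h x) hq.le⟩
  supp := by
    obtain ⟨R, hR, h⟩ := hf.supp
    exact ⟨R, hR, fun x hx => by rw [h x hx, Real.zero_rpow hq.ne']⟩

lemma Adm.integrable (hf : Adm f) : Integrable f := by
  refine ⟨hf.meas.aestronglyMeasurable, ?_⟩
  rw [hasFiniteIntegral_iff_ofReal (ae_of_all _ hf.nonneg)]
  exact hf.lintegral_lt_top

lemma Adm.integrable_rpow (hf : Adm f) (hq : 0 < q) : Integrable fun x => f x ^ q :=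
  (hf.rpow hq).integrable

lemma lintegral_comp_smul_eq (H : Eu N → ℝ≥0∞) {ρ : ℝ} (hρ : 0 < ρ) :
    ∫⁻ x, H (ρ • x) = ENNReal.ofReal (ρ ^ N)⁻¹ * ∫⁻ x, H x := by
  have h1 := Measure.map_addHaar_smul (volume : Measure (Eu N)) hρ.ne'
  have h2 : MeasurableEmbedding fun x : Eu N => ρ • x :=
    (Homeomorph.smulOfNeZero ρ hρ.ne').measurableEmbedding
  rw [← h2.lintegral_map, h1, lintegral_smul_measure, smul_eq_mul]
  congr 2
  rw [abs_of_nonneg (by positivity)]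
  simp

lemma volume_pos_comp_smul {ρ : ℝ} (hf : Measurable f) (hρ : 0 < ρ) :
    volume {x | 0 < f (ρ • x)} = ENNReal.ofReal (ρ ^ N)⁻¹ * volume {x | 0 < f x} := by
  have hm : MeasurableSet {x | 0 < f x} := measurableSet_lt measurable_const hf
  have hm' : MeasurableSet {x | 0 < f (ρ • x)} :=
    measurableSet_lt measurable_const (hf.comp (measurable_const_smul ρ))
  rw [← lintegral_indicator_one hm, ← lintegral_indicator_one hm', ← lintegral_comp_smul_eq _ hρ]
  rfl

/-- The optimal constant among admissible functions supported in sets of unit measure. -/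
def lam (N : ℕ) (s q : ℝ) : ℝ≥0∞ :=
  sInf {E | ∃ f : Eu N → ℝ, Adm f ∧ volume {x | 0 < f x} ≤ 1 ∧
    ∫⁻ x, ENNReal.ofReal (f x ^ q) = 1 ∧ E = gagliardoSq N s f}

lemma exponent_pos (hN : 2 ≤ N) (hs1 : s < 1) (hq1 : 1 ≤ q)
    (hq2 : q < 2 * N / ((N : ℝ) - 2 * s)) : 0 < 2 / q - 1 + 2 * s / N := by
  have hN' : (2 : ℝ) ≤ N := by exact_mod_cast hN
  have h1 : 0 < (N : ℝ) - 2 * s := by linarith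
  rw [lt_div_iff₀ h1] at hq2
  have h2 : 2 / q - 1 + 2 * s / N = (2 * N - q * (N - 2 * s)) / (q * N) := by
    field_simp
    ring
  rw [h2]
  exact div_pos (by linarith) (by positivity)

/-- The Faber–Krahn type inequality for `lam`. -/
lemma lam_le (hN : 2 ≤ N) (hq1 : 1 ≤ q) (hf : Adm f) {m J : ℝ} (hm : 0 < m)
    (hv : volume {x | 0 < f x} ≤ ENNReal.ofReal m) (hJ : 0 < J)
    (hfJ : ∫⁻ x, ENNReal.ofReal (f x ^ q) = ENNReal.ofReal J) :
    lam N s q * ENNReal.ofReal (J ^ (2 / q)) ≤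
      ENNReal.ofReal (m ^ (2 / q - 1 + 2 * s / N)) * gagliardoSq N s f := by
  have hq0 : 0 < q := by linarith
  have hN0 : (N : ℝ) ≠ 0 := by positivity
  obtain ⟨ρ, hρd⟩ : ∃ ρ : ℝ, ρ = m ^ ((N : ℝ)⁻¹) := ⟨_, rfl⟩
  have hρ : 0 < ρ := by rw [hρd]; positivity
  have hρN : ρ ^ N = m := by rw [hρd, Real.rpow_inv_natCast_pow hm.le (by omega)]
  obtain ⟨a, had⟩ : ∃ a : ℝ, a = (m / J) ^ (1 / q) := ⟨_, rfl⟩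
  have ha : 0 < a := by rw [had]; positivity
  have haq : a ^ q = m / J := by
    rw [had, ← Real.rpow_mul (by positivity), one_div_mul_cancel hq0.ne', Real.rpow_one]
  have h1 : lam N s q ≤ gagliardoSq N s fun x => a * f (ρ • x) := by
    refine sInf_le ⟨_, (hf.comp_smul hρ).const_mul ha, ?_, ?_, rfl⟩
    · have e : {x | 0 < a * f (ρ • x)} = {x | 0 < f (ρ • x)} := by
        ext x; simp [ha]
      rw [e, volume_pos_comp_smul hf.meas hρ, hρN]
      calc _ ≤ ENNReal.ofReal m⁻¹ * ENNReal.ofReal m := by gcongr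
        _ = 1 := by rw [← ENNReal.ofReal_mul (by positivity), inv_mul_cancel₀ hm.ne']; simp
    · have e : ∀ x, ENNReal.ofReal ((a * f (ρ • x)) ^ q) =
          ENNReal.ofReal (a ^ q) * ENNReal.ofReal (f (ρ • x) ^ q) := fun x => by
        rw [Real.mul_rpow ha.le (hf.nonneg _), ENNReal.ofReal_mul (by positivity)]
      simp only [e]
      rw [lintegral_const_mul' _ _ ENNReal.ofReal_ne_top,
        lintegral_comp_smul_eq (fun x => ENNReal.ofReal (f x ^ q)) hρ, hfJ, hρN, haq,
        ← ENNReal.ofReal_mul (by positivity), ← ENNReal.ofReal_mul (by positivity)]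
      rw [show m / J * (m⁻¹ * J) = 1 by field_simp]
      simp
  rw [gagliardoSq_const_mul a (fun x => f (ρ • x)), gagliardoSq_comp_smul hρ] at h1
  have h2 : a ^ 2 * ρ ^ (2 * s - N) * J ^ (2 / q) = m ^ (2 / q - 1 + 2 * s / N) := by
    rw [had, hρd, ← Real.rpow_natCast, ← Real.rpow_mul (by positivity), ← Real.rpow_mul hm.le,
      Real.div_rpow hm.le hJ.le]
    have e1 : 1 / q * ((2 : ℕ) : ℝ) = 2 / q := by push_cast; ring
    rw [e1, div_mul_eq_mul_div, div_mul_cancel₀ _ (by positivity), ← Real.rpow_add hm]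
    congr 1
    field_simp
    ring
  calc _ ≤ ENNReal.ofReal (a ^ 2) * (ENNReal.ofReal (ρ ^ (2 * s - N)) * gagliardoSq N s f) *
        ENNReal.ofReal (J ^ (2 / q)) := by gcongr
    _ = ENNReal.ofReal (a ^ 2 * ρ ^ (2 * s - N) * J ^ (2 / q)) * gagliardoSq N s f := by
        rw [ENNReal.ofReal_mul (by positivity), ENNReal.ofReal_mul (by positivity)]; ring
    _ = _ := by rw [h2]

/-- Sobolev inequality on sets of bounded measure. -/
lemma lam_pos (hN : 2 ≤ N) (hs0 : 0 < s) (hs1 : s < 1) (hq1 : 1 ≤ q)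
    (hq2 : q < 2 * N / ((N : ℝ) - 2 * s)) : 0 < lam N s q := by
  have hN' : (2 : ℝ) ≤ N := by exact_mod_cast hN
  have hq0 : 0 < q := by linarith
  have h1 : 0 < (N : ℝ) - 2 * s := by linarith
  obtain ⟨P, hP⟩ : ∃ P : ℝ, P = 2 * N / ((N : ℝ) - 2 * s) := ⟨_, rfl⟩
  obtain ⟨θ, hθ⟩ : ∃ θ : ℝ, θ = 2 * s / N := ⟨_, rfl⟩
  have hP0 : 0 < P := by rw [hP]; positivity
  have hPθ : P * θ = P - 2 := by
    rw [hP, hθ]; field_simp; ring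
  have hθ1 : θ < 1 := by rw [hθ, div_lt_one (by linarith)]; linarith
  have hθ0 : 0 < θ := by rw [hθ]; positivity
  rw [← hP] at hq2
  obtain ⟨c, hc, hL2⟩ := gagliardoSq_l2 (N := N) (s := s) hN hs0
  rw [← hθ] at hL2
  -- the level `a` and the lower bound `X0` for the weak norm
  obtain ⟨a, ha, haq⟩ : ∃ a : ℝ, 0 < a ∧ a ^ q = 1 / 2 :=
    ⟨(1 / 2) ^ (1 / q), by positivity, by
      rw [← Real.rpow_mul (by norm_num), one_div_mul_cancel hq0.ne', Real.rpow_one]⟩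
  obtain ⟨X0, hX0⟩ : ∃ X0 : ℝ, X0 = (P - q) * a ^ (P - q) / (2 * q) := ⟨_, rfl⟩
  have hX0p : 0 < X0 := by rw [hX0]; have := sub_pos.2 hq2; positivity
  have hX0p' : 0 < X0 ^ (1 - θ) * c / 2 ^ P := by positivity
  refine lt_of_lt_of_le (ENNReal.ofReal_pos.2 hX0p') (le_sInf ?_)
  rintro E ⟨f, hf, hv, hfq, rfl⟩
  by_cases hE : gagliardoSq N s f = ⊤
  · rw [hE]; exact le_top
  obtain ⟨M, hM, hfM⟩ := hf.bdd
  obtain ⟨μ, hμ⟩ : ∃ μ : ℝ → ℝ, μ = fun t => (volume {x | t < f x}).toReal := ⟨_, rfl⟩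
  have hμ' : ∀ t, 0 ≤ t → volume {x | t < f x} = ENNReal.ofReal (μ t) := fun t ht => by
    rw [hμ]; exact (ENNReal.ofReal_toReal (hf.volume_lt_lt_top ht).ne).symm
  have hμ0 : ∀ t, 0 ≤ μ t := fun t => by rw [hμ]; exact ENNReal.toReal_nonneg
  have hμ1 : ∀ t, 0 ≤ t → μ t ≤ 1 := fun t ht => by
    have h2 : volume {x | t < f x} ≤ 1 := (measure_mono fun x hx => lt_of_le_of_lt ht hx).trans hv
    rw [hμ]
    exact ENNReal.toReal_le_of_le_ofReal zero_le_one (by simpa using h2)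
  have hμM : ∀ t, M ≤ t → μ t = 0 := fun t ht => by
    have : {x | t < f x} = ∅ := by
      ext x; simpa using (hfM x).trans ht
    rw [hμ]; simp [this]
  obtain ⟨e, he⟩ : ∃ e : ℝ, e = (gagliardoSq N s f).toReal := ⟨_, rfl⟩
  have he' : gagliardoSq N s f = ENNReal.ofReal e := by rw [he, ENNReal.ofReal_toReal hE]
  have he0 : 0 ≤ e := by rw [he]; exact ENNReal.toReal_nonneg
  have hdecay : ∀ t, 0 < t → μ (2 * t) * t ^ 2 * c ≤ e * μ t ^ θ := by
    intro t ht
    rcases (hμ0 t).eq_or_lt with h3 | h3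
    · have h4 : μ (2 * t) ≤ μ t := by
        rw [hμ]
        exact ENNReal.toReal_mono (hf.volume_lt_lt_top ht.le).ne
          (measure_mono fun x (hx : 2 * t < f x) => show t < f x by linarith)
      rw [← h3, Real.zero_rpow hθ0.ne', mul_zero, le_antisymm (h4.trans h3.ge) (hμ0 _)]
      simp
    · have h5 := hL2 (fun x => max (f x - t) 0)
        ((hf.meas.sub_const t).max measurable_const) (μ t) h3 (by
          rw [← hμ' t ht.le]
          refine measure_mono fun x hx => ?_
          by_contra hc
          have hc' : ¬ t < f x := hc
          exact hx (max_eq_right (by linarith [not_lt.1 hc'])))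
      have h6 : gagliardoSq N s (fun x => max (f x - t) 0) ≤ gagliardoSq N s f :=
        gagliardoSq_le_of_abs_sub_le fun x y => by
          have := abs_max_sub_max_le_abs (f x - t) (f y - t) 0
          simpa using this
      have h7 : ENNReal.ofReal (t ^ 2 * μ (2 * t)) ≤
          ∫⁻ x, ENNReal.ofReal ((max (f x - t) 0) ^ 2) := by
        rw [ENNReal.ofReal_mul (by positivity), ← hμ' _ (by positivity)]
        have hms : MeasurableSet {x | 2 * t < f x} := measurableSet_lt measurable_const hf.meas
        rw [← setLIntegral_const]
        refine (setLIntegral_mono' hms fun x hx => ?_).trans (setLIntegral_le_lintegral _ _)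
        have hx' : 2 * t < f x := hx
        refine ENNReal.ofReal_le_ofReal ?_
        have : t ≤ max (f x - t) 0 := le_max_of_le_left (by linarith)
        gcongr
      have h8 : ENNReal.ofReal (c * μ t ^ (-θ)) * ENNReal.ofReal (t ^ 2 * μ (2 * t)) ≤
          ENNReal.ofReal e := by
        rw [← he']
        exact (mul_le_mul_right h7 _).trans (h5.trans h6)
      rw [← ENNReal.ofReal_mul (by positivity), ENNReal.ofReal_le_ofReal_iff he0,
        Real.rpow_neg (hμ0 t)] at h8
      have h9 : 0 < μ t ^ θ := by positivity
      have h10 : c * (μ t ^ θ)⁻¹ * (t ^ 2 * μ (2 * t)) = (μ (2 * t) * t ^ 2 * c) / μ t ^ θ := by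
        field_simp
      rwa [h10, div_le_iff₀ h9] at h8
  -- the weak norm
  obtain ⟨X, hX⟩ : ∃ X : ℝ, X = sSup ((fun t => t ^ P * μ t) '' Set.Ioi 0) := ⟨_, rfl⟩
  have hbdd : BddAbove ((fun t => t ^ P * μ t) '' Set.Ioi 0) := by
    refine ⟨M ^ P, ?_⟩
    rintro _ ⟨t, ht, rfl⟩
    have ht : 0 < t := ht
    beta_reduce
    rcases le_total M t with h3 | h3
    · rw [hμM t h3, mul_zero]; positivity
    · calc t ^ P * μ t ≤ M ^ P * 1 :=
          mul_le_mul (Real.rpow_le_rpow ht.le h3 hP0.le) (hμ1 t ht.le) (hμ0 t) (by positivity)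
        _ = _ := mul_one _
  have hXle : ∀ t, 0 < t → t ^ P * μ t ≤ X := fun t ht => by
    rw [hX]; exact le_csSup hbdd ⟨t, ht, rfl⟩
  have hXX0 : X0 ≤ X := by
    have hlc := lintegral_rpow_eq_lintegral_meas_lt_mul (volume : Measure (Eu N))
      (ae_of_all _ hf.nonneg) hf.meas.aemeasurable hq0
    rw [hfq] at hlc
    have hX' : 0 ≤ X := le_trans (mul_nonneg (by positivity) (hμ0 1)) (hXle 1 one_pos)
    have i1 : ∫⁻ t in Set.Ioc 0 a, volume {x | t < f x} * ENNReal.ofReal (t ^ (q - 1)) ≤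
        ENNReal.ofReal (a ^ q / q) := by
      have h3 : ∫⁻ t in Set.Ioc 0 a, ENNReal.ofReal (t ^ (q - 1)) = ENNReal.ofReal (a ^ q / q) := by
        rw [← ofReal_integral_eq_lintegral_ofReal]
        · rw [← intervalIntegral.integral_of_le ha.le, integral_rpow (Or.inl (by linarith))]
          simp [hq0.ne']
        · rw [← IntegrableOn, ← intervalIntegrable_iff_integrableOn_Ioc_of_le ha.le]
          exact intervalIntegral.intervalIntegrable_rpow' (by linarith)
        · filter_upwards [ae_restrict_mem measurableSet_Ioc] with t ht
          exact Real.rpow_nonneg ht.1.le _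
      rw [← h3]
      refine setLIntegral_mono' measurableSet_Ioc fun t ht => ?_
      calc _ ≤ 1 * ENNReal.ofReal (t ^ (q - 1)) := by
            gcongr
            exact (measure_mono fun x hx => lt_of_le_of_lt ht.1.le hx).trans hv
        _ = _ := one_mul _
    have i2 : ∫⁻ t in Set.Ioi a, volume {x | t < f x} * ENNReal.ofReal (t ^ (q - 1)) ≤
        ENNReal.ofReal (X * (a ^ (q - P) / (P - q))) := by
      have hPq : q - 1 - P < -1 := by linarith
      have h3 : ∫⁻ t in Set.Ioi a, ENNReal.ofReal (t ^ (q - 1 - P)) =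
          ENNReal.ofReal (a ^ (q - P) / (P - q)) := by
        rw [← ofReal_integral_eq_lintegral_ofReal]
        · rw [integral_Ioi_rpow_of_lt hPq ha]
          rw [show q - 1 - P + 1 = q - P by ring, show q - P = -(P - q) by ring, neg_div_neg_eq]
        · exact integrableOn_Ioi_rpow_of_lt hPq ha
        · filter_upwards [ae_restrict_mem measurableSet_Ioi] with t ht
          exact Real.rpow_nonneg (ha.trans ht).le _
      rw [ENNReal.ofReal_mul hX', ← h3, ← lintegral_const_mul' _ _ ENNReal.ofReal_ne_top]
      refine setLIntegral_mono' measurableSet_Ioi fun t ht => ?_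
      have ht0 : 0 < t := ha.trans ht
      rw [hμ' t ht0.le, ← ENNReal.ofReal_mul (hμ0 t), ← ENNReal.ofReal_mul hX']
      refine ENNReal.ofReal_le_ofReal ?_
      rw [Real.rpow_sub ht0 (q - 1) P, mul_div_assoc', le_div_iff₀ (by positivity)]
      calc _ = (t ^ P * μ t) * t ^ (q - 1) := by ring
        _ ≤ _ := by gcongr; exact hXle t ht0
    have i3 : (1 : ℝ≥0∞) ≤ ENNReal.ofReal
        (q * (a ^ q / q + X * (a ^ (q - P) / (P - q)))) := by
      have hPq : 0 < P - q := by linarith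
      rw [hlc, ENNReal.ofReal_mul hq0.le, ENNReal.ofReal_add (by positivity) (by positivity),
        ← Set.Ioc_union_Ioi_eq_Ioi ha.le, lintegral_union measurableSet_Ioi
          (Set.Ioc_disjoint_Ioi le_rfl)]
      gcongr
    rw [ENNReal.one_le_ofReal, mul_add, mul_div_cancel₀ _ hq0.ne', haq] at i3
    have hPq : 0 < P - q := by linarith
    have e5 : a ^ (q - P) = (a ^ (P - q))⁻¹ := by
      rw [show q - P = -(P - q) by ring, Real.rpow_neg ha.le]
    rw [e5] at i3
    have h6 : 0 < a ^ (P - q) := by positivity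
    have h7 : q * (X * ((a ^ (P - q))⁻¹ / (P - q))) = q * X / (a ^ (P - q) * (P - q)) := by
      field_simp
    rw [h7] at i3
    have h8 : 1 / 2 ≤ q * X / (a ^ (P - q) * (P - q)) := by linarith
    rw [le_div_iff₀ (by positivity)] at h8
    rw [hX0, div_le_iff₀ (by positivity)]
    linarith
  have hXp : 0 < X := hX0p.trans_le hXX0
  have hXE : X * c ≤ 2 ^ P * e * X ^ θ := by
    rw [← le_div_iff₀ hc, hX]
    refine csSup_le ⟨_, 1, Set.mem_Ioi.2 one_pos, rfl⟩ ?_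
    rintro _ ⟨t, ht, rfl⟩
    have ht : 0 < t := ht
    rw [← hX, le_div_iff₀ hc]
    obtain ⟨r, rfl⟩ : ∃ r, t = 2 * r := ⟨t / 2, by ring⟩
    have hr : 0 < r := by linarith
    have h3 := hdecay r hr
    have h4 : r ^ P = r ^ 2 * (r ^ P) ^ θ := by
      rw [← Real.rpow_mul hr.le, hPθ, ← Real.rpow_natCast, ← Real.rpow_add hr]
      congr 1; push_cast; ring
    beta_reduce
    rw [Real.mul_rpow (by norm_num) hr.le]
    have h5 : (r ^ P) ^ θ * μ r ^ θ ≤ X ^ θ := by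
      rw [← Real.mul_rpow (by positivity) (hμ0 r)]
      exact Real.rpow_le_rpow (mul_nonneg (by positivity) (hμ0 r)) (hXle r hr) hθ0.le
    calc 2 ^ P * r ^ P * μ (2 * r) * c
        = 2 ^ P * (r ^ P) ^ θ * (μ (2 * r) * r ^ 2 * c) := by
          nth_rw 1 [h4]; ring
      _ ≤ 2 ^ P * (r ^ P) ^ θ * (e * μ r ^ θ) := by gcongr
      _ = 2 ^ P * e * ((r ^ P) ^ θ * μ r ^ θ) := by ring
      _ ≤ _ := by gcongr
  rw [he']
  refine ENNReal.ofReal_le_ofReal ?_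
  rw [div_le_iff₀ (by positivity)]
  have h3 : X0 ^ (1 - θ) ≤ X ^ (1 - θ) := Real.rpow_le_rpow hX0p.le hXX0 (by linarith)
  have h4 : X = X ^ (1 - θ) * X ^ θ := by rw [← Real.rpow_add hXp]; simp
  have h5 : X ^ (1 - θ) * c * X ^ θ ≤ 2 ^ P * e * X ^ θ := by
    calc _ = X * c := by nth_rw 3 [h4]; ring
      _ ≤ _ := hXE
  have h6 := le_of_mul_le_mul_right h5 (by positivity)
  calc X0 ^ (1 - θ) * c ≤ X ^ (1 - θ) * c := by gcongr
    _ ≤ _ := by linarith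

end Admissible

section RealForm

variable {N : ℕ} {s q : ℝ} {f u : Eu N → ℝ}

/-- The optimal constant, as a real number. -/
def lamR (N : ℕ) (s q : ℝ) : ℝ := (lam N s q).toReal

lemma Adm.lintegral_rpow (hf : Adm f) (hq : 0 < q) :
    ∫⁻ x, ENNReal.ofReal (f x ^ q) = ENNReal.ofReal (∫ x, f x ^ q) :=
  (ofReal_integral_eq_lintegral_ofReal (hf.integrable_rpow hq)
    (ae_of_all _ fun x => Real.rpow_nonneg (hf.nonneg x) q)).symm

lemma Adm.integral_rpow_nonneg (hf : Adm f) : 0 ≤ ∫ x, f x ^ q :=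
  integral_nonneg fun x => Real.rpow_nonneg (hf.nonneg x) q

lemma lamR_le (hN : 2 ≤ N) (hq1 : 1 ≤ q) (hf : Adm f) (hE : gagliardoSq N s f ≠ ⊤) {m : ℝ}
    (hm : 0 < m) (hv : volume {x | 0 < f x} ≤ ENNReal.ofReal m) :
    lamR N s q * (∫ x, f x ^ q) ^ (2 / q) ≤
      m ^ (2 / q - 1 + 2 * s / N) * gagliardoSqR N s f := by
  have hq0 : 0 < q := by linarith
  have hγ : 0 ≤ m ^ (2 / q - 1 + 2 * s / N) := by positivity
  rcases (hf.integral_rpow_nonneg (q := q)).eq_or_lt with h | h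
  · rw [← h, Real.zero_rpow (by positivity), mul_zero]
    exact mul_nonneg hγ ENNReal.toReal_nonneg
  · have h1 := lam_le (s := s) hN hq1 hf hm hv h (hf.lintegral_rpow hq0)
    have h2 := ENNReal.toReal_mono (ENNReal.mul_ne_top ENNReal.ofReal_ne_top hE) h1
    rwa [ENNReal.toReal_mul, ENNReal.toReal_mul, ENNReal.toReal_ofReal (by positivity),
      ENNReal.toReal_ofReal hγ] at h2

lemma lam_lt_top (hN : 2 ≤ N) (hs0 : 0 < s) (hs1 : s < 1) (hq1 : 1 ≤ q) : lam N s q < ⊤ := by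
  have hq0 : 0 < q := by linarith
  obtain ⟨f, hf⟩ : ∃ f : Eu N → ℝ, f = fun x => max (1 - ‖x‖) 0 := ⟨_, rfl⟩
  have hfx : ∀ x, f x = max (1 - ‖x‖) 0 := fun x => by rw [hf]
  have hf0 : ∀ x, 0 ≤ f x := fun x => by rw [hfx]; exact le_max_right _ _
  have hf1 : ∀ x, f x ≤ 1 := fun x => by
    rw [hfx]; exact max_le (by linarith [norm_nonneg x]) zero_le_one
  have hA : Adm f := by
    refine ⟨by rw [hf]; fun_prop, hf0, ⟨1, one_pos, hf1⟩, 1, one_pos, fun x hx => ?_⟩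
    rw [hfx]; exact max_eq_right (by linarith)
  have hpos : ∀ x, 0 < f x ↔ x ∈ Metric.ball (0 : Eu N) 1 := fun x => by
    rw [hfx, mem_ball_zero_iff]
    constructor
    · intro h
      by_contra hc
      exact h.ne' (max_eq_right (by linarith [not_lt.1 hc]))
    · exact fun h => lt_max_of_lt_left (by linarith)
  have hset : {x | 0 < f x} = Metric.ball (0 : Eu N) 1 := by ext x; exact hpos x
  have hv : volume {x | 0 < f x} = ENNReal.ofReal (om N) := by
    rw [hset, volume_ball_eq hN _ zero_le_one]; simp
  have hJ : 0 < ∫ x, f x ^ q := by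
    rw [integral_pos_iff_support_of_nonneg (fun x => Real.rpow_nonneg (hf0 x) q)
      (hA.integrable_rpow hq0)]
    refine lt_of_lt_of_le ?_ (measure_mono (s := {x | 0 < f x}) fun x hx => ?_)
    · rw [hv]; exact ENNReal.ofReal_pos.2 om_pos
    · exact (Real.rpow_pos_of_pos hx q).ne'
  have hE : gagliardoSq N s f < ⊤ := by
    refine gagliardoSq_lt_top (L := 1) hN hs0 hs1 (S := Metric.ball (0 : Eu N) 1)
      measurableSet_ball measure_ball_lt_top.ne (fun x hx => ?_) fun x y => ?_
    · exact le_antisymm (not_lt.1 (mt (hpos x).1 hx)) (hf0 x)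
    · have h1 : |f x - f y| ≤ 1 := by
        rw [abs_le]; constructor <;> linarith [hf0 x, hf0 y, hf1 x, hf1 y]
      have h2 : |f x - f y| ≤ ‖x - y‖ := by
        rw [hfx, hfx]
        refine (abs_max_sub_max_le_abs _ _ _).trans ?_
        rw [show 1 - ‖x‖ - (1 - ‖y‖) = ‖y‖ - ‖x‖ by ring, norm_sub_rev]
        exact abs_norm_sub_norm_le y x
      rw [one_mul, ← sq_abs]
      refine le_min ?_ ?_
      · nlinarith [abs_nonneg (f x - f y)]
      · gcongr
  have h := lam_le (s := s) hN hq1 hA om_pos hv.le hJ (hA.lintegral_rpow hq0)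
  have h2 : lam N s q * ENNReal.ofReal ((∫ x, f x ^ q) ^ (2 / q)) < ⊤ :=
    h.trans_lt (ENNReal.mul_lt_top ENNReal.ofReal_lt_top hE)
  by_contra hc
  rw [not_lt_top_iff.1 hc, ENNReal.top_mul] at h2
  · exact h2.ne rfl
  · exact (ENNReal.ofReal_pos.2 (by positivity)).ne'

lemma lamR_pos (hN : 2 ≤ N) (hs0 : 0 < s) (hs1 : s < 1) (hq1 : 1 ≤ q)
    (hq2 : q < 2 * N / ((N : ℝ) - 2 * s)) : 0 < lamR N s q :=
  ENNReal.toReal_pos (lam_pos hN hs0 hs1 hq1 hq2).ne' (lam_lt_top hN hs0 hs1 hq1).ne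

/-- De Giorgi–Stampacchia iteration. -/
lemma eq_zero_of_stampacchia {Y : ℝ → ℝ} (hY0 : ∀ t, 0 ≤ Y t) (hanti : Antitone Y)
    {L m κ : ℝ} (hL : 0 ≤ L) (hm : 0 < m) (hκ : 0 < κ)
    (h : ∀ t t', 0 ≤ t → t < t' → t' < 1 → Y t' ≤ L * (t' - t) ^ (-m) * Y t ^ (1 + κ))
    (hsmall : L * 2 ^ m * Y 0 ^ κ ≤ 2 ^ (-(m / κ))) : Y 1 = 0 := by
  obtain ⟨b, hb⟩ : ∃ b : ℝ, b = 2 ^ (-(m / κ)) := ⟨_, rfl⟩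
  have hb0 : 0 < b := by rw [hb]; positivity
  have hb1 : b < 1 := by
    rw [hb]; exact Real.rpow_lt_one_of_one_lt_of_neg (by norm_num) (by simp; positivity)
  have hbκ : 2 ^ m * b ^ κ = (1 : ℝ) := by
    rw [hb, ← Real.rpow_mul (by norm_num), ← Real.rpow_add (by norm_num)]
    rw [show m + -(m / κ) * κ = 0 by field_simp; ring, Real.rpow_zero]
  have key : ∀ n : ℕ, Y (1 - (1 / 2) ^ n) ≤ Y 0 * b ^ n := by
    intro n
    induction n with
    | zero => simp
    | succ n ih =>
      have h1 : (0 : ℝ) < (1 / 2) ^ (n + 1) := by positivity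
      have h2 : ((1 : ℝ) / 2) ^ n = 2 * (1 / 2) ^ (n + 1) := by rw [pow_succ]; ring
      have h3 : ((1 : ℝ) / 2) ^ n ≤ 1 := pow_le_one₀ (by norm_num) (by norm_num)
      refine (h (1 - (1 / 2) ^ n) _ (by linarith) (by linarith) (by linarith)).trans ?_
      have h4 : (1 - (1 / 2 : ℝ) ^ (n + 1) - (1 - (1 / 2) ^ n)) ^ (-m) = 2 ^ m * (2 ^ m) ^ n := by
        rw [h2, show 1 - (1 / 2 : ℝ) ^ (n + 1) - (1 - 2 * (1 / 2) ^ (n + 1)) = (1 / 2) ^ (n + 1)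
          by ring, ← Real.rpow_natCast, ← Real.rpow_mul (by norm_num), one_div,
          Real.inv_rpow (by norm_num), ← Real.rpow_neg (by norm_num), ← Real.rpow_natCast,
          ← Real.rpow_mul (by norm_num), ← Real.rpow_add (by norm_num)]
        congr 1; push_cast; ring
      have h5 : Y (1 - (1 / 2) ^ n) ^ (1 + κ) ≤ (Y 0 * b ^ n) ^ (1 + κ) :=
        Real.rpow_le_rpow (hY0 _) ih (by positivity)
      have h6 : (Y 0 * b ^ n) ^ (1 + κ) = Y 0 * b ^ n * (Y 0 ^ κ * (b ^ κ) ^ n) := by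
        rw [Real.rpow_add' (mul_nonneg (hY0 _) (by positivity)) (by positivity), Real.rpow_one,
          Real.mul_rpow (hY0 _) (by positivity), ← Real.rpow_natCast, ← Real.rpow_natCast,
          ← Real.rpow_mul hb0.le, ← Real.rpow_mul hb0.le, mul_comm κ]
      rw [h4]
      calc L * (2 ^ m * (2 ^ m) ^ n) * Y (1 - (1 / 2) ^ n) ^ (1 + κ)
          ≤ L * (2 ^ m * (2 ^ m) ^ n) * (Y 0 * b ^ n * (Y 0 ^ κ * (b ^ κ) ^ n)) := by
            rw [← h6]; gcongr
        _ = L * 2 ^ m * Y 0 ^ κ * (2 ^ m * b ^ κ) ^ n * (Y 0 * b ^ n) := by rw [mul_pow]; ring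
        _ ≤ b * (Y 0 * b ^ n) := by
            rw [hbκ, one_pow, mul_one]
            have := hY0 0
            rw [hb] at hb0 ⊢
            gcongr
        _ = Y 0 * b ^ (n + 1) := by ring
  have hlim : Tendsto (fun n : ℕ => Y 0 * b ^ n) atTop (𝓝 0) := by
    simpa using (tendsto_pow_atTop_nhds_zero_of_lt_one hb0.le hb1).const_mul (Y 0)
  refine le_antisymm (ge_of_tendsto' hlim fun n => (hanti ?_).trans (key n)) (hY0 1)
  have : (0 : ℝ) < (1 / 2) ^ n := by positivity
  linarith

end RealForm

section Truncation

variable {N : ℕ} {s q : ℝ} {f u : Eu N → ℝ}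

lemma lamR_le_of_nonneg (hN : 2 ≤ N) (hs0 : 0 < s) (hs1 : s < 1) (hq1 : 1 ≤ q)
    (hf : Adm f) (hE : gagliardoSq N s f ≠ ⊤) {m : ℝ} (hm : 0 ≤ m)
    (hv : volume {x | 0 < f x} ≤ ENNReal.ofReal m) :
    lamR N s q * (∫ x, f x ^ q) ^ (2 / q) ≤
      m ^ (2 / q - 1 + 2 * s / N) * gagliardoSqR N s f := by
  rcases hm.eq_or_lt with rfl | hm'
  · have h0 : ∀ᵐ x, f x ^ q = 0 := by
      rw [ENNReal.ofReal_zero, nonpos_iff_eq_zero] at hv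
      have : ∀ᵐ x, ¬ 0 < f x := by rw [ae_iff]; simpa using hv
      filter_upwards [this] with x hx
      rw [le_antisymm (not_lt.1 hx) (hf.nonneg x), Real.zero_rpow (by linarith)]
    rw [integral_congr_ae h0, integral_zero, Real.zero_rpow (by positivity), mul_zero]
    exact mul_nonneg (Real.rpow_nonneg le_rfl _) ENNReal.toReal_nonneg
  · exact lamR_le hN hq1 hf hE hm' hv

lemma one_sub_rpow_le {J α : ℝ} (hJ0 : 0 ≤ J) (hJ1 : J ≤ 1) (hα0 : 0 < α) (hα : α ≤ 2) :
    1 - J ^ α ≤ 2 * (1 - J) := by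
  have h := Real.rpow_le_rpow_of_exponent_ge' hJ0 hJ1 hα0.le hα
  rw [Real.rpow_two] at h
  nlinarith [sq_nonneg (J - 1)]

lemma gagliardoSqR_const_mul (c : ℝ) (u : Eu N → ℝ) :
    gagliardoSqR N s (fun x => c * u x) = c ^ 2 * gagliardoSqR N s u := by
  unfold gagliardoSqR
  rw [gagliardoSq_const_mul, ENNReal.toReal_mul, ENNReal.toReal_ofReal (sq_nonneg c)]

/-- Normalisation in `L^q`. -/
lemma Adm.normalize (hf : Adm f) (hq : 0 < q) {J : ℝ} (hJ : 0 < J) (hfJ : ∫ x, f x ^ q = J) :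
    ∃ c : ℝ, 0 < c ∧ c ^ q = J⁻¹ ∧ Adm (fun x => c * f x) ∧ ∫ x, (c * f x) ^ q = 1 ∧
      ∀ s, gagliardoSqR N s (fun x => c * f x) * J ^ (2 / q) = gagliardoSqR N s f := by
  refine ⟨(J⁻¹) ^ (1 / q), by positivity, ?_, hf.const_mul (by positivity), ?_, fun s => ?_⟩
  · rw [← Real.rpow_mul (by positivity), one_div_mul_cancel hq.ne', Real.rpow_one]
  · have : ∀ x, (J⁻¹ ^ (1 / q) * f x) ^ q = J⁻¹ * f x ^ q := fun x => by
      rw [Real.mul_rpow (by positivity) (hf.nonneg x), ← Real.rpow_mul (by positivity),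
        one_div_mul_cancel hq.ne', Real.rpow_one]
    simp only [this]
    rw [integral_const_mul, hfJ, inv_mul_cancel₀ hJ.ne']
  · rw [gagliardoSqR_const_mul, ← Real.rpow_natCast, ← Real.rpow_mul (by positivity),
      Real.inv_rpow hJ.le, show 1 / q * ((2 : ℕ) : ℝ) = 2 / q by push_cast; ring]
    have : J ^ (2 / q) ≠ 0 := by positivity
    field_simp

lemma exists_rpow_neg_le {a ε : ℝ} (ha : 0 < a) (hε : 0 < ε) : ∃ M : ℝ, 1 ≤ M ∧ M ^ (-a) ≤ ε := by
  have h := (tendsto_rpow_neg_atTop ha).eventually (ge_mem_nhds hε)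
  obtain ⟨M, h1, h2⟩ := (h.and (eventually_ge_atTop 1)).exists
  exact ⟨M, h2, h1⟩

/-- Near-optimal functions may be replaced by uniformly bounded ones with the same support. -/
lemma exists_bounded_competitor (hN : 2 ≤ N) (hs0 : 0 < s) (hs1 : s < 1) (hq1 : 1 ≤ q)
    (hq2 : q < 2 * N / ((N : ℝ) - 2 * s)) :
    ∃ M₀ : ℝ, 0 < M₀ ∧ ∀ f : Eu N → ℝ, Adm f → volume {x | 0 < f x} ≤ 1 →
      ∫ x, f x ^ q = 1 → gagliardoSq N s f ≠ ⊤ → gagliardoSqR N s f ≤ 2 * lamR N s q →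
      ∃ v : Eu N → ℝ, Adm v ∧ (∀ x, v x ≤ M₀) ∧ (∀ x, 0 < v x ↔ 0 < f x) ∧
        ∫ x, v x ^ q = 1 ∧ gagliardoSq N s v ≠ ⊤ ∧ gagliardoSqR N s v ≤ gagliardoSqR N s f := by
  have hq0 : 0 < q := by linarith
  have hN0 : (0 : ℝ) < N := by positivity
  have hγ := exponent_pos hN hs1 hq1 hq2
  have hlam := lamR_pos hN hs0 hs1 hq1 hq2
  have hα2 : 2 / q ≤ 2 := by rw [div_le_iff₀ hq0]; linarith
  have hα0 : 0 < 2 / q := by positivity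
  obtain ⟨γ, hγd⟩ : ∃ γ : ℝ, γ = 2 / q - 1 + 2 * s / N := ⟨_, rfl⟩
  obtain ⟨κ, hκd⟩ : ∃ κ : ℝ, κ = s * q / N := ⟨_, rfl⟩
  have hκ : 0 < κ := by rw [hκd]; positivity
  have hγκ : (1 + γ) * (q / 2) = 1 + κ := by rw [hγd, hκd]; field_simp; ring
  rw [← hγd] at hγ
  obtain ⟨ε₁, hε₁⟩ : ∃ ε : ℝ, ε = (2 ^ (-q - 1)) ^ (2 / q) / 2 := ⟨_, rfl⟩
  obtain ⟨ε₂, hε₂⟩ : ∃ ε : ℝ, ε = (4 ^ (-q) * 2 ^ (-(q / κ))) ^ (2 / q) / 4 := ⟨_, rfl⟩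
  have hε₁0 : 0 < ε₁ := by rw [hε₁]; positivity
  have hε₂0 : 0 < ε₂ := by rw [hε₂]; positivity
  obtain ⟨M, hM1, hM⟩ := exists_rpow_neg_le (a := q * γ) (by positivity) (lt_min hε₁0 hε₂0)
  have hM0 : 0 < M := by linarith
  refine ⟨(2 ^ (q + 1)) ^ (1 / q) * (2 * M), by positivity, fun f hf hv hJ1 hE hEle => ?_⟩
  have hvR : volume {x | 0 < f x} ≤ ENNReal.ofReal 1 := by simpa using hv
  obtain ⟨E, hEd⟩ : ∃ E, E = gagliardoSqR N s f := ⟨_, rfl⟩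
  have hE0 : 0 ≤ E := by rw [hEd]; exact ENNReal.toReal_nonneg
  have hfi := hf.integrable_rpow hq0
  -- upper part of the mass
  obtain ⟨Y, hY⟩ : ∃ Y : ℝ → ℝ, ∀ t, Y t = ∫ x in {x | t < f x}, f x ^ q := ⟨_, fun _ => rfl⟩
  have hset : ∀ t, MeasurableSet {x | t < f x} := fun t =>
    measurableSet_lt measurable_const hf.meas
  have hp0 : ∀ x, 0 ≤ f x ^ q := fun x => Real.rpow_nonneg (hf.nonneg x) q
  have hY0 : ∀ t, 0 ≤ Y t := fun t => by rw [hY]; exact integral_nonneg hp0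
  have hYanti : Antitone Y := fun a b hab => by
    rw [hY, hY]
    exact setIntegral_mono_set hfi.integrableOn (ae_of_all _ hp0)
      (LE.le.eventuallyLE fun x (hx : b < f x) => show a < f x by linarith)
  have hY1 : ∀ t, Y t ≤ 1 := fun t => by
    rw [hY, ← hJ1]; exact setIntegral_le_integral hfi (ae_of_all _ hp0)
  have hmin : ∀ t, 0 < t → Adm fun x => min (f x) t := fun t ht =>
    hf.of_le (hf.meas.min measurable_const) (fun x => le_min (hf.nonneg x) ht.le)
      fun x => min_le_left _ _
  have hmax : ∀ t, 0 < t → Adm fun x => max (f x - t) 0 := fun t ht =>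
    hf.of_le ((hf.meas.sub_const t).max measurable_const) (fun x => le_max_right _ _)
      fun x => max_le (by linarith) (hf.nonneg x)
  have hsum : ∀ t : ℝ, gagliardoSq N s (fun x => min (f x) t) ≠ ⊤ ∧
      gagliardoSq N s (fun x => max (f x - t) 0) ≠ ⊤ ∧
      gagliardoSqR N s (fun x => min (f x) t) + gagliardoSqR N s (fun x => max (f x - t) 0)
        ≤ E := fun t => by
    have h := gagliardoSq_min_add_posPart (s := s) hf.meas t
    have h1 := (le_self_add.trans h).trans_lt hE.lt_top
    have h2 := (le_add_self.trans h).trans_lt hE.lt_top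
    refine ⟨h1.ne, h2.ne, ?_⟩
    rw [hEd]; unfold gagliardoSqR
    rw [← ENNReal.toReal_add h1.ne h2.ne]
    exact ENNReal.toReal_mono hE h
  have hcheb : ∀ t, 0 < t → volume {x | 0 < max (f x - t) 0} ≤ ENNReal.ofReal (Y t / t ^ q) := by
    intro t ht
    have e : {x | 0 < max (f x - t) 0} = {x | t < f x} := by
      ext x; simp
    have hfin := hf.volume_lt_lt_top ht.le
    rw [e, ← ENNReal.ofReal_toReal hfin.ne]
    refine ENNReal.ofReal_le_ofReal ?_
    rw [le_div_iff₀ (by positivity), hY]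
    have h1 : ∫ x in {x | t < f x}, t ^ q ≤ ∫ x in {x | t < f x}, f x ^ q := by
      refine setIntegral_mono_on (integrableOn_const hfin.ne) hfi.integrableOn (hset t)
        fun x hx => ?_
      have hx' : t < f x := hx
      gcongr
    rwa [setIntegral_const, smul_eq_mul] at h1
  have hFK : ∀ t, 0 < t → lamR N s q * (∫ x, max (f x - t) 0 ^ q) ^ (2 / q) ≤
      (Y t / t ^ q) ^ γ * gagliardoSqR N s (fun x => max (f x - t) 0) := fun t ht => by
    rw [hγd]
    exact lamR_le_of_nonneg hN hs0 hs1 hq1 (hmax t ht) (hsum t).2.1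
      (div_nonneg (hY0 t) (by positivity)) (hcheb t ht)
  have hpow : ∀ t, M ≤ t → (Y t / t ^ q) ^ γ ≤ M ^ (-(q * γ)) * Y t ^ γ := fun t ht => by
    have ht0 : 0 < t := by linarith
    rw [Real.div_rpow (hY0 t) (by positivity), ← Real.rpow_mul ht0.le, div_eq_mul_inv,
      ← Real.rpow_neg ht0.le, mul_comm]
    have := hY0 t
    gcongr ?_ * _
    exact Real.rpow_le_rpow_of_nonpos hM0 ht (by simp; positivity)
  have hJle : ∀ t, 0 < t → 1 - ∫ x, min (f x) t ^ q ≤ Y t := fun t ht => by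
    rw [← hJ1, ← integral_sub hfi ((hmin t ht).integrable_rpow hq0), hY,
      ← integral_indicator (hset t)]
    refine integral_mono (hfi.sub ((hmin t ht).integrable_rpow hq0))
      (hfi.indicator (hset t)) fun x => ?_
    by_cases hx : t < f x
    · rw [Set.indicator_of_mem (show x ∈ {x | t < f x} from hx)]
      have : 0 ≤ min (f x) t ^ q := Real.rpow_nonneg ((hmin t ht).nonneg x) q
      simpa using this
    · rw [Set.indicator_of_notMem (show x ∉ {x | t < f x} from hx)]
      simp [min_eq_left (not_lt.1 hx)]
  have hJ0 : ∀ t, 0 < t → 0 ≤ ∫ x, min (f x) t ^ q := fun t ht => (hmin t ht).integral_rpow_nonneg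
  have hJ1' : ∀ t, 0 < t → ∫ x, min (f x) t ^ q ≤ 1 := fun t ht => by
    rw [← hJ1]
    refine integral_mono ((hmin t ht).integrable_rpow hq0) hfi fun x => ?_
    exact Real.rpow_le_rpow ((hmin t ht).nonneg x) (min_le_left _ _) hq0.le
  by_cases hgood : ∃ t, M ≤ t ∧ t ≤ 2 * M ∧ gagliardoSqR N s (fun x => min (f x) t) ≤
      E * (∫ x, min (f x) t ^ q) ^ (2 / q)
  · obtain ⟨t, htM, ht2, hgood⟩ := hgood
    have ht0 : 0 < t := by linarith
    obtain ⟨J, hJd⟩ : ∃ J, J = ∫ x, min (f x) t ^ q := ⟨_, rfl⟩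
    obtain ⟨G, hGd⟩ : ∃ G, G = ∫ x, max (f x - t) 0 ^ q := ⟨_, rfl⟩
    have hG0 : 0 ≤ G := by rw [hGd]; exact (hmax t ht0).integral_rpow_nonneg
    have hGs : G ≤ 2 ^ (-q - 1) := by
      have h1 := hFK t ht0
      rw [← hGd] at h1
      have h2 : lamR N s q * G ^ (2 / q) ≤ ε₁ * (2 * lamR N s q) := by
        refine h1.trans (mul_le_mul ?_ ?_ ENNReal.toReal_nonneg hε₁0.le)
        · refine (hpow t htM).trans ?_
          calc _ ≤ ε₁ * 1 := by
                gcongr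
                · exact Real.rpow_nonneg (hY0 t) _
                · exact hM.trans (min_le_left _ _)
                · exact Real.rpow_le_one (hY0 t) (hY1 t) hγ.le
            _ = ε₁ := mul_one _
        · have := (hsum t).2.2
          have h3 : 0 ≤ gagliardoSqR N s (fun x => min (f x) t) := ENNReal.toReal_nonneg
          rw [← hEd] at hEle
          linarith
      have h3 : G ^ (2 / q) ≤ (2 ^ (-q - 1)) ^ (2 / q) := by
        rw [hε₁] at h2
        refine le_of_mul_le_mul_left ?_ hlam
        linarith
      exact (Real.rpow_le_rpow_iff hG0 (by positivity) hα0).1 h3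
    have hJlow : 2 ^ (-q - 1) ≤ J := by
      have h1 : (1 : ℝ) ≤ 2 ^ q * (J + G) := by
        rw [hJd, hGd, ← integral_add ((hmin t ht0).integrable_rpow hq0)
          ((hmax t ht0).integrable_rpow hq0), ← integral_const_mul, ← hJ1]
        refine integral_mono hfi ((((hmin t ht0).integrable_rpow hq0).add
          ((hmax t ht0).integrable_rpow hq0)).const_mul _) fun x => ?_
        have ha := (hmin t ht0).nonneg x
        have hb := (hmax t ht0).nonneg x
        have hab : f x = min (f x) t + max (f x - t) 0 := by
          rcases le_total (f x) t with h | h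
          · rw [min_eq_left h, max_eq_right (by linarith), add_zero]
          · rw [min_eq_right h, max_eq_left (by linarith)]; ring
        beta_reduce at ha hb ⊢
        generalize min (f x) t = a at *
        generalize max (f x - t) 0 = b at *
        rw [hab]
        have h3 : 0 ≤ a ^ q := Real.rpow_nonneg ha q
        have h4 : 0 ≤ b ^ q := Real.rpow_nonneg hb q
        have h2q : (0 : ℝ) ≤ 2 ^ q := by positivity
        rcases le_total a b with h | h
        · calc (a + b) ^ q ≤ (2 * b) ^ q := Real.rpow_le_rpow (by linarith) (by linarith) hq0.le
            _ = 2 ^ q * b ^ q := Real.mul_rpow (by norm_num) hb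
            _ ≤ 2 ^ q * (a ^ q + b ^ q) := by gcongr; linarith
        · calc (a + b) ^ q ≤ (2 * a) ^ q := Real.rpow_le_rpow (by linarith) (by linarith) hq0.le
            _ = 2 ^ q * a ^ q := Real.mul_rpow (by norm_num) ha
            _ ≤ 2 ^ q * (a ^ q + b ^ q) := by gcongr; linarith
      have h2 : (2 : ℝ) ^ q * 2 ^ (-q - 1) = 1 / 2 := by
        rw [← Real.rpow_add (by norm_num), show q + (-q - 1) = -1 by ring, Real.rpow_neg_one]
        norm_num
      have h3 : (0 : ℝ) < 2 ^ q := by positivity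
      have h4 : (2 : ℝ) ^ q * G ≤ 1 / 2 := by
        rw [← h2]; gcongr
      refine le_of_mul_le_mul_left ?_ h3
      rw [h2]; linarith
    have hJpos : 0 < J := lt_of_lt_of_le (by positivity) hJlow
    obtain ⟨c, hc0, hcq, hcA, hcJ, hcE⟩ := (hmin t ht0).normalize hq0 hJpos hJd.symm
    refine ⟨_, hcA, fun x => ?_, fun x => ?_, hcJ, ?_, ?_⟩
    · have h1 : c ≤ (2 ^ (q + 1)) ^ (1 / q) := by
        rw [← Real.rpow_le_rpow_iff hc0.le (by positivity) hq0, hcq, ← Real.rpow_mul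
          (by positivity), one_div_mul_cancel hq0.ne', Real.rpow_one]
        rw [show q + 1 = -(-q - 1) by ring, Real.rpow_neg (by norm_num)]
        exact inv_anti₀ (by positivity) hJlow
      have h2 : min (f x) t ≤ 2 * M := (min_le_right _ _).trans ht2
      have := (hmin t ht0).nonneg x
      gcongr
    · rw [mul_pos_iff_of_pos_left hc0, lt_min_iff]
      exact and_iff_left ht0
    · rw [gagliardoSq_const_mul]
      exact ENNReal.mul_ne_top ENNReal.ofReal_ne_top (hsum t).1
    · rw [← hEd]
      have h1 := hcE s
      rw [← hJd] at hgood
      have h2 : 0 < J ^ (2 / q) := by positivity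
      rw [← h1] at hgood
      exact le_of_mul_le_mul_right hgood h2
  · exfalso
    push Not at hgood
    have hbad : ∀ t, M ≤ t → t ≤ 2 * M →
        ∫ x, max (f x - t) 0 ^ q ≤ (4 * M ^ (-(q * γ))) ^ (q / 2) * Y t ^ (1 + κ) := by
      intro t htM ht2
      have ht0 : 0 < t := by linarith
      have h1 := hgood t htM ht2
      have h2 := (hsum t).2.2
      have h3 := one_sub_rpow_le (hJ0 t ht0) (hJ1' t ht0) hα0 hα2
      have h4 := hJle t ht0
      have h5 : gagliardoSqR N s (fun x => max (f x - t) 0) ≤ 4 * lamR N s q * Y t := by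
        have h6 : E * (1 - (∫ x, min (f x) t ^ q) ^ (2 / q)) ≤ 2 * lamR N s q * (2 * Y t) := by
          refine (mul_le_mul_of_nonneg_left (h3.trans (by linarith :
            2 * (1 - ∫ x, min (f x) t ^ q) ≤ 2 * Y t)) hE0).trans ?_
          rw [← hEd] at hEle
          have := hY0 t
          gcongr
        linarith
      have h6 := hFK t ht0
      have h7 : lamR N s q * (∫ x, max (f x - t) 0 ^ q) ^ (2 / q) ≤
          (M ^ (-(q * γ)) * Y t ^ γ) * (4 * lamR N s q * Y t) := by
        refine h6.trans (mul_le_mul (hpow t htM) h5 ENNReal.toReal_nonneg ?_)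
        have := hY0 t
        positivity
      have h8 : (∫ x, max (f x - t) 0 ^ q) ^ (2 / q) ≤ 4 * M ^ (-(q * γ)) * Y t ^ (1 + γ) := by
        rw [Real.rpow_add' (hY0 t) (by positivity), Real.rpow_one]
        refine le_of_mul_le_mul_left ?_ hlam
        linarith
      have hG0 : 0 ≤ ∫ x, max (f x - t) 0 ^ q := (hmax t ht0).integral_rpow_nonneg
      have h9 := Real.rpow_le_rpow (by positivity) h8 (by positivity : 0 ≤ q / 2)
      rw [← Real.rpow_mul hG0, show 2 / q * (q / 2) = 1 by field_simp, Real.rpow_one,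
        Real.mul_rpow (by positivity) (Real.rpow_nonneg (hY0 t) _), ← Real.rpow_mul (hY0 t),
        hγκ] at h9
      exact h9
    have hK : (4 * M ^ (-(q * γ))) ^ (q / 2) ≤ 4 ^ (-q) * 2 ^ (-(q / κ)) := by
      have h1 : 4 * M ^ (-(q * γ)) ≤ (4 ^ (-q) * 2 ^ (-(q / κ))) ^ (2 / q) := by
        have := hM.trans (min_le_right _ _)
        rw [hε₂] at this
        linarith
      have h2 := Real.rpow_le_rpow (by positivity) h1 (by positivity : 0 ≤ q / 2)
      rwa [← Real.rpow_mul (by positivity), show 2 / q * (q / 2) = 1 by field_simp,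
        Real.rpow_one] at h2
    have hYz : Y (M * (1 + 1)) = 0 := by
      refine eq_zero_of_stampacchia (Y := fun τ => Y (M * (1 + τ))) (fun τ => hY0 _)
        (fun a b hab => hYanti (by gcongr)) (L := 2 ^ q * (4 * M ^ (-(q * γ))) ^ (q / 2))
        (m := q) (κ := κ) (by positivity) hq0 hκ (fun τ τ' h0 hττ h1 => ?_) ?_
      · obtain ⟨t, htd⟩ : ∃ t, t = M * (1 + τ) := ⟨_, rfl⟩
        have htM : M ≤ t := by rw [htd]; nlinarith
        have ht0 : 0 < t := by linarith
        have hd : 0 < τ' - τ := by linarith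
        have h2 := hbad t htM (by rw [htd]; nlinarith)
        rw [← htd]
        calc Y (M * (1 + τ')) ≤ (2 * (τ' - τ)⁻¹) ^ q * ∫ x, max (f x - t) 0 ^ q := by
              rw [hY, ← integral_indicator (hset _), ← integral_const_mul]
              refine integral_mono (hfi.indicator (hset _))
                (((hmax t ht0).integrable_rpow hq0).const_mul _) fun x => ?_
              have hb := (hmax t ht0).nonneg x
              have hbq := Real.rpow_nonneg hb q
              by_cases hx : M * (1 + τ') < f x
              · rw [Set.indicator_of_mem (show x ∈ {x | M * (1 + τ') < f x} from hx)]
                beta_reduce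
                rw [← Real.mul_rpow (by positivity) hb]
                refine Real.rpow_le_rpow (hf.nonneg x) ?_ hq0.le
                have h3 : f x - t ≤ max (f x - t) 0 := le_max_left _ _
                have h4 : f x ≤ 2 * (τ' - τ)⁻¹ * (f x - t) := by
                  rw [show 2 * (τ' - τ)⁻¹ * (f x - t) = 2 * (f x - t) / (τ' - τ) by
                    field_simp, le_div_iff₀ hd, htd]
                  have h5 : (2 - (τ' - τ)) * (M * (1 + τ')) ≤ (2 - (τ' - τ)) * f x := by
                    gcongr
                    linarith
                  have h6 : 0 ≤ M * ((τ' - τ) * (1 - τ')) :=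
                    mul_nonneg hM0.le (mul_nonneg hd.le (by linarith))
                  linarith
                exact h4.trans (by gcongr)
              · rw [Set.indicator_of_notMem (show x ∉ {x | M * (1 + τ') < f x} from hx)]
                beta_reduce at hbq ⊢
                positivity
          _ ≤ (2 * (τ' - τ)⁻¹) ^ q * ((4 * M ^ (-(q * γ))) ^ (q / 2) * Y t ^ (1 + κ)) := by
              gcongr
          _ = _ := by
              rw [Real.mul_rpow (by norm_num) (by positivity), Real.inv_rpow hd.le,
                ← Real.rpow_neg hd.le]
              ring
      · calc 2 ^ q * (4 * M ^ (-(q * γ))) ^ (q / 2) * 2 ^ q * Y (M * (1 + 0)) ^ κ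
            ≤ 2 ^ q * (4 ^ (-q) * 2 ^ (-(q / κ))) * 2 ^ q * 1 := by
              have := hY0 (M * (1 + 0))
              gcongr
              exact Real.rpow_le_one this (hY1 _) hκ.le
          _ = 2 ^ (-(q / κ)) := by
              have : (2 : ℝ) ^ q * 4 ^ (-q) * 2 ^ q = 1 := by
                rw [show (4 : ℝ) = 2 * 2 by norm_num, Real.mul_rpow (by norm_num) (by norm_num),
                  Real.rpow_neg (by norm_num)]
                field_simp
              linear_combination (2 : ℝ) ^ (-(q / κ)) * this
    have h1 := hgood (2 * M) (by linarith) le_rfl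
    have h2 := hJle (2 * M) (by linarith)
    rw [show M * (1 + 1) = 2 * M by ring] at hYz
    rw [hYz] at h2
    have h3 : (1 : ℝ) ≤ (∫ x, min (f x) (2 * M) ^ q) ^ (2 / q) :=
      Real.one_le_rpow (by linarith) hα0.le
    have h4 := (hsum (2 * M)).2.2
    have h5 : 0 ≤ gagliardoSqR N s (fun x => max (f x - 2 * M) 0) := ENNReal.toReal_nonneg
    have h6 := mul_le_mul_of_nonneg_left h3 hE0
    linarith

end Truncation

section Concentration

variable {N : ℕ} {s q : ℝ} {f u : Eu N → ℝ}

lemma dint_weight_scaled (hf : Measurable f) (hf0 : ∀ x, 0 ≤ f x) {d : ℝ} (hd : 0 < d) :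
    dint (fun x y => f x * (min 1 (‖x - y‖ ^ 2 / d ^ 2) * kk N s x y))
      = ENNReal.ofReal (d ^ (-(2 * s))) * (kerInt N s * ∫⁻ x, ENNReal.ofReal (f x)) := by
  have h1 := dint_weight (s := s) (f := fun x => f (d • x)) (hf.comp (measurable_const_smul d))
    fun x => hf0 _
  rw [lintegral_comp_smul_eq (fun x => ENNReal.ofReal (f x)) hd] at h1
  have h2 : dint (fun x y => f (d • x) * (min 1 (‖x - y‖ ^ 2) * kk N s x y)) =
      ENNReal.ofReal (d ^ N)⁻¹ * (ENNReal.ofReal (d ^ N)⁻¹ * (ENNReal.ofReal (d ^ ((N : ℝ) + 2 * s)) *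
        dint (fun x y => f x * (min 1 (‖x - y‖ ^ 2 / d ^ 2) * kk N s x y)))) := by
    rw [← dint_const_mul (by positivity)]
    obtain ⟨G, hG⟩ : ∃ G : Eu N → Eu N → ℝ, ∀ x y, G x y =
      d ^ ((N : ℝ) + 2 * s) * (f x * (min 1 (‖x - y‖ ^ 2 / d ^ 2) * kk N s x y)) :=
      ⟨_, fun _ _ => rfl⟩
    rw [dint_congr (F := fun x y => d ^ ((N : ℝ) + 2 * s) *
      (f x * (min 1 (‖x - y‖ ^ 2 / d ^ 2) * kk N s x y))) (fun x y => (hG x y).symm)]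
    rw [dint_congr (G := fun x y => G (d • x) (d • y))]
    · unfold dint
      have k2 : ∀ x, ∫⁻ y, ENNReal.ofReal (G (d • x) (d • y)) =
          ENNReal.ofReal (d ^ N)⁻¹ * ∫⁻ y, ENNReal.ofReal (G (d • x) y) := fun x =>
        lintegral_comp_smul_eq (fun y => ENNReal.ofReal (G (d • x) y)) hd
      simp only [k2]
      rw [lintegral_const_mul' _ _ ENNReal.ofReal_ne_top,
        lintegral_comp_smul_eq (fun x => ∫⁻ y, ENNReal.ofReal (G x y)) hd]
    · intro x y
      rw [hG, ← smul_sub, norm_smul, Real.norm_of_nonneg hd.le, mul_pow,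
        mul_div_cancel_left₀ _ (by positivity)]
      unfold kk
      rw [← smul_sub, norm_smul, Real.norm_of_nonneg hd.le, Real.mul_rpow hd.le (norm_nonneg _),
        mul_inv]
      have : d ^ ((N : ℝ) + 2 * s) ≠ 0 := by positivity
      field_simp
  rw [h2] at h1
  obtain ⟨D, hD⟩ : ∃ D, D = dint (fun x y => f x *
    (min 1 (‖x - y‖ ^ 2 / d ^ 2) * kk N s x y)) := ⟨_, rfl⟩
  obtain ⟨I, hI⟩ : ∃ I, I = ∫⁻ x, ENNReal.ofReal (f x) := ⟨_, rfl⟩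
  rw [← hD, ← hI] at h1 ⊢
  have e : ENNReal.ofReal (d ^ (-(2 * s))) * (ENNReal.ofReal (d ^ N) * (ENNReal.ofReal (d ^ N)⁻¹ *
      ENNReal.ofReal (d ^ ((N : ℝ) + 2 * s)) * ENNReal.ofReal (d ^ N)⁻¹)) = 1 := by
    rw [← ENNReal.ofReal_mul (by positivity), ← ENNReal.ofReal_mul (by positivity),
      ← ENNReal.ofReal_mul (by positivity), ← ENNReal.ofReal_mul (by positivity),
      Real.rpow_add hd, Real.rpow_natCast, Real.rpow_neg hd.le]
    have : d ^ (2 * s) ≠ 0 := by positivity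
    have : d ^ N ≠ 0 := by positivity
    rw [← ENNReal.ofReal_one]; congr 1; field_simp
  have e2 : ENNReal.ofReal (d ^ N) * ENNReal.ofReal (d ^ N)⁻¹ = 1 := by
    rw [← ENNReal.ofReal_mul (by positivity), mul_inv_cancel₀ (by positivity), ENNReal.ofReal_one]
  calc D = (ENNReal.ofReal (d ^ (-(2 * s))) * (ENNReal.ofReal (d ^ N) * (ENNReal.ofReal (d ^ N)⁻¹ *
      ENNReal.ofReal (d ^ ((N : ℝ) + 2 * s)) * ENNReal.ofReal (d ^ N)⁻¹))) * D := by rw [e, one_mul]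
    _ = ENNReal.ofReal (d ^ (-(2 * s))) * ENNReal.ofReal (d ^ N) * (ENNReal.ofReal (d ^ N)⁻¹ *
        (ENNReal.ofReal (d ^ N)⁻¹ * (ENNReal.ofReal (d ^ ((N : ℝ) + 2 * s)) * D))) := by ring
    _ = ENNReal.ofReal (d ^ (-(2 * s))) * (ENNReal.ofReal (d ^ N) * ENNReal.ofReal (d ^ N)⁻¹) *
        (kerInt N s * I) := by rw [h1]; ring
    _ = _ := by rw [e2, mul_one]

/-- A Lipschitz cutoff, equal to one on the ball of radius `L` and vanishing off the ball of
radius `L + d`. -/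
def cutoff {N : ℕ} (L d : ℝ) (x : Eu N) : ℝ := max 0 (min 1 (1 + (L - ‖x‖) / d))

variable {L d : ℝ}

lemma cutoff_nonneg (x : Eu N) : 0 ≤ cutoff L d x := le_max_left _ _

lemma cutoff_le_one (x : Eu N) : cutoff L d x ≤ 1 := max_le zero_le_one (min_le_left _ _)

lemma measurable_cutoff : Measurable (cutoff L d : Eu N → ℝ) := by
  unfold cutoff; fun_prop

lemma cutoff_eq_one (hd : 0 < d) {x : Eu N} (hx : ‖x‖ ≤ L) : cutoff L d x = 1 := by
  unfold cutoff
  have : 0 ≤ (L - ‖x‖) / d := div_nonneg (by linarith) hd.le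
  rw [min_eq_left (by linarith), max_eq_right zero_le_one]

lemma cutoff_eq_zero (hd : 0 < d) {x : Eu N} (hx : L + d ≤ ‖x‖) : cutoff L d x = 0 := by
  unfold cutoff
  refine max_eq_left ((min_le_right _ _).trans ?_)
  have : (L - ‖x‖) / d ≤ -1 := by rw [div_le_iff₀ hd]; linarith
  linarith

lemma sq_cutoff_sub_le (hd : 0 < d) (x y : Eu N) :
    (cutoff L d x - cutoff L d y) ^ 2 ≤ min 1 (‖x - y‖ ^ 2 / d ^ 2) := by
  have h1 : |cutoff L d x - cutoff L d y| ≤ 1 := by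
    rw [abs_le]
    constructor <;> linarith [cutoff_nonneg (L := L) (d := d) x, cutoff_nonneg (L := L) (d := d) y,
      cutoff_le_one (L := L) (d := d) x, cutoff_le_one (L := L) (d := d) y]
  have h2 : |cutoff L d x - cutoff L d y| ≤ ‖x - y‖ / d := by
    unfold cutoff
    refine (abs_max_sub_max_le_max _ _ _ _).trans ?_
    refine max_le (by simp; positivity) ((abs_min_sub_min_le_max _ _ _ _).trans ?_)
    refine max_le (by simp; positivity) ?_
    rw [show 1 + (L - ‖x‖) / d - (1 + (L - ‖y‖) / d) = (‖y‖ - ‖x‖) / d by ring, abs_div,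
      abs_of_pos hd, norm_sub_rev]
    gcongr
    exact abs_norm_sub_norm_le y x
  rw [← sq_abs, ← div_pow]
  refine le_min ?_ (by gcongr)
  nlinarith [abs_nonneg (cutoff L d x - cutoff L d y)]

lemma volume_norm_sub_lt (hN : 2 ≤ N) (x : Eu N) {r : ℝ} (hr : 0 ≤ r) :
    volume {z : Eu N | ‖x - z‖ < r} = ENNReal.ofReal (om N * r ^ N) := by
  rw [← volume_ball_eq hN x hr]
  congr 1; ext z
  simp [dist_eq_norm, norm_sub_rev]

lemma lintegral_gagliardoSq_cutoff_le (hN : 2 ≤ N) (hf : Measurable f) (hf0 : ∀ x, 0 ≤ f x)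
    (hL : 0 ≤ L) (hd : 0 < d) :
    ∫⁻ z, gagliardoSq N s (fun x => cutoff L d (x - z) * f x) ≤
      ENNReal.ofReal (om N * (L + d) ^ N) * (gagliardoSq N s f + 2 *
        (ENNReal.ofReal (d ^ (-(2 * s))) * (kerInt N s * ∫⁻ x, ENNReal.ofReal (f x ^ 2)))) := by
  obtain ⟨V, hV⟩ : ∃ V, V = om N * (L + d) ^ N := ⟨_, rfl⟩
  have hV0 : 0 ≤ V := by rw [hV]; have := om_pos (N := N); positivity
  obtain ⟨φ, hφ⟩ : ∃ φ : Eu N → ℝ, φ = cutoff L d := ⟨_, rfl⟩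
  have hφm : Measurable φ := by rw [hφ]; exact measurable_cutoff
  have hφ0 : ∀ x, 0 ≤ φ x := by rw [hφ]; exact cutoff_nonneg
  have hφ1 : ∀ x, φ x ≤ 1 := by rw [hφ]; exact cutoff_le_one
  have hφz : ∀ x, ¬ ‖x‖ < L + d → φ x = 0 := fun x hx => by
    rw [hφ]; exact cutoff_eq_zero hd (not_lt.1 hx)
  have hφd : ∀ x y, (φ x - φ y) ^ 2 ≤ min 1 (‖x - y‖ ^ 2 / d ^ 2) := by
    rw [hφ]; exact sq_cutoff_sub_le hd
  rw [← hV, ← hφ]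
  have hm0 : ∀ x y : Eu N, 0 ≤ min 1 (‖x - y‖ ^ 2 / d ^ 2) := fun x y => by positivity
  obtain ⟨m, hm⟩ : ∃ m : Eu N → Eu N → ℝ, ∀ x y, m x y = min 1 (‖x - y‖ ^ 2 / d ^ 2) :=
    ⟨_, fun _ _ => rfl⟩
  obtain ⟨ψ, hψ⟩ : ∃ ψ : Eu N → Eu N → ℝ, ∀ x, ψ x =
    Set.indicator {z : Eu N | ‖x - z‖ < L + d} 1 := ⟨_, fun _ => rfl⟩
  have hS : ∀ x : Eu N, MeasurableSet {z : Eu N | ‖x - z‖ < L + d} := fun x =>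
    measurableSet_lt (measurable_const.sub measurable_id).norm measurable_const
  have hψv : ∀ x : Eu N, volume {z : Eu N | ‖x - z‖ < L + d} = ENNReal.ofReal V := fun x => by
    rw [volume_norm_sub_lt hN x (by linarith), hV]
  have hψi : ∀ x, Integrable (ψ x) := fun x => by
    rw [hψ, integrable_indicator_iff (hS x)]
    exact integrableOn_const (by rw [hψv]; exact ENNReal.ofReal_ne_top)
  have hψI : ∀ x, ∫ z, ψ x z = V := fun x => by
    rw [hψ, integral_indicator_one (hS x), measureReal_def, hψv, ENNReal.toReal_ofReal hV0]
  have hψ0 : ∀ x z, 0 ≤ ψ x z := fun x z => by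
    rw [hψ]; exact Set.indicator_nonneg (fun _ _ => zero_le_one) z
  have hφψ : ∀ x z, φ (x - z) ^ 2 ≤ ψ x z := fun x z => by
    by_cases hz : ‖x - z‖ < L + d
    · rw [hψ, Set.indicator_of_mem (show z ∈ {z : Eu N | ‖x - z‖ < L + d} from hz), Pi.one_apply]
      nlinarith [hφ0 (x - z), hφ1 (x - z)]
    · rw [hφz _ hz]; simpa using hψ0 x z
  have hφi : ∀ x, Integrable fun z => φ (x - z) ^ 2 := fun x =>
    (hψi x).mono' ((hφm.comp (measurable_const.sub measurable_id)).pow_const 2).aestronglyMeasurable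
      (ae_of_all _ fun z => by
        rw [Real.norm_of_nonneg (sq_nonneg _)]; exact hφψ x z)
  have hΦ : ∀ x, ∫ z, φ (x - z) ^ 2 = ∫ z, φ z ^ 2 := fun x =>
    integral_sub_left_eq_self (fun z => φ z ^ 2) volume x
  have hΦV : ∫ z, φ z ^ 2 ≤ V := by
    rw [← hΦ 0, ← hψI 0]
    exact integral_mono (hφi 0) (hψi 0) (hφψ 0)
  have hpt : ∀ x y, ∫⁻ z, ENNReal.ofReal ((φ (x - z) * f x - φ (y - z) * f y) ^ 2 * kk N s x y) ≤
      ENNReal.ofReal (V * ((f x - f y) ^ 2 * kk N s x y) +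
        2 * V * (f x * f y * (m x y * kk N s x y))) := by
    intro x y
    obtain ⟨H, hH⟩ : ∃ H : Eu N → ℝ, H = fun z => (f x * f y * m x y * (ψ x z + ψ y z) +
      (f x - f y) * (f x * φ (x - z) ^ 2 - f y * φ (y - z) ^ 2)) * kk N s x y := ⟨_, rfl⟩
    have hle : ∀ z, (φ (x - z) * f x - φ (y - z) * f y) ^ 2 * kk N s x y ≤ H z := fun z => by
      rw [hH]
      refine mul_le_mul_of_nonneg_right ?_ (kk_nonneg x y)
      have h1 : (φ (x - z) - φ (y - z)) ^ 2 ≤ m x y * (ψ x z + ψ y z) := by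
        have h2 := hφd (x - z) (y - z)
        rw [sub_sub_sub_cancel_right, ← hm] at h2
        by_cases hx : ‖x - z‖ < L + d
        · have e : ψ x z = 1 := by
            rw [hψ, Set.indicator_of_mem (show z ∈ {z : Eu N | ‖x - z‖ < L + d} from hx)]; rfl
          have h0 := hm0 x y
          rw [← hm] at h0
          rw [e]
          nlinarith [hψ0 y z, mul_nonneg h0 (hψ0 y z)]
        · by_cases hy : ‖y - z‖ < L + d
          · have e : ψ y z = 1 := by
              rw [hψ, Set.indicator_of_mem (show z ∈ {z : Eu N | ‖y - z‖ < L + d} from hy)]; rfl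
            have h0 := hm0 x y
            rw [← hm] at h0
            rw [e]
            nlinarith [hψ0 x z, mul_nonneg h0 (hψ0 x z)]
          · rw [hφz _ hx, hφz _ hy]
            have h0 := hm0 x y
            rw [← hm] at h0
            have := add_nonneg (hψ0 x z) (hψ0 y z)
            simpa using mul_nonneg h0 this
      have h3 := mul_le_mul_of_nonneg_left h1 (mul_nonneg (hf0 x) (hf0 y))
      nlinarith
    have hHi : Integrable H := by
      rw [hH]
      exact (((((hψi x).add (hψi y)).const_mul _).add
        ((((hφi x).const_mul _).sub ((hφi y).const_mul _)).const_mul _)).mul_const _)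
    have hHI : ∫ z, H z = (2 * V * (f x * f y * m x y) +
        (f x - f y) ^ 2 * ∫ z, φ z ^ 2) * kk N s x y := by
      have i1 : Integrable fun z => f x * f y * m x y * (ψ x z + ψ y z) :=
        ((hψi x).add (hψi y)).const_mul _
      have i2 : Integrable fun z => f x * φ (x - z) ^ 2 := (hφi x).const_mul _
      have i3 : Integrable fun z => f y * φ (y - z) ^ 2 := (hφi y).const_mul _
      have i4 : Integrable fun z => (f x - f y) * (f x * φ (x - z) ^ 2 - f y * φ (y - z) ^ 2) :=
        (i2.sub i3).const_mul _
      rw [hH, integral_mul_const, integral_add i1 i4, integral_const_mul,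
        integral_const_mul, integral_add (hψi x) (hψi y), integral_sub i2 i3, integral_const_mul, integral_const_mul, hΦ, hΦ, hψI, hψI]
      ring
    calc _ ≤ ∫⁻ z, ENNReal.ofReal (H z) := lintegral_mono fun z => ENNReal.ofReal_le_ofReal (hle z)
      _ = ENNReal.ofReal (∫ z, H z) := (ofReal_integral_eq_lintegral_ofReal hHi
          (ae_of_all _ fun z => (mul_nonneg (sq_nonneg _) (kk_nonneg x y)).trans (hle z))).symm
      _ ≤ _ := by
        refine ENNReal.ofReal_le_ofReal ?_
        rw [hHI]
        have := mul_le_mul_of_nonneg_right hΦV (mul_nonneg (sq_nonneg (f x - f y)) (kk_nonneg (s := s) x y))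
        linarith
  have hmm : Measurable fun p : Eu N × Eu N => m p.1 p.2 := by
    simp only [hm]
    exact measurable_const.min (((measurable_fst.sub measurable_snd).norm.pow_const 2).div_const _)
  have hswap : ∫⁻ z, gagliardoSq N s (fun x => φ (x - z) * f x) =
      ∫⁻ p : Eu N × Eu N, ∫⁻ z, ENNReal.ofReal
        ((φ (p.1 - z) * f p.1 - φ (p.2 - z) * f p.2) ^ 2 * kk N s p.1 p.2) := by
    have e : ∀ z, gagliardoSq N s (fun x => φ (x - z) * f x) = ∫⁻ p : Eu N × Eu N, ENNReal.ofReal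
        ((φ (p.1 - z) * f p.1 - φ (p.2 - z) * f p.2) ^ 2 * kk N s p.1 p.2) := fun z => by
      rw [gagliardoSq_eq, dint_eq_prod (measurable_energy
        ((hφm.comp (measurable_id.sub_const z)).mul hf))]
    simp only [e]
    refine lintegral_lintegral_swap ?_
    refine Measurable.aemeasurable (Measurable.ennreal_ofReal (Measurable.mul ?_ ?_))
    · refine ((Measurable.mul ?_ ?_).sub (Measurable.mul ?_ ?_)).pow_const 2
      · exact hφm.comp ((measurable_fst.comp measurable_snd).sub measurable_fst)
      · exact hf.comp (measurable_fst.comp measurable_snd)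
      · exact hφm.comp ((measurable_snd.comp measurable_snd).sub measurable_fst)
      · exact hf.comp (measurable_snd.comp measurable_snd)
    · exact measurable_kk.comp measurable_snd
  rw [hswap]
  have hk0 : ∀ x y, 0 ≤ m x y * kk N s x y := fun x y => by
    rw [hm]; exact mul_nonneg (hm0 x y) (kk_nonneg x y)
  have hmeas1 : Measurable fun p : Eu N × Eu N => V * ((f p.1 - f p.2) ^ 2 * kk N s p.1 p.2) :=
    (measurable_energy hf).const_mul V
  have hmeas2 : Measurable fun p : Eu N × Eu N =>
      2 * V * (f p.1 * f p.2 * (m p.1 p.2 * kk N s p.1 p.2)) :=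
    (((hf.comp measurable_fst).mul (hf.comp measurable_snd)).mul
      (hmm.mul measurable_kk)).const_mul _
  have hW : dint (fun x y => 2 * V * (f x * f y * (m x y * kk N s x y))) ≤
      ENNReal.ofReal V * (2 *
      (ENNReal.ofReal (d ^ (-(2 * s))) * (kerInt N s * ∫⁻ x, ENNReal.ofReal (f x ^ 2)))) := by
    have hw := dint_weight_scaled (s := s) (hf.pow_const 2) (fun x => sq_nonneg (f x)) hd
    simp only [← hm] at hw
    have hmeas3 : Measurable fun p : Eu N × Eu N => f p.1 ^ 2 * (m p.1 p.2 * kk N s p.1 p.2) :=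
      ((hf.comp measurable_fst).pow_const 2).mul (hmm.mul measurable_kk)
    have hsw : dint (fun x y => f y ^ 2 * (m x y * kk N s x y)) =
        dint fun x y => f x ^ 2 * (m x y * kk N s x y) := by
      rw [← dint_swap (F := fun x y => f x ^ 2 * (m x y * kk N s x y)) hmeas3]
      refine dint_congr fun x y => ?_
      rw [hm, hm, norm_sub_rev, kk_comm]
    have h2 : 2 * dint (fun x y => f x ^ 2 * (m x y * kk N s x y)) =
        dint (fun x y => f x ^ 2 * (m x y * kk N s x y)) +
        dint (fun x y => f y ^ 2 * (m x y * kk N s x y)) := by rw [hsw, two_mul]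
    rw [← hw, h2, ← dint_add hmeas3 (fun x y => mul_nonneg (sq_nonneg _) (hk0 x y))
      (fun x y => mul_nonneg (sq_nonneg _) (hk0 x y)), ← dint_const_mul hV0]
    refine dint_mono fun x y => ?_
    rw [mul_comm 2 V, mul_assoc]
    refine mul_le_mul_of_nonneg_left ?_ hV0
    have := mul_nonneg (sq_nonneg (f x - f y)) (hk0 x y)
    nlinarith
  calc _ ≤ ∫⁻ p : Eu N × Eu N, ENNReal.ofReal (V * ((f p.1 - f p.2) ^ 2 * kk N s p.1 p.2) +
        2 * V * (f p.1 * f p.2 * (m p.1 p.2 * kk N s p.1 p.2))) :=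
        lintegral_mono fun p => hpt p.1 p.2
    _ = dint (fun x y => V * ((f x - f y) ^ 2 * kk N s x y) +
        2 * V * (f x * f y * (m x y * kk N s x y))) :=
        (dint_eq_prod (F := fun x y => V * ((f x - f y) ^ 2 * kk N s x y) +
          2 * V * (f x * f y * (m x y * kk N s x y))) (hmeas1.add hmeas2)).symm
    _ = ENNReal.ofReal V * gagliardoSq N s f +
        dint (fun x y => 2 * V * (f x * f y * (m x y * kk N s x y))) := by
        rw [dint_add hmeas1 (fun x y => mul_nonneg hV0 (mul_nonneg (sq_nonneg _) (kk_nonneg x y)))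
          (fun x y => mul_nonneg (by positivity) (mul_nonneg (mul_nonneg (hf0 x) (hf0 y))
          (hk0 x y))), dint_const_mul hV0, gagliardoSq_eq]
    _ ≤ _ := by rw [mul_add]; gcongr

end Concentration

section Lieb

variable {N : ℕ} {s q : ℝ} {f u : Eu N → ℝ}

lemma linear_le_of_power_le {lam α κ κ₀ ε m J E : ℝ} (hlam : 0 ≤ lam) (hα : 0 < α)
    (hκ : κ₀ ≤ κ) (hγ : κ₀ ≤ α - 1 + κ) (h0 : 0 < κ₀) (hε1 : ε < 1) (hε : 0 < ε)
    (hm0 : 0 ≤ m) (hm : m ≤ 1 - ε) (hJ0 : 0 ≤ J) (hJ1 : J ≤ 1) (hE : 0 ≤ E)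
    (hlampos : 0 < lam)
    (h : lam * J ^ α ≤ m ^ (α - 1 + κ) * E) :
    (1 - ε) ^ (-κ₀) * lam * max α 1 * J ≤
      E + (1 - ε) ^ (-κ₀) * lam * (max α 1 - 1) * m := by
  have hΘ : 0 < (1 - ε) ^ (-κ₀) := Real.rpow_pos_of_pos (by linarith) _
  have hβ : 0 ≤ max α 1 - 1 := by linarith [le_max_right α 1]
  rcases hm0.eq_or_lt with rfl | hm0
  · rw [Real.zero_rpow (by linarith), zero_mul] at h
    have hJ : J = 0 := by
      by_contra hJ
      have := Real.rpow_pos_of_pos (lt_of_le_of_ne hJ0 (Ne.symm hJ)) α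
      have := mul_pos hlampos this
      linarith
    rw [hJ]; simpa using hE
  have hmono : ∀ e, κ₀ ≤ e → (1 - ε) ^ (-κ₀) ≤ m ^ (-e) := fun e he => by
    calc (1 - ε) ^ (-κ₀) ≤ m ^ (-κ₀) := Real.rpow_le_rpow_of_nonpos hm0 hm (by linarith)
      _ ≤ m ^ (-e) := Real.rpow_le_rpow_of_exponent_ge hm0 (by linarith) (by linarith)
  have hE' : lam * (J ^ α * m ^ (-(α - 1 + κ))) ≤ E := by
    have h2 := mul_le_mul_of_nonneg_right h (Real.rpow_nonneg hm0.le (-(α - 1 + κ)))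
    have h3 : m ^ (α - 1 + κ) * m ^ (-(α - 1 + κ)) = 1 := by
      rw [← Real.rpow_add hm0]; simp
    calc lam * (J ^ α * m ^ (-(α - 1 + κ))) = lam * J ^ α * m ^ (-(α - 1 + κ)) := by ring
      _ ≤ m ^ (α - 1 + κ) * E * m ^ (-(α - 1 + κ)) := h2
      _ = m ^ (α - 1 + κ) * m ^ (-(α - 1 + κ)) * E := by ring
      _ = E := by rw [h3, one_mul]
  rcases le_total 1 α with h1 | h1
  · rw [max_eq_left h1]
    have hB : α * J - (α - 1) * m ≤ J ^ α * m ^ (1 - α) := by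
      have hb := one_add_mul_self_le_rpow_one_add (s := J / m - 1)
        (by linarith [div_nonneg hJ0 hm0.le]) h1
      rw [add_sub_cancel, Real.div_rpow hJ0 hm0.le] at hb
      have hb2 := mul_le_mul_of_nonneg_right hb hm0.le
      have e1 : J ^ α / m ^ α * m = J ^ α * m ^ (1 - α) := by
        rw [Real.rpow_sub hm0, Real.rpow_one]; ring
      have e2 : (1 + α * (J / m - 1)) * m = α * J - (α - 1) * m := by
        field_simp; ring
      rw [e1, e2] at hb2
      exact hb2
    have hsplit : m ^ (-(α - 1 + κ)) = m ^ (1 - α) * m ^ (-κ) := by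
      rw [← Real.rpow_add hm0]; congr 1; ring
    have h5 : J ^ α * m ^ (1 - α) * (1 - ε) ^ (-κ₀) ≤ J ^ α * m ^ (1 - α) * m ^ (-κ) :=
      mul_le_mul_of_nonneg_left (hmono κ hκ) (mul_nonneg (Real.rpow_nonneg hJ0 _)
        (Real.rpow_nonneg hm0.le _))
    have h6 := mul_le_mul_of_nonneg_right hB hΘ.le
    rw [hsplit, ← mul_assoc] at hE'
    have h7 := mul_le_mul_of_nonneg_left (h6.trans h5) hlam
    nlinarith
  · rw [max_eq_right h1]
    have hB : J ≤ J ^ α := by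
      simpa using Real.rpow_le_rpow_of_exponent_ge' hJ0 hJ1 hα.le h1
    have h5 := mul_le_mul hB (hmono _ hγ) hΘ.le (Real.rpow_nonneg hJ0 _)
    have h7 := mul_le_mul_of_nonneg_left h5 hlam
    nlinarith

lemma measurable_volume_inter_ball {A : Set (Eu N)} (hA : MeasurableSet A) (r : ℝ) :
    Measurable (fun z : Eu N => volume (A ∩ Metric.ball z r)) ∧
    ∀ z, volume (A ∩ Metric.ball z r) =
      ∫⁻ x, A.indicator 1 x * Set.indicator {z : Eu N | ‖x - z‖ < r} (1 : Eu N → ℝ≥0∞) z := by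
  have key : ∀ z, volume (A ∩ Metric.ball z r) =
      ∫⁻ x, A.indicator 1 x * Set.indicator {z : Eu N | ‖x - z‖ < r} (1 : Eu N → ℝ≥0∞) z := by
    intro z
    rw [← lintegral_indicator_one (hA.inter measurableSet_ball)]
    refine lintegral_congr fun x => ?_
    by_cases h1 : x ∈ A
    · by_cases h2 : ‖x - z‖ < r
      · rw [Set.indicator_of_mem h1, Set.indicator_of_mem
          (show z ∈ {z : Eu N | ‖x - z‖ < r} from h2), Set.indicator_of_mem
          (show x ∈ A ∩ Metric.ball z r from ⟨h1, by rwa [Metric.mem_ball, dist_eq_norm]⟩)]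
        simp
      · rw [Set.indicator_of_notMem (s := {z : Eu N | ‖x - z‖ < r}) (show ¬ ‖x - z‖ < r from h2),
          Set.indicator_of_notMem (s := A ∩ Metric.ball z r)
          (fun h => h2 (by simpa [dist_eq_norm] using h.2)), mul_zero]
    · rw [Set.indicator_of_notMem h1, Set.indicator_of_notMem (s := A ∩ Metric.ball z r)
        (fun h => h1 h.1), zero_mul]
  refine ⟨?_, key⟩
  simp only [key]
  have hm : Measurable fun p : Eu N × Eu N => A.indicator (1 : Eu N → ℝ≥0∞) p.2 *
      Set.indicator {z : Eu N | ‖p.2 - z‖ < r} (1 : Eu N → ℝ≥0∞) p.1 := by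
    refine ((measurable_one.indicator hA).comp measurable_snd).mul ?_
    have : (fun p : Eu N × Eu N => Set.indicator {z : Eu N | ‖p.2 - z‖ < r}
        (1 : Eu N → ℝ≥0∞) p.1) =
        Set.indicator {p : Eu N × Eu N | ‖p.2 - p.1‖ < r} 1 := by
      ext p; rfl
    rw [this]
    exact measurable_one.indicator
      (measurableSet_lt (measurable_snd.sub measurable_fst).norm measurable_const)
  exact hm.lintegral_prod_right'

lemma lintegral_volume_inter_ball (hN : 2 ≤ N) {A : Set (Eu N)} (hA : MeasurableSet A) {r : ℝ}
    (hr : 0 ≤ r) :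
    ∫⁻ z, volume (A ∩ Metric.ball z r) = ENNReal.ofReal (om N * r ^ N) * volume A := by
  simp only [(measurable_volume_inter_ball hA r).2]
  have hm : Measurable fun p : Eu N × Eu N => A.indicator (1 : Eu N → ℝ≥0∞) p.2 *
      Set.indicator {z : Eu N | ‖p.2 - z‖ < r} (1 : Eu N → ℝ≥0∞) p.1 := by
    refine ((measurable_one.indicator hA).comp measurable_snd).mul ?_
    have : (fun p : Eu N × Eu N => Set.indicator {z : Eu N | ‖p.2 - z‖ < r}
        (1 : Eu N → ℝ≥0∞) p.1) =
        Set.indicator {p : Eu N × Eu N | ‖p.2 - p.1‖ < r} 1 := by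
      ext p; rfl
    rw [this]
    exact measurable_one.indicator
      (measurableSet_lt (measurable_snd.sub measurable_fst).norm measurable_const)
  rw [lintegral_lintegral_swap hm.aemeasurable]
  have hS : ∀ x : Eu N, MeasurableSet {z : Eu N | ‖x - z‖ < r} := fun x =>
    measurableSet_lt (measurable_const.sub measurable_id).norm measurable_const
  calc _ = ∫⁻ x, ENNReal.ofReal (om N * r ^ N) * A.indicator 1 x := by
        refine lintegral_congr fun x => ?_
        rw [lintegral_const_mul _ (measurable_one.indicator (hS x)), lintegral_indicator_one (hS x),
          volume_norm_sub_lt hN x hr, mul_comm]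
    _ = _ := by
        rw [lintegral_const_mul _ (measurable_one.indicator hA), lintegral_indicator_one hA]

lemma le_lintegral_cutoff_rpow (hN : 2 ≤ N) (hf : Measurable f) {L d : ℝ}
    (hL : 0 ≤ L) (hd : 0 < d) :
    ENNReal.ofReal (om N * L ^ N) * ∫⁻ x, ENNReal.ofReal (f x ^ q) ≤
      ∫⁻ z, ∫⁻ x, ENNReal.ofReal ((cutoff L d (x - z) * f x) ^ q) := by
  rw [lintegral_lintegral_swap]
  · rw [← lintegral_const_mul _ (hf.pow_const q).ennreal_ofReal]
    refine lintegral_mono fun x => ?_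
    have hS : MeasurableSet {z : Eu N | ‖x - z‖ < L} :=
      measurableSet_lt (measurable_const.sub measurable_id).norm measurable_const
    calc ENNReal.ofReal (om N * L ^ N) * ENNReal.ofReal (f x ^ q)
        = ∫⁻ z in {z : Eu N | ‖x - z‖ < L}, ENNReal.ofReal (f x ^ q) := by
          rw [setLIntegral_const, volume_norm_sub_lt hN x hL, mul_comm]
      _ = ∫⁻ z in {z : Eu N | ‖x - z‖ < L}, ENNReal.ofReal ((cutoff L d (x - z) * f x) ^ q) := by
          refine setLIntegral_congr_fun hS fun z hz => ?_
          have hz' : ‖x - z‖ < L := hz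
          beta_reduce
          rw [cutoff_eq_one hd hz'.le, one_mul]
      _ ≤ _ := setLIntegral_le_lintegral _ _
  · refine Measurable.aemeasurable (Measurable.ennreal_ofReal (Measurable.pow_const ?_ q))
    exact (measurable_cutoff.comp (measurable_snd.sub measurable_fst)).mul (hf.comp measurable_snd)


set_option maxHeartbeats 1000000 in
lemma exists_concentration (hN : 2 ≤ N) (hs0 : 0 < s) (hs1 : s < 1) (hq1 : 1 ≤ q)
    (hq2 : q < 2 * N / ((N : ℝ) - 2 * s)) {ε : ℝ} (hε : 0 < ε) (hε1 : ε < 1) :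
    ∃ R, 0 < R ∧ ∃ δ, 0 < δ ∧ ∀ f : Eu N → ℝ, Adm f → volume {x | 0 < f x} ≤ 1 →
      (∫ x, f x ^ q) = 1 → gagliardoSq N s f ≠ ⊤ → gagliardoSqR N s f ≤ lamR N s q + δ →
      ∃ z, ENNReal.ofReal (1 - ε) < volume ({x | 0 < f x} ∩ Metric.ball z R) := by
  have hq0 : 0 < q := by linarith
  have hN0 : (0 : ℝ) < N := by exact_mod_cast (by omega : 0 < N)
  have hom := om_pos (N := N)
  have hγ := exponent_pos hN hs1 hq1 hq2
  obtain ⟨c, hc, hl2⟩ := gagliardoSq_l2 hN hs0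
  obtain ⟨Λ, hΛ⟩ : ∃ Λ, Λ = lamR N s q := ⟨_, rfl⟩
  have hΛ0 : 0 < Λ := hΛ ▸ lamR_pos hN hs0 hs1 hq1 hq2
  obtain ⟨κ₀, hκ₀⟩ : ∃ κ₀, κ₀ = min (2 / q - 1 + 2 * s / N) (2 * s / N) := ⟨_, rfl⟩
  have hκp : 0 < κ₀ := by rw [hκ₀]; exact lt_min hγ (by positivity)
  obtain ⟨Θ, hΘ⟩ : ∃ Θ, Θ = (1 - ε) ^ (-κ₀) := ⟨_, rfl⟩
  have hΘ1 : 1 < Θ := by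
    rw [hΘ]
    exact Real.one_lt_rpow_of_pos_of_lt_one_of_neg (by linarith) (by linarith) (by linarith)
  obtain ⟨β, hβ⟩ : ∃ β, β = max (2 / q) 1 := ⟨_, rfl⟩
  have hβ1 : 1 ≤ β := by rw [hβ]; exact le_max_right _ _
  obtain ⟨g, hg⟩ : ∃ g, g = (Θ - 1) * Λ := ⟨_, rfl⟩
  have hg0 : 0 < g := by rw [hg]; exact mul_pos (by linarith) hΛ0
  obtain ⟨K, hK⟩ : ∃ K, K = (kerInt N s).toReal := ⟨_, rfl⟩
  have hK0 : 0 ≤ K := by rw [hK]; exact ENNReal.toReal_nonneg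
  have hKe : kerInt N s = ENNReal.ofReal K := by
    rw [hK, ENNReal.ofReal_toReal (kerInt_lt_top hN hs0 hs1).ne]
  obtain ⟨W, hW⟩ : ∃ W, W = 2 * (K * (2 * Λ / c)) := ⟨_, rfl⟩
  have hW0 : 0 ≤ W := by rw [hW]; positivity
  obtain ⟨d, hd1, hd⟩ := exists_rpow_neg_le (a := 2 * s) (ε := g / 4 / (W + 1)) (by linarith)
    (by positivity)
  have hd0 : 0 < d := by linarith
  have hdW : d ^ (-(2 * s)) * W ≤ g / 4 := by
    rw [le_div_iff₀ (by linarith)] at hd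
    have := Real.rpow_nonneg hd0.le (-(2 * s))
    nlinarith
  obtain ⟨n, hn⟩ := exists_nat_ge (Θ * Λ * β * N / (g / 4))
  rw [div_le_iff₀ (by linarith)] at hn
  have hn0 : (0 : ℝ) ≤ n := n.cast_nonneg
  have hL : 0 ≤ n * d := by positivity
  refine ⟨n * d + d, by positivity, min Λ (g / 4), lt_min hΛ0 (by linarith),
    fun f hf hv hf1 hE hEle => ?_⟩
  rw [← hΛ] at hEle
  by_contra! hcon
  obtain ⟨A, hA⟩ : ∃ A, A = {x | 0 < f x} := ⟨_, rfl⟩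
  rw [← hA] at hcon hv
  have hAm : MeasurableSet A := hA ▸ measurableSet_lt measurable_const hf.meas
  obtain ⟨e, he⟩ : ∃ e, e = gagliardoSqR N s f := ⟨_, rfl⟩
  have he0 : 0 ≤ e := by rw [he]; exact ENNReal.toReal_nonneg
  rw [← he] at hEle
  have hEe : gagliardoSq N s f = ENNReal.ofReal e := by
    rw [he, gagliardoSqR, ENNReal.ofReal_toReal hE]
  have hfq : ∫⁻ x, ENNReal.ofReal (f x ^ q) = 1 := by
    rw [hf.lintegral_rpow hq0, hf1, ENNReal.ofReal_one]
  obtain ⟨φ, hφ⟩ : ∃ φ : Eu N → ℝ, φ = cutoff (n * d) d := ⟨_, rfl⟩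
  have hφm : Measurable φ := by rw [hφ]; exact measurable_cutoff
  have hφ0 : ∀ x, 0 ≤ φ x := by rw [hφ]; exact cutoff_nonneg
  have hφ1 : ∀ x, φ x ≤ 1 := by rw [hφ]; exact cutoff_le_one
  have hΘΛ : 0 ≤ Θ * Λ * (β - 1) := by
    have : 0 ≤ β - 1 := by linarith
    positivity
  have hpt : ∀ z, ENNReal.ofReal (Θ * Λ * β) * ∫⁻ x, ENNReal.ofReal ((φ (x - z) * f x) ^ q) ≤
      gagliardoSq N s (fun x => φ (x - z) * f x) +
        ENNReal.ofReal (Θ * Λ * (β - 1)) * volume (A ∩ Metric.ball z (n * d + d)) := by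
    intro z
    by_cases hEz : gagliardoSq N s (fun x => φ (x - z) * f x) = ⊤
    · rw [hEz, top_add]; exact le_top
    have hgA : Adm fun x => φ (x - z) * f x := by
      refine hf.of_le ((hφm.comp (measurable_id.sub_const z)).mul hf.meas)
        (fun x => mul_nonneg (hφ0 _) (hf.nonneg x)) fun x => ?_
      have := mul_le_mul_of_nonneg_right (hφ1 (x - z)) (hf.nonneg x)
      linarith
    obtain ⟨m, hm⟩ : ∃ m, m = (volume (A ∩ Metric.ball z (n * d + d))).toReal := ⟨_, rfl⟩
    have hmt : volume (A ∩ Metric.ball z (n * d + d)) ≠ ⊤ :=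
      ((hcon z).trans_lt ENNReal.ofReal_lt_top).ne
    have hme : volume (A ∩ Metric.ball z (n * d + d)) = ENNReal.ofReal m := by
      rw [hm, ENNReal.ofReal_toReal hmt]
    have hm0 : 0 ≤ m := by rw [hm]; exact ENNReal.toReal_nonneg
    have hm1 : m ≤ 1 - ε := by
      have h1 := hcon z
      rw [hme] at h1
      exact (ENNReal.ofReal_le_ofReal_iff (by linarith)).1 h1
    have hsub : {x | 0 < φ (x - z) * f x} ⊆ A ∩ Metric.ball z (n * d + d) := by
      intro x hx
      have hx' : 0 < φ (x - z) * f x := hx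
      refine ⟨?_, ?_⟩
      · rw [hA]
        exact pos_of_mul_pos_right hx' (hφ0 _)
      · rw [Metric.mem_ball, dist_eq_norm]
        by_contra hcc
        rw [hφ, cutoff_eq_zero hd0 (not_lt.1 hcc), zero_mul] at hx'
        exact lt_irrefl _ hx'
    have hlam := lamR_le_of_nonneg hN hs0 hs1 hq1 hgA hEz hm0
      ((measure_mono hsub).trans hme.le)
    have hJ1 : ∫ x, (φ (x - z) * f x) ^ q ≤ 1 := by
      rw [← hf1]
      refine integral_mono (hgA.integrable_rpow hq0) (hf.integrable_rpow hq0) fun x => ?_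
      refine Real.rpow_le_rpow (hgA.nonneg x) ?_ hq0.le
      have := mul_le_mul_of_nonneg_right (hφ1 (x - z)) (hf.nonneg x)
      linarith
    rw [← hΛ] at hlam
    have key := linear_le_of_power_le (ε := ε) (κ₀ := κ₀) (κ := 2 * s / N) (α := 2 / q) hΛ0.le
      (by positivity)
      (by rw [hκ₀]; exact min_le_right _ _) (by rw [hκ₀]; exact min_le_left _ _) hκp hε1 hε hm0 hm1
      hgA.integral_rpow_nonneg hJ1 ENNReal.toReal_nonneg hΛ0 hlam
    rw [← hΘ, ← hβ] at key
    rw [hgA.lintegral_rpow hq0, hme, ← ENNReal.ofReal_mul (by positivity),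
      ← ENNReal.ofReal_mul hΘΛ]
    refine (ENNReal.ofReal_le_ofReal key).trans ?_
    rw [ENNReal.ofReal_add ENNReal.toReal_nonneg (mul_nonneg hΘΛ hm0),
      ENNReal.ofReal_toReal hEz]
  have hInt : ENNReal.ofReal (Θ * Λ * β) * (ENNReal.ofReal (om N * (n * d) ^ N) * 1) ≤
      ENNReal.ofReal (om N * (n * d + d) ^ N) * (gagliardoSq N s f + 2 *
        (ENNReal.ofReal (d ^ (-(2 * s))) * (kerInt N s * ∫⁻ x, ENNReal.ofReal (f x ^ 2)))) +
      ENNReal.ofReal (Θ * Λ * (β - 1)) *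
        (ENNReal.ofReal (om N * (n * d + d) ^ N) * 1) := by
    have h1 := le_lintegral_cutoff_rpow (q := q) hN hf.meas hL hd0
    rw [hfq, ← hφ] at h1
    have hmm : Measurable fun z => ENNReal.ofReal (Θ * Λ * (β - 1)) *
        volume (A ∩ Metric.ball z (n * d + d)) :=
      ((measurable_volume_inter_ball hAm (n * d + d)).1).const_mul _
    calc _ ≤ ENNReal.ofReal (Θ * Λ * β) *
          ∫⁻ z, ∫⁻ x, ENNReal.ofReal ((φ (x - z) * f x) ^ q) := by gcongr
      _ = ∫⁻ z, ENNReal.ofReal (Θ * Λ * β) *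
          ∫⁻ x, ENNReal.ofReal ((φ (x - z) * f x) ^ q) := by
          rw [lintegral_const_mul' _ _ ENNReal.ofReal_ne_top]
      _ ≤ ∫⁻ z, (gagliardoSq N s (fun x => φ (x - z) * f x) +
          ENNReal.ofReal (Θ * Λ * (β - 1)) * volume (A ∩ Metric.ball z (n * d + d))) :=
          lintegral_mono hpt
      _ = (∫⁻ z, gagliardoSq N s (fun x => φ (x - z) * f x)) +
          ENNReal.ofReal (Θ * Λ * (β - 1)) *
            (ENNReal.ofReal (om N * (n * d + d) ^ N) * volume A) := by
          rw [lintegral_add_right _ hmm, lintegral_const_mul' _ _ ENNReal.ofReal_ne_top,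
            lintegral_volume_inter_ball hN hAm (by positivity)]
      _ ≤ _ := by
          refine add_le_add ?_ (by gcongr)
          rw [hφ]
          exact lintegral_gagliardoSq_cutoff_le hN hf.meas hf.nonneg hL hd0
  have hF : ∫⁻ x, ENNReal.ofReal (f x ^ 2) ≤ ENNReal.ofReal (e / c) := by
    have h1 := hl2 f hf.meas 1 one_pos (by
      rw [ENNReal.ofReal_one]
      refine le_trans (measure_mono fun x hx => ?_) hv
      rw [hA]
      exact lt_of_le_of_ne (hf.nonneg x) (Ne.symm hx))
    rw [Real.one_rpow, mul_one, hEe] at h1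
    rw [ENNReal.ofReal_div_of_pos hc, ENNReal.le_div_iff_mul_le (by simp [hc])
      (by simp), mul_comm]
    exact h1
  obtain ⟨V, hV⟩ : ∃ V, V = om N * (n * d + d) ^ N := ⟨_, rfl⟩
  have hV0 : 0 < V := by rw [hV]; positivity
  have hVL : V * (1 - N / (n + 1)) ≤ om N * (n * d) ^ N := by
    have hb := one_add_mul_le_pow (a := -(1 / ((n : ℝ) + 1))) (by
      have : 1 / ((n : ℝ) + 1) ≤ 1 := by rw [div_le_one (by linarith)]; linarith
      linarith) N
    have e1 : ((n : ℝ) * d) = (n * d + d) * (1 + -(1 / ((n : ℝ) + 1))) := by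
      have : (n : ℝ) + 1 ≠ 0 := by linarith
      field_simp; ring
    rw [hV, e1, mul_pow, ← e1, ← mul_assoc]
    refine mul_le_mul_of_nonneg_left (le_trans (le_of_eq ?_) hb) (by positivity)
    ring
  have hreal : Θ * Λ * β * (om N * (n * d) ^ N) ≤
      V * (e + 2 * (d ^ (-(2 * s)) * (K * (e / c)))) + Θ * Λ * (β - 1) * V := by
    have hdp : 0 ≤ d ^ (-(2 * s)) := Real.rpow_nonneg hd0.le _
    have hec : 0 ≤ e / c := by positivity
    have hT : 0 ≤ V * (e + 2 * (d ^ (-(2 * s)) * (K * (e / c)))) := by positivity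
    refine (ENNReal.ofReal_le_ofReal_iff (add_nonneg hT (mul_nonneg hΘΛ hV0.le))).1 ?_
    rw [mul_one, mul_one, ← ENNReal.ofReal_mul (by positivity), ← hV] at hInt
    refine hInt.trans ?_
    rw [ENNReal.ofReal_add hT (mul_nonneg hΘΛ hV0.le), ENNReal.ofReal_mul hV0.le,
      ENNReal.ofReal_add he0 (by positivity), ENNReal.ofReal_mul (by norm_num : (0 : ℝ) ≤ 2),
      ENNReal.ofReal_mul hdp, ENNReal.ofReal_mul hK0, ENNReal.ofReal_mul hΘΛ, ← hEe, ← hKe,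
      ENNReal.ofReal_ofNat]
    gcongr
  have hmin1 : e ≤ Λ + g / 4 := hEle.trans (by gcongr; exact min_le_right _ _)
  have hmin2 : e ≤ 2 * Λ := hEle.trans (by linarith [min_le_left Λ (g / 4)])
  have h2 : Θ * Λ * β * (V * (1 - N / (n + 1))) ≤
      V * (e + 2 * (d ^ (-(2 * s)) * (K * (e / c)))) + Θ * Λ * (β - 1) * V :=
    le_trans (mul_le_mul_of_nonneg_left hVL (by positivity)) hreal
  have h3 : Θ * Λ * β * (1 - N / (n + 1)) ≤
      e + 2 * (d ^ (-(2 * s)) * (K * (e / c))) + Θ * Λ * (β - 1) := by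
    refine le_of_mul_le_mul_left ?_ hV0
    linarith
  have h4 : 2 * (d ^ (-(2 * s)) * (K * (e / c))) ≤ d ^ (-(2 * s)) * W := by
    rw [hW]
    have hdp : 0 ≤ d ^ (-(2 * s)) := Real.rpow_nonneg hd0.le _
    have : d ^ (-(2 * s)) * (K * (e / c)) ≤ d ^ (-(2 * s)) * (K * (2 * Λ / c)) := by gcongr
    linarith
  have h5 : Θ * Λ * β * (N / (n + 1)) ≤ g / 4 := by
    rw [← mul_div_assoc, div_le_iff₀ (by linarith)]
    nlinarith
  nlinarith

end Lieb

section Cut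

variable {N : ℕ} {s q : ℝ} {f u : Eu N → ℝ}

lemma exists_cut (hu : Adm u) {M : ℝ} (hM : 0 < M) (huM : ∀ x, u x ≤ M)
    (z : Eu N) {L d : ℝ} (hd : 0 < d) (hd1 : d ≤ 1) :
    ∃ v w : Eu N → ℝ, Adm v ∧ Adm w ∧ (∀ x, v x ≤ u x) ∧ (∀ x, w x ≤ u x) ∧
      {x | 0 < v x} = {x | 0 < u x} ∩ {x | ‖x - z‖ < L + d} ∧
      (∀ x, ‖x - z‖ < L → v x = u x) ∧ (∀ x, ‖x - z‖ < L → w x = 0) ∧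
      (∀ x, L + d ≤ ‖x - z‖ → w x = u x) ∧
      gagliardoSq N s v + gagliardoSq N s w ≤ gagliardoSq N s u +
        ENNReal.ofReal (8 * M / d ^ 2) * (kerInt N s *
          ∫⁻ x, ENNReal.ofReal (Set.indicator {x | L ≤ ‖x - z‖} u x)) := by
  obtain ⟨φ, hφ⟩ : ∃ φ : Eu N → ℝ, φ = fun x => cutoff L d (x - z) := ⟨_, rfl⟩
  have hφv : ∀ x, φ x = cutoff L d (x - z) := fun x => by rw [hφ]
  have hφm : Measurable φ := by rw [hφ]; exact measurable_cutoff.comp (measurable_id.sub_const z)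
  have hφ0 : ∀ x, 0 ≤ φ x := fun x => by rw [hφv]; exact cutoff_nonneg _
  have hφ1 : ∀ x, φ x ≤ 1 := fun x => by rw [hφv]; exact cutoff_le_one _
  obtain ⟨θ, hθ⟩ : ∃ θ : Eu N → ℝ, ∀ x, θ x = Real.pi / 2 * (1 - φ x) := ⟨_, fun _ => rfl⟩
  have hpi := Real.pi_pos
  have hθ0 : ∀ x, 0 ≤ θ x := fun x => by
    rw [hθ]; exact mul_nonneg (by linarith) (by linarith [hφ1 x])
  have hθ1 : ∀ x, θ x ≤ Real.pi / 2 := fun x => by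
    rw [hθ]; nlinarith [hφ0 x]
  have hθm : Measurable θ := by
    have : θ = fun x => Real.pi / 2 * (1 - φ x) := funext hθ
    rw [this]; exact (measurable_const.sub hφm).const_mul _
  have hc0 : ∀ x, 0 ≤ Real.cos (θ x) := fun x =>
    Real.cos_nonneg_of_neg_pi_div_two_le_of_le (by linarith [hθ0 x]) (hθ1 x)
  have hs0 : ∀ x, 0 ≤ Real.sin (θ x) := fun x =>
    Real.sin_nonneg_of_nonneg_of_le_pi (hθ0 x) (by linarith [hθ1 x])
  have hin : ∀ x, ‖x - z‖ < L → θ x = 0 := fun x hx => by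
    rw [hθ, hφv, cutoff_eq_one hd hx.le]; simp
  have hout : ∀ x, L + d ≤ ‖x - z‖ → θ x = Real.pi / 2 := fun x hx => by
    rw [hθ, hφv, cutoff_eq_zero hd hx]; simp
  have hmid : ∀ x, ‖x - z‖ < L + d → θ x < Real.pi / 2 := fun x hx => by
    have : 0 < φ x := by
      rw [hφv, cutoff]
      refine lt_max_of_lt_right (lt_min one_pos ?_)
      have : (‖x - z‖ - L) / d < 1 := by rw [div_lt_one hd]; linarith
      have e : (L - ‖x - z‖) / d = - ((‖x - z‖ - L) / d) := by ring
      rw [e]; linarith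
    rw [hθ]; nlinarith
  have hvA : Adm fun x => Real.cos (θ x) * u x := by
    refine hu.of_le ((Real.measurable_cos.comp hθm).mul hu.meas)
      (fun x => mul_nonneg (hc0 x) (hu.nonneg x)) fun x => ?_
    have := mul_le_mul_of_nonneg_right (Real.cos_le_one (θ x)) (hu.nonneg x)
    linarith
  have hwA : Adm fun x => Real.sin (θ x) * u x := by
    refine hu.of_le ((Real.measurable_sin.comp hθm).mul hu.meas)
      (fun x => mul_nonneg (hs0 x) (hu.nonneg x)) fun x => ?_
    have := mul_le_mul_of_nonneg_right (Real.sin_le_one (θ x)) (hu.nonneg x)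
    linarith
  refine ⟨_, _, hvA, hwA, fun x => ?_, fun x => ?_, ?_, fun x hx => ?_, fun x hx => ?_,
    fun x hx => ?_, ?_⟩
  · have := mul_le_mul_of_nonneg_right (Real.cos_le_one (θ x)) (hu.nonneg x)
    linarith
  · have := mul_le_mul_of_nonneg_right (Real.sin_le_one (θ x)) (hu.nonneg x)
    linarith
  · ext x
    constructor
    · intro hx
      have hx' : 0 < Real.cos (θ x) * u x := hx
      refine ⟨pos_of_mul_pos_right hx' (hc0 x), ?_⟩
      by_contra hcon
      rw [hout x (not_lt.1 hcon), Real.cos_pi_div_two, zero_mul] at hx'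
      exact lt_irrefl _ hx'
    · rintro ⟨h1, h2⟩
      exact mul_pos (Real.cos_pos_of_mem_Ioo ⟨by linarith [hθ0 x], hmid x h2⟩) h1
  · rw [hin x hx, Real.cos_zero, one_mul]
  · rw [hin x hx, Real.sin_zero, zero_mul]
  · rw [hout x hx, Real.sin_pi_div_two, one_mul]
  · rw [gagliardoSq_ims (χ := fun x => Real.cos (θ x)) (η := fun x => Real.sin (θ x)) hu.meas
      hu.nonneg (Real.measurable_cos.comp hθm) (fun x => Real.cos_sq_add_sin_sq (θ x))]
    refine add_le_add le_rfl ?_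
    obtain ⟨g, hg⟩ : ∃ g : Eu N → ℝ, g = Set.indicator {x | L ≤ ‖x - z‖} u := ⟨_, rfl⟩
    rw [← hg]
    have hS : MeasurableSet {x : Eu N | L ≤ ‖x - z‖} :=
      measurableSet_le measurable_const (measurable_id.sub_const z).norm
    have hgm : Measurable g := by rw [hg]; exact hu.meas.indicator hS
    have hg0 : ∀ x, 0 ≤ g x := fun x => by
      rw [hg]; exact Set.indicator_nonneg (fun x _ => hu.nonneg x) x
    have hpt : ∀ x y, u x * u y * ((Real.cos (θ x) - Real.cos (θ y)) ^ 2 +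
        (Real.sin (θ x) - Real.sin (θ y)) ^ 2) * kk N s x y ≤
        4 * M / d ^ 2 * (g x * (min 1 (‖x - y‖ ^ 2) * kk N s x y) +
          g y * (min 1 (‖x - y‖ ^ 2) * kk N s x y)) := by
      intro x y
      have hk := kk_nonneg (s := s) x y
      have hmn : 0 ≤ min 1 (‖x - y‖ ^ 2) := by positivity
      have e1 : (Real.cos (θ x) - Real.cos (θ y)) ^ 2 + (Real.sin (θ x) - Real.sin (θ y)) ^ 2 =
          2 - 2 * Real.cos (θ x - θ y) := by
        rw [Real.cos_sub]
        linarith [Real.cos_sq_add_sin_sq (θ x), Real.cos_sq_add_sin_sq (θ y)]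
      have e2 : 2 - 2 * Real.cos (θ x - θ y) ≤ (θ x - θ y) ^ 2 := by
        linarith [Real.one_sub_sq_div_two_le_cos (x := θ x - θ y)]
      have e3 : (θ x - θ y) ^ 2 ≤ 4 / d ^ 2 * min 1 (‖x - y‖ ^ 2) := by
        have h1 := sq_cutoff_sub_le (L := L) hd (x - z) (y - z)
        rw [← hφv, ← hφv, sub_sub_sub_cancel_right] at h1
        have h2 : min 1 (‖x - y‖ ^ 2 / d ^ 2) ≤ 1 / d ^ 2 * min 1 (‖x - y‖ ^ 2) := by
          rw [mul_min_of_nonneg _ _ (by positivity : 0 ≤ 1 / d ^ 2)]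
          refine min_le_min ?_ (le_of_eq (by ring))
          rw [mul_one, le_div_iff₀ (by positivity), one_mul]
          nlinarith
        have h3 : (θ x - θ y) ^ 2 = (Real.pi / 2) ^ 2 * (φ x - φ y) ^ 2 := by
          rw [hθ, hθ]; ring
        have h4 : (Real.pi / 2) ^ 2 ≤ 4 := by nlinarith [Real.pi_le_four]
        rw [h3]
        calc _ ≤ 4 * (1 / d ^ 2 * min 1 (‖x - y‖ ^ 2)) :=
              mul_le_mul h4 (h1.trans h2) (sq_nonneg _) (by norm_num)
          _ = _ := by ring
      have e4 : u x * u y * ((Real.cos (θ x) - Real.cos (θ y)) ^ 2 +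
          (Real.sin (θ x) - Real.sin (θ y)) ^ 2) ≤
          4 * M / d ^ 2 * (g x + g y) * min 1 (‖x - y‖ ^ 2) := by
        have hux := hu.nonneg x
        have huy := hu.nonneg y
        have hbig : ∀ t, 0 ≤ t → u x * u y ≤ M * t →
            u x * u y * ((Real.cos (θ x) - Real.cos (θ y)) ^ 2 +
            (Real.sin (θ x) - Real.sin (θ y)) ^ 2) ≤
            4 * M / d ^ 2 * t * min 1 (‖x - y‖ ^ 2) := fun t ht h => by
          calc _ ≤ M * t * (4 / d ^ 2 * min 1 (‖x - y‖ ^ 2)) := by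
                rw [e1]
                exact mul_le_mul h (e2.trans e3) (by linarith [Real.cos_le_one (θ x - θ y)])
                  (mul_nonneg hM.le ht)
            _ = _ := by ring
        by_cases hx : ‖x - z‖ < L
        · by_cases hy : ‖y - z‖ < L
          · rw [hin x hx, hin y hy]
            simp only [sub_self, ne_eq, OfNat.ofNat_ne_zero, not_false_eq_true, zero_pow, add_zero,
              mul_zero]
            have := add_nonneg (hg0 x) (hg0 y)
            positivity
          · refine hbig _ (add_nonneg (hg0 x) (hg0 y)) ?_
            have : g y = u y := by
              rw [hg, Set.indicator_of_mem (show y ∈ {x | L ≤ ‖x - z‖} from not_lt.1 hy)]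
            rw [this]
            nlinarith [mul_le_mul_of_nonneg_right (huM x) huy, mul_nonneg hM.le (hg0 x)]
        · refine hbig _ (add_nonneg (hg0 x) (hg0 y)) ?_
          have : g x = u x := by
            rw [hg, Set.indicator_of_mem (show x ∈ {x | L ≤ ‖x - z‖} from not_lt.1 hx)]
          rw [this]
          nlinarith [mul_le_mul_of_nonneg_left (huM y) hux, mul_nonneg hM.le (hg0 y)]
      have := mul_le_mul_of_nonneg_right e4 hk
      linarith
    have hmk : Measurable fun p : Eu N × Eu N => min 1 (‖p.1 - p.2‖ ^ 2) * kk N s p.1 p.2 :=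
      (measurable_const.min ((measurable_fst.sub measurable_snd).norm.pow_const 2)).mul
        measurable_kk
    have hmk0 : ∀ x y : Eu N, 0 ≤ min 1 (‖x - y‖ ^ 2) * kk N s x y := fun x y =>
      mul_nonneg (by positivity) (kk_nonneg x y)
    have hmeas : Measurable fun p : Eu N × Eu N =>
        g p.1 * (min 1 (‖p.1 - p.2‖ ^ 2) * kk N s p.1 p.2) := (hgm.comp measurable_fst).mul hmk
    have hw := dint_weight (s := s) hgm hg0
    have hsw : dint (fun x y => g y * (min 1 (‖x - y‖ ^ 2) * kk N s x y)) =
        dint fun x y => g x * (min 1 (‖x - y‖ ^ 2) * kk N s x y) := by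
      rw [← dint_swap (F := fun x y => g x * (min 1 (‖x - y‖ ^ 2) * kk N s x y)) hmeas]
      refine dint_congr fun x y => ?_
      rw [norm_sub_rev, kk_comm]
    refine (dint_mono hpt).trans ?_
    rw [dint_const_mul (by positivity), dint_add hmeas
      (fun x y => mul_nonneg (hg0 x) (hmk0 x y)) (fun x y => mul_nonneg (hg0 y) (hmk0 x y)),
      hsw, hw, ← two_mul, ← mul_assoc]
    rw [show 8 * M / d ^ 2 = 4 * M / d ^ 2 * 2 by ring, ENNReal.ofReal_mul (by positivity)]
    simp


lemma one_sub_rpow_le_one_sub {x γ : ℝ} (hx0 : 0 ≤ x) (hx1 : x ≤ 1) (hγ : 0 < γ) :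
    (1 - x) ^ γ ≤ 1 - min 1 γ * x := by
  have h0 : 0 < min 1 γ := lt_min one_pos hγ
  have h1 := Real.rpow_le_rpow_of_exponent_ge' (sub_nonneg.2 hx1) (by linarith) h0.le
    (min_le_right 1 γ)
  have h2 := rpow_one_add_le_one_add_mul_self (s := -x) (by linarith) h0.le (min_le_left 1 γ)
  rw [← sub_eq_add_neg] at h2
  linarith

/-- Volume of the part of the positivity set at distance at least `t` from `z`. -/
def tailVol {N : ℕ} (u : Eu N → ℝ) (z : Eu N) (t : ℝ) : ℝ :=
  (volume ({x | 0 < u x} ∩ {x | t ≤ ‖x - z‖})).toReal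

/-- Mass of `u` at distance at least `t` from `z`. -/
def tailInt {N : ℕ} (u : Eu N → ℝ) (z : Eu N) (t : ℝ) : ℝ :=
  ∫ x, Set.indicator {x | t ≤ ‖x - z‖} u x

lemma measurableSet_tail (z : Eu N) (t : ℝ) : MeasurableSet {x : Eu N | t ≤ ‖x - z‖} :=
  measurableSet_le measurable_const (measurable_id.sub_const z).norm

lemma tailVol_nonneg (u : Eu N → ℝ) (z : Eu N) (t : ℝ) : 0 ≤ tailVol u z t :=
  ENNReal.toReal_nonneg

lemma volume_tail_ne_top (hv : volume {x | 0 < u x} ≤ 1) (z : Eu N) (t : ℝ) :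
    volume ({x | 0 < u x} ∩ {x | t ≤ ‖x - z‖}) ≠ ⊤ :=
  ((measure_mono Set.inter_subset_left).trans_lt (hv.trans_lt ENNReal.one_lt_top)).ne

lemma ofReal_tailVol (hv : volume {x | 0 < u x} ≤ 1) (z : Eu N) (t : ℝ) :
    ENNReal.ofReal (tailVol u z t) = volume ({x | 0 < u x} ∩ {x | t ≤ ‖x - z‖}) :=
  ENNReal.ofReal_toReal (volume_tail_ne_top hv z t)

lemma tailVol_le_one (hv : volume {x | 0 < u x} ≤ 1) (z : Eu N) (t : ℝ) : tailVol u z t ≤ 1 := by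
  refine ENNReal.toReal_le_of_le_ofReal zero_le_one ?_
  rw [ENNReal.ofReal_one]
  exact (measure_mono Set.inter_subset_left).trans hv

lemma tailVol_antitone (hv : volume {x | 0 < u x} ≤ 1) (z : Eu N) : Antitone (tailVol u z) := by
  intro a b hab
  refine ENNReal.toReal_mono (volume_tail_ne_top hv z a) (measure_mono ?_)
  exact Set.inter_subset_inter_right _ fun x (hx : b ≤ ‖x - z‖) => hab.trans hx

lemma Adm.tail (hu : Adm u) (z : Eu N) (t : ℝ) : Adm (Set.indicator {x | t ≤ ‖x - z‖} u) := by
  refine hu.of_le (hu.meas.indicator (measurableSet_tail z t))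
    (fun x => Set.indicator_nonneg (fun x _ => hu.nonneg x) x) fun x => ?_
  exact Set.indicator_le_self' (fun x _ => hu.nonneg x) x

lemma Adm.lintegral_tail (hu : Adm u) (z : Eu N) (t : ℝ) :
    ∫⁻ x, ENNReal.ofReal (Set.indicator {x | t ≤ ‖x - z‖} u x) = ENNReal.ofReal (tailInt u z t) :=
  (ofReal_integral_eq_lintegral_ofReal (hu.tail z t).integrable
    (ae_of_all _ (hu.tail z t).nonneg)).symm

lemma Adm.tailInt_nonneg (hu : Adm u) (z : Eu N) (t : ℝ) : 0 ≤ tailInt u z t :=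
  integral_nonneg (hu.tail z t).nonneg

lemma Adm.tailInt_le (hu : Adm u) (hv : volume {x | 0 < u x} ≤ 1) {M : ℝ} (hM : 0 ≤ M)
    (huM : ∀ x, u x ≤ M) (z : Eu N) (t : ℝ) : tailInt u z t ≤ M * tailVol u z t := by
  refine (ENNReal.ofReal_le_ofReal_iff (mul_nonneg hM (tailVol_nonneg u z t))).1 ?_
  rw [← hu.lintegral_tail, ENNReal.ofReal_mul hM, ofReal_tailVol hv]
  have hS : MeasurableSet ({x | 0 < u x} ∩ {x | t ≤ ‖x - z‖}) :=
    (measurableSet_lt measurable_const hu.meas).inter (measurableSet_tail z t)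
  rw [← setLIntegral_const, ← lintegral_indicator hS]
  refine lintegral_mono fun x => ?_
  by_cases hx : t ≤ ‖x - z‖
  · rw [Set.indicator_of_mem (show x ∈ {x | t ≤ ‖x - z‖} from hx)]
    by_cases hu0 : 0 < u x
    · rw [Set.indicator_of_mem (show x ∈ {x | 0 < u x} ∩ {x | t ≤ ‖x - z‖} from ⟨hu0, hx⟩)]
      exact ENNReal.ofReal_le_ofReal (huM x)
    · rw [ENNReal.ofReal_of_nonpos (not_lt.1 hu0)]; exact zero_le
  · rw [Set.indicator_of_notMem (show x ∉ {x | t ≤ ‖x - z‖} from hx), ENNReal.ofReal_zero]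
    exact zero_le

/-- A truncation of `u` to the ball of radius `L + d` which does not lose energy. -/
def GoodCut {N : ℕ} (s q c' : ℝ) (u : Eu N → ℝ) (z : Eu N) (L : ℝ) : Prop :=
  ∃ v, Adm v ∧ (∀ x, v x ≤ u x) ∧ {x | 0 < v x} = {x | 0 < u x} ∩ {x | ‖x - z‖ < L} ∧
    gagliardoSq N s v ≠ ⊤ ∧ 3 / 4 ≤ ∫ x, v x ^ q ∧
    gagliardoSqR N s v * (1 - tailVol u z L) ^ (2 / q - 1 + 2 * s / N) + c' * tailVol u z L ≤
      gagliardoSqR N s u * (∫ x, v x ^ q) ^ (2 / q)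

set_option maxHeartbeats 1000000 in
lemma cut_dichotomy (hN : 2 ≤ N) (hs0 : 0 < s) (hs1 : s < 1) (hq1 : 1 ≤ q)
    (hq2 : q < 2 * N / ((N : ℝ) - 2 * s)) {M : ℝ} (hM : 0 < M) :
    ∃ c', 0 < c' ∧ ∃ C, 0 < C ∧ ∀ (u : Eu N → ℝ) (z : Eu N) (L d : ℝ), Adm u →
      volume {x | 0 < u x} ≤ 1 → (∫ x, u x ^ q) = 1 → gagliardoSq N s u ≠ ⊤ →
      gagliardoSqR N s u ≤ 2 * lamR N s q → (∀ x, u x ≤ M) → 0 < d → d ≤ 1 →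
      M ^ q * tailVol u z L ≤ 1 / 4 →
      GoodCut s q c' u z (L + d) ∨ (tailVol u z (L + d) < C / d ^ 2 * tailInt u z L ∧
        tailInt u z (L + d) ^ 2 ≤ C / d ^ 2 * tailInt u z L * tailVol u z L ^ (1 + 2 * s / N)) := by
  have hq0 : 0 < q := by linarith
  have hγ := exponent_pos hN hs1 hq1 hq2
  obtain ⟨c, hc, hl2⟩ := gagliardoSq_l2 hN hs0
  obtain ⟨Λ, hΛ⟩ : ∃ Λ, Λ = lamR N s q := ⟨_, rfl⟩
  have hΛ0 : 0 < Λ := hΛ ▸ lamR_pos hN hs0 hs1 hq1 hq2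
  obtain ⟨γ, hγe⟩ : ∃ γ, γ = 2 / q - 1 + 2 * s / N := ⟨_, rfl⟩
  rw [← hγe] at hγ
  obtain ⟨α, hα⟩ : ∃ α, α = 2 / q := ⟨_, rfl⟩
  have hα0 : 0 < α := by rw [hα]; positivity
  have hα2 : α ≤ 2 := by rw [hα, div_le_iff₀ hq0]; linarith
  obtain ⟨K, hK⟩ : ∃ K, K = (kerInt N s).toReal := ⟨_, rfl⟩
  have hK0 : 0 ≤ K := by rw [hK]; exact ENNReal.toReal_nonneg
  have hKe : kerInt N s = ENNReal.ofReal K := by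
    rw [hK, ENNReal.ofReal_toReal (kerInt_lt_top hN hs0 hs1).ne]
  obtain ⟨c₂, hc₂⟩ : ∃ c₂, c₂ = min 1 γ := ⟨_, rfl⟩
  have hc₂0 : 0 < c₂ := by rw [hc₂]; exact lt_min one_pos hγ
  obtain ⟨c', hc'⟩ : ∃ c', c' = c₂ * Λ / 4 := ⟨_, rfl⟩
  have hc'0 : 0 < c' := by rw [hc']; positivity
  obtain ⟨C₂, hC₂⟩ : ∃ C₂, C₂ = 8 * M * K + 4 * Λ * M ^ (q - 1) := ⟨_, rfl⟩
  have hMq : 0 < M ^ (q - 1) := Real.rpow_pos_of_pos hM _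
  have hC₂0 : 0 < C₂ := by rw [hC₂]; positivity
  refine ⟨c', hc'0, C₂ / c' + C₂ / c, by positivity,
    fun u z L d hu hv hu1 hE hE2 huM hd hd1 hsm => ?_⟩
  rw [← hΛ] at hE2
  obtain ⟨v, w, hvA, hwA, hvu, hwu, hvpos, hvin, hwin, hwout, hsum⟩ :=
    exists_cut (s := s) hu hM huM z (L := L) hd hd1
  rw [hu.lintegral_tail, hKe] at hsum
  obtain ⟨l, hl⟩ : ∃ l, l = tailInt u z L := ⟨_, rfl⟩
  have hl0 : 0 ≤ l := hl ▸ hu.tailInt_nonneg z L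
  obtain ⟨V, hV⟩ : ∃ V, V = tailVol u z L := ⟨_, rfl⟩
  have hV0 : 0 ≤ V := hV ▸ tailVol_nonneg u z L
  obtain ⟨V', hV'⟩ : ∃ V', V' = tailVol u z (L + d) := ⟨_, rfl⟩
  have hV'0 : 0 ≤ V' := hV' ▸ tailVol_nonneg u z _
  have hV'1 : V' ≤ 1 := hV' ▸ tailVol_le_one hv z _
  have hlV : l ≤ M * V := by rw [hl, hV]; exact hu.tailInt_le hv hM.le huM z L
  rw [← hl, ← ENNReal.ofReal_mul hK0, ← ENNReal.ofReal_mul (by positivity)] at hsum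
  rw [← hV] at hsm
  have hR : gagliardoSq N s u + ENNReal.ofReal (8 * M / d ^ 2 * (K * l)) ≠ ⊤ :=
    ENNReal.add_ne_top.2 ⟨hE, ENNReal.ofReal_ne_top⟩
  have hEv : gagliardoSq N s v ≠ ⊤ := fun h => hR (top_le_iff.1 (by
    refine le_trans ?_ hsum; rw [h, top_add]))
  have hEw : gagliardoSq N s w ≠ ⊤ := fun h => hR (top_le_iff.1 (by
    refine le_trans ?_ hsum; rw [h, add_top]))
  obtain ⟨e, he⟩ : ∃ e, e = gagliardoSqR N s u := ⟨_, rfl⟩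
  obtain ⟨e₁, he₁⟩ : ∃ e, e = gagliardoSqR N s v := ⟨_, rfl⟩
  obtain ⟨e₂, he₂⟩ : ∃ e, e = gagliardoSqR N s w := ⟨_, rfl⟩
  have he₁0 : 0 ≤ e₁ := by rw [he₁]; exact ENNReal.toReal_nonneg
  have he₂0 : 0 ≤ e₂ := by rw [he₂]; exact ENNReal.toReal_nonneg
  have he0 : 0 ≤ e := by rw [he]; exact ENNReal.toReal_nonneg
  have hsumR : e₁ + e₂ ≤ e + 8 * M / d ^ 2 * (K * l) := by
    have h := ENNReal.toReal_mono hR hsum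
    rw [ENNReal.toReal_add hEv hEw, ENNReal.toReal_add hE ENNReal.ofReal_ne_top,
      ENNReal.toReal_ofReal (by positivity)] at h
    rw [he, he₁, he₂]; exact h
  obtain ⟨J, hJ⟩ : ∃ J, J = ∫ x, v x ^ q := ⟨_, rfl⟩
  have hJ0 : 0 ≤ J := hJ ▸ hvA.integral_rpow_nonneg
  have hJ1 : J ≤ 1 := by
    rw [hJ, ← hu1]
    exact integral_mono (hvA.integrable_rpow hq0) (hu.integrable_rpow hq0) fun x =>
      Real.rpow_le_rpow (hvA.nonneg x) (hvu x) hq0.le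
  have hJl : 1 - J ≤ M ^ (q - 1) * l := by
    have h1 : ∫ x, (u x ^ q - v x ^ q) ≤ ∫ x, M ^ (q - 1) *
        Set.indicator {x | L ≤ ‖x - z‖} u x := by
      refine integral_mono ((hu.integrable_rpow hq0).sub (hvA.integrable_rpow hq0))
        ((hu.tail z L).integrable.const_mul _) fun x => ?_
      beta_reduce
      by_cases hx : ‖x - z‖ < L
      · rw [hvin x hx, sub_self]
        exact mul_nonneg hMq.le ((hu.tail z L).nonneg x)
      · rw [Set.indicator_of_mem (show x ∈ {x | L ≤ ‖x - z‖} from not_lt.1 hx)]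
        have h2 : u x ^ q ≤ M ^ (q - 1) * u x := by
          have h3 := Real.rpow_le_rpow (hu.nonneg x) (huM x) (by linarith : 0 ≤ q - 1)
          have h4 : u x ^ q = u x ^ (q - 1) * u x := by
            nth_rewrite 3 [← Real.rpow_one (u x)]
            rw [← Real.rpow_add' (hu.nonneg x) (by linarith), sub_add_cancel]
          rw [h4]
          exact mul_le_mul_of_nonneg_right h3 (hu.nonneg x)
        linarith [Real.rpow_nonneg (hvA.nonneg x) q]
    rw [integral_sub (hu.integrable_rpow hq0) (hvA.integrable_rpow hq0), integral_const_mul, hu1,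
      ← hJ] at h1
    rw [hl]; exact h1
  have hMM : M ^ (q - 1) * M = M ^ q := by
    nth_rewrite 2 [← Real.rpow_one M]
    rw [← Real.rpow_add hM, sub_add_cancel]
  have hJ34 : 3 / 4 ≤ J := by
    have := mul_le_mul_of_nonneg_left hlV hMq.le
    rw [← mul_assoc, hMM] at this
    linarith
  by_cases hgood : GoodCut s q c' u z (L + d)
  · exact Or.inl hgood
  right
  have hbad : e * J ^ α < e₁ * (1 - V') ^ γ + c' * V' := by
    by_contra hcon
    refine hgood ⟨v, hvA, hvu, hvpos, hEv, hJ ▸ hJ34, ?_⟩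
    rw [← hV', ← hγe, ← hα, ← hJ, ← he, ← he₁]
    exact not_lt.1 hcon
  have hJα := one_sub_rpow_le hJ0 hJ1 hα0 hα2
  have hV'γ := one_sub_rpow_le_one_sub hV'0 hV'1 hγ
  rw [← hc₂] at hV'γ
  have he₁Λ : Λ / 2 ≤ e₁ := by
    have hvol : volume {x | 0 < v x} ≤ ENNReal.ofReal 1 := by
      rw [hvpos, ENNReal.ofReal_one]
      exact (measure_mono Set.inter_subset_left).trans hv
    have h := lamR_le_of_nonneg (s := s) (q := q) hN hs0 hs1 hq1 hvA hEv zero_le_one hvol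
    rw [Real.one_rpow, one_mul, ← hΛ, ← hJ, ← hα, ← he₁] at h
    nlinarith
  have hmain : e₂ + c' * V' < C₂ / d ^ 2 * l := by
    have h1 := mul_le_mul_of_nonneg_left hV'γ he₁0
    have h2 : e * (1 - 2 * (1 - J)) ≤ e * J ^ α :=
      mul_le_mul_of_nonneg_left (by linarith) he0
    have h3 : e * (1 - J) ≤ 2 * Λ * (M ^ (q - 1) * l) :=
      mul_le_mul (he ▸ hE2) hJl (by linarith) (by linarith)
    have h4 : c' * V' * 2 ≤ c₂ * V' * e₁ := by
      have := mul_le_mul_of_nonneg_left he₁Λ (mul_nonneg hc₂0.le hV'0)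
      rw [hc']; linarith
    have h5 : 4 * Λ * M ^ (q - 1) * l ≤ 4 * Λ * M ^ (q - 1) / d ^ 2 * l := by
      refine mul_le_mul_of_nonneg_right ?_ hl0
      rw [le_div_iff₀ (by positivity)]
      have : d ^ 2 ≤ 1 := by nlinarith
      nlinarith [mul_pos (mul_pos (by norm_num : (0 : ℝ) < 4) hΛ0) hMq]
    have h6 : C₂ / d ^ 2 * l = 8 * M / d ^ 2 * (K * l) + 4 * Λ * M ^ (q - 1) / d ^ 2 * l := by
      rw [hC₂]; ring
    rw [h6]
    nlinarith
  have hdl : 0 ≤ l / d ^ 2 := by positivity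
  have hcV' := mul_nonneg hc'0.le hV'0
  refine ⟨?_, ?_⟩
  · rw [← hV', ← hl]
    have h1 : V' < C₂ / c' * (l / d ^ 2) := by
      rw [div_mul_eq_mul_div, lt_div_iff₀ hc'0]
      have e1 : C₂ / d ^ 2 * l = C₂ * (l / d ^ 2) := by ring
      linarith
    have h2 : 0 ≤ C₂ / c * (l / d ^ 2) := by positivity
    have e2 : (C₂ / c' + C₂ / c) / d ^ 2 * l = C₂ / c' * (l / d ^ 2) + C₂ / c * (l / d ^ 2) := by
      ring
    rw [e2]; linarith
  · rw [← hV, ← hl]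
    obtain ⟨l', hl'⟩ : ∃ l', l' = tailInt u z (L + d) := ⟨_, rfl⟩
    have hl'0 : 0 ≤ l' := hl' ▸ hu.tailInt_nonneg z _
    rw [← hl']
    have hrhs : 0 ≤ (C₂ / c' + C₂ / c) / d ^ 2 * l * V ^ (1 + 2 * s / N) := by positivity
    rcases hV0.eq_or_lt with h0 | hVp
    · have hle : V' ≤ V := by rw [hV, hV']; exact tailVol_antitone hv z (by linarith)
      have h1 : l' ≤ M * V' := by rw [hl', hV']; exact hu.tailInt_le hv hM.le huM z _
      have h2 : l' = 0 := le_antisymm (h1.trans (by nlinarith)) hl'0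
      rw [h2]; simpa using hrhs
    obtain ⟨S, hS⟩ : ∃ S, S = {x | 0 < u x} ∩ {x | L ≤ ‖x - z‖} := ⟨_, rfl⟩
    have hSm : MeasurableSet S := by
      rw [hS]
      exact (measurableSet_lt measurable_const hu.meas).inter (measurableSet_tail z L)
    have hSV : volume S = ENNReal.ofReal V := by rw [hS, hV, ofReal_tailVol hv]
    have hwS : ∀ x, x ∉ S → w x = 0 := fun x hx => by
      by_cases hxL : ‖x - z‖ < L
      · exact hwin x hxL
      · have : ¬ 0 < u x := fun h => hx (by rw [hS]; exact ⟨h, not_lt.1 hxL⟩)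
        exact le_antisymm ((hwu x).trans (not_lt.1 this)) (hwA.nonneg x)
    have hb := hl2 w hwA.meas V hVp (by
      rw [← hSV]
      exact measure_mono fun x hx => by_contra fun h => hx (hwS x h))
    have hcs := sq_lintegral_le (volume.restrict S) (F := fun x => ENNReal.ofReal (w x))
      hwA.meas.ennreal_ofReal.aemeasurable
    rw [Measure.restrict_apply_univ, hSV] at hcs
    have h1 : ENNReal.ofReal l' ≤ ∫⁻ x in S, ENNReal.ofReal (w x) := by
      rw [hl', ← hu.lintegral_tail, ← lintegral_indicator hSm]
      refine lintegral_mono fun x => ?_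
      by_cases hx : L + d ≤ ‖x - z‖
      · rw [Set.indicator_of_mem (show x ∈ {x | L + d ≤ ‖x - z‖} from hx), ← hwout x hx]
        by_cases hxS : x ∈ S
        · rw [Set.indicator_of_mem hxS]
        · rw [hwS x hxS, ENNReal.ofReal_zero]; exact zero_le
      · rw [Set.indicator_of_notMem (show x ∉ {x | L + d ≤ ‖x - z‖} from hx), ENNReal.ofReal_zero]
        exact zero_le
    have h2 : ∫⁻ x in S, ENNReal.ofReal (w x) ^ 2 ≤ ∫⁻ x, ENNReal.ofReal (w x ^ 2) := by
      refine (setLIntegral_le_lintegral _ _).trans (lintegral_mono fun x => ?_)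
      rw [ENNReal.ofReal_pow (hwA.nonneg x)]
    have hcV : 0 < c * V ^ (-(2 * s / N)) := by positivity
    have h3 : ∫⁻ x, ENNReal.ofReal (w x ^ 2) ≤ ENNReal.ofReal (e₂ / (c * V ^ (-(2 * s / N)))) := by
      rw [ENNReal.ofReal_div_of_pos hcV, ENNReal.le_div_iff_mul_le (by simp [hcV])
        (by simp), mul_comm]
      refine hb.trans (le_of_eq ?_)
      rw [he₂, gagliardoSqR, ENNReal.ofReal_toReal hEw]
    have h4 : ENNReal.ofReal (l' ^ 2) ≤ ENNReal.ofReal (V * (e₂ / (c * V ^ (-(2 * s / N))))) := by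
      rw [ENNReal.ofReal_pow hl'0, ENNReal.ofReal_mul hV0]
      calc ENNReal.ofReal l' ^ 2 ≤ (∫⁻ x in S, ENNReal.ofReal (w x)) ^ 2 := by gcongr
        _ ≤ _ := hcs
        _ ≤ _ := by gcongr; exact h2.trans h3
    have h5 := (ENNReal.ofReal_le_ofReal_iff (by positivity)).1 h4
    have h6 : V * (e₂ / (c * V ^ (-(2 * s / N)))) = e₂ / c * V ^ (1 + 2 * s / N) := by
      rw [Real.rpow_add hVp, Real.rpow_one, Real.rpow_neg hVp.le]
      have : V ^ (2 * s / N) ≠ 0 := (Real.rpow_pos_of_pos hVp _).ne'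
      field_simp
    rw [h6] at h5
    refine h5.trans (mul_le_mul_of_nonneg_right ?_ (Real.rpow_nonneg hV0 _))
    have h7 : e₂ / c ≤ C₂ / c * (l / d ^ 2) := by
      rw [div_mul_eq_mul_div]
      refine div_le_div_of_nonneg_right ?_ hc.le
      have e1 : C₂ / d ^ 2 * l = C₂ * (l / d ^ 2) := by ring
      linarith
    have h8 : 0 ≤ C₂ / c' * (l / d ^ 2) := by positivity
    have e2 : (C₂ / c' + C₂ / c) / d ^ 2 * l = C₂ / c' * (l / d ^ 2) + C₂ / c * (l / d ^ 2) := by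
      ring
    rw [e2]; linarith


lemma exists_goodCut (hN : 2 ≤ N) (hs0 : 0 < s) (hs1 : s < 1) (hq1 : 1 ≤ q)
    (hq2 : q < 2 * N / ((N : ℝ) - 2 * s)) {M : ℝ} (hM : 0 < M) :
    ∃ c', 0 < c' ∧ ∃ ε, 0 < ε ∧ ε < 1 ∧ ∀ (u : Eu N → ℝ) (z : Eu N) (R : ℝ), Adm u →
      volume {x | 0 < u x} ≤ 1 → (∫ x, u x ^ q) = 1 → gagliardoSq N s u ≠ ⊤ →
      gagliardoSqR N s u ≤ 2 * lamR N s q → (∀ x, u x ≤ M) → tailVol u z R ≤ ε →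
      ∃ L, R ≤ L ∧ L ≤ R + 2 ∧ GoodCut s q c' u z L := by
  obtain ⟨c', hc', C, hC, hdich⟩ := cut_dichotomy hN hs0 hs1 hq1 hq2 hM
  have hN0 : (0 : ℝ) < N := by exact_mod_cast (by omega : 0 < N)
  obtain ⟨κ, hκ⟩ : ∃ κ, κ = s / N := ⟨_, rfl⟩
  have hκ0 : 0 < κ := by rw [hκ]; positivity
  have hMq : 0 < M ^ q := Real.rpow_pos_of_pos hM q
  obtain ⟨B, hB⟩ : ∃ B, B = 8 * (C * Real.sqrt (C * M)) := ⟨_, rfl⟩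
  have hB0 : 0 < B := by
    rw [hB]; have := Real.sqrt_pos.2 (mul_pos hC hM); positivity
  obtain ⟨b, hb⟩ : ∃ b : ℝ, b = 2 ^ (-((3 : ℝ) / κ)) / (B * 2 ^ (3 : ℝ)) := ⟨_, rfl⟩
  have hb0 : 0 < b := by rw [hb]; positivity
  refine ⟨c', hc', min (min (1 / 2) (1 / 4 / M ^ q)) (b ^ (1 / κ)), by positivity, ?_,
    fun u z R hu hv hu1 hE hE2 huM hε => ?_⟩
  · exact ((min_le_left _ _).trans (min_le_left _ _)).trans_lt (by norm_num)
  by_contra! hcon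
  obtain ⟨Y, hY⟩ : ∃ Y : ℝ → ℝ, ∀ t, Y t = tailVol u z (R + t) := ⟨_, fun _ => rfl⟩
  have hY0 : ∀ t, 0 ≤ Y t := fun t => by rw [hY]; exact tailVol_nonneg u z _
  have hYa : Antitone Y := fun a b' hab => by
    rw [hY, hY]; exact tailVol_antitone hv z (by linarith)
  have hYε : Y 0 ≤ min (min (1 / 2) (1 / 4 / M ^ q)) (b ^ (1 / κ)) := by
    rw [hY, add_zero]; exact hε
  have hsm : ∀ t, 0 ≤ t → M ^ q * tailVol u z (R + t) ≤ 1 / 4 := fun t ht => by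
    have h1 : Y t ≤ 1 / 4 / M ^ q :=
      (hYa ht).trans (hYε.trans ((min_le_left _ _).trans (min_le_right _ _)))
    rw [le_div_iff₀ hMq, hY] at h1
    linarith
  have hstep : ∀ t d, 0 ≤ t → 0 < d → d ≤ 1 → t + d ≤ 2 →
      Y (t + d) < C / d ^ 2 * tailInt u z (R + t) ∧
      tailInt u z (R + (t + d)) ^ 2 ≤ C / d ^ 2 * tailInt u z (R + t) * Y t ^ (1 + 2 * s / N) := by
    intro t d ht hd hd1 htd
    rcases hdich u z (R + t) d hu hv hu1 hE hE2 huM hd hd1 (hsm t ht) with h | h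
    · exact absurd h (hcon _ (by linarith) (by linarith))
    · rw [hY, hY, ← add_assoc]; exact h
  have h1 : Y 1 = 0 := by
    refine eq_zero_of_stampacchia (L := B) (m := 3) (κ := κ) hY0 hYa hB0.le (by norm_num) hκ0
      (fun t t' ht htt ht1 => ?_) ?_
    · obtain ⟨h, hh⟩ : ∃ h, h = (t' - t) / 2 := ⟨_, rfl⟩
      have hh0 : 0 < h := by rw [hh]; linarith
      have ha := (hstep t h ht hh0 (by linarith) (by linarith)).2
      have hb' := (hstep (t + h) h (by linarith) hh0 (by linarith) (by linarith)).1
      rw [show t + h + h = t' by rw [hh]; ring] at hb'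
      have hl : tailInt u z (R + t) ≤ M * Y t := by
        rw [hY]; exact hu.tailInt_le hv hM.le huM z _
      obtain ⟨l, hle⟩ : ∃ l, l = tailInt u z (R + (t + h)) := ⟨_, rfl⟩
      have hl0 : 0 ≤ l := hle ▸ hu.tailInt_nonneg z _
      rw [← hle] at ha hb'
      have hYp : Y t * Y t ^ (1 + 2 * s / N) = (Y t ^ (1 + κ)) ^ 2 := by
        rw [← Real.rpow_natCast (Y t ^ (1 + κ)) 2, ← Real.rpow_mul (hY0 t)]
        nth_rewrite 1 [← Real.rpow_one (Y t)]
        rw [← Real.rpow_add' (hY0 t) (by positivity)]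
        congr 1; rw [hκ]; push_cast; ring
      have hsq : l ^ 2 ≤ (Real.sqrt (C * M) / h * Y t ^ (1 + κ)) ^ 2 := by
        calc l ^ 2 ≤ C / h ^ 2 * (M * Y t) * Y t ^ (1 + 2 * s / N) := by
              refine ha.trans (mul_le_mul_of_nonneg_right ?_ (Real.rpow_nonneg (hY0 t) _))
              exact mul_le_mul_of_nonneg_left hl (by positivity)
          _ = C * M / h ^ 2 * (Y t * Y t ^ (1 + 2 * s / N)) := by ring
          _ = _ := by
              rw [hYp, mul_pow, div_pow, Real.sq_sqrt (mul_nonneg hC.le hM.le)]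
      have hl2 : l ≤ Real.sqrt (C * M) / h * Y t ^ (1 + κ) :=
        le_of_sq_le_sq hsq (mul_nonneg (by positivity) (Real.rpow_nonneg (hY0 t) _))
      refine hb'.le.trans ((mul_le_mul_of_nonneg_left hl2 (by positivity)).trans (le_of_eq ?_))
      have e : (t' - t) ^ (-(3 : ℝ)) = 1 / (8 * h ^ 3) := by
        rw [Real.rpow_neg (by linarith), show t' - t = 2 * h by rw [hh]; ring,
          show (3 : ℝ) = ((3 : ℕ) : ℝ) by norm_num, Real.rpow_natCast, mul_pow, one_div]
        norm_num
      rw [e, hB]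
      field_simp
    · have h2 : Y 0 ^ κ ≤ b := by
        calc Y 0 ^ κ ≤ (b ^ (1 / κ)) ^ κ :=
              Real.rpow_le_rpow (hY0 0) (hYε.trans (min_le_right _ _)) hκ0.le
          _ = b := by rw [← Real.rpow_mul hb0.le, one_div_mul_cancel hκ0.ne', Real.rpow_one]
      calc B * 2 ^ (3 : ℝ) * Y 0 ^ κ ≤ B * 2 ^ (3 : ℝ) * b :=
            mul_le_mul_of_nonneg_left h2 (by positivity)
        _ = _ := by rw [hb]; field_simp
  have h2 := (hstep 1 1 zero_le_one one_pos le_rfl (by norm_num)).1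
  have h3 : tailInt u z (R + 1) ≤ M * Y 1 := by
    rw [hY]; exact hu.tailInt_le hv hM.le huM z _
  have h4 : tailInt u z (R + 1) = 0 :=
    le_antisymm (h3.trans (by rw [h1, mul_zero])) (hu.tailInt_nonneg z _)
  rw [h4, mul_zero] at h2
  exact absurd h2 (not_lt.2 (hY0 _))

end Cut

section Compact

variable {N : ℕ} {s q : ℝ} {f u : Eu N → ℝ}

set_option maxHeartbeats 1000000 in
lemma exists_compact_competitor (hN : 2 ≤ N) (hs0 : 0 < s) (hs1 : s < 1) (hq1 : 1 ≤ q)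
    (hq2 : q < 2 * N / ((N : ℝ) - 2 * s)) :
    ∃ R, 0 < R ∧ ∃ M, 0 < M ∧ ∃ δ₀, 0 < δ₀ ∧ ∃ C, 0 < C ∧ ∀ (f : Eu N → ℝ) (δ : ℝ), Adm f →
      volume {x | 0 < f x} ≤ 1 → (∫ x, f x ^ q) = 1 → gagliardoSq N s f ≠ ⊤ → δ ≤ δ₀ →
      gagliardoSqR N s f ≤ lamR N s q + δ →
      ∃ (v : Eu N → ℝ) (z : Eu N) (m : ℝ), Adm v ∧ (∀ x, v x ≤ M) ∧
        (∀ x, R ≤ ‖x - z‖ → v x = 0) ∧ (∫ x, v x ^ q) = 1 ∧ gagliardoSq N s v ≠ ⊤ ∧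
        volume {x | 0 < v x} = ENNReal.ofReal m ∧ 1 / 2 ≤ m ∧ m ≤ 1 ∧ 1 - m ≤ C * δ ∧
        {x | 0 < v x} ⊆ {x | 0 < f x} ∧
        m ^ (2 / q - 1 + 2 * s / N) * gagliardoSqR N s v ≤ lamR N s q + δ := by
  have hq0 : 0 < q := by linarith
  obtain ⟨γ, hγe⟩ : ∃ γ, γ = 2 / q - 1 + 2 * s / N := ⟨_, rfl⟩
  have hγ : 0 < γ := hγe ▸ exponent_pos hN hs1 hq1 hq2
  obtain ⟨Λ, hΛ⟩ : ∃ Λ, Λ = lamR N s q := ⟨_, rfl⟩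
  have hΛ0 : 0 < Λ := hΛ ▸ lamR_pos hN hs0 hs1 hq1 hq2
  obtain ⟨M₀, hM₀, hbdd⟩ := exists_bounded_competitor hN hs0 hs1 hq1 hq2
  obtain ⟨c', hc', ε, hε, hε1, hcut⟩ := exists_goodCut hN hs0 hs1 hq1 hq2 hM₀
  obtain ⟨R, hR, δ₁, hδ₁, hconc⟩ := exists_concentration hN hs0 hs1 hq1 hq2 hε hε1
  obtain ⟨c₂, hc₂⟩ : ∃ c₂, c₂ = min 1 γ := ⟨_, rfl⟩
  have hc₂0 : 0 < c₂ := by rw [hc₂]; exact lt_min one_pos hγ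
  obtain ⟨C, hC⟩ : ∃ C, C = 1 / c' + 1 / (c₂ * Λ) := ⟨_, rfl⟩
  have hC0 : 0 < C := by rw [hC]; positivity
  refine ⟨R + 2, by linarith, 2 * M₀, by linarith, min (min δ₁ Λ) (1 / (2 * C)), by positivity,
    C, hC0, fun f δ hf hv hf1 hE hδ hEle => ?_⟩
  rw [← hΛ] at hEle
  have hδ1 : δ ≤ δ₁ := hδ.trans ((min_le_left _ _).trans (min_le_left _ _))
  have hδ2 : δ ≤ Λ := hδ.trans ((min_le_left _ _).trans (min_le_right _ _))
  have hδ3 : C * δ ≤ 1 / 2 := by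
    have := hδ.trans (min_le_right _ _)
    rw [le_div_iff₀ (by linarith)] at this
    linarith
  obtain ⟨u, hu, huM, hpos, hu1, huE, hufE⟩ := hbdd f hf hv hf1 hE (by rw [← hΛ]; linarith)
  have hset : {x | 0 < u x} = {x | 0 < f x} := Set.ext hpos
  have huv : volume {x | 0 < u x} ≤ 1 := hset ▸ hv
  obtain ⟨e, he⟩ : ∃ e, e = gagliardoSqR N s u := ⟨_, rfl⟩
  have heδ : e ≤ Λ + δ := he ▸ hufE.trans hEle
  obtain ⟨z, hz⟩ := hconc u hu huv hu1 huE (by rw [← hΛ, ← he]; linarith)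
  obtain ⟨A, hA⟩ : ∃ A, A = {x | 0 < u x} := ⟨_, rfl⟩
  obtain ⟨a, ha⟩ : ∃ a, a = (volume A).toReal := ⟨_, rfl⟩
  have haA : volume A = ENNReal.ofReal a := by
    rw [ha, ENNReal.ofReal_toReal (by rw [hA]; exact (huv.trans_lt ENNReal.one_lt_top).ne)]
  have ha0 : 0 ≤ a := ha ▸ ENNReal.toReal_nonneg
  have ha1 : a ≤ 1 := by
    rw [hA.symm, haA, ← ENNReal.ofReal_one] at huv
    exact (ENNReal.ofReal_le_ofReal_iff zero_le_one).1 huv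
  have hsplit : ∀ t, ∃ b, 0 ≤ b ∧ volume (A ∩ {x | ‖x - z‖ < t}) = ENNReal.ofReal b ∧
      b + tailVol u z t = a := by
    intro t
    have h1 := measure_inter_add_sdiff (μ := volume) A (measurableSet_tail z t)
    have h2 : A \ {x | t ≤ ‖x - z‖} = A ∩ {x | ‖x - z‖ < t} := by
      ext x; simp [not_le]
    rw [h2, hA, ← ofReal_tailVol huv, ← hA, haA] at h1
    refine ⟨(volume (A ∩ {x | ‖x - z‖ < t})).toReal, ENNReal.toReal_nonneg, ?_, ?_⟩
    · rw [ENNReal.ofReal_toReal]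
      exact ((measure_mono Set.inter_subset_left).trans_lt
        (haA.trans_lt ENNReal.ofReal_lt_top)).ne
    · have h3 := congrArg ENNReal.toReal h1
      rw [ENNReal.toReal_add ENNReal.ofReal_ne_top ((measure_mono Set.inter_subset_left).trans_lt
        (haA.trans_lt ENNReal.ofReal_lt_top)).ne, ENNReal.toReal_ofReal ha0,
        ENNReal.toReal_ofReal (tailVol_nonneg u z t)] at h3
      linarith
  have htail : tailVol u z R ≤ ε := by
    obtain ⟨b, hb0, hb, hba⟩ := hsplit R
    have hball : Metric.ball z R = {x | ‖x - z‖ < R} := by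
      ext x; rw [Metric.mem_ball, dist_eq_norm]; rfl
    rw [hball, ← hA, hb] at hz
    have := (ENNReal.ofReal_lt_ofReal_iff_of_nonneg (by linarith)).1 hz
    linarith
  obtain ⟨L, hRL, hLR, v, hvA, hvu, hvpos, hvE, hJ34, hgood⟩ := hcut u z R hu huv hu1 huE
    (by rw [← hΛ, ← he]; linarith) huM htail
  obtain ⟨m, hm0, hm, hma⟩ := hsplit L
  rw [← hγe, ← he] at hgood
  obtain ⟨V', hV'⟩ : ∃ V', V' = tailVol u z L := ⟨_, rfl⟩
  have hV'0 : 0 ≤ V' := hV' ▸ tailVol_nonneg u z L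
  rw [← hV'] at hgood hma
  obtain ⟨J, hJ⟩ : ∃ J, J = ∫ x, v x ^ q := ⟨_, rfl⟩
  rw [← hJ] at hJ34 hgood
  have hJ1 : J ≤ 1 := by
    rw [hJ, ← hu1]
    exact integral_mono (hvA.integrable_rpow hq0) (hu.integrable_rpow hq0) fun x =>
      Real.rpow_le_rpow (hvA.nonneg x) (hvu x) hq0.le
  obtain ⟨c, hc0, hcJ, hcA, hc1, hcE⟩ := hvA.normalize hq0 (by linarith : 0 < J) hJ.symm
  have hc2 : c ≤ 2 := by
    by_contra! hcon
    have h1 : c ≤ c ^ q := by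
      simpa using Real.rpow_le_rpow_of_exponent_le (by linarith : 1 ≤ c) hq1
    have h2 : J⁻¹ ≤ (3 / 4)⁻¹ := inv_anti₀ (by norm_num) hJ34
    rw [hcJ] at h1
    norm_num at h2
    linarith
  have hpos' : {x | 0 < c * v x} = {x | 0 < v x} := by
    ext x; exact mul_pos_iff_of_pos_left hc0
  have hwvol : volume {x | 0 < c * v x} = ENNReal.ofReal m := by
    rw [hpos', hvpos, ← hm, hA]
  have hEc : gagliardoSq N s (fun x => c * v x) ≠ ⊤ := by
    rw [gagliardoSq_const_mul]; exact ENNReal.mul_ne_top ENNReal.ofReal_ne_top hvE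
  obtain ⟨e', he'⟩ : ∃ e', e' = gagliardoSqR N s (fun x => c * v x) := ⟨_, rfl⟩
  have he'0 : 0 ≤ e' := he' ▸ ENNReal.toReal_nonneg
  have hcE' := hcE s
  rw [← he'] at hcE'
  have hJα : 0 < J ^ (2 / q) := Real.rpow_pos_of_pos (by linarith) _
  have hJα1 : J ^ (2 / q) ≤ 1 := Real.rpow_le_one (by linarith) hJ1 (by positivity)
  have hmγ : m ^ γ * e' + c' * V' ≤ e := by
    have h1 : m ^ γ ≤ (1 - V') ^ γ := Real.rpow_le_rpow hm0 (by linarith) hγ.le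
    have h2 : ((1 - V') ^ γ * e' + c' * V') * J ^ (2 / q) ≤ e * J ^ (2 / q) := by
      have := mul_nonneg hc'.le hV'0
      rw [← hcE'] at hgood
      nlinarith
    have h3 := le_of_mul_le_mul_right h2 hJα
    have := mul_le_mul_of_nonneg_right h1 he'0
    linarith
  have hlow := lamR_le_of_nonneg (s := s) (q := q) hN hs0 hs1 hq1 hcA hEc hm0 hwvol.le
  rw [hc1, Real.one_rpow, mul_one, ← hΛ, ← hγe, ← he'] at hlow
  have hV'δ : V' ≤ 1 / c' * δ := by
    rw [div_mul_eq_mul_div, le_div_iff₀ hc']; linarith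
  have haδ : 1 - a ≤ 1 / (c₂ * Λ) * δ := by
    have h1 := lamR_le_of_nonneg (s := s) (q := q) hN hs0 hs1 hq1 hu huE ha0
      (by rw [← hA, haA])
    rw [hu1, Real.one_rpow, mul_one, ← hΛ, ← hγe, ← he] at h1
    have h2 := one_sub_rpow_le_one_sub (x := 1 - a) (by linarith) (by linarith) hγ
    rw [sub_sub_cancel, ← hc₂] at h2
    have hae : 0 ≤ a ^ γ := Real.rpow_nonneg ha0 γ
    have h3 : a ^ γ * e ≤ a ^ γ * (Λ + δ) := mul_le_mul_of_nonneg_left heδ hae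
    have he1 : Λ ≤ e := by
      have : a ^ γ ≤ 1 := Real.rpow_le_one ha0 ha1 hγ.le
      have : a ^ γ * e ≤ 1 * e := mul_le_mul_of_nonneg_right this (he ▸ ENNReal.toReal_nonneg)
      linarith
    have h4 : a ^ γ * (Λ + δ) ≤ (1 - c₂ * (1 - a)) * (Λ + δ) :=
      mul_le_mul_of_nonneg_right h2 (by linarith)
    rw [div_mul_eq_mul_div, le_div_iff₀ (by positivity)]
    have h5 : 0 ≤ c₂ * (1 - a) * δ := by
      have : 0 ≤ δ := by linarith
      have : 0 ≤ 1 - a := by linarith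
      positivity
    linarith
  have hmC : 1 - m ≤ C * δ := by rw [hC, add_mul]; linarith
  have hcV := mul_nonneg hc'.le hV'0
  refine ⟨fun x => c * v x, z, m, hcA, fun x => ?_, fun x hx => ?_, hc1, hEc, hwvol, by linarith,
    by linarith, hmC, ?_, ?_⟩
  · have := huM x
    exact mul_le_mul hc2 ((hvu x).trans (huM x)) (hvA.nonneg x) (by norm_num)
  · have : ¬ 0 < v x := fun h => by
      have h1 : x ∈ {x | 0 < v x} := h
      rw [hvpos] at h1
      have h2 : ‖x - z‖ < L := h1.2
      linarith
    beta_reduce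
    rw [le_antisymm (not_lt.1 this) (hvA.nonneg x), mul_zero]
  · rw [hpos', hvpos, ← hset]; exact Set.inter_subset_left
  · rw [← he', ← hΛ, ← hγe]; linarith

end Compact

section Defect

variable {N : ℕ} {s q : ℝ} {f u : Eu N → ℝ} {ν : Eu N} {h : ℝ}

lemma kk_sub_kk_rfl'_ge (hN : 2 ≤ N) (hs : 0 < s) (hν : ‖ν‖ = 1) {R : ℝ}
    {x y : Eu N} (hxy : x ≠ y) (hx : ⟪x, ν⟫ ≤ h) (hy : ⟪y, ν⟫ ≤ h)
    (hb : ‖x - rfl' ν h y‖ ≤ R) :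
    (R ^ ((N : ℝ) + 2 * s + 2))⁻¹ * (4 * ((h - ⟪x, ν⟫) * (h - ⟪y, ν⟫)))
      ≤ kk N s x y - kk N s x (rfl' ν h y) := by
  have h1 := norm_sub_rfl'_sq (h := h) hν x y
  unfold kk
  obtain ⟨a, ha⟩ : ∃ a, a = ‖x - y‖ := ⟨_, rfl⟩
  obtain ⟨b, hbe⟩ : ∃ b, b = ‖x - rfl' ν h y‖ := ⟨_, rfl⟩
  have ha0 : 0 < a := ha ▸ norm_pos_iff.2 (sub_ne_zero.2 hxy)
  rw [← ha, ← hbe] at h1 ⊢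
  rw [← hbe] at hb
  have hprod := mul_nonneg (sub_nonneg.2 hx) (sub_nonneg.2 hy)
  have hab : a ≤ b := le_of_sq_le_sq (by rw [h1]; nlinarith) (hbe ▸ norm_nonneg _)
  have hb0 : 0 < b := ha0.trans_le hab
  obtain ⟨p, hp⟩ : ∃ p, p = (N : ℝ) + 2 * s := ⟨_, rfl⟩
  have hN' : (2 : ℝ) ≤ N := by exact_mod_cast hN
  have hp2 : 2 ≤ p := by rw [hp]; linarith
  rw [← hp]
  have e1 : 4 * ((h - ⟪x, ν⟫) * (h - ⟪y, ν⟫)) = b ^ 2 - a ^ 2 := by rw [h1]; ring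
  rw [e1]
  have e2 : (R ^ (p + 2))⁻¹ ≤ (b ^ (p + 2))⁻¹ := by gcongr
  have e3 : b ^ (p + 2) = b ^ p * b ^ 2 := by rw [Real.rpow_add hb0]; norm_num
  have e4 : (a / b) ^ p ≤ (a / b) ^ 2 := by
    have := Real.rpow_le_rpow_of_exponent_ge (div_pos ha0 hb0) ((div_le_one hb0).2 hab) hp2
    simpa using this
  have hap : 0 < a ^ p := Real.rpow_pos_of_pos ha0 p
  have hbp : 0 < b ^ p := Real.rpow_pos_of_pos hb0 p
  have hapb : a ^ p ≤ b ^ p := Real.rpow_le_rpow ha0.le hab (by linarith)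
  have hsq : 0 ≤ b ^ 2 - a ^ 2 := by nlinarith
  calc (R ^ (p + 2))⁻¹ * (b ^ 2 - a ^ 2) ≤ (b ^ (p + 2))⁻¹ * (b ^ 2 - a ^ 2) := by gcongr
    _ = (b ^ p)⁻¹ * (1 - (a / b) ^ 2) := by rw [e3]; field_simp
    _ ≤ (b ^ p)⁻¹ * (1 - (a / b) ^ p) := by gcongr
    _ = (b ^ p)⁻¹ * (1 - a ^ p / b ^ p) := by rw [Real.div_rpow ha0.le hb0.le]
    _ ≤ (a ^ p)⁻¹ * (1 - a ^ p / b ^ p) := by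
        have : 0 ≤ 1 - a ^ p / b ^ p := sub_nonneg.2 ((div_le_one hbp).2 hapb)
        gcongr
    _ = (a ^ p)⁻¹ - (b ^ p)⁻¹ := by field_simp

/-- The part of the weighted asymmetry across `⟪x, ν⟫ = h` with the favourable sign. -/
def reflExcess (f : Eu N → ℝ) (ν : Eu N) (h : ℝ) : ℝ≥0∞ :=
  ∫⁻ x, ENNReal.ofReal (if ⟪x, ν⟫ < h then (h - ⟪x, ν⟫) * max (f x - f (rfl' ν h x)) 0 else 0)

lemma measurable_ite_inner_lt {g : Eu N → ℝ} (hg : Measurable g) :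
    Measurable fun x : Eu N => if ⟪x, ν⟫ < h then (h - ⟪x, ν⟫) * g x else 0 :=
  Measurable.ite (measurableSet_lt (by fun_prop) measurable_const) (by fun_prop) measurable_const

lemma reflExcess_eq (hν : ‖ν‖ = 1) (hf : Adm f) (hS : ∀ v : Eu N, ∫ x, ⟪x, v⟫ * f x = 0)
    (hInt : ∀ v : Eu N, Integrable fun x => ⟪x, v⟫ * f x) (hh : 0 ≤ h) :
    reflExcess f ν h = reflDefect f ν h + ENNReal.ofReal (h * ∫ x, f x) := by
  have hfm := hf.meas
  have hfσ : Measurable fun x => f (rfl' ν h x) := hfm.comp (measurable_rfl')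
  have hI : Integrable fun x => h * f x - ⟪x, ν⟫ * f x := (hf.integrable.const_mul h).sub (hInt ν)
  have e0 : ∫ x, (h * f x - ⟪x, ν⟫ * f x) = h * ∫ x, f x := by
    rw [integral_sub (hf.integrable.const_mul h) (hInt ν), hS, integral_const_mul, sub_zero]
  obtain ⟨A, hA⟩ : ∃ A, A = ∫⁻ x, ENNReal.ofReal
    (if ⟪x, ν⟫ < h then (h - ⟪x, ν⟫) * f x else 0) := ⟨_, rfl⟩
  obtain ⟨B, hB⟩ : ∃ B, B = ∫⁻ x, ENNReal.ofReal
    (if ⟪x, ν⟫ < h then (h - ⟪x, ν⟫) * f (rfl' ν h x) else 0) := ⟨_, rfl⟩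
  have hA' : A = ∫⁻ x, ENNReal.ofReal (h * f x - ⟪x, ν⟫ * f x) := by
    rw [hA]
    refine lintegral_congr fun x => ?_
    split_ifs with hx
    · rw [sub_mul]
    · rw [ENNReal.ofReal_zero, ENNReal.ofReal_of_nonpos]
      have := mul_nonneg (sub_nonneg.2 (not_lt.1 hx)) (hf.nonneg x)
      linarith
  have hB' : B = ∫⁻ x, ENNReal.ofReal (-(h * f x - ⟪x, ν⟫ * f x)) := by
    rw [hB, ← lintegral_comp_rfl' (h := h) hν fun x => ENNReal.ofReal (-(h * f x - ⟪x, ν⟫ * f x))]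
    refine lintegral_congr fun x => ?_
    rw [inner_rfl' hν]
    split_ifs with hx
    · congr 1; ring
    · rw [ENNReal.ofReal_zero, ENNReal.ofReal_of_nonpos]
      have := mul_nonneg (sub_nonneg.2 (not_lt.1 hx)) (hf.nonneg (rfl' ν h x))
      linarith
  have hBfin : B ≠ ⊤ := by
    rw [hB']
    exact hI.neg.lintegral_lt_top.ne
  have hAfin : A ≠ ⊤ := by
    rw [hA']
    exact hI.lintegral_lt_top.ne
  have hAB : A = B + ENNReal.ofReal (h * ∫ x, f x) := by
    have := integral_eq_lintegral_pos_part_sub_lintegral_neg_part hI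
    rw [e0, ← hA', ← hB'] at this
    rw [this, ← ENNReal.ofReal_toReal hAfin, ← ENNReal.ofReal_toReal hBfin,
      ENNReal.toReal_ofReal ENNReal.toReal_nonneg, ENNReal.toReal_ofReal ENNReal.toReal_nonneg,
      ← ENNReal.ofReal_add ENNReal.toReal_nonneg]
    · congr 1; ring
    · rw [← this]
      exact mul_nonneg hh (integral_nonneg hf.nonneg)
  have key : reflExcess f ν h + B = reflDefect f ν h + A := by
    unfold reflExcess reflDefect
    have m1 := (measurable_ite_inner_lt (ν := ν) (h := h) hfσ).ennreal_ofReal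
    have m2 := (measurable_ite_inner_lt (ν := ν) (h := h) hfm).ennreal_ofReal
    rw [hA, hB, ← lintegral_add_right _ m1, ← lintegral_add_right _ m2]
    refine lintegral_congr fun x => ?_
    split_ifs with hx
    · have h0 : 0 ≤ h - ⟪x, ν⟫ := by linarith
      have hf0 := hf.nonneg x
      have hf1 := hf.nonneg (rfl' ν h x)
      rw [← ENNReal.ofReal_add (by positivity) (by positivity),
        ← ENNReal.ofReal_add (by positivity) (by positivity), ← mul_add, ← mul_add]
      congr 2
      rcases le_total (f x) (f (rfl' ν h x)) with h3 | h3
      · rw [max_eq_right (by linarith), max_eq_left (by linarith)]; ring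
      · rw [max_eq_left (by linarith), max_eq_right (by linarith)]; ring
    · simp
  rw [hAB] at key
  have : reflExcess f ν h + B = (reflDefect f ν h + ENNReal.ofReal (h * ∫ x, f x)) + B := by
    rw [key]; ring
  exact (ENNReal.add_left_inj hBfin).1 this

lemma reflExcess_mul_reflDefect_le (hN : 2 ≤ N) (hs : 0 < s) (hν : ‖ν‖ = 1) (hf : Adm f)
    {R : ℝ} (hR : 0 < R) (hfR : ∀ x, R < ‖x‖ → f x = 0) :
    ENNReal.ofReal (4 * ((2 * R) ^ ((N : ℝ) + 2 * s + 2))⁻¹) *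
      (reflExcess f ν h * reflDefect f ν h) ≤ dint (polGain s ν h f) := by
  have hfm := hf.meas
  have hfσ : Measurable fun x => f (rfl' ν h x) := hfm.comp (measurable_rfl')
  obtain ⟨c, hc⟩ : ∃ c, c = 4 * ((2 * R) ^ ((N : ℝ) + 2 * s + 2))⁻¹ := ⟨_, rfl⟩
  have hc0 : 0 ≤ c := by rw [hc]; positivity
  obtain ⟨F, hF⟩ : ∃ F : Eu N → ℝ, F = fun x =>
    if ⟪x, ν⟫ < h then (h - ⟪x, ν⟫) * max (f x - f (rfl' ν h x)) 0 else 0 := ⟨_, rfl⟩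
  obtain ⟨G, hG⟩ : ∃ G : Eu N → ℝ, G = fun x =>
    if ⟪x, ν⟫ < h then (h - ⟪x, ν⟫) * max (f (rfl' ν h x) - f x) 0 else 0 := ⟨_, rfl⟩
  have hFm : Measurable F := hF ▸ measurable_ite_inner_lt ((hfm.sub hfσ).max measurable_const)
  have hGm : Measurable G := hG ▸ measurable_ite_inner_lt ((hfσ.sub hfm).max measurable_const)
  have hF0 : ∀ x, 0 ≤ F x := fun x => by
    rw [hF]; beta_reduce; split_ifs with hx
    · exact mul_nonneg (sub_nonneg.2 hx.le) (le_max_right _ _)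
    · exact le_rfl
  have e1 : ENNReal.ofReal c * (reflExcess f ν h * reflDefect f ν h) =
      dint fun x y => c * (F x * G y) := by
    rw [dint_const_mul hc0]
    congr 1
    have : reflExcess f ν h = ∫⁻ x, ENNReal.ofReal (F x) := by rw [hF]; rfl
    rw [this]
    have : reflDefect f ν h = ∫⁻ x, ENNReal.ofReal (G x) := by rw [hG]; rfl
    rw [this, ← lintegral_mul_const _ hFm.ennreal_ofReal]
    refine lintegral_congr fun x => ?_
    rw [← lintegral_const_mul _ hGm.ennreal_ofReal]
    refine lintegral_congr fun y => ?_
    rw [ENNReal.ofReal_mul (hF0 x)]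
  rw [← hc, e1]
  refine dint_mono fun x y => ?_
  by_cases hxy : ⟪x, ν⟫ < h ∧ ⟪y, ν⟫ < h
  swap
  · have : F x * G y = 0 := by
      rw [hF, hG]; beta_reduce
      by_cases hx : ⟪x, ν⟫ < h
      · rw [if_neg (fun hy : ⟪y, ν⟫ < h => hxy ⟨hx, hy⟩), mul_zero]
      · rw [if_neg hx, zero_mul]
    rw [this, mul_zero]
    exact polGain_nonneg hs hν x y
  have hprod := mul_pos (sub_pos.2 hxy.1) (sub_pos.2 hxy.2)
  rw [hF, hG, polGain, if_pos hxy]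
  beta_reduce
  rw [if_pos hxy.1, if_pos hxy.2]
  by_cases hz : 0 < max (f x - f (rfl' ν h x)) 0 * max (f (rfl' ν h y) - f y) 0
  swap
  · have h0 : max (f x - f (rfl' ν h x)) 0 * max (f (rfl' ν h y) - f y) 0 = 0 :=
      le_antisymm (not_lt.1 hz) (by positivity)
    rw [h0, zero_mul]
    have : (h - ⟪x, ν⟫) * max (f x - f (rfl' ν h x)) 0 *
        ((h - ⟪y, ν⟫) * max (f (rfl' ν h y) - f y) 0) = 0 := by
      linear_combination (h - ⟪x, ν⟫) * (h - ⟪y, ν⟫) * h0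
    rw [this, mul_zero]
  have hz1 : f (rfl' ν h x) < f x := by
    by_contra hcon
    rw [max_eq_right (by linarith), zero_mul] at hz
    exact lt_irrefl _ hz
  have hz2 : f y < f (rfl' ν h y) := by
    by_contra hcon
    rw [max_eq_right (a := f (rfl' ν h y) - f y) (by linarith), mul_zero] at hz
    exact lt_irrefl _ hz
  have hne : x ≠ y := by rintro rfl; linarith
  have hx2 : ‖x‖ ≤ R := by
    by_contra hcon
    have := hf.nonneg (rfl' ν h x)
    rw [hfR x (not_le.1 hcon)] at hz1; linarith
  have hy2 : ‖rfl' ν h y‖ ≤ R := by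
    by_contra hcon
    have := hf.nonneg y
    rw [hfR _ (not_le.1 hcon)] at hz2; linarith
  have hker := kk_sub_kk_rfl'_ge hN hs hν (R := 2 * R) hne hxy.1.le hxy.2.le
    ((norm_sub_le _ _).trans (by linarith))
  calc c * ((h - ⟪x, ν⟫) * max (f x - f (rfl' ν h x)) 0 *
        ((h - ⟪y, ν⟫) * max (f (rfl' ν h y) - f y) 0))
      = max (f x - f (rfl' ν h x)) 0 * max (f (rfl' ν h y) - f y) 0 *
        (((2 * R) ^ ((N : ℝ) + 2 * s + 2))⁻¹ * (4 * ((h - ⟪x, ν⟫) * (h - ⟪y, ν⟫)))) := by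
        rw [hc]; ring
    _ ≤ _ := mul_le_mul_of_nonneg_left hker hz.le

end Defect

section RearrDistance

variable {N : ℕ} {s q : ℝ} {f u : Eu N → ℝ} {ν : Eu N} {h : ℝ}

lemma Adm.integrable_inner (hf : Adm f) (v : Eu N) : Integrable fun x => ⟪x, v⟫ * f x := by
  obtain ⟨R, hR, hfR⟩ := hf.supp
  refine Integrable.mono' (hf.integrable.const_mul (R * ‖v‖))
    (Measurable.aestronglyMeasurable ((by fun_prop : Measurable fun x : Eu N => ⟪x, v⟫).mul hf.meas))
    (Eventually.of_forall fun x => ?_)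
  rw [Real.norm_eq_abs, abs_mul, abs_of_nonneg (hf.nonneg x)]
  rcases le_or_gt ‖x‖ R with hx | hx
  · exact mul_le_mul_of_nonneg_right ((abs_real_inner_le_norm x v).trans (by gcongr)) (hf.nonneg x)
  · rw [hfR x hx]; simp

lemma Adm.integrable_smul (hf : Adm f) : Integrable fun x => f x • x := by
  obtain ⟨R, hR, hfR⟩ := hf.supp
  refine Integrable.mono' (hf.integrable.const_mul R)
    (hf.meas.smul measurable_id).aestronglyMeasurable
    (Eventually.of_forall fun x => ?_)
  rw [norm_smul, Real.norm_eq_abs, abs_of_nonneg (hf.nonneg x), mul_comm]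
  rcases le_or_gt ‖x‖ R with hx | hx
  · exact mul_le_mul_of_nonneg_right hx (hf.nonneg x)
  · rw [hfR x hx]; simp

lemma Adm.exists_barycenter (hf : Adm f) {z : Eu N} {R : ℝ} (hR : ∀ x, R ≤ ‖x - z‖ → f x = 0)
    (hS : 0 < ∫ x, f x) :
    ∃ b : Eu N, ‖b - z‖ ≤ R ∧ ∀ v : Eu N, ∫ x, ⟪x, v⟫ * f (x + b) = 0 := by
  obtain ⟨S, hSe⟩ : ∃ S, S = ∫ x, f x := ⟨_, rfl⟩
  rw [← hSe] at hS
  have hi := hf.integrable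
  have hi2 := hf.integrable_smul
  refine ⟨S⁻¹ • ∫ x, f x • x, ?_, fun v => ?_⟩
  · have e1 : (S⁻¹ • ∫ x, f x • x) - z = S⁻¹ • ∫ x, f x • (x - z) := by
      simp only [smul_sub]
      rw [integral_sub hi2 (hi.smul_const z), integral_smul_const, ← hSe, smul_sub,
        smul_smul, inv_mul_cancel₀ hS.ne', one_smul]
    rw [e1, norm_smul, norm_inv, Real.norm_of_nonneg hS.le, inv_mul_le_iff₀ hS, hSe,
      ← integral_mul_const]
    refine norm_integral_le_of_norm_le (hi.mul_const R) (Eventually.of_forall fun x => ?_)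
    rw [norm_smul, Real.norm_of_nonneg (hf.nonneg x)]
    rcases le_or_gt R ‖x - z‖ with hx | hx
    · rw [hR x hx]; simp
    · exact mul_le_mul_of_nonneg_left hx.le (hf.nonneg x)
  · obtain ⟨b, hb⟩ : ∃ b, b = S⁻¹ • ∫ x, f x • x := ⟨_, rfl⟩
    rw [← hb]
    have e1 := integral_add_right_eq_self (μ := (volume : Measure (Eu N)))
      (fun x => ⟪x - b, v⟫ * f x) b
    simp only [add_sub_cancel_right] at e1
    rw [e1]
    simp only [inner_sub_left, sub_mul]
    rw [integral_sub (hf.integrable_inner v) (hi.const_mul _), integral_const_mul, ← hSe]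
    have e2 : ∫ x, ⟪x, v⟫ * f x = ⟪∫ x, f x • x, v⟫ := by
      rw [real_inner_comm, ← integral_inner hi2 v]
      refine integral_congr_ae (Eventually.of_forall fun x => ?_)
      beta_reduce
      rw [real_inner_smul_right, real_inner_comm, mul_comm]
    rw [e2, hb, real_inner_smul_left]
    field_simp
    ring

lemma reflDefect_pow_three_mul_le (hN : 2 ≤ N) (hs : 0 < s) (hν : ‖ν‖ = 1) (hf : Adm f)
    {R : ℝ} (hR : 0 < R) (hfR : ∀ x, R < ‖x‖ → f x = 0) (hh : 0 < h)
    (hS : ∀ v : Eu N, ∫ x, ⟪x, v⟫ * f x = 0) {S : ℝ} (hS0 : 0 < S) (hSf : S ≤ ∫ x, f x) {D : ℝ}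
    (hD : 0 ≤ D) (hE : gagliardoSq N s f ≠ ⊤)
    (hdef : gagliardoSq N s f ≤ gagliardoSq N s (pol ν h f) + ENNReal.ofReal D) :
    reflDefect f ν h ^ 3 * ENNReal.ofReal h ≤
      ENNReal.ofReal ((2 / (4 * ((2 * R) ^ ((N : ℝ) + 2 * s + 2))⁻¹)) ^ 2 / S * D ^ 2) := by
  have h1 := reflExcess_mul_reflDefect_le (h := h) hN hs hν hf hR hfR
  have h2 := gagliardoSq_pol_add (h := h) hs hν hf.meas
  have h3 := reflExcess_eq hν hf hS hf.integrable_inner hh.le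
  obtain ⟨c, hc⟩ : ∃ c, c = 4 * ((2 * R) ^ ((N : ℝ) + 2 * s + 2))⁻¹ := ⟨_, rfl⟩
  have hc0 : 0 < c := by rw [hc]; positivity
  rw [← hc] at h1 ⊢
  obtain ⟨P, hP⟩ : ∃ P, P = reflExcess f ν h := ⟨_, rfl⟩
  obtain ⟨n, hn⟩ : ∃ n, n = reflDefect f ν h := ⟨_, rfl⟩
  rw [← hP, ← hn] at h1 h3
  rw [← hn]
  have hEp : gagliardoSq N s (pol ν h f) ≠ ⊤ :=
    ne_top_of_le_ne_top hE (gagliardoSq_pol_le hs hν hf.meas)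
  have h4 : 2 * dint (polGain s ν h f) ≤ 4 * ENNReal.ofReal D := by
    have : 4 * gagliardoSq N s (pol ν h f) + 2 * dint (polGain s ν h f) ≤
        4 * gagliardoSq N s (pol ν h f) + 4 * ENNReal.ofReal D := by
      rw [← mul_add]
      exact h2.trans (by gcongr)
    exact (ENNReal.add_le_add_iff_left (ENNReal.mul_ne_top (by norm_num) hEp)).1 this
  have h5 : P * n ≤ ENNReal.ofReal (2 / c * D) := by
    have e : 2 / c * D = (4 * D) / (2 * c) := by field_simp; ring
    rw [e, ENNReal.ofReal_div_of_pos (by positivity), ENNReal.le_div_iff_mul_le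
      (Or.inl (by simp [hc0])) (Or.inl ENNReal.ofReal_ne_top),
      ENNReal.ofReal_mul (by norm_num), ENNReal.ofReal_mul (by norm_num)]
    calc P * n * (ENNReal.ofReal 2 * ENNReal.ofReal c) = 2 * (ENNReal.ofReal c * (P * n)) := by
          simp; ring
      _ ≤ 2 * dint (polGain s ν h f) := by gcongr
      _ ≤ _ := h4.trans (by simp)
  have hnP : n ≤ P := by rw [h3]; exact le_self_add
  have hSP : ENNReal.ofReal (h * S) ≤ P := by
    rw [h3]
    exact (ENNReal.ofReal_le_ofReal (by gcongr)).trans le_add_self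
  have e : (2 / c) ^ 2 / S * D ^ 2 = (2 / c * D) ^ 2 / S := by ring
  rw [e, ENNReal.ofReal_div_of_pos hS0, ENNReal.le_div_iff_mul_le
      (Or.inl (by simp [hS0])) (Or.inl ENNReal.ofReal_ne_top), ENNReal.ofReal_pow (by positivity)]
  calc n ^ 3 * ENNReal.ofReal h * ENNReal.ofReal S = (n * n) * (ENNReal.ofReal (h * S) * n) := by
        rw [ENNReal.ofReal_mul hh.le]; ring
    _ ≤ (P * n) * (P * n) := by gcongr
    _ ≤ ENNReal.ofReal (2 / c * D) * ENNReal.ofReal (2 / c * D) := by gcongr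
    _ = _ := by ring

lemma exists_lintegral_sub_rearr_le (hN : 2 ≤ N) (hs : 0 < s) {R M S : ℝ} (hR : 0 < R)
    (hM : 0 < M) (hS0 : 0 < S) :
    ∃ C, 0 < C ∧ ∀ (f : Eu N → ℝ) (D : ℝ), Adm f → (∀ x, f x ≤ M) → (∀ x, R < ‖x‖ → f x = 0) →
      (∀ v : Eu N, ∫ x, ⟪x, v⟫ * f x = 0) → S ≤ ∫ x, f x → 0 ≤ D → gagliardoSq N s f ≠ ⊤ →
      (∀ ν : Eu N, ‖ν‖ = 1 → ∀ h : ℝ, 0 < h →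
        gagliardoSq N s f ≤ gagliardoSq N s (pol ν h f) + ENNReal.ofReal D) →
      ∫⁻ x, ENNReal.ofReal (f x - rearr f x) ≤ ENNReal.ofReal (C * D ^ (1 / 3 : ℝ)) := by
  obtain ⟨κ, hκ⟩ : ∃ κ, κ = (2 / (4 * ((2 * R) ^ ((N : ℝ) + 2 * s + 2))⁻¹)) ^ 2 / S := ⟨_, rfl⟩
  have hκ0 : 0 < κ := by rw [hκ]; positivity
  obtain ⟨ρ, hρ⟩ : ∃ ρ, ρ = (radConst N R).toReal := ⟨_, rfl⟩
  have hρ0 : 0 ≤ ρ := hρ ▸ ENNReal.toReal_nonneg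
  have hρ' : radConst N R = ENNReal.ofReal ρ := by
    rw [hρ, ENNReal.ofReal_toReal (radConst_lt_top R hR).ne]
  obtain ⟨T, hT⟩ : ∃ T, T = M * (ρ * κ ^ (1 / 3 : ℝ)) := ⟨_, rfl⟩
  have hT0 : 0 ≤ T := by rw [hT]; positivity
  refine ⟨√T + 1, by positivity, fun f D hf hfM hfR hbar hSf hD hE hdef => ?_⟩
  have h1 := sq_lintegral_sub_rearr_le_of_reflDefect hN hf hfM hR hfR
    (K := ENNReal.ofReal (κ * D ^ 2)) (fun ν hν h hh => by
      rw [hκ]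
      exact reflDefect_pow_three_mul_le hN hs hν hf hR hfR hh hbar hS0 hSf hD hE (hdef ν hν h hh))
  have e1 : (κ * D ^ 2) ^ (1 / 3 : ℝ) = κ ^ (1 / 3 : ℝ) * (D ^ (1 / 3 : ℝ)) ^ 2 := by
    rw [Real.mul_rpow hκ0.le (by positivity), ← Real.rpow_natCast, ← Real.rpow_natCast,
      ← Real.rpow_mul hD, ← Real.rpow_mul hD]
    congr 2; ring
  rw [ENNReal.ofReal_rpow_of_nonneg (by positivity) (by norm_num), hρ', ← ENNReal.ofReal_mul hρ0,
    ← ENNReal.ofReal_mul hM.le, e1] at h1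
  have h2 : M * (ρ * (κ ^ (1 / 3 : ℝ) * (D ^ (1 / 3 : ℝ)) ^ 2)) ≤
      ((√T + 1) * D ^ (1 / 3 : ℝ)) ^ 2 := by
    have : M * (ρ * (κ ^ (1 / 3 : ℝ) * (D ^ (1 / 3 : ℝ)) ^ 2)) = T * (D ^ (1 / 3 : ℝ)) ^ 2 := by
      rw [hT]; ring
    rw [this, mul_pow]
    gcongr
    nlinarith [Real.sq_sqrt hT0, Real.sqrt_nonneg T]
  have h3 := h1.trans (ENNReal.ofReal_le_ofReal h2)
  rw [ENNReal.ofReal_pow (by positivity)] at h3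
  exact (ENNReal.pow_right_strictMono two_ne_zero).le_iff_le.1 h3

end RearrDistance

section MinMax

variable {N : ℕ} {s q : ℝ} {f u : Eu N → ℝ}

lemma rpow_sub_rpow_le {x y M q : ℝ} (hy : 0 ≤ y) (hyx : y ≤ x) (hxM : x ≤ M) (hq : 1 ≤ q) :
    x ^ q - y ^ q ≤ q * M ^ (q - 1) * (x - y) := by
  rcases eq_or_lt_of_le (hy.trans hyx) with hx | hx
  · have hy' : y = 0 := le_antisymm (hyx.trans hx.symm.le) hy
    rw [← hx, hy']; simp
  have h1 := one_add_mul_self_le_rpow_one_add (s := y / x - 1) (p := q)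
    (by have := div_nonneg hy hx.le; linarith) hq
  rw [add_sub_cancel, Real.div_rpow hy hx.le, le_div_iff₀ (Real.rpow_pos_of_pos hx q)] at h1
  have h2 : x ^ q = x ^ (q - 1) * x := by
    rw [← Real.rpow_add_one hx.ne', sub_add_cancel]
  have h3 : x ^ (q - 1) ≤ M ^ (q - 1) := Real.rpow_le_rpow hx.le hxM (by linarith)
  have h4 : x ^ q - y ^ q ≤ q * x ^ (q - 1) * (x - y) := by
    have : (1 + q * (y / x - 1)) * x ^ q = x ^ q + q * x ^ (q - 1) * (y - x) := by
      rw [h2]; field_simp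
    linarith
  refine h4.trans ?_
  have := sub_nonneg.2 hyx
  gcongr

lemma min_mul_sq_le_of_power_le {Λ α γ b m a E₁ E₂ E δ : ℝ} (hΛ : 0 < Λ) (hα0 : 0 < α)
    (hα : α ≤ 2) (hγ : 0 < γ) (hb0 : 0 ≤ b) (hb1 : b ≤ 1) (hm : 0 < m) (ha0 : 0 ≤ a) (ham : a ≤ m)
    (hE₁ : 0 ≤ E₁) (hE₂ : 0 ≤ E₂) (hEE : E₁ + E₂ ≤ 2 * E) (hE : m ^ γ * E ≤ Λ + δ)
    (hδ0 : 0 ≤ δ) (hδ : δ ≤ Λ) (h₁ : Λ * (1 - b) ^ α ≤ (m - a) ^ γ * E₁)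
    (h₂ : Λ * (1 + b) ^ α ≤ (m + a) ^ γ * E₂) :
    min 1 γ * (a / m) ^ 2 ≤ 2 * b ^ 2 + 3 * δ / Λ := by
  have hX0 : 0 ≤ (a / m) ^ 2 := by positivity
  have ham' : a / m ≤ 1 := (div_le_one hm).2 ham
  have hX1 : (a / m) ^ 2 ≤ 1 := pow_le_one₀ (by positivity) ham'
  have k1 : (Λ * (1 - b) ^ α) * (Λ * (1 + b) ^ α) ≤
      ((m - a) ^ γ * E₁) * ((m + a) ^ γ * E₂) :=
    mul_le_mul h₁ h₂ (by positivity)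
      (mul_nonneg (Real.rpow_nonneg (by linarith) _) hE₁)
  have k2 : (Λ * (1 - b) ^ α) * (Λ * (1 + b) ^ α) = Λ ^ 2 * (1 - b ^ 2) ^ α := by
    have : 1 - b ^ 2 = (1 - b) * (1 + b) := by ring
    rw [this, Real.mul_rpow (by linarith) (by linarith)]; ring
  have k3 : ((m - a) ^ γ * E₁) * ((m + a) ^ γ * E₂) =
      (1 - (a / m) ^ 2) ^ γ * ((m ^ γ) ^ 2 * (E₁ * E₂)) := by
    have e1 : (m - a) * (m + a) = m * m * (1 - (a / m) ^ 2) := by field_simp; ring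
    have e2 : (m - a) ^ γ * (m + a) ^ γ = m ^ γ * m ^ γ * (1 - (a / m) ^ 2) ^ γ := by
      rw [← Real.mul_rpow (by linarith) (by linarith), e1,
        Real.mul_rpow (by positivity) (by linarith), Real.mul_rpow hm.le hm.le]
    calc _ = ((m - a) ^ γ * (m + a) ^ γ) * (E₁ * E₂) := by ring
      _ = _ := by rw [e2]; ring
  have hE0 : 0 ≤ E := by linarith
  have k4 : E₁ * E₂ ≤ E ^ 2 := by
    have : (E₁ + E₂) ^ 2 ≤ (2 * E) ^ 2 := pow_le_pow_left₀ (by linarith) hEE 2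
    nlinarith [sq_nonneg (E₁ - E₂)]
  have k5 : (m ^ γ) ^ 2 * (E₁ * E₂) ≤ (Λ + δ) ^ 2 := by
    calc (m ^ γ) ^ 2 * (E₁ * E₂) ≤ (m ^ γ) ^ 2 * E ^ 2 := by gcongr
      _ = (m ^ γ * E) ^ 2 := by ring
      _ ≤ _ := pow_le_pow_left₀ (by positivity) hE 2
  rw [k2, k3] at k1
  have k6 := one_sub_rpow_le_one_sub hX0 hX1 hγ
  have hb2 : b ^ 2 ≤ 1 := pow_le_one₀ hb0 hb1
  have k7 := one_sub_rpow_le (J := 1 - b ^ 2) (by linarith) (by nlinarith) hα0 hα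
  obtain ⟨κ, hκ⟩ : ∃ κ, κ = min 1 γ * (a / m) ^ 2 := ⟨_, rfl⟩
  have hκ0 : 0 ≤ κ := by rw [hκ]; have := hγ.le; positivity
  rw [← hκ] at k6 ⊢
  have k8 : 0 ≤ (1 - (a / m) ^ 2) ^ γ := Real.rpow_nonneg (by linarith) _
  have hκ1 : 0 ≤ 1 - κ := k8.trans k6
  have k9 : Λ ^ 2 * (1 - 2 * b ^ 2) ≤ (1 - κ) * (Λ + δ) ^ 2 := by
    calc Λ ^ 2 * (1 - 2 * b ^ 2) ≤ Λ ^ 2 * (1 - b ^ 2) ^ α := by gcongr; linarith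
      _ ≤ _ := k1
      _ ≤ (1 - κ) * (Λ + δ) ^ 2 := by gcongr
  have k10 : (Λ + δ) ^ 2 ≤ Λ ^ 2 + 3 * δ * Λ := by nlinarith
  have k11 : (1 - κ) * (Λ + δ) ^ 2 ≤ (1 - κ) * Λ ^ 2 + 3 * δ * Λ := by
    calc (1 - κ) * (Λ + δ) ^ 2 ≤ (1 - κ) * (Λ ^ 2 + 3 * δ * Λ) := by gcongr
      _ = (1 - κ) * Λ ^ 2 + 3 * δ * Λ - κ * (3 * δ * Λ) := by ring
      _ ≤ _ := by have : 0 ≤ κ * (3 * δ * Λ) := by positivity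
                  linarith
  have k12 : κ * Λ ^ 2 ≤ (2 * b ^ 2 + 3 * δ / Λ) * Λ ^ 2 := by
    have : (2 * b ^ 2 + 3 * δ / Λ) * Λ ^ 2 = 2 * b ^ 2 * Λ ^ 2 + 3 * δ * Λ := by field_simp
    rw [this]; linarith
  exact le_of_mul_le_mul_right k12 (by positivity)

lemma integral_rearr_rpow (hN : 2 ≤ N) (hf : Adm f) (hq : 0 < q) :
    ∫ x, rearr f x ^ q = ∫ x, f x ^ q := by
  have hg := hf.rearr hN
  have h1 := (eqDist_rearr hN hf).lintegral_eq hg.meas hf.meas hg.nonneg hf.nonneg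
    hg.volume_pos_lt_top.ne (G := fun t => ENNReal.ofReal (t ^ q)) (by fun_prop)
    (by simp [Real.zero_rpow hq.ne'])
  rw [hg.lintegral_rpow hq, hf.lintegral_rpow hq] at h1
  have h2 := congrArg ENNReal.toReal h1
  rwa [ENNReal.toReal_ofReal (hg.integral_rpow_nonneg), ENNReal.toReal_ofReal
    (hf.integral_rpow_nonneg)] at h2

set_option maxHeartbeats 1000000 in
lemma sq_volume_sdiff_rearr_le (hN : 2 ≤ N) (hs0 : 0 < s) (hs1 : s < 1) (hq1 : 1 ≤ q)
    (hq2 : q < 2 * N / ((N : ℝ) - 2 * s)) (hf : Adm f) {M m δ L : ℝ}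
    (hM : 0 < M) (hfM : ∀ x, f x ≤ M) (hf1 : (∫ x, f x ^ q) = 1) (hE : gagliardoSq N s f ≠ ⊤)
    (hv : volume {x | 0 < f x} = ENNReal.ofReal m) (hm0 : 0 < m) (hm1 : m ≤ 1)
    (hle : m ^ (2 / q - 1 + 2 * s / N) * gagliardoSqR N s f ≤ lamR N s q + δ) (hδ0 : 0 ≤ δ)
    (hδ : δ ≤ lamR N s q) (hL0 : 0 ≤ L)
    (hL : ∫⁻ x, ENNReal.ofReal (f x - rearr f x) ≤ ENNReal.ofReal L) :
    min 1 (2 / q - 1 + 2 * s / N) *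
        (volume ({x | 0 < f x} \ {x | 0 < rearr f x})).toReal ^ 2 ≤
      2 * (q * M ^ (q - 1) * L) ^ 2 + 3 * δ / lamR N s q := by
  have hq0 : 0 < q := by linarith
  have hγ := exponent_pos hN hs1 hq1 hq2
  obtain ⟨γ, hγe⟩ : ∃ γ, γ = 2 / q - 1 + 2 * s / N := ⟨_, rfl⟩
  have hΛ := lamR_pos hN hs0 hs1 hq1 hq2
  have hg := hf.rearr hN
  obtain ⟨g, hge⟩ : ∃ g, g = rearr f := ⟨_, rfl⟩
  have hgE : gagliardoSq N s g ≤ gagliardoSq N s f := hge ▸ gagliardoSq_rearr_le hN hs0 hf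
  have hg1 : (∫ x, g x ^ q) = 1 := by rw [hge, integral_rearr_rpow hN hf hq0, hf1]
  have hgv : volume {x | 0 < g x} = ENNReal.ofReal m := by
    rw [hge, eqDist_rearr hN hf 0 le_rfl, hv]
  have hgM : ∀ x, g x ≤ M := by rw [hge]; exact rearr_le hf hM.le hfM
  rw [← hge] at hg hL ⊢
  have hAm : MeasurableSet {x | 0 < f x} := measurableSet_lt measurable_const hf.meas
  have hBm : MeasurableSet {x | 0 < g x} := measurableSet_lt measurable_const hg.meas
  obtain ⟨a, ha⟩ : ∃ a, a = (volume ({x | 0 < f x} \ {x | 0 < g x})).toReal := ⟨_, rfl⟩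
  have hafin : volume ({x | 0 < f x} \ {x | 0 < g x}) ≠ ⊤ :=
    ne_top_of_le_ne_top (hv ▸ ENNReal.ofReal_ne_top) (measure_mono Set.sdiff_subset)
  have ha' : volume ({x | 0 < f x} \ {x | 0 < g x}) = ENNReal.ofReal a := by
    rw [ha, ENNReal.ofReal_toReal hafin]
  have ha0 : 0 ≤ a := ha ▸ ENNReal.toReal_nonneg
  have ham : a ≤ m := by
    have := measure_mono (μ := volume) (Set.sdiff_subset : {x | 0 < f x} \ {x | 0 < g x} ⊆ _)
    rw [ha', hv] at this
    exact (ENNReal.ofReal_le_ofReal_iff hm0.le).1 this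
  rw [← ha]
  have hmin : Adm fun x => min (f x) (g x) :=
    hf.of_le (hf.meas.min hg.meas) (fun x => le_min (hf.nonneg x) (hg.nonneg x))
      (fun x => min_le_left _ _)
  have hmax : Adm fun x => max (f x) (g x) := by
    obtain ⟨R₁, hR₁, h1⟩ := hf.supp
    obtain ⟨R₂, hR₂, h2⟩ := hg.supp
    exact ⟨hf.meas.max hg.meas, fun x => (hf.nonneg x).trans (le_max_left _ _),
      ⟨M, hM, fun x => max_le (hfM x) (hgM x)⟩, ⟨max R₁ R₂, lt_max_of_lt_left hR₁, fun x hx => by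
        rw [h1 x ((le_max_left _ _).trans_lt hx), h2 x ((le_max_right _ _).trans_lt hx), max_self]⟩⟩
  have hEsum := gagliardoSq_min_add_max (s := s) hf.meas hg.meas
  have hgEfin : gagliardoSq N s g ≠ ⊤ := ne_top_of_le_ne_top hE hgE
  have hsumfin : gagliardoSq N s f + gagliardoSq N s g ≠ ⊤ := ENNReal.add_ne_top.2 ⟨hE, hgEfin⟩
  have hE1 : gagliardoSq N s (fun x => min (f x) (g x)) ≠ ⊤ :=
    ne_top_of_le_ne_top hsumfin (le_self_add.trans hEsum)
  have hE2 : gagliardoSq N s (fun x => max (f x) (g x)) ≠ ⊤ :=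
    ne_top_of_le_ne_top hsumfin (le_add_self.trans hEsum)
  have hEE : gagliardoSqR N s (fun x => min (f x) (g x)) +
      gagliardoSqR N s (fun x => max (f x) (g x)) ≤ 2 * gagliardoSqR N s f := by
    have h1 := ENNReal.toReal_mono hsumfin hEsum
    rw [ENNReal.toReal_add hE1 hE2, ENNReal.toReal_add hE hgEfin] at h1
    have h2 := ENNReal.toReal_mono hE hgE
    unfold gagliardoSqR
    linarith
  have hvmin : volume {x | 0 < min (f x) (g x)} ≤ ENNReal.ofReal (m - a) := by
    have e1 : {x | 0 < min (f x) (g x)} = {x | 0 < f x} ∩ {x | 0 < g x} := by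
      ext x; simp
    have h1 := measure_inter_add_sdiff (μ := volume) {x | 0 < f x} hBm
    rw [ha', hv] at h1
    rw [e1, ENNReal.ofReal_sub _ ha0, ← h1, ENNReal.add_sub_cancel_right ENNReal.ofReal_ne_top]
  have hvmax : volume {x | 0 < max (f x) (g x)} ≤ ENNReal.ofReal (m + a) := by
    have e1 : {x | 0 < max (f x) (g x)} = ({x | 0 < f x} \ {x | 0 < g x}) ∪ {x | 0 < g x} := by
      rw [Set.sdiff_union_self]
      ext x; simp
    rw [e1, ENNReal.ofReal_add hm0.le ha0, ← ha', ← hgv, add_comm]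
    exact measure_union_le _ _
  have hif := hf.integrable_rpow hq0
  have hig := hg.integrable_rpow hq0
  have himin := hmin.integrable_rpow hq0
  obtain ⟨b, hb⟩ : ∃ b, b = 1 - ∫ x, min (f x) (g x) ^ q := ⟨_, rfl⟩
  have hb' : (∫ x, min (f x) (g x) ^ q) = 1 - b := by rw [hb]; ring
  have hbmax : (∫ x, max (f x) (g x) ^ q) = 1 + b := by
    have e1 : ∀ x, max (f x) (g x) ^ q = f x ^ q + g x ^ q - min (f x) (g x) ^ q := fun x => by
      rcases le_total (f x) (g x) with h | h
      · rw [max_eq_right h, min_eq_left h]; ring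
      · rw [max_eq_left h, min_eq_right h]; ring
    have hifg : Integrable fun x => f x ^ q + g x ^ q := hif.add hig
    simp only [e1]
    rw [integral_sub hifg himin, integral_add hif hig, hf1, hg1, hb']; ring
  have hb1 : b ≤ 1 := by
    have : 0 ≤ ∫ x, min (f x) (g x) ^ q :=
      integral_nonneg fun x => Real.rpow_nonneg (hmin.nonneg x) _
    rw [hb]; linarith
  have hb0 : 0 ≤ b := by
    have : (∫ x, min (f x) (g x) ^ q) ≤ ∫ x, f x ^ q :=
      integral_mono himin hif fun x =>
        Real.rpow_le_rpow (hmin.nonneg x) (min_le_left _ _) hq0.le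
    rw [hf1] at this
    rw [hb]; linarith
  have hbL : b ≤ q * M ^ (q - 1) * L := by
    have hid : Integrable fun x => f x - min (f x) (g x) := hf.integrable.sub hmin.integrable
    have h1 : (∫ x, (f x - min (f x) (g x))) ≤ L := by
      refine (ENNReal.ofReal_le_ofReal_iff hL0).1 ?_
      rw [ofReal_integral_eq_lintegral_ofReal hid
        (Eventually.of_forall fun x => sub_nonneg.2 (min_le_left _ _))]
      refine le_trans (lintegral_mono fun x => ?_) hL
      rcases le_total (f x) (g x) with h | h
      · rw [min_eq_left h]; simp
      · rw [min_eq_right h]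
    have h2 : b = ∫ x, (f x ^ q - min (f x) (g x) ^ q) := by
      rw [integral_sub hif himin, hf1, hb]
    have h3 : (∫ x, (f x ^ q - min (f x) (g x) ^ q)) ≤
        ∫ x, q * M ^ (q - 1) * (f x - min (f x) (g x)) :=
      integral_mono (hif.sub himin) (hid.const_mul _) fun x =>
        rpow_sub_rpow_le (hmin.nonneg x) (min_le_left _ _) (hfM x) hq1
    rw [integral_const_mul] at h3
    rw [h2]
    exact h3.trans (by gcongr)
  have k1 := lamR_le_of_nonneg hN hs0 hs1 hq1 hmin hE1 (sub_nonneg.2 ham) hvmin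
  have k2 := lamR_le_of_nonneg hN hs0 hs1 hq1 hmax hE2 (add_nonneg hm0.le ha0) hvmax
  rw [hb'] at k1
  rw [hbmax] at k2
  have hα : 2 / q ≤ 2 := by rw [div_le_iff₀ hq0]; linarith
  have k3 := min_mul_sq_le_of_power_le hΛ (by positivity) hα hγ hb0 hb1 hm0 ha0 ham
    ENNReal.toReal_nonneg ENNReal.toReal_nonneg hEE hle hδ0 hδ k1 k2
  rw [← hγe] at k3 hγ ⊢
  have h4 : a ≤ a / m := by rw [le_div_iff₀ hm0]; nlinarith
  calc min 1 γ * a ^ 2 ≤ min 1 γ * (a / m) ^ 2 := by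
        have : 0 ≤ min 1 γ := le_min one_pos.le hγ.le
        gcongr
    _ ≤ _ := k3
    _ ≤ _ := by gcongr

end MinMax

section Stability

variable {N : ℕ} {s q : ℝ} {f u : Eu N → ℝ}

lemma integral_pol_rpow {ν : Eu N} {h : ℝ} (hν : ‖ν‖ = 1) (hh : 0 ≤ h) (hf : Adm f)
    (hq : 0 < q) : ∫ x, pol ν h f x ^ q = ∫ x, f x ^ q := by
  have hg := hf.pol hν hh
  have h1 := lintegral_pol (h := h) hν hf.meas (G := fun t => ENNReal.ofReal (t ^ q)) (by fun_prop)
  rw [hg.lintegral_rpow hq, hf.lintegral_rpow hq] at h1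
  have h2 := congrArg ENNReal.toReal h1
  rwa [ENNReal.toReal_ofReal (hg.integral_rpow_nonneg), ENNReal.toReal_ofReal
    (hf.integral_rpow_nonneg)] at h2

lemma rpow_le_integral (hf : Adm f) {M : ℝ} (hM : 0 < M) (hfM : ∀ x, f x ≤ M) (hq : 1 ≤ q)
    (hf1 : (∫ x, f x ^ q) = 1) : M ^ (1 - q) ≤ ∫ x, f x := by
  have h1 : (∫ x, f x ^ q) ≤ ∫ x, M ^ (q - 1) * f x := by
    refine integral_mono (hf.integrable_rpow (by linarith)) (hf.integrable.const_mul _) fun x => ?_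
    beta_reduce
    rcases eq_or_lt_of_le (hf.nonneg x) with h0 | h0
    · rw [← h0, Real.zero_rpow (by linarith), mul_zero]
    · have : f x ^ q = f x ^ (q - 1) * f x := by
        rw [← Real.rpow_add_one h0.ne', sub_add_cancel]
      rw [this]
      have := Real.rpow_le_rpow h0.le (hfM x) (sub_nonneg.2 hq)
      gcongr
  rw [hf1, integral_const_mul] at h1
  have h2 : M ^ (1 - q) = (M ^ (q - 1))⁻¹ := by
    rw [← Real.rpow_neg hM.le, neg_sub]
  rw [h2]
  exact (inv_le_iff_one_le_mul₀' (Real.rpow_pos_of_pos hM _)).2 h1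

set_option maxHeartbeats 1000000 in
lemma exists_center_of_almost_minimal (hN : 2 ≤ N) (hs0 : 0 < s) (hs1 : s < 1) (hq1 : 1 ≤ q)
    (hq2 : q < 2 * N / ((N : ℝ) - 2 * s)) :
    ∃ δ₀, 0 < δ₀ ∧ ∃ C, 0 < C ∧ ∀ (f : Eu N → ℝ) (δ : ℝ) (Ω : Set (Eu N)), Adm f →
      MeasurableSet Ω → volume Ω = 1 → {x | 0 < f x} ⊆ Ω → (∫ x, f x ^ q) = 1 →
      gagliardoSq N s f ≠ ⊤ → δ ≤ δ₀ → gagliardoSqR N s f ≤ lamR N s q + δ →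
      ∃ z : Eu N, ∀ r : ℝ, 0 < r → volume (Metric.ball z r) = 1 →
        volume (Ω \ Metric.ball z r) ≤ ENNReal.ofReal (C * δ ^ (1 / 3 : ℝ)) := by
  have hq0 : 0 < q := by linarith
  have hγ := exponent_pos hN hs1 hq1 hq2
  obtain ⟨γ, hγe⟩ : ∃ γ, γ = 2 / q - 1 + 2 * s / N := ⟨_, rfl⟩
  rw [← hγe] at hγ
  have hΛ := lamR_pos hN hs0 hs1 hq1 hq2
  obtain ⟨R, hR, M, hM, δ₁, hδ₁, C₁, hC₁, hcomp⟩ :=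
    exists_compact_competitor hN hs0 hs1 hq1 hq2
  obtain ⟨C₂, hC₂, hdist⟩ := exists_lintegral_sub_rearr_le hN hs0 (R := 2 * R) (M := M)
    (S := M ^ (1 - q)) (by positivity) hM (by positivity)
  obtain ⟨Λ, hΛe⟩ : ∃ Λ, Λ = lamR N s q := ⟨_, rfl⟩
  rw [← hΛe] at hΛ
  obtain ⟨κ, hκ⟩ : ∃ κ, κ = min 1 γ := ⟨_, rfl⟩
  have hκ0 : 0 < κ := hκ ▸ lt_min one_pos hγ
  obtain ⟨C₃, hC₃⟩ : ∃ C₃, C₃ = C₂ * ((2 : ℝ) ^ γ) ^ (1 / 3 : ℝ) := ⟨_, rfl⟩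
  have hC₃0 : 0 < C₃ := by rw [hC₃]; positivity
  obtain ⟨T, hT⟩ : ∃ T, T = (2 * (q * M ^ (q - 1) * C₃) ^ 2 + 3 / Λ) / κ := ⟨_, rfl⟩
  have hT0 : 0 < T := by rw [hT]; positivity
  refine ⟨min (min δ₁ Λ) 1, by positivity, C₁ + √T, by positivity,
    fun f δ Ω hf hΩ hΩ1 hfΩ hf1 hE hδ hle => ?_⟩
  have hδ1 : δ ≤ δ₁ := hδ.trans ((min_le_left _ _).trans (min_le_left _ _))
  have hδ2 : δ ≤ Λ := hδ.trans ((min_le_left _ _).trans (min_le_right _ _))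
  have hδ3 : δ ≤ 1 := hδ.trans (min_le_right _ _)
  have hfv : volume {x | 0 < f x} ≤ 1 := hΩ1 ▸ measure_mono hfΩ
  have hδ0 : 0 ≤ δ := by
    have := lamR_le hN hq1 hf hE one_pos (by simpa using hfv)
    rw [hf1, Real.one_rpow, Real.one_rpow] at this
    linarith
  obtain ⟨v, z, m, hv, hvM, hvR, hv1, hvE, hvm, hm2, hm1, hmC, hvf, hvle⟩ :=
    hcomp f δ hf hfv hf1 hE hδ1 hle
  have hm0 : 0 < m := by linarith
  have hvS := rpow_le_integral hv hM hvM hq1 hv1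
  have hS0 : 0 < M ^ (1 - q) := by positivity
  obtain ⟨b, hbz, hbar⟩ := hv.exists_barycenter hvR (hS0.trans_le hvS)
  have hw := hv.comp_add b
  obtain ⟨w, hwe⟩ : ∃ w, w = fun x => v (x + b) := ⟨_, rfl⟩
  have hwv : ∀ x, w x = v (x + b) := fun x => by rw [hwe]
  rw [← hwe] at hw
  have hwM : ∀ x, w x ≤ M := fun x => by rw [hwv]; exact hvM _
  have hwR : ∀ x, 2 * R < ‖x‖ → w x = 0 := fun x hx => by
    rw [hwv]
    refine hvR _ ?_
    have e : x = (x + b - z) - (b - z) := by abel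
    have := norm_sub_le (x + b - z) (b - z)
    rw [← e] at this
    linarith
  have hwbar : ∀ v : Eu N, ∫ x, ⟪x, v⟫ * w x = 0 := by rw [hwe]; exact hbar
  have hwS : M ^ (1 - q) ≤ ∫ x, w x := by
    rw [hwe, integral_add_right_eq_self v b]; exact hvS
  have hw1 : (∫ x, w x ^ q) = 1 := by
    rw [hwe, ← hv1]; exact integral_add_right_eq_self (fun x => v x ^ q) b
  have hwEeq : gagliardoSq N s w = gagliardoSq N s v := by rw [hwe, gagliardoSq_comp_add]
  have hwE : gagliardoSq N s w ≠ ⊤ := hwEeq ▸ hvE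
  have hpre : {x | 0 < w x} = (fun x => x + b) ⁻¹' {x | 0 < v x} := by rw [hwe]; rfl
  have hwm : volume {x | 0 < w x} = ENNReal.ofReal m := by
    rw [hpre, measure_preimage_add_right, hvm]
  have hwle : m ^ γ * gagliardoSqR N s w ≤ Λ + δ := by
    unfold gagliardoSqR
    rw [hwEeq, hΛe, hγe]; exact hvle
  have hdef : ∀ ν : Eu N, ‖ν‖ = 1 → ∀ h : ℝ, 0 < h →
      gagliardoSq N s w ≤ gagliardoSq N s (pol ν h w) + ENNReal.ofReal (2 ^ γ * δ) := by
    intro ν hν h hh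
    have hp := hw.pol hν hh.le
    have hpE : gagliardoSq N s (pol ν h w) ≠ ⊤ :=
      ne_top_of_le_ne_top hwE (gagliardoSq_pol_le hs0 hν hw.meas)
    have h1 := lamR_le hN hq1 hp hpE hm0
      (((eqDist_pol hν hw.meas) 0 le_rfl).trans hwm).le
    rw [integral_pol_rpow hν hh.le hw hq0, hw1, Real.one_rpow, mul_one, ← hΛe, ← hγe] at h1
    have h2 : m ^ γ * (gagliardoSqR N s w - gagliardoSqR N s (pol ν h w)) ≤ δ := by
      rw [mul_sub]; linarith
    have h3 : gagliardoSqR N s w - gagliardoSqR N s (pol ν h w) ≤ 2 ^ γ * δ := by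
      have h4 : 1 ≤ 2 ^ γ * m ^ γ := by
        rw [← Real.mul_rpow (by norm_num) hm0.le]
        exact Real.one_le_rpow (by linarith) hγ.le
      rcases le_total (gagliardoSqR N s w - gagliardoSqR N s (pol ν h w)) 0 with h5 | h5
      · exact h5.trans (by positivity)
      · calc gagliardoSqR N s w - gagliardoSqR N s (pol ν h w)
            ≤ (2 ^ γ * m ^ γ) * (gagliardoSqR N s w - gagliardoSqR N s (pol ν h w)) :=
              le_mul_of_one_le_left h5 h4
          _ = 2 ^ γ * (m ^ γ * (gagliardoSqR N s w - gagliardoSqR N s (pol ν h w))) := by ring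
          _ ≤ 2 ^ γ * δ := by gcongr
    rw [← ENNReal.ofReal_toReal hwE, ← ENNReal.ofReal_toReal hpE,
      ← ENNReal.ofReal_add ENNReal.toReal_nonneg (by positivity)]
    refine ENNReal.ofReal_le_ofReal ?_
    unfold gagliardoSqR at h3
    linarith
  have hL := hdist w (2 ^ γ * δ) hw hwM hwR hwbar hwS (by positivity) hwE hdef
  rw [Real.mul_rpow (by positivity) hδ0, ← mul_assoc, ← hC₃] at hL
  have hsq := sq_volume_sdiff_rearr_le hN hs0 hs1 hq1 hq2 hw hM hwM hw1 hwE hwm hm0 hm1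
    (by rw [← hγe, ← hΛe]; exact hwle) hδ0 (hΛe ▸ hδ2) (by positivity) hL
  rw [← hγe, ← hΛe, ← hκ] at hsq
  obtain ⟨d, hd⟩ : ∃ d, d = δ ^ (1 / 3 : ℝ) := ⟨_, rfl⟩
  have hd0 : 0 ≤ d := by rw [hd]; positivity
  have hd1 : d ≤ 1 := by rw [hd]; exact Real.rpow_le_one hδ0 hδ3 (by norm_num)
  have hd3 : δ = d ^ 3 := by
    rw [hd, ← Real.rpow_natCast, ← Real.rpow_mul hδ0]; norm_num
  have hδd2 : δ ≤ d ^ 2 := by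
    rw [hd3]; exact pow_le_pow_of_le_one hd0 hd1 (by norm_num)
  have hδd : δ ≤ d := hδd2.trans (by nlinarith)
  rw [← hd] at hsq ⊢
  obtain ⟨a, ha⟩ : ∃ a, a = (volume ({x | 0 < w x} \ {x | 0 < rearr w x})).toReal := ⟨_, rfl⟩
  have hafin : volume ({x | 0 < w x} \ {x | 0 < rearr w x}) ≠ ⊤ :=
    ne_top_of_le_ne_top (hwm ▸ ENNReal.ofReal_ne_top) (measure_mono Set.sdiff_subset)
  rw [← ha] at hsq
  have ha2 : a ≤ √T * d := by
    refine le_of_sq_le_sq ?_ (by positivity)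
    rw [mul_pow, Real.sq_sqrt hT0.le, hT, div_mul_eq_mul_div, le_div_iff₀ hκ0, mul_comm]
    refine hsq.trans ?_
    have h1 : 3 * δ / Λ ≤ 3 / Λ * d ^ 2 := by
      rw [mul_div_right_comm]; gcongr
    calc _ ≤ 2 * (q * M ^ (q - 1) * (C₃ * d)) ^ 2 + 3 / Λ * d ^ 2 := by gcongr
      _ = _ := by ring
  refine ⟨b, fun r hr hr1 => ?_⟩
  have hvmeas : MeasurableSet {x | 0 < v x} := measurableSet_lt measurable_const hv.meas
  have hsub : Ω \ Metric.ball b r ⊆ (Ω \ {x | 0 < v x}) ∪ ({x | 0 < v x} \ Metric.ball b r) := by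
    intro x hx
    by_cases hxv : x ∈ {x | 0 < v x}
    · exact Or.inr ⟨hxv, hx.2⟩
    · exact Or.inl ⟨hx.1, hxv⟩
  have k1 : volume (Ω \ {x | 0 < v x}) ≤ ENNReal.ofReal (C₁ * d) := by
    rw [measure_sdiff (hvf.trans hfΩ) hvmeas.nullMeasurableSet (hvm ▸ ENNReal.ofReal_ne_top),
      hΩ1, hvm, ← ENNReal.ofReal_one, ← ENNReal.ofReal_sub _ hm0.le]
    exact ENNReal.ofReal_le_ofReal (hmC.trans (by gcongr))
  have k2 : volume ({x | 0 < v x} \ Metric.ball b r) ≤ ENNReal.ofReal (√T * d) := by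
    obtain ⟨r₀, hr₀, hB, hBv⟩ := rearr_superlevel hN hw (le_refl 0)
    have hrr : r₀ ≤ r := by
      by_contra hcon
      have := (volume_ball_lt_iff hN hr.le hr₀ b 0).2 (not_le.1 hcon)
      rw [hr1, hBv, hwm] at this
      exact absurd this (not_lt.2 (ENNReal.ofReal_le_one.2 hm1))
    rw [← measure_preimage_add_right volume b ({x | 0 < v x} \ Metric.ball b r)]
    have e1 : (fun x => x + b) ⁻¹' ({x | 0 < v x} \ Metric.ball b r) ⊆
        {x | 0 < w x} \ {x | 0 < rearr w x} := by
      rw [Set.preimage_sdiff, ← hpre, hB]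
      refine Set.sdiff_subset_sdiff_right fun x hx => ?_
      have hx' : ‖x‖ < r₀ := by simpa using hx
      show x + b ∈ Metric.ball b r
      rw [Metric.mem_ball, dist_eq_norm, add_sub_cancel_right]
      linarith
    refine (measure_mono e1).trans ?_
    rw [← ENNReal.ofReal_toReal hafin, ← ha]
    exact ENNReal.ofReal_le_ofReal ha2
  refine (measure_mono hsub).trans ((measure_union_le _ _).trans ?_)
  rw [add_mul, ENNReal.ofReal_add (by positivity) (by positivity)]
  exact add_le_add k1 k2

end Stability

section Mollification

variable {N : ℕ} {s q : ℝ} {f g u w : Eu N → ℝ}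

lemma integrable_mul_comp_sub (hw : Integrable w) (hg : Adm g) (x : Eu N) :
    Integrable fun t => w t * g (x - t) := by
  obtain ⟨M, hM, hgM⟩ := hg.bdd
  have hm : Measurable fun t => g (x - t) := hg.meas.comp (measurable_const.sub measurable_id)
  refine hw.mul_bdd (c := M) hm.aestronglyMeasurable (Eventually.of_forall fun t => ?_)
  rw [Real.norm_of_nonneg (hg.nonneg _)]
  exact hgM _

lemma ofReal_sq_convolution_sub_le (hw : Measurable w) (hw0 : ∀ t, 0 ≤ w t) (hwi : Integrable w)
    (hw1 : ∫ t, w t = 1) (hg : Adm g) (x y : Eu N) :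
    ENNReal.ofReal (((∫ t, w t * g (x - t)) - ∫ t, w t * g (y - t)) ^ 2) ≤
      ∫⁻ t, ENNReal.ofReal (w t) * ENNReal.ofReal ((g (x - t) - g (y - t)) ^ 2) := by
  have hψ : Measurable fun t => ENNReal.ofReal (w t) := hw.ennreal_ofReal
  have hx : Measurable fun t => g (x - t) := hg.meas.comp (measurable_const.sub measurable_id)
  have hy : Measurable fun t => g (y - t) := hg.meas.comp (measurable_const.sub measurable_id)
  have hF : Measurable fun t => ENNReal.ofReal |g (x - t) - g (y - t)| := by
    exact (continuous_abs.measurable.comp (hx.sub hy)).ennreal_ofReal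
  have h1 := sq_lintegral_le ((volume : Measure (Eu N)).withDensity fun t => ENNReal.ofReal (w t))
    hF.aemeasurable
  rw [lintegral_withDensity_eq_lintegral_mul _ hψ hF,
    lintegral_withDensity_eq_lintegral_mul _ hψ (hF.pow_const 2), withDensity_apply _ .univ,
    Measure.restrict_univ, ← ofReal_integral_eq_lintegral_ofReal hwi (Eventually.of_forall hw0),
    hw1, ENNReal.ofReal_one, one_mul] at h1
  have h2 : ENNReal.ofReal |(∫ t, w t * g (x - t)) - ∫ t, w t * g (y - t)| ≤
      ∫⁻ t, ((fun t => ENNReal.ofReal (w t)) * fun t => ENNReal.ofReal |g (x - t) - g (y - t)|) t := by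
    rw [← integral_sub (integrable_mul_comp_sub hwi hg x) (integrable_mul_comp_sub hwi hg y),
      ← Real.norm_eq_abs, ofReal_norm]
    refine (enorm_integral_le_lintegral_enorm _).trans (le_of_eq (lintegral_congr fun t => ?_))
    rw [← mul_sub, ← ofReal_norm, norm_mul, Real.norm_of_nonneg (hw0 t),
      ENNReal.ofReal_mul (hw0 t), Real.norm_eq_abs, Pi.mul_apply]
  rw [← sq_abs, ENNReal.ofReal_pow (abs_nonneg _)]
  refine (pow_le_pow_left' h2 2).trans (h1.trans (le_of_eq (lintegral_congr fun t => ?_)))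
  rw [Pi.mul_apply, ← ENNReal.ofReal_pow (abs_nonneg _), sq_abs]

/-- Averaging translates does not increase the energy. -/
lemma gagliardoSq_convolution_le (hw : Measurable w) (hw0 : ∀ t, 0 ≤ w t) (hwi : Integrable w)
    (hw1 : ∫ t, w t = 1) (hg : Adm g) :
    gagliardoSq N s (fun x => ∫ t, w t * g (x - t)) ≤ gagliardoSq N s g := by
  have hgm := hg.meas
  rw [gagliardoSq_eq, gagliardoSq_eq]
  obtain ⟨H, hH⟩ : ∃ H : Eu N → Eu N → Eu N → ℝ≥0∞, H = fun x y t =>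
    ENNReal.ofReal (w t) * ENNReal.ofReal ((g (x - t) - g (y - t)) ^ 2 * kk N s x y) := ⟨_, rfl⟩
  have hHm : Measurable fun z : (Eu N × Eu N) × Eu N => H z.1.1 z.1.2 z.2 := by
    rw [hH]
    have m1 : Measurable fun z : (Eu N × Eu N) × Eu N => g (z.1.1 - z.2) :=
      hgm.comp ((measurable_fst.comp measurable_fst).sub measurable_snd)
    have m2 : Measurable fun z : (Eu N × Eu N) × Eu N => g (z.1.2 - z.2) :=
      hgm.comp ((measurable_snd.comp measurable_fst).sub measurable_snd)
    have m3 : Measurable fun z : (Eu N × Eu N) × Eu N => kk N s z.1.1 z.1.2 :=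
      measurable_kk.comp measurable_fst
    exact (hw.comp measurable_snd).ennreal_ofReal.mul
      (((m1.sub m2).pow_const 2).mul m3).ennreal_ofReal
  have k1 : (dint fun x y => ((∫ t, w t * g (x - t)) - ∫ t, w t * g (y - t)) ^ 2 * kk N s x y) ≤
      ∫⁻ x, ∫⁻ y, ∫⁻ t, H x y t := by
    unfold dint
    refine lintegral_mono fun x => lintegral_mono fun y => ?_
    rw [ENNReal.ofReal_mul (sq_nonneg _)]
    have m1 : Measurable fun t => ENNReal.ofReal (w t) *
        ENNReal.ofReal ((g (x - t) - g (y - t)) ^ 2) :=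
      hw.ennreal_ofReal.mul ((((hgm.comp (measurable_const.sub measurable_id)).sub
        (hgm.comp (measurable_const.sub measurable_id))).pow_const 2).ennreal_ofReal)
    refine (mul_le_mul_left (ofReal_sq_convolution_sub_le hw hw0 hwi hw1 hg x y) _).trans
      (le_of_eq ?_)
    rw [← lintegral_mul_const _ m1, hH]
    refine lintegral_congr fun t => ?_
    beta_reduce
    rw [ENNReal.ofReal_mul (sq_nonneg _), mul_assoc]
  have k2 : ∫⁻ x, ∫⁻ y, ∫⁻ t, H x y t = ∫⁻ t, ∫⁻ x, ∫⁻ y, H x y t := by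
    have e1 : ∀ x, ∫⁻ y, ∫⁻ t, H x y t = ∫⁻ t, ∫⁻ y, H x y t := fun x =>
      lintegral_lintegral_swap (f := fun y t => H x y t)
        (hHm.comp ((measurable_const.prodMk measurable_fst).prodMk measurable_snd)).aemeasurable
    simp only [e1]
    refine lintegral_lintegral_swap (f := fun x t => ∫⁻ y, H x y t) (Measurable.aemeasurable ?_)
    exact Measurable.lintegral_prod_right' (f := fun z : (Eu N × Eu N) × Eu N => H z.1.1 z.2 z.1.2)
      (hHm.comp (((measurable_fst.comp measurable_fst).prodMk measurable_snd).prodMk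
        (measurable_snd.comp measurable_fst)))
  have k3 : ∀ t, ∫⁻ x, ∫⁻ y, H x y t =
      ENNReal.ofReal (w t) * dint fun x y => (g x - g y) ^ 2 * kk N s x y := by
    intro t
    have e1 := gagliardoSq_comp_add (s := s) (-t) g
    rw [gagliardoSq_eq, gagliardoSq_eq] at e1
    rw [← e1, ← dint_const_mul (hw0 t), hH]
    unfold dint
    refine lintegral_congr fun x => lintegral_congr fun y => ?_
    beta_reduce
    rw [ENNReal.ofReal_mul (hw0 t), sub_eq_add_neg x t, sub_eq_add_neg y t]
  refine k1.trans (k2.trans ?_).le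
  simp only [k3]
  rw [lintegral_mul_const _ hw.ennreal_ofReal,
    ← ofReal_integral_eq_lintegral_ofReal hwi (Eventually.of_forall hw0), hw1, ENNReal.ofReal_one,
    one_mul]

lemma sobolevConst_le (hq : 0 < q) {Ω : Set (Eu N)} (hu : ContDiff ℝ (⊤ : ℕ∞) u)
    (hc : HasCompactSupport u) (hΩ : tsupport u ⊆ Ω) (h1 : (∫ x, |u x| ^ q) = 1) :
    sobolevConst N s q Ω ≤ gagliardoSqR N s u := by
  refine csInf_le ⟨0, ?_⟩ ⟨u, hu, hc, hΩ, ?_, rfl⟩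
  · rintro c ⟨v, -, -, -, -, rfl⟩
    exact ENNReal.toReal_nonneg
  · rw [setIntegral_eq_integral_of_forall_compl_eq_zero, h1]
    intro x hx
    rw [image_eq_zero_of_notMem_tsupport fun h => hx (hΩ h), abs_zero, Real.zero_rpow hq.ne']

lemma sobolevConst_mul_le (hq : 0 < q) {Ω : Set (Eu N)} (hu : ContDiff ℝ (⊤ : ℕ∞) u)
    (hc : HasCompactSupport u) (hΩ : tsupport u ⊆ Ω) {J : ℝ} (hJ : 0 < J)
    (h1 : (∫ x, |u x| ^ q) = J) :
    sobolevConst N s q Ω * J ^ (2 / q) ≤ gagliardoSqR N s u := by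
  obtain ⟨c, hce⟩ : ∃ c, c = J ^ (-(1 / q)) := ⟨_, rfl⟩
  have hc0 : 0 < c := hce ▸ Real.rpow_pos_of_pos hJ _
  have hcq : c ^ q * J = 1 := by
    rw [hce, ← Real.rpow_mul hJ.le, neg_mul, one_div, inv_mul_cancel₀ hq.ne', Real.rpow_neg_one,
      inv_mul_cancel₀ hJ.ne']
  have hc2 : c ^ 2 * J ^ (2 / q) = 1 := by
    rw [hce, ← Real.rpow_natCast, ← Real.rpow_mul hJ.le, ← Real.rpow_add hJ]
    have : -(1 / q) * ((2 : ℕ) : ℝ) + 2 / q = 0 := by push_cast; ring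
    rw [this, Real.rpow_zero]
  have hts : tsupport (fun x => c * u x) ⊆ tsupport u := tsupport_mul_subset_right
  have h2 : (∫ x, |c * u x| ^ q) = 1 := by
    have e1 : ∀ x, |c * u x| ^ q = c ^ q * |u x| ^ q := fun x => by
      rw [abs_mul, abs_of_pos hc0, Real.mul_rpow hc0.le (abs_nonneg _)]
    simp only [e1]
    rw [integral_const_mul, h1, hcq]
  have h3 := sobolevConst_le (s := s) hq (contDiff_const.mul hu)
    (hc.mul_left (f := fun _ => c)) (hts.trans hΩ) h2
  have h4 : gagliardoSqR N s (fun x => c * u x) = c ^ 2 * gagliardoSqR N s u := by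
    unfold gagliardoSqR
    rw [gagliardoSq_const_mul, ENNReal.toReal_mul, ENNReal.toReal_ofReal (sq_nonneg c)]
  rw [h4] at h3
  calc sobolevConst N s q Ω * J ^ (2 / q) ≤ c ^ 2 * gagliardoSqR N s u * J ^ (2 / q) := by gcongr
    _ = (c ^ 2 * J ^ (2 / q)) * gagliardoSqR N s u := by ring
    _ = _ := by rw [hc2, one_mul]

end Mollification

section BallConstant

variable {N : ℕ} {s q : ℝ} {f g : Eu N → ℝ}

lemma exists_mollifier_seq {d : ℝ} (hd : 0 < d) :
    ∃ φ : ℕ → ContDiffBump (0 : Eu N), (∀ n, (φ n).rOut ≤ d) ∧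
      Tendsto (fun n => (φ n).rOut) atTop (𝓝 0) ∧ ∀ n, (φ n).rOut ≤ 2 * (φ n).rIn := by
  have hp : ∀ n : ℕ, 0 < d / ((n : ℝ) + 1) := fun n => by positivity
  refine ⟨fun n => ⟨d / ((n : ℝ) + 1) / 2, d / ((n : ℝ) + 1), half_pos (hp n),
    half_lt_self (hp n)⟩, fun n => ?_, ?_, fun n => ?_⟩
  · exact div_le_self hd.le (by linarith [(Nat.cast_nonneg n : (0 : ℝ) ≤ n)])
  · have := (tendsto_one_div_add_atTop_nhds_zero_nat (𝕜 := ℝ)).const_mul d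
    rw [mul_zero] at this
    exact this.congr fun n => by ring
  · exact (by linarith : d / ((n : ℝ) + 1) ≤ 2 * (d / ((n : ℝ) + 1) / 2))

set_option maxHeartbeats 1000000 in
lemma sobolevConst_ball_mul_le (hq1 : 1 ≤ q) (hg : Adm g) {r r' : ℝ} (hr : r' < r)
    (hz : ∀ x, r' ≤ ‖x‖ → g x = 0) (hE : gagliardoSq N s g ≠ ⊤) (hJ : 0 < ∫ x, g x ^ q)
    (x₀ : Eu N) :
    sobolevConst N s q (Metric.ball x₀ r) * (∫ x, g x ^ q) ^ (2 / q) ≤ gagliardoSqR N s g := by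
  have hq : 0 < q := by linarith
  obtain ⟨M, hM, hgM⟩ := hg.bdd
  obtain ⟨φ, hφd, hφ0, hφK⟩ := exists_mollifier_seq (N := N) (half_pos (sub_pos.2 hr))
  have hgl : LocallyIntegrable g volume := hg.integrable.locallyIntegrable
  obtain ⟨v, hv⟩ : ∃ v : ℕ → Eu N → ℝ, v = fun n x => ∫ t, (φ n).normed volume t * g (x - t) :=
    ⟨_, rfl⟩
  have hvc : ∀ n, v n = convolution ((φ n).normed volume) g (ContinuousLinearMap.lsmul ℝ ℝ)
      volume := by
    intro n
    rw [hv]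
    rfl
  have hv0 : ∀ n x, 0 ≤ v n x := fun n x => by
    rw [hv]
    exact integral_nonneg fun t => mul_nonneg ((φ n).nonneg_normed t) (hg.nonneg _)
  have hvM : ∀ n x, v n x ≤ M := fun n x => by
    rw [hv]
    calc ∫ t, (φ n).normed volume t * g (x - t) ≤ ∫ t, (φ n).normed volume t * M :=
          integral_mono (integrable_mul_comp_sub (φ n).integrable_normed hg x)
            ((φ n).integrable_normed.mul_const M)
            fun t => mul_le_mul_of_nonneg_left (hgM _) ((φ n).nonneg_normed t)
      _ = M := by rw [integral_mul_const, (φ n).integral_normed, one_mul]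
  have hvz : ∀ n x, (r' + r) / 2 ≤ ‖x‖ → v n x = 0 := fun n x hx => by
    rw [hv]
    refine integral_eq_zero_of_ae (Eventually.of_forall fun t => ?_)
    by_cases ht : t ∈ Metric.ball (0 : Eu N) (φ n).rOut
    · have h1 : ‖t‖ < (φ n).rOut := mem_ball_zero_iff.1 ht
      have h2 := norm_sub_norm_le x t
      have h3 := hφd n
      have : g (x - t) = 0 := hz _ (by linarith)
      simp [this]
    · have : (φ n).normed volume t = 0 := by
        rw [← Function.notMem_support, (φ n).support_normed_eq]
        exact ht
      simp [this]
  have hvs : ∀ n, ContDiff ℝ (⊤ : ℕ∞) (v n) := fun n => by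
    rw [hvc]
    exact (φ n).hasCompactSupport_normed.contDiff_convolution_left _ (φ n).contDiff_normed hgl
  have hvE : ∀ n, gagliardoSq N s (v n) ≤ gagliardoSq N s g := fun n => by
    rw [hv]
    exact gagliardoSq_convolution_le (φ n).continuous_normed.measurable (φ n).nonneg_normed
      (φ n).integrable_normed (φ n).integral_normed hg
  have hlim : Tendsto (fun n => ∫ x, v n x ^ q) atTop (𝓝 (∫ x, g x ^ q)) := by
    refine tendsto_integral_of_dominated_convergence
      ((Metric.closedBall (0 : Eu N) ((r' + r) / 2)).indicator fun _ => M ^ q) (fun n => ?_) ?_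
      (fun n => Eventually.of_forall fun x => ?_) ?_
    · exact ((hvs n).continuous.measurable.pow_const q).aestronglyMeasurable
    · exact (integrableOn_const (Metric.isCompact_iff_isClosed_bounded.2
        ⟨Metric.isClosed_closedBall, Metric.isBounded_closedBall⟩).measure_lt_top.ne).integrable_indicator
        Metric.isClosed_closedBall.measurableSet
    · rw [Real.norm_of_nonneg (Real.rpow_nonneg (hv0 n x) q)]
      by_cases hx : x ∈ Metric.closedBall (0 : Eu N) ((r' + r) / 2)
      · rw [Set.indicator_of_mem hx]
        exact Real.rpow_le_rpow (hv0 n x) (hvM n x) hq.le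
      · rw [Set.indicator_of_notMem hx, hvz n x, Real.zero_rpow hq.ne']
        rw [mem_closedBall_zero_iff] at hx
        exact (not_le.1 hx).le
    · have := ContDiffBump.ae_convolution_tendsto_right_of_locallyIntegrable
        (μ := (volume : Measure (Eu N))) hφ0 (Eventually.of_forall hφK) hgl
      filter_upwards [this] with x hx
      simp only [← hvc] at hx
      exact hx.rpow_const (Or.inr hq.le)
  have hev : ∀ᶠ n in atTop, sobolevConst N s q (Metric.ball x₀ r) * (∫ x, v n x ^ q) ^ (2 / q) ≤
      gagliardoSqR N s g := by
    filter_upwards [hlim.eventually (lt_mem_nhds hJ)] with n hn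
    have hzero : ∀ x, x ∉ Metric.closedBall x₀ ((r' + r) / 2) → v n (x + -x₀) = 0 := by
      intro x hx
      rw [Metric.mem_closedBall, dist_eq_norm, not_le, sub_eq_add_neg] at hx
      exact hvz n _ hx.le
    have hcpt : IsCompact (Metric.closedBall x₀ ((r' + r) / 2)) := isCompact_closedBall _ _
    have h1 : tsupport (fun x => v n (x + -x₀)) ⊆ Metric.closedBall x₀ ((r' + r) / 2) := by
      refine closure_minimal (fun x hx => ?_) Metric.isClosed_closedBall
      by_contra h
      exact hx (hzero x h)
    have h2 : (∫ x, |v n (x + -x₀)| ^ q) = ∫ x, v n x ^ q := by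
      rw [integral_add_right_eq_self (fun x => |v n x| ^ q) (-x₀)]
      simp only [abs_of_nonneg (hv0 n _)]
    have h3 := sobolevConst_mul_le (s := s) hq (u := fun x => v n (x + -x₀))
      (Ω := Metric.ball x₀ r) ((hvs n).comp (contDiff_id.add contDiff_const))
      (HasCompactSupport.intro hcpt hzero)
      (h1.trans (Metric.closedBall_subset_ball (by linarith))) hn h2
    refine h3.trans ?_
    unfold gagliardoSqR
    rw [gagliardoSq_comp_add]
    exact ENNReal.toReal_mono hE (hvE n)
  exact le_of_tendsto ((hlim.rpow_const (Or.inr (by positivity))).const_mul _) hev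

lemma integral_comp_smul_rpow {ρ : ℝ} (hρ : 0 < ρ) (f : Eu N → ℝ) :
    (∫ x, f (ρ • x) ^ q) = (ρ ^ N)⁻¹ * ∫ x, f x ^ q := by
  rw [Measure.integral_comp_smul volume (fun x => f x ^ q) ρ, finrank_euclideanSpace_fin,
    abs_of_pos (by positivity), smul_eq_mul]

lemma gagliardoSqR_comp_smul {ρ : ℝ} (hρ : 0 < ρ) (f : Eu N → ℝ) :
    gagliardoSqR N s (fun x => f (ρ • x)) = ρ ^ (2 * s - N) * gagliardoSqR N s f := by
  unfold gagliardoSqR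
  rw [gagliardoSq_comp_smul hρ, ENNReal.toReal_mul,
    ENNReal.toReal_ofReal (Real.rpow_nonneg hρ.le _)]

set_option maxHeartbeats 1000000 in
lemma sobolevConst_ball_le_of_adm (hN : 2 ≤ N) (hs0 : 0 < s) (hs1 : s < 1) (hq1 : 1 ≤ q)
    (hf : Adm f) (hv : volume {x | 0 < f x} ≤ 1) (hf1 : (∫ x, f x ^ q) = 1)
    (hE : gagliardoSq N s f ≠ ⊤) (x₀ : Eu N) {r : ℝ} (hr : 0 < r) :
    (volume (Metric.ball x₀ r)).toReal ^ (2 / q - 1 + 2 * s / N) *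
      sobolevConst N s q (Metric.ball x₀ r) ≤ gagliardoSqR N s f := by
  have hq : 0 < q := by linarith
  have hom := om_pos (N := N)
  have hN0 : (N : ℝ) ≠ 0 := by positivity
  have hgE : gagliardoSq N s (rearr f) ≠ ⊤ := ne_top_of_le_ne_top hE (gagliardoSq_rearr_le hN hs0 hf)
  have hgER : gagliardoSqR N s (rearr f) ≤ gagliardoSqR N s f :=
    ENNReal.toReal_mono hE (gagliardoSq_rearr_le hN hs0 hf)
  have hg1 : (∫ x, rearr f x ^ q) = 1 := (integral_rearr_rpow hN hf hq).trans hf1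
  have hgA : Adm (rearr f) := hf.rearr hN
  obtain ⟨ρ, hρ, hρs, hρv⟩ := rearr_superlevel hN hf le_rfl
  rw [← hρv, volume_ball_eq hN _ hρ, ENNReal.ofReal_le_one] at hv
  have hzg : ∀ x, ρ ≤ ‖x‖ → rearr f x = 0 := fun x hx => by
    refine le_antisymm (not_lt.1 fun h => ?_) (hgA.nonneg x)
    have h' : x ∈ Metric.ball (0 : Eu N) ρ := hρs ▸ h
    rw [mem_ball_zero_iff] at h'
    linarith
  obtain ⟨S, hS⟩ : ∃ S, S = sobolevConst N s q (Metric.ball x₀ r) := ⟨_, rfl⟩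
  obtain ⟨γ, hγ⟩ : ∃ γ, γ = 2 / q - 1 + 2 * s / N := ⟨_, rfl⟩
  have hvr : (volume (Metric.ball x₀ r)).toReal = om N * r ^ N := by
    rw [volume_ball_eq hN _ hr.le, ENNReal.toReal_ofReal (by positivity)]
  rw [hvr, ← hS, ← hγ]
  have key : ∀ η : ℝ, 0 < η → η < 1 → (η ^ N * (om N * r ^ N)) ^ γ * S ≤ gagliardoSqR N s f := by
    intro η hη hη1
    obtain ⟨r1, hr1, hr1v⟩ := exists_ball_volume hN (m := 1) ENNReal.one_ne_top
    have hr1o : om N * r1 ^ N = 1 := by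
      have := hr1v 0
      rwa [volume_ball_eq hN _ hr1, ENNReal.ofReal_eq_one] at this
    have hr1p : 0 < r1 := by
      rcases hr1.eq_or_lt with h | h
      · rw [← h, zero_pow (by lia), mul_zero] at hr1o
        exact absurd hr1o zero_ne_one
      · exact h
    have hρ1 : ρ ≤ r1 := by
      have : ρ ^ N ≤ r1 ^ N := by
        rw [← hr1o] at hv
        exact le_of_mul_le_mul_left hv hom
      exact (pow_le_pow_iff_left₀ hρ hr1 (by lia)).1 this
    obtain ⟨κ, hκ⟩ : ∃ κ, κ = η * r / r1 := ⟨_, rfl⟩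
    have hκ0 : 0 < κ := by rw [hκ]; positivity
    have hκN : κ ^ N = η ^ N * (om N * r ^ N) := by
      have h1 : κ * r1 = η * r := by rw [hκ]; field_simp
      have h2 : κ ^ N * r1 ^ N = η ^ N * r ^ N := by rw [← mul_pow, h1, mul_pow]
      calc κ ^ N = (om N * r1 ^ N) * κ ^ N := by rw [hr1o, one_mul]
        _ = om N * (κ ^ N * r1 ^ N) := by ring
        _ = _ := by rw [h2]; ring
    have hInt : (∫ x, rearr f (κ⁻¹ • x) ^ q) = κ ^ N := by
      rw [integral_comp_smul_rpow (inv_pos.2 hκ0), hg1, mul_one, inv_pow, inv_inv]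
    have hzk : ∀ x, η * r ≤ ‖x‖ → rearr f (κ⁻¹ • x) = 0 := fun x hx => by
      refine hzg _ (hρ1.trans ?_)
      rw [norm_smul, Real.norm_of_nonneg (inv_nonneg.2 hκ0.le), inv_mul_eq_div, le_div_iff₀ hκ0]
      calc r1 * κ = η * r := by rw [hκ]; field_simp
        _ ≤ _ := hx
    have hEk : gagliardoSq N s (fun x => rearr f (κ⁻¹ • x)) ≠ ⊤ := by
      rw [gagliardoSq_comp_smul (inv_pos.2 hκ0)]
      exact ENNReal.mul_ne_top ENNReal.ofReal_ne_top hgE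
    have h1 := sobolevConst_ball_mul_le (s := s) hq1 (hgA.comp_smul (inv_pos.2 hκ0))
      (by nlinarith : η * r < r) hzk hEk (by rw [hInt]; positivity) x₀
    rw [hInt, ← hS, gagliardoSqR_comp_smul (inv_pos.2 hκ0)] at h1
    have h2 : (κ ^ N) ^ γ = (κ ^ N) ^ (2 / q) * κ ^ (2 * s - N) := by
      rw [← Real.rpow_natCast, ← Real.rpow_mul hκ0.le, ← Real.rpow_mul hκ0.le,
        ← Real.rpow_add hκ0, hγ]
      congr 1
      field_simp
      ring
    have h3 : κ ^ (2 * s - N) * (κ⁻¹) ^ (2 * s - N) = 1 := by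
      rw [← Real.mul_rpow hκ0.le (inv_nonneg.2 hκ0.le), mul_inv_cancel₀ hκ0.ne', Real.one_rpow]
    rw [← hκN, h2]
    refine le_trans ?_ hgER
    calc (κ ^ N) ^ (2 / q) * κ ^ (2 * s - N) * S = κ ^ (2 * s - N) * (S * (κ ^ N) ^ (2 / q)) := by
          ring
      _ ≤ κ ^ (2 * s - N) * ((κ⁻¹) ^ (2 * s - N) * gagliardoSqR N s (rearr f)) :=
          mul_le_mul_of_nonneg_left h1 (Real.rpow_nonneg hκ0.le _)
      _ = (κ ^ (2 * s - N) * (κ⁻¹) ^ (2 * s - N)) * gagliardoSqR N s (rearr f) := by ring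
      _ = _ := by rw [h3, one_mul]
  have hlim : Tendsto (fun η : ℝ => (η ^ N * (om N * r ^ N)) ^ γ * S) (𝓝[<] 1)
      (𝓝 ((om N * r ^ N) ^ γ * S)) := by
    have h1 : Tendsto (fun η : ℝ => η ^ N * (om N * r ^ N)) (𝓝[<] 1) (𝓝 (om N * r ^ N)) := by
      have h2 : Continuous fun η : ℝ => η ^ N * (om N * r ^ N) := by fun_prop
      have h3 := h2.tendsto 1
      rw [one_pow, one_mul] at h3
      exact h3.mono_left nhdsWithin_le_nhds
    exact (h1.rpow_const (Or.inl (by positivity))).mul_const S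
  refine le_of_tendsto hlim ?_
  filter_upwards [Ioo_mem_nhdsLT (zero_lt_one' ℝ)] with η hη
  exact key η hη.1 hη.2

/-- The normalized constant of a ball is at most the infimum over admissible functions. -/
lemma sobolevConst_ball_le_lamR (hN : 2 ≤ N) (hs0 : 0 < s) (hs1 : s < 1) (hq1 : 1 ≤ q)
    (x₀ : Eu N) {r : ℝ} (hr : 0 < r) :
    (volume (Metric.ball x₀ r)).toReal ^ (2 / q - 1 + 2 * s / N) *
      sobolevConst N s q (Metric.ball x₀ r) ≤ lamR N s q := by
  refine (ENNReal.ofReal_le_iff_le_toReal (lam_lt_top hN hs0 hs1 hq1).ne).1 (le_sInf ?_)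
  rintro E ⟨f, hf, hv, h1, rfl⟩
  by_cases hE : gagliardoSq N s f = ⊤
  · rw [hE]
    exact le_top
  rw [hf.lintegral_rpow (by linarith), ENNReal.ofReal_eq_one] at h1
  exact ENNReal.ofReal_le_of_le_toReal (sobolevConst_ball_le_of_adm hN hs0 hs1 hq1 hf hv h1 hE x₀ hr)

end BallConstant

section Assembly

variable {N : ℕ} {s q : ℝ} {f u : Eu N → ℝ}

lemma asym_nonneg (Ω : Set (Eu N)) : 0 ≤ asym N Ω := by
  refine Real.sInf_nonneg ?_
  rintro c ⟨x, r, -, -, rfl⟩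
  positivity

lemma asym_le_of_ball {Ω : Set (Eu N)} (hΩ : MeasurableSet Ω) (hf : volume Ω ≠ ⊤) {z : Eu N} {r : ℝ}
    (hr : 0 < r) (hv : volume (Metric.ball z r) = volume Ω) :
    asym N Ω ≤ 2 * (volume (Ω \ Metric.ball z r)).toReal / (volume Ω).toReal := by
  have hB : MeasurableSet (Metric.ball z r) := Metric.isOpen_ball.measurableSet
  have h1 : volume (symmDiff Ω (Metric.ball z r)) =
      volume (Ω \ Metric.ball z r) + volume (Metric.ball z r \ Ω) :=
    measure_symmDiff_eq hΩ.nullMeasurableSet hB.nullMeasurableSet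
  have h2 : volume (Metric.ball z r \ Ω) = volume (Ω \ Metric.ball z r) := by
    have e1 := measure_inter_add_sdiff (μ := (volume : Measure (Eu N))) Ω hB
    have e2 := measure_inter_add_sdiff (μ := (volume : Measure (Eu N))) (Metric.ball z r) hΩ
    rw [Set.inter_comm, hv, ← e1] at e2
    exact (ENNReal.add_right_inj
      (ne_top_of_le_ne_top hf (measure_mono Set.inter_subset_left))).1 e2
  have h3 : (volume (symmDiff Ω (Metric.ball z r))).toReal =
      2 * (volume (Ω \ Metric.ball z r)).toReal := by
    rw [h1, h2, ← two_mul, ENNReal.toReal_mul, ENNReal.toReal_ofNat]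
  refine csInf_le ⟨0, ?_⟩ ⟨z, r, hr, hv, by rw [h3]⟩
  rintro c ⟨x, r, -, -, rfl⟩
  positivity

lemma exists_ball_volume_pos (hN : 2 ≤ N) {m : ℝ≥0∞} (hm : m ≠ ⊤) (hm0 : 0 < m) :
    ∃ r, 0 < r ∧ ∀ x : Eu N, volume (Metric.ball x r) = m := by
  obtain ⟨r, hr, hv⟩ := exists_ball_volume hN hm
  refine ⟨r, hr.lt_of_ne ?_, hv⟩
  rintro rfl
  have := hv 0
  rw [Metric.ball_zero, measure_empty] at this
  exact hm0.ne this

lemma asym_le_two (hN : 2 ≤ N) {Ω : Set (Eu N)} (hΩ : MeasurableSet Ω) (hf : volume Ω ≠ ⊤)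
    (h0 : 0 < volume Ω) : asym N Ω ≤ 2 := by
  obtain ⟨r, hr, hv⟩ := exists_ball_volume_pos hN hf h0
  refine (asym_le_of_ball hΩ hf hr (hv 0)).trans ?_
  rw [div_le_iff₀ (ENNReal.toReal_pos h0.ne' hf)]
  gcongr
  exact Set.sdiff_subset

lemma adm_abs_of_continuous (hu : Continuous u) (hc : HasCompactSupport u) :
    Adm fun x => |u x| := by
  obtain ⟨M, hM⟩ := hu.bounded_above_of_compact_support hc
  obtain ⟨R, hR⟩ := hc.isBounded.subset_closedBall (0 : Eu N)
  refine ⟨hu.abs.measurable, fun x => abs_nonneg _, ⟨max M 1, by positivity, fun x => ?_⟩,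
    ⟨max R 1, by positivity, fun x hx => ?_⟩⟩
  · exact (hM x).trans (le_max_left _ _)
  · rw [image_eq_zero_of_notMem_tsupport (f := u), abs_zero]
    intro h
    have := mem_closedBall_zero_iff.1 (hR h)
    exact absurd (this.trans (le_max_left _ _)) (not_le.2 hx)

lemma volume_preimage_smul {ρ : ℝ} (hρ : 0 < ρ) (S : Set (Eu N)) :
    volume ((fun x : Eu N => ρ • x) ⁻¹' S) = ENNReal.ofReal (ρ ^ N)⁻¹ * volume S := by
  have := Measure.addHaar_preimage_smul (volume : Measure (Eu N)) hρ.ne' S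
  rwa [finrank_euclideanSpace_fin, abs_of_pos (by positivity)] at this

lemma preimage_smul_ball {ρ : ℝ} (hρ : 0 < ρ) (z : Eu N) (r : ℝ) :
    (fun x : Eu N => ρ • x) ⁻¹' Metric.ball (ρ • z) (ρ * r) = Metric.ball z r := by
  ext x
  rw [Set.mem_preimage, Metric.mem_ball, Metric.mem_ball, dist_smul₀, Real.norm_of_nonneg hρ.le,
    mul_lt_mul_iff_right₀ hρ]

/-- Rescaling a test function to a set of unit volume. -/
lemma exists_rescaled_test (hN : 2 ≤ N) (hs0 : 0 < s) (hs1 : s < 1) (hq : 0 < q)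
    {Ω : Set (Eu N)} {ρ : ℝ} (hρ : 0 < ρ) (hV : volume Ω = ENNReal.ofReal (ρ ^ N))
    (hu : ContDiff ℝ (⊤ : ℕ∞) u) (hc : HasCompactSupport u) (hsupp : tsupport u ⊆ Ω)
    (h1 : (∫ x in Ω, |u x| ^ q) = 1) :
    ∃ f : Eu N → ℝ, Adm f ∧ {x | 0 < f x} ⊆ (fun x : Eu N => ρ • x) ⁻¹' Ω ∧
      (∫ x, f x ^ q) = 1 ∧ gagliardoSq N s f ≠ ⊤ ∧
      gagliardoSqR N s f ≤ (volume Ω).toReal ^ (2 / q - 1 + 2 * s / N) * gagliardoSqR N s u := by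
  have hN0 : (N : ℝ) ≠ 0 := by positivity
  have hu0 : ∀ x, x ∉ Ω → u x = 0 := fun x hx => image_eq_zero_of_notMem_tsupport fun h => hx (hsupp h)
  have hA := adm_abs_of_continuous hu.continuous hc
  have h2 : (∫ x, |u x| ^ q) = 1 := by
    rw [← h1, setIntegral_eq_integral_of_forall_compl_eq_zero]
    intro x hx
    rw [hu0 x hx, abs_zero, Real.zero_rpow hq.ne']
  have h3 : (∫ x, |u (ρ • x)| ^ q) = (ρ ^ N)⁻¹ := by
    rw [integral_comp_smul_rpow hρ (fun x => |u x|), h2, mul_one]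
  have hEu := (gagliardoSq_lt_top_of_smooth hN hs0 hs1 hu hc).ne
  have hEa : gagliardoSq N s (fun x => |u x|) ≠ ⊤ := ne_top_of_le_ne_top hEu (gagliardoSq_abs_le u)
  have hEd : gagliardoSq N s (fun x => |u (ρ • x)|) ≠ ⊤ := by
    rw [gagliardoSq_comp_smul hρ fun x => |u x|]
    exact ENNReal.mul_ne_top ENNReal.ofReal_ne_top hEa
  obtain ⟨c, hc0, -, hcA, hc1, hcE⟩ := (hA.comp_smul hρ).normalize hq
    (by positivity : 0 < (ρ ^ N)⁻¹) h3
  refine ⟨_, hcA, fun x hx => ?_, hc1, ?_, ?_⟩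
  · have hx' : 0 < c * |u (ρ • x)| := hx
    by_contra h
    rw [hu0 (ρ • x) h, abs_zero, mul_zero] at hx'
    exact lt_irrefl _ hx'
  · rw [gagliardoSq_const_mul]
    exact ENNReal.mul_ne_top ENNReal.ofReal_ne_top hEd
  · have h4 := hcE s
    rw [gagliardoSqR_comp_smul hρ fun x => |u x|] at h4
    have h5 : gagliardoSqR N s (fun x => |u x|) ≤ gagliardoSqR N s u :=
      ENNReal.toReal_mono hEu (gagliardoSq_abs_le u)
    have h6 : ((ρ ^ N)⁻¹) ^ (2 / q) * (ρ ^ N) ^ (2 / q) = 1 := by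
      rw [← Real.mul_rpow (by positivity) (by positivity), inv_mul_cancel₀ (by positivity),
        Real.one_rpow]
    have h7 : (ρ ^ N) ^ (2 / q - 1 + 2 * s / N) = (ρ ^ N) ^ (2 / q) * ρ ^ (2 * s - N) := by
      rw [← Real.rpow_natCast, ← Real.rpow_mul hρ.le, ← Real.rpow_mul hρ.le, ← Real.rpow_add hρ]
      congr 1
      field_simp
      ring
    rw [hV, ENNReal.toReal_ofReal (by positivity), h7]
    calc (gagliardoSqR N s fun x => c * |u (ρ • x)|)
        = ((gagliardoSqR N s fun x => c * |u (ρ • x)|) * ((ρ ^ N)⁻¹) ^ (2 / q)) *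
          (ρ ^ N) ^ (2 / q) := by rw [mul_assoc, h6, mul_one]
      _ = (ρ ^ N) ^ (2 / q) * ρ ^ (2 * s - N) * gagliardoSqR N s (fun x => |u x|) := by
          rw [h4]; ring
      _ ≤ _ := by gcongr

lemma asym_le_of_rescaled (hN : 2 ≤ N) {Ω : Set (Eu N)} (hΩ : MeasurableSet Ω) {ρ : ℝ} (hρ : 0 < ρ)
    (hV : volume Ω = ENNReal.ofReal (ρ ^ N)) {z : Eu N} {b : ℝ} (hb : 0 ≤ b)
    (h : ∀ r, 0 < r → volume (Metric.ball z r) = 1 →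
      volume ((fun x : Eu N => ρ • x) ⁻¹' Ω \ Metric.ball z r) ≤ ENNReal.ofReal b) :
    asym N Ω ≤ 2 * b := by
  obtain ⟨r, hr, hv⟩ := exists_ball_volume_pos hN (m := 1) ENNReal.one_ne_top one_pos
  have hρN : 0 < ρ ^ N := by positivity
  have hsc : ∀ S : Set (Eu N), volume S =
      ENNReal.ofReal (ρ ^ N) * volume ((fun x : Eu N => ρ • x) ⁻¹' S) := fun S => by
    rw [volume_preimage_smul hρ, ← mul_assoc, ← ENNReal.ofReal_mul hρN.le,
      mul_inv_cancel₀ hρN.ne', ENNReal.ofReal_one, one_mul]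
  have hB : volume (Metric.ball (ρ • z) (ρ * r)) = volume Ω := by
    rw [hsc, preimage_smul_ball hρ, hv, mul_one, hV]
  refine (asym_le_of_ball hΩ (by rw [hV]; exact ENNReal.ofReal_ne_top) (mul_pos hρ hr) hB).trans ?_
  rw [hsc (Ω \ _), Set.preimage_sdiff, preimage_smul_ball hρ, hV, ENNReal.toReal_mul,
    ENNReal.toReal_ofReal hρN.le, div_le_iff₀ hρN]
  have h2 : (volume ((fun x : Eu N => ρ • x) ⁻¹' Ω \ Metric.ball z r)).toReal ≤ b :=
    ENNReal.toReal_le_of_le_ofReal hb (h r hr (hv z))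
  calc 2 * (ρ ^ N * (volume ((fun x : Eu N => ρ • x) ⁻¹' Ω \ Metric.ball z r)).toReal)
      ≤ 2 * (ρ ^ N * b) := by gcongr
    _ = _ := by ring

lemma exists_radius_volume (hN : 2 ≤ N) {m : ℝ≥0∞} (hm : m ≠ ⊤) (hm0 : 0 < m) :
    ∃ ρ : ℝ, 0 < ρ ∧ m = ENNReal.ofReal (ρ ^ N) := by
  have h : 0 < m.toReal := ENNReal.toReal_pos hm0.ne' hm
  refine ⟨m.toReal ^ ((N : ℝ)⁻¹), Real.rpow_pos_of_pos h _, ?_⟩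
  rw [Real.rpow_inv_natCast_pow h.le (by lia), ENNReal.ofReal_toReal hm]

/-- Deficit bound for a single test function. -/
lemma exists_deficit_const (hN : 2 ≤ N) (hs0 : 0 < s) (hs1 : s < 1) (hq1 : 1 ≤ q)
    (hq2 : q < 2 * N / ((N : ℝ) - 2 * s)) :
    ∃ c : ℝ, 0 < c ∧ ∀ Ω : Set (Eu N), IsOpen Ω → volume Ω ≠ ⊤ → 0 < volume Ω →
      ∀ u : Eu N → ℝ, ContDiff ℝ (⊤ : ℕ∞) u → HasCompactSupport u → tsupport u ⊆ Ω →
        (∫ x in Ω, |u x| ^ q) = 1 →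
        lamR N s q + c * asym N Ω ^ 3 ≤
          (volume Ω).toReal ^ (2 / q - 1 + 2 * s / N) * gagliardoSqR N s u := by
  have hq : 0 < q := by linarith
  obtain ⟨δ₀, hδ₀, C, hC, key⟩ := exists_center_of_almost_minimal hN hs0 hs1 hq1 hq2
  refine ⟨min (1 / (8 * C ^ 3)) (δ₀ / 8), by positivity, ?_⟩
  intro Ω hΩ hf h0 u hu hc hsupp h1
  obtain ⟨ρ, hρ, hV⟩ := exists_radius_volume hN hf h0
  obtain ⟨f, hA, hpos, hf1, hE, hle⟩ := exists_rescaled_test hN hs0 hs1 hq hρ hV hu hc hsupp h1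
  have hρN : 0 < ρ ^ N := by positivity
  have hV' : volume ((fun x : Eu N => ρ • x) ⁻¹' Ω) = 1 := by
    rw [volume_preimage_smul hρ, hV, ← ENNReal.ofReal_mul (by positivity),
      inv_mul_cancel₀ hρN.ne', ENNReal.ofReal_one]
  have hl : lamR N s q ≤ gagliardoSqR N s f := by
    have := lamR_le (m := 1) hN hq1 hA hE one_pos
      (by rw [ENNReal.ofReal_one, ← hV']; exact measure_mono hpos)
    rwa [hf1, Real.one_rpow, Real.one_rpow, mul_one, one_mul] at this
  refine le_trans ?_ hle
  obtain ⟨δ, hδ⟩ : ∃ δ, δ = gagliardoSqR N s f - lamR N s q := ⟨_, rfl⟩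
  have hδ0 : 0 ≤ δ := by linarith
  have ha := asym_nonneg Ω
  suffices min (1 / (8 * C ^ 3)) (δ₀ / 8) * asym N Ω ^ 3 ≤ δ by linarith
  rcases le_total δ δ₀ with h | h
  · obtain ⟨z, hz⟩ := key f δ ((fun x : Eu N => ρ • x) ⁻¹' Ω) hA
      (hΩ.measurableSet.preimage (measurable_const_smul ρ)) hV' hpos hf1 hE h (by linarith)
    have h2 := asym_le_of_rescaled hN hΩ.measurableSet hρ hV
      (by positivity : 0 ≤ C * δ ^ (1 / 3 : ℝ)) hz
    have h3 : (δ ^ (1 / 3 : ℝ)) ^ 3 = δ := by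
      rw [← Real.rpow_natCast, ← Real.rpow_mul hδ0]
      norm_num
    calc min (1 / (8 * C ^ 3)) (δ₀ / 8) * asym N Ω ^ 3
        ≤ (1 / (8 * C ^ 3)) * (2 * (C * δ ^ (1 / 3 : ℝ))) ^ 3 :=
          mul_le_mul (min_le_left _ _) (pow_le_pow_left₀ ha h2 3) (by positivity) (by positivity)
      _ = (1 / (8 * C ^ 3)) * (8 * C ^ 3) * (δ ^ (1 / 3 : ℝ)) ^ 3 := by ring
      _ = δ := by rw [h3]; field_simp
  · calc min (1 / (8 * C ^ 3)) (δ₀ / 8) * asym N Ω ^ 3 ≤ (δ₀ / 8) * 2 ^ 3 :=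
          mul_le_mul (min_le_right _ _)
            (pow_le_pow_left₀ ha (asym_le_two hN hΩ.measurableSet hf h0) 3) (by positivity)
            (by positivity)
      _ = δ₀ := by ring
      _ ≤ δ := h

lemma exists_test_function (hq : 0 < q) {Ω : Set (Eu N)} (hΩ : IsOpen Ω) (h0 : 0 < volume Ω) :
    ∃ u : Eu N → ℝ, ContDiff ℝ (⊤ : ℕ∞) u ∧ HasCompactSupport u ∧ tsupport u ⊆ Ω ∧
      (∫ x in Ω, |u x| ^ q) = 1 := by
  obtain ⟨x, hx⟩ := nonempty_of_measure_ne_zero h0.ne'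
  obtain ⟨ε, hε, hεΩ⟩ := Metric.isOpen_iff.1 hΩ x hx
  obtain ⟨φ, hφ⟩ : ∃ φ : ContDiffBump x, φ.rOut = ε / 2 :=
    ⟨⟨ε / 4, ε / 2, by positivity, by linarith⟩, rfl⟩
  have hts : tsupport φ ⊆ Ω := by
    rw [φ.tsupport_eq, hφ]
    exact (Metric.closedBall_subset_ball (by linarith)).trans hεΩ
  have hA : Adm φ := by
    have := adm_abs_of_continuous φ.continuous φ.hasCompactSupport
    simpa only [abs_of_nonneg φ.nonneg] using this
  have hJ : 0 < ∫ y, φ y ^ q := by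
    refine Continuous.integral_pos_of_hasCompactSupport_nonneg_nonzero (x := x)
      (φ.continuous.rpow_const fun y => Or.inr hq.le) ?_ (fun y => Real.rpow_nonneg φ.nonneg q) ?_
    · exact φ.hasCompactSupport.comp_left (g := fun t : ℝ => t ^ q) (Real.zero_rpow hq.ne')
    · rw [φ.one_of_mem_closedBall (Metric.mem_closedBall_self φ.rIn_pos.le), Real.one_rpow]
      exact one_ne_zero
  obtain ⟨c, hc, -, -, h1, -⟩ := hA.normalize hq hJ rfl
  have hts' : tsupport (fun y => c * φ y) ⊆ Ω := (tsupport_mul_subset_right).trans hts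
  refine ⟨fun y => c * φ y, contDiff_const.mul φ.contDiff, φ.hasCompactSupport.mul_left, hts', ?_⟩
  rw [setIntegral_eq_integral_of_forall_compl_eq_zero, ← h1]
  · simp only [abs_of_nonneg (mul_nonneg hc.le φ.nonneg)]
  · intro y hy
    beta_reduce
    rw [image_eq_zero_of_notMem_tsupport (f := fun y => c * φ y) fun h => hy (hts' h), abs_zero,
      Real.zero_rpow hq.ne']

end Assembly

/-- **Quantitative fractional Faber–Krahn inequality** (Theorem 1.1).
For `N ≥ 2`, `0 < s < 1` and `1 ≤ q < 2N/(N-2s)` there is a constant `σ₁ > 0`,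
depending only on `N, s, q`, such that for every open set `Ω ⊆ ℝ^N` of finite positive
measure and every open ball `B`,
`|Ω|^{2/q-1+2s/N} λ_{s,q}(Ω) - |B|^{2/q-1+2s/N} λ_{s,q}(B) ≥ (σ₁/(1-s)) A(Ω)^{3/s}`. -/
theorem quantitative_fractional_faber_krahn
    (N : ℕ) (hN : 2 ≤ N) (s q : ℝ) (hs0 : 0 < s) (hs1 : s < 1)
    (hq1 : 1 ≤ q) (hq2 : q < 2 * N / ((N : ℝ) - 2 * s)) :
    ∃ σ₁ : ℝ, 0 < σ₁ ∧
      ∀ Ω : Set (Eu N), IsOpen Ω → volume Ω ≠ ⊤ → 0 < volume Ω →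
      ∀ (x₀ : Eu N) (r : ℝ), 0 < r →
        (volume Ω).toReal ^ (2 / q - 1 + 2 * s / N) * sobolevConst N s q Ω
            - (volume (Metric.ball x₀ r)).toReal ^ (2 / q - 1 + 2 * s / N)
              * sobolevConst N s q (Metric.ball x₀ r)
          ≥ σ₁ / (1 - s) * asym N Ω ^ (3 / s) := by
  obtain ⟨c, hc, key⟩ := exists_deficit_const hN hs0 hs1 hq1 hq2
  have h2 : (0 : ℝ) < 2 ^ (3 / s - 3) := by positivity
  refine ⟨c * (1 - s) / 2 ^ (3 / s - 3), div_pos (mul_pos hc (by linarith)) h2, ?_⟩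
  intro Ω hΩ hf h0 x₀ r hr
  have hV : 0 < (volume Ω).toReal ^ (2 / q - 1 + 2 * s / N) :=
    Real.rpow_pos_of_pos (ENNReal.toReal_pos h0.ne' hf) _
  have hball := sobolevConst_ball_le_lamR hN hs0 hs1 hq1 x₀ hr
  have hΩl : (lamR N s q + c * asym N Ω ^ 3) / (volume Ω).toReal ^ (2 / q - 1 + 2 * s / N) ≤
      sobolevConst N s q Ω := by
    refine le_csInf ?_ ?_
    · obtain ⟨u, h1, h2, h3, h4⟩ := exists_test_function (by linarith : 0 < q) hΩ h0
      exact ⟨_, u, h1, h2, h3, h4, rfl⟩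
    · rintro E ⟨u, h1, h2, h3, h4, rfl⟩
      rw [div_le_iff₀ hV, mul_comm (gagliardoSqR N s u)]
      exact key Ω hΩ hf h0 u h1 h2 h3 h4
  rw [div_le_iff₀ hV] at hΩl
  have ha := asym_nonneg Ω
  have ha2 := asym_le_two hN hΩ.measurableSet hf h0
  have h3s : 0 ≤ 3 / s - 3 := by
    rw [sub_nonneg, le_div_iff₀ hs0]
    linarith
  have hpow : asym N Ω ^ (3 / s) ≤ 2 ^ (3 / s - 3) * asym N Ω ^ 3 := by
    have h4 : asym N Ω ^ (3 / s) = asym N Ω ^ (3 / s - 3) * asym N Ω ^ 3 := by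
      rw [← Real.rpow_natCast, ← Real.rpow_add_of_nonneg ha h3s (by norm_num)]
      congr 1
      push_cast
      ring
    rw [h4]
    exact mul_le_mul_of_nonneg_right (Real.rpow_le_rpow ha ha2 h3s) (by positivity)
  have h5 : c * (1 - s) / 2 ^ (3 / s - 3) / (1 - s) * asym N Ω ^ (3 / s) ≤ c * asym N Ω ^ 3 := by
    have e1 : c * (1 - s) / 2 ^ (3 / s - 3) / (1 - s) = c / 2 ^ (3 / s - 3) := by
      have : (1 - s) ≠ 0 := by linarith
      field_simp
    rw [e1, div_mul_eq_mul_div, div_le_iff₀ h2]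
    calc c * asym N Ω ^ (3 / s) ≤ c * (2 ^ (3 / s - 3) * asym N Ω ^ 3) := by gcongr
      _ = _ := by ring
  rw [ge_iff_le]
  linarith
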